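/- (Plane case of the translation-arc theorem, with explicit constant.) Let f : ℝ² → ℝ² be an orientation-preserving homeomorphism and U ⊆ ℝ² an open f-invariant set homeomorphic to ℝ² such that ℝ²∖U has more than one point, and suppose f is ∂-nonwandering in U. Suppose there exist an extension F of f|_U to c_E(U,ℝ²), a homeomorphism φ : b_E(U,ℝ²) → ℝ/ℤ, and a lift G of φ ∘ F|_{b_E(U,ℝ²)} ∘ φ⁻¹ whose rotation number is α ≠ 0. Let q = q(α,0) and N = q + 2. Then there is a compact set K ⊆ U such that every N-translation arc for f contained in ℝ²∖K is disjoint from ∂U. -/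

import Mathlib

open Set Topology Filter

noncomputable section

universe u

variable {X : Type u} [TopologicalSpace X]

/-- A homeomorphism is *orientation preserving* if it is isotopic to the identity. -/
def IsOrientationPreserving (f : X ≃ₜ X) : Prop :=
  ∃ H : unitInterval × X → X,
    Continuous H ∧ (∀ x, H (0, x) = x) ∧ (∀ x, H (1, x) = f x) ∧
      ∀ t : unitInterval, IsHomeomorph fun x => H (t, x)

/-- `D` is a connected component of `A`. -/
def IsCompOf (A D : Set X) : Prop := ∃ x ∈ A, D = connectedComponentIn A x

/-- `A` has exactly two connected components, the distinct sets `D₁` and `D₂`. -/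
def HasTwoComps (A D₁ D₂ : Set X) : Prop :=
  IsCompOf A D₁ ∧ IsCompOf A D₂ ∧ D₁ ≠ D₂ ∧
    ∀ x ∈ A, connectedComponentIn A x = D₁ ∨ connectedComponentIn A x = D₂

/-- A *cross-cut* of the open set `U`: the image of an arc `g` on `(0,1)`, where `g` is
continuous and injective on `[0,1]`'s interior, runs inside `U`, has endpoints on `∂U`, and
separates `U` into exactly two components, each with a boundary point on `∂U` away from the
closed arc. -/
def IsCrossCut (U γ : Set X) : Prop :=
  ∃ g : ℝ → X,
    ContinuousOn g (Icc 0 1) ∧ InjOn g (Ioo 0 1) ∧ (∀ t ∈ Ioo (0:ℝ) 1, g t ∈ U) ∧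
      g 0 ∈ frontier U ∧ g 1 ∈ frontier U ∧ γ = g '' Ioo 0 1 ∧
      ∃ D₁ D₂ : Set X, HasTwoComps (U \ γ) D₁ D₂ ∧
        (frontier D₁ ∩ (frontier U \ g '' Icc 0 1)).Nonempty ∧
        (frontier D₂ ∩ (frontier U \ g '' Icc 0 1)).Nonempty

/-- A *cross-section* of `U`: a connected component of `U ∖ γ` for a cross-cut `γ`. -/
def IsCrossSection (U D : Set X) : Prop := ∃ γ : Set X, IsCrossCut U γ ∧ IsCompOf (U \ γ) D

/-- The image of a set under the `k`-th integer iterate of a homeomorphism. -/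
def iterZ (f : X ≃ₜ X) (k : ℤ) (A : Set X) : Set X := ⇑(f.toEquiv ^ k) '' A

/-- A cross-section of `U` which is wandering for `f^n`. -/
def IsWanderingSection (f : X ≃ₜ X) (U : Set X) (n : ℕ) (D : Set X) : Prop :=
  IsCrossSection U D ∧ ∀ k : ℤ, k ≠ 0 → iterZ f ((n : ℤ) * k) D ∩ D = ∅

/-- `f` is ∂-nonwandering in `U`. -/
def BdNonwandering (f : X ≃ₜ X) (U : Set X) : Prop :=
  ∀ n : ℕ, 1 ≤ n → ∃ K : Set X, IsCompact K ∧ K ⊆ U ∧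
    ∀ D : Set X, IsWanderingSection f U n D →
      (∃ k : ℤ, 0 < k ∧ (iterZ f ((n : ℤ) * k) D ∩ K).Nonempty) ∧
      (∃ k : ℤ, k < 0 ∧ (iterZ f ((n : ℤ) * k) D ∩ K).Nonempty)

/-- The boundary of `D` inside `U` (for `D` open in `U`). -/
def bdIn (U D : Set X) : Set X := (closure D \ D) ∩ U

/-- A chain of cross-sections of `U`. -/
def IsPEChain (U : Set X) (D : ℕ → Set X) : Prop :=
  (∀ i, IsCrossSection U (D i)) ∧ (∀ i j : ℕ, j ≤ i → D i ⊆ D j) ∧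
    ∀ i j : ℕ, i ≠ j → closure (bdIn U (D i)) ∩ closure (bdIn U (D j)) = ∅

/-- The chain `D` divides the cross-section `E`. -/
def ChainDividesSection (D : ℕ → Set X) (E : Set X) : Prop := ∃ N : ℕ, ∀ i, N ≤ i → D i ⊆ E

/-- The chain `D` divides the chain `D'`. -/
def ChainDivides (D D' : ℕ → Set X) : Prop := ∀ n : ℕ, ∃ m : ℕ, D m ⊆ D' n

/-- A prime chain: a chain dividing every chain that divides it. -/
def IsPrimeChain (U : Set X) (D : ℕ → Set X) : Prop :=
  IsPEChain U D ∧ ∀ D' : ℕ → Set X, IsPEChain U D' → ChainDivides D' D → ChainDivides D D'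

/-- The type of prime chains of `U`. -/
def PrimeChain (U : Set X) : Type u := {D : ℕ → Set X // IsPrimeChain U D}

/-- A prime end of `U`: an equivalence class of prime chains. -/
def PrimeEnd (U : Set X) : Type u :=
  Quot fun C C' : PrimeChain U => ChainDivides C.1 C'.1 ∧ ChainDivides C'.1 C.1

/-- The prime end `p` divides the cross-section `E`. -/
def PrimeEndDivides {U : Set X} (p : PrimeEnd U) (E : Set X) : Prop :=
  ∃ C : PrimeChain U, Quot.mk _ C = p ∧ ChainDividesSection C.1 E

/-- The prime ends compactification of `U` (as a set: `U ⊔ (prime ends)`). -/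
def PrimeEndComp (U : Set X) : Type u := ↥U ⊕ PrimeEnd U

/-- A point of `U`, as an element of the prime ends compactification. -/
def pePt (U : Set X) (x : ↥U) : PrimeEndComp U := Sum.inl x

/-- A prime end, as an element of the prime ends compactification. -/
def peEnd (U : Set X) (p : PrimeEnd U) : PrimeEndComp U := Sum.inr p

/-- The copy of a subset `V ⊆ U` inside the prime ends compactification. -/
def peOpen (U V : Set X) : Set (PrimeEndComp U) := {z | ∃ x : ↥U, z = pePt U x ∧ (x : X) ∈ V}

/-- The basic set `E ∪ i_E(E)` of the prime ends compactification, for a cross-section `E`. -/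
def peSection (U E : Set X) : Set (PrimeEndComp U) :=
  peOpen U E ∪ {z | ∃ p : PrimeEnd U, z = peEnd U p ∧ PrimeEndDivides p E}

/-- The topology of the prime ends compactification. -/
instance primeEndCompTopology (U : Set X) : TopologicalSpace (PrimeEndComp U) :=
  TopologicalSpace.generateFrom
    ({s | ∃ V : Set X, IsOpen V ∧ V ⊆ U ∧ s = peOpen U V} ∪
      {s | ∃ E : Set X, IsCrossSection U E ∧ s = peSection U E})

/-- The circle of prime ends, as a subset of the prime ends compactification. -/
def PrimeEndCircle (U : Set X) : Set (PrimeEndComp U) := Set.range (peEnd U)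

/-- `F` is an extension of `f|_U` to the prime ends compactification of `U`. -/
def IsPEExtension (f : X ≃ₜ X) (U : Set X) (F : PrimeEndComp U ≃ₜ PrimeEndComp U) : Prop :=
  ∀ (x : X) (hx : x ∈ U) (hfx : f x ∈ U), F (pePt U ⟨x, hx⟩) = pePt U ⟨f x, hfx⟩

/-- An end-cut of `U`: an injective arc in `U` defined on `[0,1)` converging in the ambient
space as `t → 1⁻`. -/
def IsEndCut (U : Set X) (γ : ℝ → X) : Prop :=
  ContinuousOn γ (Ico 0 1) ∧ InjOn γ (Ico 0 1) ∧ (∀ t ∈ Ico (0:ℝ) 1, γ t ∈ U) ∧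
    ∃ z : X, Tendsto γ (𝓝[<] (1:ℝ)) (𝓝 z)

/-- `z` is an accessible point of `∂U`. -/
def IsAccessiblePoint (U : Set X) (z : X) : Prop :=
  ∃ γ : ℝ → X, IsEndCut U γ ∧ Tendsto γ (𝓝[<] (1:ℝ)) (𝓝 z)

/-- `p` is an accessible prime end of `U`. -/
def IsAccessiblePrimeEnd (U : Set X) (p : PrimeEnd U) : Prop :=
  ∃ (γ : ℝ → X) (hγ : ∀ t ∈ Ico (0:ℝ) 1, γ t ∈ U), IsEndCut U γ ∧
    Tendsto (fun t : ↥(Ico (0:ℝ) 1) => pePt U ⟨γ ↑t, hγ ↑t t.2⟩)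
      (comap Subtype.val (𝓝[<] (1:ℝ))) (𝓝 (peEnd U p))

/-- A translation arc for `f` based at `x`: a simple arc from `x` to `f x` meeting its image
only as allowed. -/
def IsTranslationArc (f : X ≃ₜ X) (γ : Set X) (x : X) : Prop :=
  f x ≠ x ∧
    ∃ g : ℝ → X, ContinuousOn g (Icc 0 1) ∧ InjOn g (Icc 0 1) ∧
      g 0 = x ∧ g 1 = f x ∧ γ = g '' Icc 0 1 ∧
      ((⇑f '' γ) ∩ γ = {f x} ∨ ((⇑f '' γ) ∩ γ = {x, f x} ∧ f (f x) = x))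

/-- An `N`-translation arc for `f` based at `x` (for `N = 1` this is just a translation arc). -/
def IsNTranslationArc (f : X ≃ₜ X) (N : ℕ) (γ : Set X) (x : X) : Prop :=
  IsTranslationArc f γ x ∧
    (2 ≤ N →
      (∀ k : ℕ, 2 ≤ k → k ≤ N - 1 → (⇑f)^[k] '' γ ∩ γ = ∅) ∧
        ((⇑f)^[N] '' γ ∩ γ = ∅ ∨ ((⇑f)^[N] '' γ ∩ γ = {x} ∧ (⇑f)^[N + 1] x = x)))

/-- An ∞-translation arc: an `N`-translation arc for every `N ≥ 1`. -/
def IsInfTranslationArc (f : X ≃ₜ X) (γ : Set X) (x : X) : Prop :=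
  ∀ N : ℕ, 1 ≤ N → IsNTranslationArc f N γ x

/-- A nonwandering homeomorphism. -/
def IsNonwanderingMap (f : X → X) : Prop :=
  ∀ V : Set X, IsOpen V → V.Nonempty → ∃ n : ℕ, 1 ≤ n ∧ (f^[n] '' V ∩ V).Nonempty

/-- A loop contained in `A` which is not null-homotopic in `V`. -/
def IsEssentialLoopIn (V A : Set X) : Prop :=
  ∃ (z : ↥V) (δ : Path z z), (∀ t : unitInterval, (↑(δ t) : X) ∈ A) ∧
    ¬ δ.Homotopic (Path.refl z)

/-- An annular continuum: a continuum with an open annular neighborhood `V` such that `V ∖ K`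
has exactly two components, each essential in `V`. -/
def IsAnnularContinuum (K : Set X) : Prop :=
  IsCompact K ∧ IsConnected K ∧ K.Nontrivial ∧
    ∃ V : Set X, IsOpen V ∧ K ⊆ V ∧
      Nonempty (↥V ≃ₜ AddCircle (1 : ℝ) × ↥(Ioo (0 : ℝ) 1)) ∧
      ∃ D₁ D₂ : Set X, HasTwoComps (V \ K) D₁ D₂ ∧
        IsEssentialLoopIn V D₁ ∧ IsEssentialLoopIn V D₂

/-- A set contractible in the ambient surface: it has an open neighborhood homeomorphic to the
plane. -/
def ContractibleInSurface (K : Set X) : Prop :=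
  ∃ W : Set X, IsOpen W ∧ K ⊆ W ∧ Nonempty (↥W ≃ₜ (ℝ × ℝ))

/-- `α ∈ ℝ/ℤ` is rational. -/
def IsRationalAC (α : AddCircle (1 : ℝ)) : Prop := ∃ r : ℚ, α = ((r : ℝ) : AddCircle (1 : ℝ))

/-- The constant `q(α,g)`: the smallest positive integer `q` with `‖qα‖ = 0` if `α` is
rational, and `(2g+1)‖qα‖ < ‖α‖` if `α` is irrational. -/
def qConst (α : AddCircle (1 : ℝ)) (g : ℕ) : ℕ :=
  sInf {q : ℕ | 0 < q ∧
    ((IsRationalAC α ∧ ‖q • α‖ = 0) ∨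
      (¬IsRationalAC α ∧ ((2 * g + 1 : ℕ) : ℝ) * ‖q • α‖ < ‖α‖))}

set_option linter.unusedSectionVars false

section

/-! ### Logarithms -/

theorem log_diff_const {A : Type*} [TopologicalSpace A] {S : Set A} (hS : IsPreconnected S)
    {l₁ l₂ : A → ℂ} (h₁ : ContinuousOn l₁ S) (h₂ : ContinuousOn l₂ S)
    (he : ∀ x ∈ S, Complex.exp (l₁ x) = Complex.exp (l₂ x)) :
    ∃ n : ℤ, ∀ x ∈ S, l₁ x = l₂ x + n * (2 * Real.pi * Complex.I) := by
  rcases S.eq_empty_or_nonempty with rfl | ⟨x₀, hx₀⟩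
  · exact ⟨0, by simp⟩
  obtain ⟨n, hn⟩ := Complex.exp_eq_exp_iff_exists_int.1 (he x₀ hx₀)
  refine ⟨n, ?_⟩
  have := Complex.isCoveringMap_exp.eqOn_of_comp_eqOn hS h₁
    (g₂ := fun x => l₂ x + n * (2 * Real.pi * Complex.I)) (by fun_prop) (fun x hx => ?_) hx₀ hn
  · exact this
  · apply Subtype.ext
    have h2 : Complex.exp (l₂ x + n * (2 * Real.pi * Complex.I)) = Complex.exp (l₂ x) :=
      Complex.exp_eq_exp_iff_exists_int.2 ⟨n, rfl⟩
    simp [h2, he x hx]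

theorem homotopy_log {A : Type*} [TopologicalSpace A] (H : C(unitInterval × A, ℂ))
    (hne : ∀ x, H x ≠ 0) (f : C(A, ℂ)) (h0 : ∀ a, Complex.exp (f a) = H (0, a)) :
    ∃ L : C(unitInterval × A, ℂ), (∀ x, Complex.exp (L x) = H x) ∧ ∀ a, L (0, a) = f a := by
  have cov := Complex.isCoveringMap_exp
  let H' : C(unitInterval × A, {z : ℂ // z ≠ 0}) := ⟨fun x => ⟨H x, hne x⟩, by fun_prop⟩
  have h0' : ∀ a, H' (0, a) = (⟨_, (f a).exp_ne_zero⟩ : {z : ℂ // z ≠ 0}) :=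
    fun a => Subtype.ext (h0 a).symm
  refine ⟨cov.liftHomotopy H' f h0', fun x => ?_, fun a => cov.liftHomotopy_zero H' f h0' a⟩
  exact congrArg Subtype.val (congrFun (cov.liftHomotopy_lifts H' f h0') x)

theorem exists_log_of_module {E : Type*} [TopologicalSpace E] [AddCommGroup E] [Module ℝ E]
    [ContinuousSMul ℝ E] {g : E → ℂ} (hg : Continuous g) (hne : ∀ x, g x ≠ 0) :
    ∃ l : E → ℂ, Continuous l ∧ ∀ x, Complex.exp (l x) = g x := by
  obtain ⟨L, hL, -⟩ := homotopy_log (A := E)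
    ⟨fun x => g ((x.1 : ℝ) • x.2), by fun_prop⟩ (fun x => hne _)
    (ContinuousMap.const E (Complex.log (g 0))) (fun a => by simp [Complex.exp_log (hne 0)])
  refine ⟨fun x => L (1, x), by fun_prop, fun x => ?_⟩
  simpa using hL (1, x)

theorem no_log_sphere {q : ℂ} {R : ℝ} (hq : ‖q‖ < R) (l : ℂ → ℂ)
    (hl : ContinuousOn l (Metric.sphere 0 R)) :
    ¬ ∀ z ∈ Metric.sphere (0 : ℂ) R, Complex.exp (l z) = z - q := by
  intro h
  have hR : 0 < R := lt_of_le_of_lt (norm_nonneg _) hq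
  obtain ⟨L, hL, -⟩ := homotopy_log (A := Metric.sphere (0 : ℂ) R)
    ⟨fun x => x.2 - (1 - (x.1 : ℝ)) * q, by fun_prop⟩ (fun x => by
      intro h0
      have h1 : (x.2 : ℂ) = (1 - (x.1 : ℝ)) * q := by simpa [sub_eq_zero] using h0
      have h2 : ‖(x.2 : ℂ)‖ = R := by simp
      rw [h1, norm_mul] at h2
      have h3 : ‖(1 - ((x.1 : ℝ) : ℂ))‖ ≤ 1 := by
        rw [← Complex.ofReal_one, ← Complex.ofReal_sub, Complex.norm_real, Real.norm_eq_abs,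
          abs_le]
        constructor <;> linarith [x.1.2.1, x.1.2.2]
      nlinarith [norm_nonneg q])
    ⟨fun x => l x, by exact continuousOn_iff_continuous_domRestrict.1 hl⟩
    (fun a => by simpa using! h a a.2)
  let c : ℝ → Metric.sphere (0 : ℂ) R := fun t => ⟨R * Complex.exp (t * Complex.I), by
    simp [Complex.norm_exp_ofReal_mul_I, abs_of_pos hR]⟩
  have hc : Continuous c := by
    apply Continuous.subtype_mk; fun_prop
  obtain ⟨n, hn⟩ := log_diff_const (S := (univ : Set ℝ)) isPreconnected_univ
    (l₁ := fun t => L (1, c t)) (l₂ := fun t => Complex.log R + t * Complex.I)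
    (by fun_prop) (by fun_prop) (fun t _ => by
      rw [hL, Complex.exp_add, Complex.exp_log (by exact_mod_cast hR.ne')]
      simp [c])
  have h0 := hn 0 trivial
  have h1 := hn (2 * Real.pi) trivial
  have : c 0 = c (2 * Real.pi) := by
    apply Subtype.ext; simp [c]
  rw [← this, h0] at h1
  have := congrArg Complex.im h1
  simp at this

/-! ### Good logarithms and separation -/

/-- A continuous logarithm of `(z - p) / (z - q)` on `A`, tame at infinity. -/
def GoodLog (A : Set ℂ) (p q : ℂ) : Prop :=
  ∃ L : ℂ → ℂ, ContinuousOn L A ∧ (∀ z ∈ A, Complex.exp (L z) = (z - p) / (z - q)) ∧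
    ∃ R : ℝ, ∀ z ∈ A, R ≤ ‖z‖ → |(L z).im| ≤ 1

theorem abs_im_log_le {w : ℂ} (hw : ‖w - 1‖ ≤ 1 / 2) : |(Complex.log w).im| ≤ 1 := by
  have := Complex.norm_log_one_add_half_le_self hw
  have h2 := Complex.abs_im_le_norm (Complex.log w)
  rw [show 1 + (w - 1) = w by ring] at this
  linarith

theorem norm_div_sub_one_le {z p q : ℂ} {C : ℝ} (hp : ‖p‖ ≤ C) (hq : ‖q‖ ≤ C) (hC : 0 < C)
    (hz : 5 * C ≤ ‖z‖) : ‖(z - p) / (z - q) - 1‖ ≤ 1 / 2 ∧ z ≠ q := by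
  have hzq : 4 * C ≤ ‖z - q‖ := by have := norm_sub_norm_le z q; linarith
  have hne : z - q ≠ 0 := by intro h; rw [h] at hzq; simp at hzq; linarith
  refine ⟨?_, fun h => hne (by simp [h])⟩
  have : (z - p) / (z - q) - 1 = (q - p) / (z - q) := by field_simp; ring
  rw [this, norm_div, div_le_iff₀ (by linarith)]
  have := norm_sub_le q p
  linarith

theorem mem_slitPlane_of_near {w : ℂ} (hw : ‖w - 1‖ ≤ 1 / 2) : w ∈ Complex.slitPlane := by
  left
  have := Complex.abs_re_le_norm (w - 1)
  simp only [Complex.sub_re, Complex.one_re] at this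
  have := abs_le.1 (this.trans hw)
  linarith

theorem goodLog_of_joinedIn {A : Set ℂ} {p q : ℂ} (h : JoinedIn Aᶜ p q) : GoodLog A p q := by
  obtain ⟨γ, hγ⟩ := h.symm
  have hqA : q ∉ A := by simpa using hγ 0
  obtain ⟨C, hC0, hC⟩ : ∃ C : ℝ, 0 < C ∧ ∀ t, ‖γ t‖ ≤ C := by
    obtain ⟨C, hC⟩ := (isCompact_range γ.continuous).isBounded.exists_norm_le
    exact ⟨max C 1, by simp, fun t => (hC _ ⟨t, rfl⟩).trans (le_max_left _ _)⟩
  have hq : ‖q‖ ≤ C := by simpa using hC 0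
  have hA : ∀ a : A, (a : ℂ) - q ≠ 0 := fun a h => hqA (by
    rw [← sub_eq_zero.1 h]; exact a.2)
  have hA' : ∀ (a : A) t, (a : ℂ) - γ t ≠ 0 := fun a t h => hγ t (by
    rw [← sub_eq_zero.1 h]; exact a.2)
  obtain ⟨L, hL, hL0⟩ := homotopy_log (A := A)
    ⟨fun x => ((x.2 : ℂ) - γ x.1) / (x.2 - q), by
      apply Continuous.div (by fun_prop) (by fun_prop)
      intro x; exact hA _⟩ (fun x => by
      simp only [ContinuousMap.coe_mk]; exact div_ne_zero (hA' _ _) (hA _))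
    (ContinuousMap.const A 0) (fun a => by simp [div_self (hA a)])
  classical
  refine ⟨fun z => if hz : z ∈ A then L (1, ⟨z, hz⟩) else 0, ?_, ?_, 5 * C, ?_⟩
  · rw [continuousOn_iff_continuous_domRestrict]
    have : A.domRestrict (fun z => if hz : z ∈ A then L (1, ⟨z, hz⟩) else 0) = fun z => L (1, z) := by
      ext z; simp [Set.domRestrict]
    rw [this]; fun_prop
  · intro z hz
    simp only [hz, dite_true, hL]
    simp
  · intro z hz hzR
    simp only [hz, dite_true]
    have key : ∀ t : unitInterval, ‖(z - γ t) / (z - q) - 1‖ ≤ 1 / 2 := fun t =>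
      (norm_div_sub_one_le (hC t) hq hC0 hzR).1
    obtain ⟨n, hn⟩ := log_diff_const (S := (univ : Set unitInterval)) isPreconnected_univ
      (l₁ := fun t => L (t, ⟨z, hz⟩)) (l₂ := fun t => Complex.log ((z - γ t) / (z - q)))
      (by fun_prop) (by
        apply ContinuousOn.clog (by fun_prop)
        exact fun t _ => mem_slitPlane_of_near (key t)) (fun t _ => by
        rw [hL, Complex.exp_log]
        · rfl
        · exact div_ne_zero (hA' ⟨z, hz⟩ t) (hA ⟨z, hz⟩))
    have h0 := hn 0 trivial
    rw [hL0] at h0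
    simp [div_self (hA ⟨z, hz⟩)] at h0
    subst h0
    have h1 := hn 1 trivial
    simp only [Int.cast_zero, zero_mul, add_zero] at h1
    rw [h1]
    exact abs_im_log_le (key 1)

theorem joinedIn_of_goodLog {A : Set ℂ} (hA : IsClosed A) {p q : ℂ} (hp : p ∉ A) (hq : q ∉ A)
    (h : GoodLog A p q) : JoinedIn Aᶜ p q := by
  obtain ⟨L, hLc, hLe, R, hLR⟩ := h
  by_contra hnj
  set W := connectedComponentIn Aᶜ p with hW
  have hWo : IsOpen W := hA.isOpen_compl.connectedComponentIn
  have hWp : IsPathConnected W :=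
    hWo.isConnected_iff_isPathConnected.1 (isConnected_connectedComponentIn_iff.2 hp)
  have hpW : p ∈ W := mem_connectedComponentIn hp
  have hqW : q ∉ W := fun hqW => hnj ((hWp.joinedIn p hpW q hqW).mono
    (connectedComponentIn_subset _ _))
  have hfr : frontier W ⊆ A := by
    intro z hz
    by_contra hzA
    have hopen := hA.isOpen_compl.connectedComponentIn (x := z)
    have hzm : z ∈ connectedComponentIn Aᶜ z := mem_connectedComponentIn hzA
    obtain ⟨y, hy1, hy2⟩ := mem_closure_iff.1 hz.1 _ hopen hzm
    have e1 := connectedComponentIn_eq hy1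
    have e2 := connectedComponentIn_eq hy2
    rw [hWo.frontier_eq] at hz
    exact hz.2 (by rw [hW, e2, ← e1]; exact hzm)
  obtain ⟨g, hg⟩ := ContinuousMap.exists_restrict_eq hA
    ⟨A.domRestrict L, continuousOn_iff_continuous_domRestrict.1 hLc⟩
  have hgL : ∀ z ∈ A, g z = L z := fun z hz => by
    exact congrArg (fun k => k ⟨z, hz⟩) hg
  classical
  let Θ : ℂ → ℂ := fun z => if z ∈ W then (z - q) * Complex.exp (g z) else z - p
  have hΘc : Continuous Θ := by
    apply continuous_if
    · intro z hz
      have hzA : z ∈ A := hfr hz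
      rw [hgL z hzA, hLe z hzA]
      have : z - q ≠ 0 := fun h => hq (by rw [← sub_eq_zero.1 h]; exact hzA)
      field_simp
    · fun_prop
    · fun_prop
  have hΘ0 : ∀ z, Θ z ≠ 0 := by
    intro z
    by_cases hz : z ∈ W
    · simp only [Θ, hz, if_true]
      exact mul_ne_zero (fun h => hqW (by rw [← sub_eq_zero.1 h]; exact hz)) (Complex.exp_ne_zero _)
    · simp only [Θ, hz, if_false]
      exact fun h => hz (by rw [sub_eq_zero.1 h]; exact hpW)
  obtain ⟨l, hlc, hl⟩ := exists_log_of_module hΘc hΘ0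
  set C := max (max ‖p‖ ‖q‖) 1
  have hC0 : 0 < C := by simp [C]
  have hpC : ‖p‖ ≤ C := by simp [C]
  have hqC : ‖q‖ ≤ C := by simp [C]
  set R' := max R (5 * C)
  have hR'0 : 0 < R' := lt_of_lt_of_le (by linarith) (le_max_right _ _)
  have key : ∀ z : ℂ, ‖z‖ = R' → ‖(z - p) / (z - q) - 1‖ ≤ 1 / 2 ∧ z ≠ q := fun z hz =>
    norm_div_sub_one_le hpC hqC hC0 (by rw [hz]; exact le_max_right _ _)
  let Λ : ℂ → ℂ := fun z => if z ∈ W then g z else Complex.log ((z - p) / (z - q))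
  have hΛc : ContinuousOn Λ (Metric.sphere 0 R') := by
    apply ContinuousOn.if
    · rintro z ⟨hzs, hz⟩
      have hzA : z ∈ A := hfr hz
      have hzs' : ‖z‖ = R' := by simpa using hzs
      rw [hgL z hzA]
      have e1 := hLe z hzA
      have e2 := Complex.exp_log (x := (z - p) / (z - q)) (by rw [← e1]; exact Complex.exp_ne_zero _)
      obtain ⟨n, hn⟩ := Complex.exp_eq_exp_iff_exists_int.1 (e1.trans e2.symm)
      have b1 := abs_le.1 (hLR z hzA (by rw [hzs']; exact le_max_left _ _))
      have b2 := abs_le.1 (abs_im_log_le (key z hzs').1)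
      have him := congrArg Complex.im hn
      simp at him
      have : n = 0 := by
        have hpi := Real.pi_gt_three
        have h1 : (n : ℝ) * (2 * Real.pi) < 1 * (2 * Real.pi) := by linarith
        have h2 : (-1) * (2 * Real.pi) < (n : ℝ) * (2 * Real.pi) := by linarith
        have h3 := lt_of_mul_lt_mul_right h1 (by positivity)
        have h4 := lt_of_mul_lt_mul_right h2 (by positivity)
        have h5 : n < 1 := by exact_mod_cast h3
        have h6 : -1 < n := by exact_mod_cast h4
        omega
      rw [hn, this]; simp
    · exact g.continuous.continuousOn
    · apply ContinuousOn.clog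
      · apply ContinuousOn.div (by fun_prop) (by fun_prop)
        intro z hz h
        exact (key z (by simpa using hz.1)).2 (sub_eq_zero.1 h)
      · intro z hz
        exact mem_slitPlane_of_near (key z (by simpa using hz.1)).1
  refine no_log_sphere (q := q) (R := R') (lt_of_lt_of_le (by linarith) (le_max_right _ _))
    (fun z => l z - Λ z) (hlc.continuousOn.sub hΛc) ?_
  intro z hz
  have hzs : ‖z‖ = R' := by simpa using hz
  have hzq : z - q ≠ 0 := sub_ne_zero.2 (key z hzs).2
  rw [Complex.exp_sub, hl]
  by_cases hzW : z ∈ W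
  · simp only [Θ, Λ, hzW, if_true]
    field_simp [Complex.exp_ne_zero]
  · have hzp : z - p ≠ 0 := by
      have := hΘ0 z
      simpa only [Θ, hzW, if_false] using this
    simp only [Θ, Λ, hzW, if_false]
    rw [Complex.exp_log (div_ne_zero hzp hzq)]
    field_simp

/-- Janiszewski: connected intersection version. -/
theorem joinedIn_union_compl {A B : Set ℂ} (hA : IsCompact A) (hB : IsClosed B)
    (hAB : IsPreconnected (A ∩ B)) {p q : ℂ} (h1 : JoinedIn Aᶜ p q) (h2 : JoinedIn Bᶜ p q) :
    JoinedIn (A ∪ B)ᶜ p q := by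
  have hpA := h1.source_mem
  have hqA := h1.target_mem
  have hpB := h2.source_mem
  have hqB := h2.target_mem
  apply joinedIn_of_goodLog (hA.isClosed.union hB) (by simp_all) (by simp_all)
  obtain ⟨L₁, c₁, e₁, -⟩ := goodLog_of_joinedIn h1
  obtain ⟨L₂, c₂, e₂, R, hR⟩ := goodLog_of_joinedIn h2
  obtain ⟨n, hn⟩ := log_diff_const hAB (c₁.mono inter_subset_left) (c₂.mono inter_subset_right)
    (fun x hx => (e₁ x hx.1).trans (e₂ x hx.2).symm)
  classical
  obtain ⟨C, hC⟩ := hA.isBounded.exists_norm_le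
  refine ⟨fun z => if z ∈ B then L₂ z else L₁ z - n * (2 * Real.pi * Complex.I), ?_, ?_,
    max R (C + 1), ?_⟩
  · have hAc : ContinuousOn (fun z => if z ∈ B then L₂ z else L₁ z - n * (2 * Real.pi * Complex.I))
        A := by
      have : ContinuousOn (fun z => L₁ z - n * (2 * Real.pi * Complex.I)) A := by fun_prop
      refine this.congr fun z hz => ?_
      by_cases hzB : z ∈ B
      · simp [hzB, hn z ⟨hz, hzB⟩]
      · simp [hzB]
    have hBc : ContinuousOn (fun z => if z ∈ B then L₂ z else L₁ z - n * (2 * Real.pi * Complex.I))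
        B := c₂.congr fun z hz => by simp [hz]
    exact hAc.union_of_isClosed hBc hA.isClosed hB
  · intro z hz
    by_cases hzB : z ∈ B
    · simp [hzB, e₂ z hzB]
    · have hzA : z ∈ A := hz.resolve_right hzB
      simp only [hzB, if_false]
      rw [← e₁ z hzA]
      exact Complex.exp_eq_exp_iff_exists_int.2 ⟨-n, by push_cast; ring⟩
  · intro z hz hzR
    have hzB : z ∈ B := hz.resolve_left fun h => by
      have := hC z h
      have := (le_max_right R (C + 1)).trans hzR
      linarith
    simp only [hzB, if_true]
    exact hR z hzB ((le_max_left _ _).trans hzR)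

/-- Janiszewski: disjoint version. -/
theorem joinedIn_union_compl' {A B : Set ℂ} (hA : IsClosed A) (hB : IsClosed B)
    (hAB : Disjoint A B) {p q : ℂ} (h1 : JoinedIn Aᶜ p q) (h2 : JoinedIn Bᶜ p q) :
    JoinedIn (A ∪ B)ᶜ p q := by
  have hpA := h1.source_mem
  have hqA := h1.target_mem
  have hpB := h2.source_mem
  have hqB := h2.target_mem
  apply joinedIn_of_goodLog (hA.union hB) (by simp_all) (by simp_all)
  obtain ⟨L₁, c₁, e₁, R₁, hR₁⟩ := goodLog_of_joinedIn h1
  obtain ⟨L₂, c₂, e₂, R₂, hR₂⟩ := goodLog_of_joinedIn h2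
  classical
  refine ⟨fun z => if z ∈ B then L₂ z else L₁ z, ?_, ?_, max R₁ R₂, ?_⟩
  · refine ContinuousOn.union_of_isClosed (c₁.congr fun z hz => ?_) (c₂.congr fun z hz => ?_) hA hB
    · simp [disjoint_left.1 hAB hz]
    · simp [hz]
  · intro z hz
    by_cases hzB : z ∈ B
    · simp [hzB, e₂ z hzB]
    · simp [hzB, e₁ z (hz.resolve_right hzB)]
  · intro z hz hzR
    by_cases hzB : z ∈ B
    · simpa [hzB] using hR₂ z hzB ((le_max_right _ _).trans hzR)
    · simpa [hzB] using hR₁ z (hz.resolve_right hzB) ((le_max_left _ _).trans hzR)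

end

section

/-! ### Arcs and rays do not separate -/

theorem joinedIn_compl_range {T : Type*} [TopologicalSpace T] {e : T → ℂ}
    (he : IsClosedEmbedding e)
    (hlog : ∀ g : T → ℂ, Continuous g → (∀ t, g t ≠ 0) →
      ∃ l : T → ℂ, Continuous l ∧ ∀ t, Complex.exp (l t) = g t)
    (hend : ∀ R : ℝ, ∃ S : Set T, IsPreconnected S ∧ (∀ t ∈ S, R ≤ ‖e t‖) ∧
      ∃ R' : ℝ, ∀ t ∉ S, ‖e t‖ < R')
    {p q : ℂ} (hp : p ∉ range e) (hq : q ∉ range e) : JoinedIn (range e)ᶜ p q := by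
  apply joinedIn_of_goodLog he.isClosed_range hp hq
  have hq' : ∀ t, e t - q ≠ 0 := fun t h => hq ⟨t, sub_eq_zero.1 h⟩
  have hp' : ∀ t, e t - p ≠ 0 := fun t h => hp ⟨t, sub_eq_zero.1 h⟩
  obtain ⟨l, hlc, hl⟩ := hlog (fun t => (e t - p) / (e t - q))
    (Continuous.div (by have := he.continuous; fun_prop) (by have := he.continuous; fun_prop) hq')
    (fun t => div_ne_zero (hp' t) (hq' t))
  set C := max (max ‖p‖ ‖q‖) 1
  have hC0 : 0 < C := by simp [C]
  have hpC : ‖p‖ ≤ C := by simp [C]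
  have hqC : ‖q‖ ≤ C := by simp [C]
  obtain ⟨S, hS, hSR, R', hR'⟩ := hend (5 * C)
  have key : ∀ t ∈ S, ‖(e t - p) / (e t - q) - 1‖ ≤ 1 / 2 := fun t ht =>
    (norm_div_sub_one_le hpC hqC hC0 (hSR t ht)).1
  obtain ⟨n, hn⟩ := log_diff_const hS (l₁ := l)
    (l₂ := fun t => Complex.log ((e t - p) / (e t - q))) hlc.continuousOn (by
      apply ContinuousOn.clog
      · exact (Continuous.div (by have := he.continuous; fun_prop)
          (by have := he.continuous; fun_prop) hq').continuousOn
      · exact fun t ht => mem_slitPlane_of_near (key t ht)) (fun t _ => by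
        rw [hl, Complex.exp_log (div_ne_zero (hp' t) (hq' t))])
  by_cases hT : Nonempty T
  swap
  · rw [not_nonempty_iff] at hT
    have h0 : ∀ z ∉ (∅ : Set ℂ), z ∉ range e := by
      rintro z - ⟨t, -⟩; exact hT.false t
    exact ⟨fun _ => 0, continuousOn_const, fun z hz => (h0 z id hz).elim, 0,
      fun z hz => (h0 z id hz).elim⟩
  have hinv : ∀ t, Function.invFun e (e t) = t := Function.leftInverse_invFun he.injective
  refine ⟨fun z => l (Function.invFun e z) - n * (2 * Real.pi * Complex.I), ?_, ?_, R', ?_⟩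
  · have : ContinuousOn (Function.invFun e) (range e) := by
      rw [continuousOn_iff_continuous_domRestrict]
      have h2 : (range e).domRestrict (Function.invFun e)
          = (he.isEmbedding.toHomeomorph).symm := by
        ext ⟨_, t, rfl⟩
        rw [Set.domRestrict_apply, hinv]
        have : (⟨e t, ⟨t, rfl⟩⟩ : range e) = he.isEmbedding.toHomeomorph t := rfl
        rw [this, Homeomorph.symm_apply_apply]
      rw [h2]; exact Homeomorph.continuous _
    exact (hlc.comp_continuousOn this).sub continuousOn_const
  · rintro _ ⟨t, rfl⟩
    simp only [hinv]
    rw [← hl]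
    exact Complex.exp_eq_exp_iff_exists_int.2 ⟨-n, by push_cast; ring⟩
  · rintro _ ⟨t, rfl⟩ ht
    have htS : t ∈ S := by
      by_contra h; exact absurd (hR' t h) (not_lt.2 ht)
    simp only [hinv, hn t htS, add_sub_cancel_right]
    exact abs_im_log_le (key t htS)

theorem exists_log_of_retract {S : Set ℝ} (r : ℝ → S) (hr : Continuous r) (hrS : ∀ s : S, r s = s)
    (g : S → ℂ) (hg : Continuous g) (hne : ∀ t, g t ≠ 0) :
    ∃ l : S → ℂ, Continuous l ∧ ∀ t, Complex.exp (l t) = g t := by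
  obtain ⟨l, hl, h⟩ := exists_log_of_module (g := fun x => g (r x)) (by fun_prop)
    (fun x => hne _)
  exact ⟨fun s => l s, by fun_prop, fun t => by rw [h, hrS]⟩

theorem arc_joinedIn_compl {g : ℝ → ℂ} {a b : ℝ} (hab : a ≤ b) (hg : ContinuousOn g (Icc a b))
    (hinj : InjOn g (Icc a b)) {p q : ℂ} (hp : p ∉ g '' Icc a b) (hq : q ∉ g '' Icc a b) :
    JoinedIn (g '' Icc a b)ᶜ p q := by
  have he : IsClosedEmbedding (fun t : Icc a b => g t) :=
    (continuousOn_iff_continuous_domRestrict.1 hg).isClosedEmbedding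
      (fun s t h => Subtype.ext (hinj s.2 t.2 h))
  have hr : range (fun t : Icc a b => g t) = g '' Icc a b := by
    ext z; simp
  rw [← hr] at hp hq ⊢
  refine joinedIn_compl_range he (exists_log_of_retract (projIcc a b hab) continuous_projIcc
    (fun s => projIcc_val hab s)) (fun R => ⟨∅, isPreconnected_empty, by simp, ?_⟩) hp hq
  obtain ⟨C, hC⟩ := (isCompact_range he.continuous).isBounded.exists_norm_le
  exact ⟨C + 1, fun t _ => by linarith [hC _ ⟨t, rfl⟩]⟩

theorem ray_joinedIn_compl {g : ℝ → ℂ} (hg : IsClosedEmbedding g) (a : ℝ) {p q : ℂ}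
    (hp : p ∉ g '' Ici a) (hq : q ∉ g '' Ici a) : JoinedIn (g '' Ici a)ᶜ p q := by
  have he : IsClosedEmbedding (fun t : Ici a => g t) :=
    hg.comp isClosed_Ici.isClosedEmbedding_subtypeVal
  have hr : range (fun t : Ici a => g t) = g '' Ici a := by
    ext z; simp
  rw [← hr] at hp hq ⊢
  refine joinedIn_compl_range he (exists_log_of_retract
    (fun x => ⟨max a x, mem_Ici.2 (le_max_left _ _)⟩)
    (Continuous.subtype_mk (by fun_prop) _)
    (fun s => Subtype.ext (max_eq_right s.2))) (fun R => ?_) hp hq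
  have h1 : Tendsto g atTop (cocompact ℂ) :=
    hg.tendsto_cocompact.mono_left (by rw [cocompact_eq_atBot_atTop]; exact le_sup_right)
  have h2 := tendsto_norm_cocompact_atTop.comp h1
  obtain ⟨T, hT⟩ := (h2.eventually_ge_atTop R).exists_forall_of_atTop
  refine ⟨{t | max a T ≤ (t : ℝ)}, ?_, fun t ht => hT t ((le_max_right _ _).trans ht), ?_⟩
  · have : {t : Ici a | max a T ≤ (t : ℝ)} = Subtype.val ⁻¹' (Ici (max a T)) := rfl
    rw [this, ← IsInducing.subtypeVal.isPreconnected_image, Subtype.image_preimage_coe,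
      inter_eq_right.2 (Ici_subset_Ici.2 (le_max_left _ _))]
    exact isPreconnected_Ici
  · obtain ⟨C, hC⟩ := (isCompact_Icc.image hg.continuous (s := Icc a (max a T))).isBounded.exists_norm_le
    refine ⟨C + 1, fun t ht => ?_⟩
    have := hC (g t) ⟨t, ⟨t.2, le_of_lt (not_le.1 ht)⟩, rfl⟩
    linarith

theorem isClosedEmbedding_comp_neg {g : ℝ → ℂ} (hg : IsClosedEmbedding g) :
    IsClosedEmbedding (fun t => g (-t)) :=
  hg.comp (Homeomorph.neg ℝ).isClosedEmbedding

theorem ray_joinedIn_compl' {g : ℝ → ℂ} (hg : IsClosedEmbedding g) (a : ℝ) {p q : ℂ}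
    (hp : p ∉ g '' Iic a) (hq : q ∉ g '' Iic a) : JoinedIn (g '' Iic a)ᶜ p q := by
  have hr : (fun t => g (-t)) '' Ici (-a) = g '' Iic a := by
    rw [← image_image g (fun t => -t)]; simp
  rw [← hr] at hp hq ⊢
  exact ray_joinedIn_compl (isClosedEmbedding_comp_neg hg) _ hp hq

theorem isConnected_compl_of_joinedIn {A : Set ℂ} 
    (h : ∀ p q, p ∉ A → q ∉ A → JoinedIn Aᶜ p q) : IsPreconnected Aᶜ := by
  apply isPreconnected_of_forall_pair
  intro p hp q hq
  obtain ⟨γ, hγ⟩ := h p q hp hq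
  exact ⟨range γ, by rintro _ ⟨t, rfl⟩; exact hγ t, ⟨0, by simp⟩, ⟨1, by simp⟩,
    isPreconnected_range γ.continuous⟩

/-! ### Separation by lines -/

/-- A logarithm of `z - g 0` off the ray `g [0, ∞)`. -/
theorem exists_log_compl_ray {g : ℝ → ℂ} (hg : IsClosedEmbedding g) :
    ∃ l : ℂ → ℂ, ContinuousOn l (g '' Ici 0)ᶜ ∧
      ∀ z ∈ (g '' Ici 0)ᶜ, Complex.exp (l z) = z - g 0 := by
  obtain ⟨p, hp⟩ : ∃ p, p ∉ g '' Ici (0 : ℝ) := by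
    refine ⟨g (-1), ?_⟩
    rintro ⟨t, ht, h⟩
    have := hg.injective h
    rw [this] at ht
    have : (0 : ℝ) ≤ -1 := ht
    linarith
  have h1 : Tendsto g atTop (cocompact ℂ) :=
    hg.tendsto_cocompact.mono_left (by rw [cocompact_eq_atBot_atTop]; exact le_sup_right)
  let κ : unitInterval → ℂ := fun u => if (u : ℝ) = 0 then 0 else (g ((u : ℝ)⁻¹ - 1) - p)⁻¹
  have hgp : ∀ u : unitInterval, (u : ℝ) ≠ 0 → (u : ℝ)⁻¹ - 1 ∈ Ici (0 : ℝ) := fun u hu => by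
    have h0 : 0 < (u : ℝ) := lt_of_le_of_ne u.2.1 (Ne.symm hu)
    have := (one_le_inv₀ h0).2 u.2.2
    simpa using this
  have hκ : Continuous κ := by
    rw [continuous_iff_continuousAt]
    intro u
    by_cases hu : (u : ℝ) = 0
    · have : κ u = 0 := if_pos hu
      rw [ContinuousAt, this]
      have h2 : Tendsto (fun x : ℝ => if x = 0 then 0 else (g (x⁻¹ - 1) - p)⁻¹)
          (𝓝[≥] (0 : ℝ)) (𝓝 0) := by
        have h3 : Tendsto (fun x : ℝ => (g (x⁻¹ - 1) - p)⁻¹) (𝓝[>] (0 : ℝ)) (𝓝 0) := by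
          have h4 : Tendsto (fun x : ℝ => x⁻¹ - 1) (𝓝[>] (0 : ℝ)) atTop :=
            tendsto_atTop_add_const_right _ _ tendsto_inv_nhdsGT_zero
          have h5 : Tendsto (fun z : ℂ => z - p) (cocompact ℂ) (Bornology.cobounded ℂ) := by
            rw [Metric.cobounded_eq_cocompact]
            exact (Homeomorph.subRight p).isClosedEmbedding.tendsto_cocompact
          exact tendsto_inv₀_cobounded.comp (h5.comp (h1.comp h4))
        rw [← Ioi_insert, nhdsWithin_insert, tendsto_sup]
        refine ⟨?_, ?_⟩
        · rw [tendsto_pure_left]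
          intro s hs
          simpa using mem_of_mem_nhds hs
        refine h3.congr' ?_
        filter_upwards [self_mem_nhdsWithin] with x hx
        exact (if_neg (ne_of_gt (mem_Ioi.1 hx))).symm
      refine h2.comp (tendsto_nhdsWithin_iff.2 ⟨?_, Eventually.of_forall fun x => x.2.1⟩)
      rw [← hu]; exact continuous_subtype_val.continuousAt
    · have : ContinuousAt (fun u : unitInterval => (g ((u : ℝ)⁻¹ - 1) - p)⁻¹) u := by
        apply ContinuousAt.inv₀
        · apply ContinuousAt.sub _ continuousAt_const
          apply hg.continuous.continuousAt.comp
          exact (continuous_subtype_val.continuousAt.inv₀ hu).sub continuousAt_const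
        · exact fun h => hp ⟨_, hgp u hu, sub_eq_zero.1 h⟩
      refine this.congr ?_
      have : ∀ᶠ x : unitInterval in 𝓝 u, (x : ℝ) ≠ 0 :=
        continuous_subtype_val.continuousAt.eventually_ne hu
      filter_upwards [this] with x hx
      simp only [κ, hx, if_false]
  obtain ⟨L, hL, -⟩ := homotopy_log (A := ((g '' Ici (0 : ℝ))ᶜ : Set ℂ))
    ⟨fun x => 1 + (p - x.2) * κ x.1, by fun_prop⟩ (fun x => by
      simp only [ContinuousMap.coe_mk]
      by_cases hu : (x.1 : ℝ) = 0
      · simp only [κ, hu, if_true, mul_zero, add_zero]; exact one_ne_zero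
      · simp only [κ, hu, if_false]
        have h1 : g ((x.1 : ℝ)⁻¹ - 1) - p ≠ 0 := fun h => hp ⟨_, hgp _ hu, sub_eq_zero.1 h⟩
        intro h
        apply x.2.2
        refine ⟨_, hgp _ hu, ?_⟩
        have h2 := mul_inv_cancel₀ h1
        linear_combination (g ((x.1 : ℝ)⁻¹ - 1) - p) * h - (p - x.2) * h2)
    (ContinuousMap.const _ 0) (fun a => by simp [κ])
  have hvp : g 0 - p ≠ 0 := fun h => hp ⟨0, by simp, sub_eq_zero.1 h⟩
  classical
  refine ⟨fun z => if hz : z ∈ (g '' Ici (0 : ℝ))ᶜ then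
    L (1, ⟨z, hz⟩) + Complex.log (-(g 0 - p)) else 0, ?_, ?_⟩
  · rw [continuousOn_iff_continuous_domRestrict]
    have : (g '' Ici (0 : ℝ))ᶜ.domRestrict (fun z => if hz : z ∈ (g '' Ici (0 : ℝ))ᶜ then
      L (1, ⟨z, hz⟩) + Complex.log (-(g 0 - p)) else 0)
        = fun z => L (1, z) + Complex.log (-(g 0 - p)) := by
      ext z
      rw [Set.domRestrict_apply, dif_pos z.2]
    rw [this]; fun_prop
  · intro z hz
    simp only [hz, dite_true]
    rw [Complex.exp_add, hL, Complex.exp_log (neg_ne_zero.2 hvp)]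
    simp [κ]
    field_simp
    ring

theorem range_eq_union_rays (g : ℝ → ℂ) (a : ℝ) : range g = g '' Ici a ∪ g '' Iic a := by
  rw [← image_union, union_comm, Iic_union_Ici, image_univ]

theorem rays_inter {g : ℝ → ℂ} (hg : Function.Injective g) (a : ℝ) :
    g '' Ici a ∩ g '' Iic a = {g a} := by
  rw [← image_inter hg, inter_comm, Iic_inter_Ici, Icc_self, image_singleton]

theorem line_separates {g : ℝ → ℂ} (hg : IsClosedEmbedding g) :
    ¬ IsPreconnected (range g)ᶜ := by
  intro hpre
  obtain ⟨l₁, c₁, e₁⟩ := exists_log_compl_ray hg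
  obtain ⟨l₂, c₂, e₂⟩ := exists_log_compl_ray (isClosedEmbedding_comp_neg hg)
  have hr : (fun t => g (-t)) '' Ici 0 = g '' Iic 0 := by
    rw [← image_image g (fun t => -t)]; simp
  rw [hr] at c₂ e₂
  simp only [neg_zero] at e₂
  have hu := range_eq_union_rays g 0
  have hi := rays_inter hg.injective 0
  have hA : IsClosed (g '' Ici 0) := hg.isClosedMap _ isClosed_Ici
  have hB : IsClosed (g '' Iic 0) := hg.isClosedMap _ isClosed_Iic
  have s1 : (range g)ᶜ ⊆ (g '' Ici 0)ᶜ := compl_subset_compl.2 (image_subset_range _ _)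
  have s2 : (range g)ᶜ ⊆ (g '' Iic 0)ᶜ := compl_subset_compl.2 (image_subset_range _ _)
  obtain ⟨n, hn⟩ := log_diff_const hpre (c₁.mono s1) (c₂.mono s2)
    (fun z hz => (e₁ z (s1 hz)).trans (e₂ z (s2 hz)).symm)
  classical
  set l : ℂ → ℂ := fun z => if z ∈ g '' Ici 0 then l₂ z + n * (2 * Real.pi * Complex.I) else l₁ z
  have hl1 : EqOn l l₁ (g '' Ici 0)ᶜ := fun z hz => by
    have : z ∉ g '' Ici 0 := hz
    simp only [l, this, if_false]
  have hl2 : EqOn l (fun z => l₂ z + n * (2 * Real.pi * Complex.I)) (g '' Iic 0)ᶜ := fun z hz => by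
    by_cases h : z ∈ g '' Ici 0
    · simp only [l, h, if_true]
    · simp only [l, h, if_false]
      apply hn
      rw [hu]
      exact fun h' => h'.elim h hz
  have hcov : ∀ z, z ≠ g 0 → z ∈ (g '' Ici 0)ᶜ ∨ z ∈ (g '' Iic 0)ᶜ := by
    intro z hz
    by_contra! h
    simp only [mem_compl_iff, not_not] at h
    have : z ∈ g '' Ici 0 ∩ g '' Iic 0 := h
    rw [hi] at this
    exact hz this
  refine no_log_sphere (q := g 0) (R := ‖g 0‖ + 1) (by linarith) l ?_ ?_
  · intro z hz
    apply ContinuousAt.continuousWithinAt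
    have hz0 : z ≠ g 0 := by rintro rfl; simp at hz
    rcases hcov z hz0 with h | h
    · exact ((c₁.congr hl1).continuousAt (hA.isOpen_compl.mem_nhds h))
    · exact (((c₂.add continuousOn_const).congr hl2).continuousAt (hB.isOpen_compl.mem_nhds h))
  · intro z hz
    have hz0 : z ≠ g 0 := by rintro rfl; simp at hz
    rcases hcov z hz0 with h | h
    · rw [hl1 h, e₁ z h]
    · rw [hl2 h, ← e₂ z h]
      exact Complex.exp_eq_exp_iff_exists_int.2 ⟨n, rfl⟩

end

section

theorem frontier_connectedComponentIn_subset {X : Type*} [TopologicalSpace X]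
    [LocallyConnectedSpace X] {O : Set X} (hO : IsOpen O) (p : X) :
    frontier (connectedComponentIn O p) ⊆ Oᶜ := by
  intro z hz hzO
  have hopen := hO.connectedComponentIn (x := z)
  have hzm : z ∈ connectedComponentIn O z := mem_connectedComponentIn hzO
  obtain ⟨y, hy1, hy2⟩ := mem_closure_iff.1 hz.1 _ hopen hzm
  have e1 := connectedComponentIn_eq hy1
  have e2 := connectedComponentIn_eq hy2
  rw [(hO.connectedComponentIn (x := p)).frontier_eq] at hz
  exact hz.2 (by rw [e2, ← e1]; exact hzm)

theorem isPreconnected_compl_two_rays {g : ℝ → ℂ} (hg : IsClosedEmbedding g) {a b : ℝ}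
    (hab : a < b) : IsPreconnected (g '' Iic a ∪ g '' Ici b)ᶜ := by
  apply isConnected_compl_of_joinedIn
  intro p q hp hq
  simp only [mem_union, not_or] at hp hq
  apply joinedIn_union_compl' (hg.isClosedMap _ isClosed_Iic) (hg.isClosedMap _ isClosed_Ici)
  · rw [disjoint_image_iff hg.injective, disjoint_left]
    intro x hx hx'
    simp at hx hx'
    linarith
  · exact ray_joinedIn_compl' hg a hp.1 hq.1
  · exact ray_joinedIn_compl hg b hp.2 hq.2

theorem line_frontier {g : ℝ → ℂ} (hg : IsClosedEmbedding g) {p : ℂ} (hp : p ∉ range g) :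
    frontier (connectedComponentIn (range g)ᶜ p) = range g := by
  set W := connectedComponentIn (range g)ᶜ p
  have hO : IsOpen (range g)ᶜ := hg.isClosed_range.isOpen_compl
  have hW : IsOpen W := hO.connectedComponentIn
  have hsub : frontier W ⊆ range g := by
    simpa using frontier_connectedComponentIn_subset hO p
  refine subset_antisymm hsub ?_
  rintro _ ⟨t, rfl⟩
  by_contra ht
  have hopen : IsOpen (g ⁻¹' (frontier W)ᶜ) := isClosed_frontier.isOpen_compl.preimage hg.continuous
  obtain ⟨ε, hε, hball⟩ := Metric.isOpen_iff.1 hopen t ht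
  have hpre := isPreconnected_compl_two_rays hg (a := t - ε / 2) (b := t + ε / 2) (by linarith)
  have hpW : p ∈ W := mem_connectedComponentIn hp
  have key := hpre.subset_of_closure_inter_subset hW ⟨p, ?_, hpW⟩ ?_
  · have : g t ∈ W := key (by
      rintro (⟨s, hs, h⟩ | ⟨s, hs, h⟩) <;> rw [hg.injective h] at hs <;>
      simp only [mem_Iic, mem_Ici] at hs <;> linarith)
    exact connectedComponentIn_subset _ _ this ⟨t, rfl⟩
  · rintro (⟨s, hs, h⟩ | ⟨s, hs, h⟩) <;> exact hp ⟨s, h⟩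
  · rintro z ⟨hz1, hz2⟩
    by_contra hzW
    have hzf : z ∈ frontier W := by rw [hW.frontier_eq]; exact ⟨hz1, hzW⟩
    obtain ⟨s, rfl⟩ := hsub hzf
    have hs : s ∉ Metric.ball t ε := fun h => hball h hzf
    rw [Metric.mem_ball, Real.dist_eq, not_lt, le_abs] at hs
    apply hz2
    rcases hs with hs | hs
    · right; exact ⟨s, by simp only [mem_Ici]; linarith, rfl⟩
    · left; exact ⟨s, by simp only [mem_Iic]; linarith, rfl⟩

theorem add_int_period {l : ℂ → ℂ} {c : ℂ} (h : ∀ w, l (w + c) = l w) (n : ℤ) (w : ℂ) :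
    l (w + n * c) = l w := by
  have : Function.Periodic l c := h
  simpa using this.int_mul n w

/-- The two partial potentials of a locally constant `0`-`1` function off a line. -/
theorem exists_potentials {g : ℝ → ℂ} (hg : IsClosedEmbedding g) (k : ℂ → ℂ)
    (hk : ∀ z, k z = 0 ∨ k z = 1)
    (hkc : ContinuousOn k (range g)ᶜ) :
    ∃ N N' : ℂ → ℂ, ContinuousOn N (g '' Ici 0)ᶜ ∧ ContinuousOn N' (g '' Iic 0)ᶜ ∧
      (∀ z, z ≠ g 0 → N z - N' z = k z) := by
  set A := g '' Ici 0
  set B := g '' Iic 0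
  have hu : range g = A ∪ B := range_eq_union_rays g 0
  have hi : A ∩ B = {g 0} := rays_inter hg.injective 0
  have hA : IsClosed A := hg.isClosedMap _ isClosed_Ici
  have hB : IsClosed B := hg.isClosedMap _ isClosed_Iic
  have hAn : A.Nonempty := ⟨g 0, 0, by simp, rfl⟩
  have hBn : B.Nonempty := ⟨g 0, 0, by simp, rfl⟩
  let a : ℂ → ℝ := fun z => Metric.infDist z A
  let b : ℂ → ℝ := fun z => Metric.infDist z B
  have ha : Continuous a := Metric.continuous_infDist_pt A
  have hb : Continuous b := Metric.continuous_infDist_pt B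
  have ha0 : ∀ z, z ∈ A ↔ a z = 0 := fun z => hA.mem_iff_infDist_zero hAn
  have hb0 : ∀ z, z ∈ B ↔ b z = 0 := fun z => hB.mem_iff_infDist_zero hBn
  have hpa : ∀ z, 0 ≤ a z := fun z => Metric.infDist_nonneg
  have hpb : ∀ z, 0 ≤ b z := fun z => Metric.infDist_nonneg
  have hsum : ∀ z, z ≠ g 0 → a z + b z ≠ 0 := by
    intro z hz h
    have h1 : a z = 0 := by linarith [hpa z, hpb z]
    have h2 : b z = 0 := by linarith [hpa z, hpb z]
    have : z ∈ A ∩ B := ⟨(ha0 z).2 h1, (hb0 z).2 h2⟩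
    rw [hi] at this; exact hz this
  have aux : ∀ (u : ℂ → ℝ) (C D : Set ℂ), IsClosed C → Continuous u → range g = C ∪ D →
      (∀ z ∈ D, u z = 0) → g 0 ∈ C →
      ContinuousOn (fun z => ((u z / (a z + b z) : ℝ) : ℂ) * k z) Cᶜ := by
    intro u C D hC hu hCD hD hgC z hz
    have hz0 : z ≠ g 0 := by rintro rfl; exact hz hgC
    apply ContinuousAt.continuousWithinAt
    have hq : ContinuousAt (fun z => ((u z / (a z + b z) : ℝ) : ℂ)) z := by
      apply Complex.continuous_ofReal.continuousAt.comp
      exact hu.continuousAt.div (ha.add hb).continuousAt (hsum z hz0)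
    by_cases hzg : z ∈ range g
    · have hzD : z ∈ D := by rw [hCD] at hzg; exact hzg.resolve_left hz
      have h0 : ((u z / (a z + b z) : ℝ) : ℂ) = 0 := by rw [hD z hzD]; simp
      rw [ContinuousAt, h0] at hq
      rw [ContinuousAt, h0, zero_mul]
      refine squeeze_zero_norm (fun w => ?_) (tendsto_norm_zero.comp hq)
      rw [norm_mul]
      rcases hk w with h | h
      · rw [h, norm_zero, mul_zero]; exact norm_nonneg _
      · rw [h, norm_one, mul_one]; rfl
    · exact hq.mul (hkc.continuousAt (hg.isClosed_range.isOpen_compl.mem_nhds hzg))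
  have hg0A : g 0 ∈ A := ⟨0, by simp, rfl⟩
  have hg0B : g 0 ∈ B := ⟨0, by simp, rfl⟩
  refine ⟨fun z => ((b z / (a z + b z) : ℝ) : ℂ) * k z,
    fun z => - (((a z / (a z + b z) : ℝ) : ℂ) * k z), ?_, ?_, ?_⟩
  · exact aux b A B hA hb hu (fun z hz => (hb0 z).1 hz) hg0A
  · exact (aux a B A hB ha (by rw [hu, union_comm]) (fun z hz => (ha0 z).1 hz) hg0B).neg
  · intro z hz
    have h1 := hsum z hz
    have : ((b z / (a z + b z) : ℝ) : ℂ) + ((a z / (a z + b z) : ℝ) : ℂ) = 1 := by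
      rw [← Complex.ofReal_add, ← add_div, add_comm (b z), div_self h1]; simp
    linear_combination k z * this

theorem exists_cover_log {g : ℝ → ℂ} (hg : IsClosedEmbedding g) {k N N' : ℂ → ℂ}
    (hk : ∀ z, k z = 0 ∨ k z = 1)
    (hN : ContinuousOn N (g '' Ici 0)ᶜ) (hN' : ContinuousOn N' (g '' Iic 0)ᶜ)
    (hNN : ∀ z, z ≠ g 0 → N z - N' z = k z) :
    ∃ (l : ℂ → ℂ) (d : ℤ), Continuous l ∧
      (∀ w, l (w + 2 * Real.pi * Complex.I) = l w + d * (2 * Real.pi * Complex.I)) ∧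
      ∀ w, Complex.exp (l w) = Complex.exp (2 * Real.pi * Complex.I * N (g 0 + Complex.exp w)) := by
  have hA : IsClosed (g '' Ici 0) := hg.isClosedMap _ isClosed_Ici
  have hB : IsClosed (g '' Iic 0) := hg.isClosedMap _ isClosed_Iic
  have hi := rays_inter hg.injective 0
  have hne : ∀ w, g 0 + Complex.exp w ≠ g 0 := fun w h => Complex.exp_ne_zero w (by simp at h)
  have hee : ∀ z, z ≠ g 0 → Complex.exp (2 * Real.pi * Complex.I * N z) =
      Complex.exp (2 * Real.pi * Complex.I * N' z) := by
    intro z hz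
    have h1 := hNN z hz
    rcases hk z with h | h <;> rw [h] at h1
    · rw [sub_eq_zero.1 h1]
    · rw [eq_add_of_sub_eq h1]
      exact Complex.exp_eq_exp_iff_exists_int.2 ⟨1, by push_cast; ring⟩
  have hMc : ∀ z, z ≠ g 0 → ContinuousAt (fun z => Complex.exp (2 * Real.pi * Complex.I * N z)) z := by
    intro z hz
    have hAB : z ∈ (g '' Ici 0)ᶜ ∨ z ∈ (g '' Iic 0)ᶜ := by
      by_contra! h
      simp only [mem_compl_iff, not_not] at h
      have : z ∈ g '' Ici 0 ∩ g '' Iic 0 := h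
      rw [hi] at this
      exact hz this
    rcases hAB with h | h
    · have := hN.continuousAt (hA.isOpen_compl.mem_nhds h)
      fun_prop
    · have := hN'.continuousAt (hB.isOpen_compl.mem_nhds h)
      have h2 : ContinuousAt (fun z => Complex.exp (2 * Real.pi * Complex.I * N' z)) z := by fun_prop
      refine h2.congr ?_
      filter_upwards [isOpen_ne.mem_nhds hz] with y hy
      exact (hee y hy).symm
  obtain ⟨l, hlc, hl⟩ := exists_log_of_module
    (g := fun w => Complex.exp (2 * Real.pi * Complex.I * N (g 0 + Complex.exp w)))
    (by
      rw [continuous_iff_continuousAt]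
      intro w
      exact ContinuousAt.comp (f := fun w => g 0 + Complex.exp w) (hMc _ (hne w)) (by fun_prop))
    (fun w => Complex.exp_ne_zero _)
  obtain ⟨d, hd⟩ := log_diff_const (S := (univ : Set ℂ)) isPreconnected_univ
    (l₁ := fun w => l (w + 2 * Real.pi * Complex.I)) (l₂ := l) (by fun_prop) (by fun_prop)
    (fun w _ => by rw [hl, hl, Complex.exp_periodic])
  exact ⟨l, d, hlc, fun w => hd w trivial, hl⟩

theorem line_three_points {g : ℝ → ℂ} (hg : IsClosedEmbedding g) {p₁ p₂ p₃ : ℂ}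
    (h₁ : p₁ ∉ range g) (h₂ : p₂ ∉ range g) (h₃ : p₃ ∉ range g) :
    connectedComponentIn (range g)ᶜ p₁ = connectedComponentIn (range g)ᶜ p₂ ∨
    connectedComponentIn (range g)ᶜ p₁ = connectedComponentIn (range g)ᶜ p₃ ∨
    connectedComponentIn (range g)ᶜ p₂ = connectedComponentIn (range g)ᶜ p₃ := by
  classical
  by_contra! hcon
  obtain ⟨n12, n13, n23⟩ := hcon
  have hO : IsOpen (range g)ᶜ := hg.isClosed_range.isOpen_compl
  let k : ℂ → ℂ → ℂ := fun p z => if z ∈ connectedComponentIn (range g)ᶜ p then 1 else 0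
  have hkm : ∀ p q, connectedComponentIn (range g)ᶜ p ≠ connectedComponentIn (range g)ᶜ q →
      k p q = 0 := by
    intro p q h
    simp only [k, ite_eq_right_iff, one_ne_zero, imp_false]
    exact fun h' => h (connectedComponentIn_eq h')
  have hks : ∀ p, p ∉ range g → k p p = 1 := fun p hp => if_pos (mem_connectedComponentIn hp)
  have hk : ∀ p z, k p z = 0 ∨ k p z = 1 := by
    intro p z
    by_cases h : z ∈ connectedComponentIn (range g)ᶜ p <;> simp [k, h]
  have hk0 : ∀ p, ∀ z ∈ range g, k p z = 0 := fun p z hz =>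
    if_neg fun h => absurd hz (connectedComponentIn_subset _ _ h : z ∈ (range g)ᶜ)
  have hkc : ∀ p, ContinuousOn (k p) (range g)ᶜ := by
    intro p
    apply ContinuousOn.if
    · rintro z ⟨hz, hz'⟩
      exact absurd hz (frontier_connectedComponentIn_subset hO p hz')
    · exact continuousOn_const
    · exact continuousOn_const
  obtain ⟨l₁, c₁, e₁⟩ := exists_log_compl_ray hg
  obtain ⟨l₂, c₂, e₂⟩ := exists_log_compl_ray (isClosedEmbedding_comp_neg hg)
  have hr : (fun t => g (-t)) '' Ici 0 = g '' Iic 0 := by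
    rw [← image_image g (fun t => -t)]; simp
  rw [hr] at c₂ e₂
  simp only [neg_zero] at e₂
  have s1 : (range g)ᶜ ⊆ (g '' Ici 0)ᶜ := compl_subset_compl.2 (image_subset_range _ _)
  have s2 : (range g)ᶜ ⊆ (g '' Iic 0)ᶜ := compl_subset_compl.2 (image_subset_range _ _)
  have preA : IsPreconnected (g '' Ici 0)ᶜ := isConnected_compl_of_joinedIn
    fun p q hp hq => ray_joinedIn_compl hg 0 hp hq
  have preB : IsPreconnected (g '' Iic 0)ᶜ := isConnected_compl_of_joinedIn
    fun p q hp hq => ray_joinedIn_compl' hg 0 hp hq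
  obtain ⟨N₁, N₁', cN₁, cN₁', hN₁⟩ := exists_potentials hg (k p₁) (hk p₁) (hkc p₁)
  obtain ⟨N₂, N₂', cN₂, cN₂', hN₂⟩ := exists_potentials hg (k p₂) (hk p₂) (hkc p₂)
  obtain ⟨L₁, d₁, cL₁, hd₁, hL₁⟩ := exists_cover_log hg (hk p₁) cN₁ cN₁' hN₁
  obtain ⟨L₂, d₂, cL₂, hd₂, hL₂⟩ := exists_cover_log hg (hk p₂) cN₂ cN₂' hN₂
  have comb : ∀ a b : ℤ, a * d₁ + b * d₂ = 0 → ∃ n : ℤ, ∀ z ∈ (range g)ᶜ,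
      a * k p₁ z + b * k p₂ z = n := by
    intro a b hab
    set L : ℂ → ℂ := fun w => a * L₁ w + b * L₂ w
    have hLc : Continuous L := by fun_prop
    have hper : ∀ w, L (w + 2 * Real.pi * Complex.I) = L w := by
      intro w
      have : (a : ℂ) * d₁ + b * d₂ = 0 := by exact_mod_cast hab
      simp only [L, hd₁, hd₂]
      linear_combination (2 * Real.pi * Complex.I) * this
    have hLe : ∀ w, Complex.exp (L w) = Complex.exp (2 * Real.pi * Complex.I *
        (a * N₁ (g 0 + Complex.exp w) + b * N₂ (g 0 + Complex.exp w))) := by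
      intro w
      simp only [L, Complex.exp_add, Complex.exp_int_mul, hL₁, hL₂, mul_add]
      rw [← Complex.exp_int_mul, ← Complex.exp_int_mul]
      congr 2 <;> ring
    have hLp : ∀ w w', Complex.exp w = Complex.exp w' → L w = L w' := by
      intro w w' h
      obtain ⟨n, rfl⟩ := Complex.exp_eq_exp_iff_exists_int.1 h
      exact add_int_period hper n w'
    obtain ⟨n₁, hn₁⟩ := log_diff_const preA (l₁ := fun z => L (l₁ z))
      (l₂ := fun z => 2 * Real.pi * Complex.I * (a * N₁ z + b * N₂ z))
      (hLc.comp_continuousOn c₁) (by fun_prop) (fun z hz => by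
        rw [hLe, e₁ z hz]; simp)
    have hshift : ∀ z, z ≠ g 0 → Complex.exp (2 * Real.pi * Complex.I * (a * N₁ z + b * N₂ z)) =
        Complex.exp (2 * Real.pi * Complex.I * (a * N₁' z + b * N₂' z)) := by
      intro z hz
      have h1 := hN₁ z hz
      have h2 := hN₂ z hz
      rw [Complex.exp_eq_exp_iff_exists_int]
      obtain ⟨m₁, hm₁⟩ : ∃ m : ℤ, k p₁ z = m := by
        rcases hk p₁ z with h | h
        · exact ⟨0, by simp [h]⟩
        · exact ⟨1, by simp [h]⟩
      obtain ⟨m₂, hm₂⟩ : ∃ m : ℤ, k p₂ z = m := by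
        rcases hk p₂ z with h | h
        · exact ⟨0, by simp [h]⟩
        · exact ⟨1, by simp [h]⟩
      refine ⟨a * m₁ + b * m₂, ?_⟩
      push_cast
      rw [← hm₁, ← hm₂]
      linear_combination (2 * Real.pi * Complex.I) * (a * h1 + b * h2)
    have hB0 : ∀ z ∈ (g '' Iic 0)ᶜ, z ≠ g 0 := by
      rintro _ h rfl; exact h ⟨0, by simp, rfl⟩
    obtain ⟨n₂, hn₂⟩ := log_diff_const preB (l₁ := fun z => L (l₂ z))
      (l₂ := fun z => 2 * Real.pi * Complex.I * (a * N₁' z + b * N₂' z))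
      (hLc.comp_continuousOn c₂) (by fun_prop) (fun z hz => by
        rw [hLe, e₂ z hz, ← hshift z (hB0 z hz)]; simp)
    refine ⟨n₂ - n₁, fun z hz => ?_⟩
    have hz0 : z ≠ g 0 := hB0 z (s2 hz)
    have e := hLp (l₁ z) (l₂ z) ((e₁ z (s1 hz)).trans (e₂ z (s2 hz)).symm)
    have q1 := hn₁ z (s1 hz)
    have q2 := hn₂ z (s2 hz)
    rw [e, q2] at q1
    have h1 := hN₁ z hz0
    have h2 := hN₂ z hz0
    have hpi : (2 * Real.pi * Complex.I : ℂ) ≠ 0 := Complex.two_pi_I_ne_zero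
    apply mul_left_cancel₀ hpi
    push_cast
    linear_combination -q1 - (2 * Real.pi * Complex.I) * (a * h1 + b * h2)
  obtain ⟨n, hn⟩ := comb d₂ (-d₁) (by ring)
  have v1 := hn p₁ h₁
  have v2 := hn p₂ h₂
  have v3 := hn p₃ h₃
  rw [hks p₁ h₁, hkm _ _ n12.symm] at v1
  rw [hks p₂ h₂, hkm _ _ n12] at v2
  rw [hkm _ _ n13, hkm _ _ n23] at v3
  have hn0 : (n : ℂ) = 0 := by rw [← v3]; simp
  rw [hn0] at v1 v2
  have hd1 : d₁ = 0 := by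
    have : (d₁ : ℂ) = 0 := by simpa using v2
    exact_mod_cast this
  obtain ⟨n', hn'⟩ := comb 1 0 (by simp [hd1])
  have w1 := hn' p₁ h₁
  have w3 := hn' p₃ h₃
  rw [hks p₁ h₁] at w1
  rw [hkm _ _ n13, ← w1] at w3
  simp at w3

end

section

theorem joinedIn_compl_iff {Z : Set ℂ} (hZ : IsClosed Z) {p q : ℂ} (hp : p ∉ Z) :
    JoinedIn Zᶜ p q ↔ q ∈ connectedComponentIn Zᶜ p := by
  constructor
  · rintro ⟨γ, hγ⟩
    have : IsPreconnected (range γ) := isPreconnected_range γ.continuous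
    refine this.subset_connectedComponentIn ⟨0, γ.source⟩ ?_ ⟨1, γ.target⟩
    rintro _ ⟨t, rfl⟩; exact hγ t
  · intro h
    have ho : IsOpen (connectedComponentIn Zᶜ p) := hZ.isOpen_compl.connectedComponentIn
    have hc : IsConnected (connectedComponentIn Zᶜ p) :=
      isConnected_connectedComponentIn_iff.2 hp
    exact ((ho.isConnected_iff_isPathConnected.1 hc).joinedIn p (mem_connectedComponentIn hp) q h).mono
      (connectedComponentIn_subset _ _)

theorem joinedIn_of_isPreconnected {O C : Set ℂ} (hO : IsOpen O) (hC : IsPreconnected C)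
    (hCO : C ⊆ O) {p q : ℂ} (hp : p ∈ C) (hq : q ∈ C) : JoinedIn O p q := by
  have := joinedIn_compl_iff hO.isClosed_compl (p := p) (q := q) (by simpa using hCO hp)
  rw [compl_compl] at this
  exact this.2 (hC.subset_connectedComponentIn hp hCO hq)

/-- The component of the complement of the line `l` containing `p`. -/
def side (l : ℝ → ℂ) (p : ℂ) : Set ℂ := connectedComponentIn (range l)ᶜ p

/-- The component of the complement of the line `l` not containing `c`. -/
def out (l : ℝ → ℂ) (c : ℂ) : Set ℂ := (range l ∪ side l c)ᶜ

theorem mem_side {l : ℝ → ℂ} {p : ℂ} (hp : p ∉ range l) : p ∈ side l p :=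
  mem_connectedComponentIn hp

theorem side_subset_compl (l : ℝ → ℂ) (p : ℂ) : side l p ⊆ (range l)ᶜ :=
  connectedComponentIn_subset _ _

theorem isPreconnected_side (l : ℝ → ℂ) (p : ℂ) : IsPreconnected (side l p) :=
  isPreconnected_connectedComponentIn

theorem side_eq {l : ℝ → ℂ} {p q : ℂ} (h : q ∈ side l p) : side l p = side l q :=
  connectedComponentIn_eq h

theorem subset_side {l : ℝ → ℂ} {p x : ℂ} {s : Set ℂ} (hs : IsPreconnected s)
    (hsl : Disjoint s (range l)) (hx : x ∈ s) (hxp : x ∈ side l p) : s ⊆ side l p := by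
  rw [side_eq hxp]
  exact hs.subset_connectedComponentIn hx (disjoint_left.1 hsl)

section line
variable {l m : ℝ → ℂ}

theorem isOpen_side (hl : IsClosedEmbedding l) (p : ℂ) : IsOpen (side l p) :=
  hl.isClosed_range.isOpen_compl.connectedComponentIn

theorem closure_side (hl : IsClosedEmbedding l) {p : ℂ} (hp : p ∉ range l) : closure (side l p) = side l p ∪ range l := by
  rw [closure_eq_self_union_frontier]
  congr 1
  exact line_frontier hl hp

theorem isPreconnected_side_union (hl : IsClosedEmbedding l) {p : ℂ} (hp : p ∉ range l) :
    IsPreconnected (side l p ∪ range l) := by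
  rw [← closure_side hl hp]; exact (isPreconnected_side l p).closure

theorem out_nonempty (hl : IsClosedEmbedding l) {c : ℂ} (hc : c ∉ range l) : (out l c).Nonempty := by
  by_contra h
  rw [not_nonempty_iff_eq_empty, out, compl_empty_iff] at h
  apply line_separates hl
  have : (range l)ᶜ = side l c := by
    apply Subset.antisymm _ (side_subset_compl l c)
    intro z hz
    have : z ∈ range l ∪ side l c := h ▸ mem_univ z
    exact this.resolve_left hz
  rw [this]; exact isPreconnected_side l c

theorem out_eq_side (hl : IsClosedEmbedding l) {c p : ℂ} (hc : c ∉ range l) (hp : p ∈ out l c) : out l c = side l p := by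
  simp only [out, mem_compl_iff, mem_union, not_or] at hp
  ext z
  simp only [out, mem_compl_iff, mem_union, not_or]
  constructor
  · rintro ⟨hz, hzc⟩
    rcases line_three_points hl hc hp.1 hz with h | h | h
    · exact absurd ((show side l c = side l p from h) ▸ mem_side hp.1 : p ∈ side l c) hp.2
    · exact absurd ((show side l c = side l z from h) ▸ mem_side hz : z ∈ side l c) hzc
    · exact (show side l p = side l z from h) ▸ mem_side hz
  · intro hz
    refine ⟨side_subset_compl _ _ hz, fun h => hp.2 ?_⟩
    rw [side_eq h, ← side_eq hz]
    exact mem_side hp.1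

theorem notMem_range_of_mem_out {c p : ℂ} (hp : p ∈ out l c) : p ∉ range l := fun h => hp (Or.inl h)

theorem mem_out_of_notMem {c p : ℂ} (hp : p ∉ range l) (h : p ∉ side l c) : p ∈ out l c := by
  simp [out, hp, h]

theorem out_symm (hl : IsClosedEmbedding l) {c p : ℂ} (hc : c ∉ range l) (hp : p ∈ out l c) : out l p = side l c := by
  have : c ∈ out l p := by
    refine mem_out_of_notMem hc fun h => ?_
    have := side_eq h
    exact hp (Or.inr (this ▸ mem_side (notMem_range_of_mem_out hp)))
  exact out_eq_side hl (notMem_range_of_mem_out hp) this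

theorem isPreconnected_out (hl : IsClosedEmbedding l) {c : ℂ} (hc : c ∉ range l) : IsPreconnected (out l c) := by
  obtain ⟨p, hp⟩ := out_nonempty hl hc
  rw [out_eq_side hl hc hp]; exact isPreconnected_side l p

theorem closure_out (hl : IsClosedEmbedding l) {c : ℂ} (hc : c ∉ range l) : closure (out l c) = out l c ∪ range l := by
  obtain ⟨p, hp⟩ := out_nonempty hl hc
  rw [out_eq_side hl hc hp]; exact closure_side hl (notMem_range_of_mem_out hp)

theorem isPreconnected_out_union (hl : IsClosedEmbedding l) {c : ℂ} (hc : c ∉ range l) :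
    IsPreconnected (out l c ∪ range l) := by
  rw [← closure_out hl hc]; exact (isPreconnected_out hl hc).closure

theorem subset_out (hl : IsClosedEmbedding l) {c x : ℂ} {s : Set ℂ} (hc : c ∉ range l) (hs : IsPreconnected s)
    (hsl : Disjoint s (range l)) (hx : x ∈ s) (hxp : x ∈ out l c) : s ⊆ out l c := by
  rw [out_eq_side hl hc hxp]
  exact subset_side hs hsl hx (mem_side (notMem_range_of_mem_out hxp))

theorem isPreconnected_line (hl : IsClosedEmbedding l) : IsPreconnected (range l) :=
  isPreconnected_range hl.continuous

theorem notMem_out {c : ℂ} (hc : c ∉ range l) : c ∉ out l c := fun h => h (Or.inr (mem_side hc))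

theorem disjoint_out_side (c : ℂ) : Disjoint (out l c) (side l c) :=
  disjoint_left.2 fun _ h h' => h (Or.inr h')

theorem disjoint_out_range (c : ℂ) : Disjoint (out l c) (range l) :=
  disjoint_left.2 fun _ h h' => h (Or.inl h')

theorem disjoint_side_range (c : ℂ) : Disjoint (side l c) (range l) :=
  disjoint_left.2 fun _ h h' => side_subset_compl _ _ h h'

theorem side_or_out {c p : ℂ} (hp : p ∉ range l) : p ∈ side l c ∨ p ∈ out l c := by
  by_cases h : p ∈ side l c
  · exact Or.inl h
  · exact Or.inr (mem_out_of_notMem hp h)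

theorem subset_side_or_out (hl : IsClosedEmbedding l) {c : ℂ} {s : Set ℂ} (hc : c ∉ range l) (hs : IsPreconnected s)
    (hsl : Disjoint s (range l)) : s ⊆ side l c ∨ s ⊆ out l c := by
  rcases s.eq_empty_or_nonempty with rfl | ⟨x, hx⟩
  · exact Or.inl (empty_subset _)
  · rcases side_or_out (c := c) (disjoint_left.1 hsl hx) with h | h
    · exact Or.inl (subset_side hs hsl hx h)
    · exact Or.inr (subset_out hl hc hs hsl hx h)



theorem out_subset_out (hl : IsClosedEmbedding l) {c : ℂ} (hcl : c ∉ range l) (hcm : c ∉ range m)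
    (h : range m ⊆ out l c) : out m c ∪ range m ⊆ out l c := by
  have h1 : Disjoint (side l c ∪ range l) (range m) := by
    rw [disjoint_left]
    rintro z hz hzm
    exact h hzm (by rwa [union_comm])
  have h2 := subset_side (isPreconnected_side_union hl hcl) h1 (Or.inl (mem_side hcl)) (mem_side hcm)
  rintro z (hz | hz)
  · rintro (h3 | h3)
    · exact hz (Or.inr (h2 (Or.inr h3)))
    · exact hz (Or.inr (h2 (Or.inl h3)))
  · exact h hz

theorem out_nested (hl : IsClosedEmbedding l) (hm : IsClosedEmbedding m) {c : ℂ} (hcl : c ∉ range l) (hcm : c ∉ range m)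
    (h : Disjoint (range l) (range m)) :
    out m c ∪ range m ⊆ out l c ∨ out l c ∪ range l ⊆ out m c ∨
      Disjoint (out l c ∪ range l) (out m c ∪ range m) := by
  rcases subset_side_or_out hl hcl (isPreconnected_line hm) h.symm with h1 | h1
  · rcases subset_side_or_out hm hcm (isPreconnected_line hl) h with h2 | h2
    · right; right
      have h3 : Disjoint (out l c ∪ range l) (range m) := by
        rw [disjoint_union_left]
        exact ⟨(disjoint_out_side c).mono_right h1, h⟩
      have h4 := subset_side (isPreconnected_out_union hl hcl) h3 (Or.inr ⟨0, rfl⟩) (h2 ⟨0, rfl⟩)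
      rw [disjoint_union_right]
      exact ⟨(disjoint_out_side c).symm.mono_left h4, h3⟩
    · right; left; exact out_subset_out hm hcm hcl h2
  · left; exact out_subset_out hl hcl hcm h1

theorem side_union_subset (hl : IsClosedEmbedding l) (hm : IsClosedEmbedding m) {p q : ℂ} (hp : p ∉ range l) (hq : q ∉ range m)
    (h : Disjoint (range l) (range m)) (hs : side m q ⊆ side l p) :
    side m q ∪ range m ⊆ side l p := by
  have := closure_mono hs
  rw [closure_side hl hp, closure_side hm hq] at this
  intro z hz
  rcases this hz with h1 | h1
  · exact h1
  · rcases hz with h2 | h2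
    · exact hs h2
    · exact absurd h2 (disjoint_left.1 h h1)

end line

/-- If a closed set is partitioned into connected, relatively open closed pieces none of which
separates `p` from `q`, then it does not separate `p` from `q`. -/
theorem joinedIn_compl_of_pieces {Z : Set ℂ} (hZ : IsClosed Z) {p q : ℂ} (hp : p ∉ Z)
    (hq : q ∉ Z)
    (h : ∀ z ∈ Z, ∃ A, z ∈ A ∧ A ⊆ Z ∧ IsClosed A ∧ IsPreconnected A ∧
      (∃ O, IsOpen O ∧ O ∩ Z = A) ∧ JoinedIn Aᶜ p q) : JoinedIn Zᶜ p q := by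
  obtain ⟨γ⟩ : Nonempty (Path p q) := ⟨(PathConnectedSpace.somePath p q)⟩
  choose! A hzA hAZ hAc hAp hAO hAj using h
  choose! O hO hOA using hAO
  have hcomp : IsCompact (range γ ∩ Z) := (isCompact_range γ.continuous).inter_right hZ
  obtain ⟨t, htZ, ht⟩ := hcomp.elim_nhds_subcover O (fun z hz => (hO z hz.2).mem_nhds
    ((hOA z hz.2).symm ▸ hzA z hz.2 : z ∈ O z ∩ Z).1)
  have key : ∀ t : Finset ℂ, (∀ x ∈ t, x ∈ Z) → JoinedIn (⋃ x ∈ t, A x)ᶜ p q := by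
    intro t
    induction t using Finset.induction_on with
    | empty => intro _; simpa using JoinedIn.ofLine (F := univ) (f := fun t => p + (t : ℂ) * (q - p))
                (by fun_prop) (by simp) (by simp) (by simp)
    | insert a s ha ih =>
      intro hs
      have hsZ : ∀ x ∈ s, x ∈ Z := fun x hx => hs x (Finset.mem_insert_of_mem hx)
      have haZ := hs a (Finset.mem_insert_self _ _)
      rw [Finset.set_biUnion_insert]
      have hcl : IsClosed (⋃ x ∈ s, A x) :=
        s.finite_toSet.isClosed_biUnion (fun x hx => hAc x (hsZ x hx))
      by_cases hd : Disjoint (A a) (⋃ x ∈ s, A x)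
      · exact joinedIn_union_compl' (hAc a haZ) hcl hd (hAj a haZ) (ih hsZ)
      · have : A a ⊆ ⋃ x ∈ s, A x := by
          rw [not_disjoint_iff] at hd
          obtain ⟨z, hz, hz'⟩ := hd
          have hop : IsOpen (⋃ x ∈ s, O x) := isOpen_biUnion fun x hx => hO x (hsZ x hx)
          have hOs : ∀ w ∈ A a, w ∈ (⋃ x ∈ s, O x) → w ∈ ⋃ x ∈ s, A x := by
            intro w hw hw'
            simp only [mem_iUnion, exists_prop] at hw' ⊢
            obtain ⟨x, hx, hx'⟩ := hw'
            exact ⟨x, hx, (hOA x (hsZ x hx)) ▸ ⟨hx', hAZ a haZ hw⟩⟩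
          have hsO : (⋃ x ∈ s, A x) ⊆ ⋃ x ∈ s, O x :=
            iUnion₂_mono fun x hx => by rw [← hOA x (hsZ x hx)]; exact inter_subset_left
          intro w hw
          by_contra hwn
          obtain ⟨y, hy, hy1, hy2⟩ := hAp a haZ _ _ hop hcl.isOpen_compl
            (fun y hy => by
              by_cases h : y ∈ ⋃ x ∈ s, A x
              · exact Or.inl (hsO h)
              · exact Or.inr h) ⟨z, hz, hsO hz'⟩ ⟨w, hw, hwn⟩
          exact hy2 (hOs y hy hy1)
        rw [union_eq_self_of_subset_left this]; exact ih hsZ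
  have htZ' : ∀ x ∈ t, x ∈ Z := fun x hx => (htZ x hx).2
  have hF : IsClosed (⋃ x ∈ t, A x) :=
    t.finite_toSet.isClosed_biUnion (fun x hx => hAc x (htZ' x hx))
  have hR : IsClosed (Z \ ⋃ x ∈ t, O x) :=
    hZ.sdiff (isOpen_biUnion fun x hx => hO x (htZ' x hx))
  have hdis : Disjoint (⋃ x ∈ t, A x) (Z \ ⋃ x ∈ t, O x) := by
    rw [disjoint_left]
    intro w hw hw'
    simp only [mem_iUnion, exists_prop] at hw
    obtain ⟨x, hx, hx'⟩ := hw
    apply hw'.2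
    simp only [mem_iUnion, exists_prop]
    rw [← hOA x (htZ' x hx)] at hx'
    exact ⟨x, hx, hx'.1⟩
  have hRj : JoinedIn (Z \ ⋃ x ∈ t, O x)ᶜ p q := by
    refine ⟨γ, fun s hs => hs.2 (ht ⟨mem_range_self s, hs.1⟩)⟩
  refine (joinedIn_union_compl' hF hR hdis (key t htZ') hRj).mono ?_
  rw [compl_subset_compl]
  intro z hz
  by_cases h : z ∈ ⋃ x ∈ t, O x
  · left
    simp only [mem_iUnion, exists_prop] at h ⊢
    obtain ⟨x, hx, hx'⟩ := h
    exact ⟨x, hx, hOA x (htZ' x hx) ▸ ⟨hx', hz⟩⟩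
  · exact Or.inr ⟨hz, h⟩

end

section

theorem exists_glue {S₁ S₂ : Set ℝ} {b : ℝ} (h₁ : IsClosed S₁) (h₂ : IsClosed S₂)
    (hS₁ : S₁ ⊆ Iic b) (hS₂ : S₂ ⊆ Ici b) {g₁ g₂ : ℝ → ℂ} (hg₁ : ContinuousOn g₁ S₁)
    (hg₂ : ContinuousOn g₂ S₂) (hi₁ : InjOn g₁ S₁) (hi₂ : InjOn g₂ S₂) (hb : g₁ b = g₂ b)
    (h : ∀ x ∈ S₁, ∀ y ∈ S₂, g₁ x = g₂ y → x = y) :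
    ∃ g : ℝ → ℂ, ContinuousOn g (S₁ ∪ S₂) ∧ InjOn g (S₁ ∪ S₂) ∧ EqOn g g₁ S₁ ∧ EqOn g g₂ S₂ := by
  classical
  have e₁ : EqOn (fun t => if t ≤ b then g₁ t else g₂ t) g₁ S₁ := fun t ht => if_pos (hS₁ ht)
  have e₂ : EqOn (fun t => if t ≤ b then g₁ t else g₂ t) g₂ S₂ := by
    intro t ht
    have hbt : b ≤ t := hS₂ ht
    by_cases h : t ≤ b
    · obtain rfl : t = b := le_antisymm h hbt
      simp [hb]
    · exact if_neg h
  refine ⟨_, ?_, ?_, e₁, e₂⟩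
  · exact (hg₁.congr e₁).union_of_isClosed (hg₂.congr e₂) h₁ h₂
  · rintro x (hx | hx) y (hy | hy) hxy
    · rw [e₁ hx, e₁ hy] at hxy; exact hi₁ hx hy hxy
    · rw [e₁ hx, e₂ hy] at hxy; exact h x hx y hy hxy
    · rw [e₂ hx, e₁ hy] at hxy; exact (h y hy x hx hxy.symm).symm
    · rw [e₂ hx, e₂ hy] at hxy; exact hi₂ hx hy hxy

theorem injective_lineMap {y w : ℂ} (h : y ≠ w) (s : ℝ) :
    Function.Injective fun t : ℝ => y + ((t - s : ℝ) : ℂ) * (w - y) := by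
  intro t t' htt
  have h1 : ((t - s : ℝ) : ℂ) * (w - y) = ((t' - s : ℝ) : ℂ) * (w - y) := add_left_cancel htt
  have h2 := mul_right_cancel₀ (sub_ne_zero.2 h.symm) h1
  have h3 : t - s = t' - s := by exact_mod_cast h2
  linarith

theorem exists_first_hit {X : Type*} [TopologicalSpace X] {a b : ℝ} {α : ℝ → X}
    (hc : ContinuousOn α (Icc a b)) {S : Set X}
    (hS : IsClosed S) {t₀ : ℝ} (ht₀ : t₀ ∈ Icc a b) (h : α t₀ ∈ S) :
    ∃ s ∈ Icc a b, α s ∈ S ∧ ∀ t ∈ Ico a s, α t ∉ S := by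
  have hH : IsCompact (Icc a b ∩ α ⁻¹' S) :=
    isCompact_Icc.of_isClosed_subset (hc.preimage_isClosed_of_isClosed isClosed_Icc hS)
      inter_subset_left
  obtain ⟨s, hs, hmin⟩ := hH.exists_isLeast ⟨t₀, ht₀, h⟩
  exact ⟨s, hs.1, hs.2, fun t ht hα =>
    absurd (hmin ⟨⟨ht.1, ht.2.le.trans hs.1.2⟩, hα⟩) (not_le.2 ht.2)⟩

theorem exists_last_hit {X : Type*} [TopologicalSpace X] {a b : ℝ} {α : ℝ → X}
    (hc : ContinuousOn α (Icc a b)) {S : Set X}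
    (hS : IsClosed S) {t₀ : ℝ} (ht₀ : t₀ ∈ Icc a b) (h : α t₀ ∈ S) :
    ∃ s ∈ Icc a b, α s ∈ S ∧ ∀ t ∈ Ioc s b, α t ∉ S := by
  have hH : IsCompact (Icc a b ∩ α ⁻¹' S) :=
    isCompact_Icc.of_isClosed_subset (hc.preimage_isClosed_of_isClosed isClosed_Icc hS)
      inter_subset_left
  obtain ⟨s, hs, hmax⟩ := hH.exists_isGreatest ⟨t₀, ht₀, h⟩
  exact ⟨s, hs.1, hs.2, fun t ht hα =>
    absurd (hmax ⟨⟨hs.1.1.trans ht.1.le, ht.2⟩, hα⟩) (not_le.2 ht.1)⟩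

theorem isClosed_segment' (z w : ℂ) : IsClosed (segment ℝ z w) := by
  rw [segment_eq_image]
  exact (isCompact_Icc.image (by fun_prop)).isClosed

/-- Joined points of an open set are joined by an injective arc. -/
theorem exists_arc {V : Set ℂ} (hV : IsOpen V) {p q : ℂ} (h : JoinedIn V p q) :
    ∃ (a b : ℝ) (α : ℝ → ℂ), a ≤ b ∧ ContinuousOn α (Icc a b) ∧ InjOn α (Icc a b) ∧
      α a = p ∧ α b = q ∧ α '' Icc a b ⊆ V := by
  set P : ℂ → Prop := fun q => ∃ (a b : ℝ) (α : ℝ → ℂ), a ≤ b ∧ ContinuousOn α (Icc a b) ∧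
    InjOn α (Icc a b) ∧ α a = p ∧ α b = q ∧ α '' Icc a b ⊆ V with hP
  have step : ∀ z w, P z → segment ℝ z w ⊆ V → P w := by
    rintro z w ⟨a, b, α, hab, hc, hi, ha, hb, hαV⟩ hs
    obtain ⟨s, hsI, hsS, hsn⟩ := exists_first_hit hc (isClosed_segment' z w)
      (right_mem_Icc.2 hab) (hb ▸ left_mem_segment ℝ z w)
    have hsub : Icc a s ⊆ Icc a b := Icc_subset_Icc_right hsI.2
    by_cases hyw : α s = w
    · exact ⟨a, s, α, hsI.1, hc.mono hsub, hi.mono hsub, ha, hyw,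
        (image_mono hsub).trans hαV⟩
    · have hseg : ∀ t ∈ Icc s (s + 1), α s + ((t - s : ℝ) : ℂ) * (w - α s) ∈ segment ℝ z w := by
        intro t ht
        apply (convex_segment z w).segment_subset hsS (right_mem_segment ℝ z w)
        rw [segment_eq_image']
        exact ⟨t - s, ⟨by linarith [ht.1], by linarith [ht.2]⟩, by simp⟩
      obtain ⟨g, hgc, hgi, e₁, e₂⟩ := exists_glue (b := s) (isClosed_Icc (a := a) (b := s))
        (isClosed_Icc (a := s) (b := s + 1)) Icc_subset_Iic_self Icc_subset_Ici_self
        (hc.mono hsub) (g₂ := fun t : ℝ => α s + ((t - s : ℝ) : ℂ) * (w - α s)) (by fun_prop)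
        (hi.mono hsub) (injective_lineMap hyw s).injOn (by simp) (by
          intro x hx y hy hxy
          have hxs : x = s := by
            by_contra hne
            exact hsn x ⟨hx.1, lt_of_le_of_ne hx.2 hne⟩ (hxy ▸ hseg y hy)
          subst hxs
          apply injective_lineMap hyw x
          simp only [sub_self, Complex.ofReal_zero, zero_mul, add_zero]
          exact hxy)
      rw [Icc_union_Icc_eq_Icc hsI.1 (by linarith)] at hgc hgi
      refine ⟨a, s + 1, g, by linarith [hsI.1], hgc, hgi, ?_, ?_, ?_⟩
      · rw [e₁ ⟨le_rfl, hsI.1⟩, ha]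
      · rw [e₂ ⟨by linarith, le_rfl⟩]; simp
      · rw [← Icc_union_Icc_eq_Icc hsI.1 (show s ≤ s + 1 by linarith), image_union, e₁.image_eq,
          e₂.image_eq, union_subset_iff]
        refine ⟨(image_mono hsub).trans hαV, ?_⟩
        rintro _ ⟨t, ht, rfl⟩
        exact hs (hseg t ht)
  have hpV : p ∈ V := h.source_mem
  have hball : ∀ z ∈ V, ∃ O, IsOpen O ∧ z ∈ O ∧ Convex ℝ O ∧ O ⊆ V := by
    intro z hz
    obtain ⟨r, hr, hrV⟩ := Metric.isOpen_iff.1 hV z hz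
    exact ⟨Metric.ball z r, Metric.isOpen_ball, Metric.mem_ball_self hr, convex_ball z r, hrV⟩
  obtain ⟨γ, hγ⟩ := h
  have hpre : IsPreconnected (range γ) := isPreconnected_range γ.continuous
  have hrV : range γ ⊆ V := by rintro _ ⟨t, rfl⟩; exact hγ t
  by_contra hq
  have h1 : IsOpen {z | P z ∧ z ∈ V} := by
    rw [isOpen_iff_mem_nhds]
    rintro z ⟨hz, hzV⟩
    obtain ⟨O, hO, hzO, hOc, hOV⟩ := hball z hzV
    exact mem_of_superset (hO.mem_nhds hzO) fun w hw =>
      ⟨step z w hz ((hOc.segment_subset hzO hw).trans hOV), hOV hw⟩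
  have h2 : IsOpen {z | ¬ P z ∧ z ∈ V} := by
    rw [isOpen_iff_mem_nhds]
    rintro z ⟨hz, hzV⟩
    obtain ⟨O, hO, hzO, hOc, hOV⟩ := hball z hzV
    exact mem_of_superset (hO.mem_nhds hzO) fun w hw =>
      ⟨fun hw' => hz (step w z hw' ((hOc.segment_subset hw hzO).trans hOV)), hOV hw⟩
  obtain ⟨z, -, hz1, hz2⟩ := hpre _ _ h1 h2
    (fun z hz => by
      by_cases h : P z
      · exact Or.inl ⟨h, hrV hz⟩
      · exact Or.inr ⟨h, hrV hz⟩)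
    ⟨p, ⟨0, γ.source⟩, ⟨0, 0, fun _ => p, le_rfl, continuousOn_const, by simp, rfl, rfl, by simpa using hpV⟩, hpV⟩
    ⟨q, ⟨1, γ.target⟩, hq, hrV ⟨1, γ.target⟩⟩
  exact hz2.1 hz1.1

theorem isClosedEmbedding_line {g : ℝ → ℂ} (hc : Continuous g) (hi : Function.Injective g)
    (h₀ : Tendsto g atBot (cocompact ℂ)) (h₁ : Tendsto g atTop (cocompact ℂ)) :
    IsClosedEmbedding g := by
  have : IsProperMap g := isProperMap_iff_tendsto_cocompact.2
    ⟨hc, by rw [cocompact_eq_atBot_atTop]; exact h₀.sup h₁⟩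
  exact .of_continuous_injective_isClosedMap hc hi this.isClosedMap

theorem line_tendsto_atTop {g : ℝ → ℂ} (hg : IsClosedEmbedding g) :
    Tendsto g atTop (cocompact ℂ) :=
  hg.tendsto_cocompact.mono_left (by rw [cocompact_eq_atBot_atTop]; exact le_sup_right)

theorem line_tendsto_atBot {g : ℝ → ℂ} (hg : IsClosedEmbedding g) :
    Tendsto g atBot (cocompact ℂ) :=
  hg.tendsto_cocompact.mono_left (by rw [cocompact_eq_atBot_atTop]; exact le_sup_left)

/-- Two disjoint tails of lines inside an open set `V`, whose origins are joined in `V`, are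
the tails of a common line in `V`. -/
theorem exists_line_of_tails {V : Set ℂ} (hV : IsOpen V) {r₀ r₁ : ℝ → ℂ}
    (h₀ : IsClosedEmbedding r₀) (h₁ : IsClosedEmbedding r₁) {T : ℝ}
    (hV₀ : r₀ '' Ici T ⊆ V) (hV₁ : r₁ '' Ici T ⊆ V)
    (hd : Disjoint (r₀ '' Ici T) (r₁ '' Ici T)) (hj : JoinedIn V (r₀ T) (r₁ T)) :
    ∃ s : ℝ → ℂ, IsClosedEmbedding s ∧ range s ⊆ V ∧ map s atTop = map r₁ atTop ∧
      map s atBot = map r₀ atTop := by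
  obtain ⟨a, b, α, hab, hc, hi, ha, hb, hαV⟩ := exists_arc hV hj
  have hR₀ : IsClosed (r₀ '' Ici T) := h₀.isClosedMap _ isClosed_Ici
  have hR₁ : IsClosed (r₁ '' Ici T) := h₁.isClosedMap _ isClosed_Ici
  obtain ⟨s, hs, hs0, hsn⟩ := exists_last_hit hc hR₀ (left_mem_Icc.2 hab)
    (ha ▸ mem_image_of_mem _ self_mem_Ici)
  have hsub : Icc s b ⊆ Icc a b := Icc_subset_Icc_left hs.1
  obtain ⟨t, ht, ht1, htn⟩ := exists_first_hit (hc.mono hsub) hR₁ (right_mem_Icc.2 hs.2)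
    (hb ▸ mem_image_of_mem _ self_mem_Ici)
  have hsub' : Icc s t ⊆ Icc a b := (Icc_subset_Icc_right ht.2).trans hsub
  obtain ⟨u, hu, hus⟩ := hs0
  obtain ⟨v, hv, hvt⟩ := ht1
  have hu' : T ≤ u := hu
  have hv' : T ≤ v := hv
  obtain ⟨g, hgc, hgi, e₁, e₂⟩ := exists_glue (b := s) (isClosed_Iic (a := s))
    (isClosed_Icc (a := s) (b := t)) subset_rfl Icc_subset_Ici_self
    (g₁ := fun x => r₀ (u + (s - x))) (h₀.continuous.comp (by fun_prop)).continuousOn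
    (hc.mono hsub') (fun x _ y _ hxy => by have := h₀.injective hxy; linarith)
    (hi.mono hsub') (by simpa using hus) (by
      intro x hx y hy hxy
      have hx' : x ≤ s := hx
      have hys : y = s := by
        by_contra hne
        exact hsn y ⟨lt_of_le_of_ne hy.1 (Ne.symm hne), (hsub' hy).2⟩
          ⟨_, (by simp; linarith : u + (s - x) ∈ Ici T), hxy⟩
      subst hys
      have := h₀.injective (hxy.trans hus.symm)
      linarith)
  rw [Iic_union_Icc_eq_Iic ht.1] at hgc hgi
  have hgV : ∀ x ≤ t, g x ∈ V := by
    intro x hx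
    rcases le_total x s with h | h
    · rw [e₁ h]; exact hV₀ ⟨_, (by simp; linarith : u + (s - x) ∈ Ici T), rfl⟩
    · rw [e₂ ⟨h, hx⟩]; exact hαV ⟨x, hsub' ⟨h, hx⟩, rfl⟩
  obtain ⟨k, hkc, hki, k₁, k₂⟩ := exists_glue (b := t) (isClosed_Iic (a := t))
    (isClosed_Ici (a := t)) subset_rfl subset_rfl hgc
    (g₂ := fun x => r₁ (v + (x - t))) (h₁.continuous.comp (by fun_prop)).continuousOn hgi
    (fun x _ y _ hxy => by have := h₁.injective hxy; linarith)
    (by rw [e₂ ⟨ht.1, le_rfl⟩]; simpa using hvt.symm) (by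
      intro x hx y hy hxy
      have hx' : x ≤ t := hx
      have hy' : t ≤ y := hy
      have hyR : g x ∈ r₁ '' Ici T := ⟨_, (by simp; linarith : v + (y - t) ∈ Ici T), hxy.symm⟩
      rcases le_total x s with h | h
      · rw [e₁ h] at hyR
        exact absurd hyR (disjoint_left.1 hd ⟨_, (by simp; linarith : u + (s - x) ∈ Ici T), rfl⟩)
      · rw [e₂ ⟨h, hx⟩] at hyR hxy
        have hxt : x = t := by
          by_contra hne
          exact htn x ⟨h, lt_of_le_of_ne hx hne⟩ hyR
        subst hxt
        have := h₁.injective (hvt.trans hxy)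
        linarith)
  rw [Iic_union_Ici, continuousOn_univ] at hkc
  rw [Iic_union_Ici, injOn_univ] at hki
  have m₁ : map k atTop = map r₁ atTop := by
    have : k =ᶠ[atTop] r₁ ∘ fun x => x + (v - t) := by
      filter_upwards [eventually_ge_atTop t] with x hx
      rw [k₂ hx]; simp only [Function.comp]; congr 1; ring
    rw [map_congr this, ← map_map]
    congr 1
    exact (OrderIso.addRight (v - t)).map_atTop
  have m₀ : map k atBot = map r₀ atTop := by
    have : k =ᶠ[atBot] r₀ ∘ (fun x => x + (u + s)) ∘ Neg.neg := by
      filter_upwards [eventually_le_atBot (min s t)] with x hx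
      rw [k₁ (hx.trans (min_le_right _ _)), e₁ (hx.trans (min_le_left _ _))]
      simp only [Function.comp]; congr 1; ring
    rw [map_congr this, ← map_map, ← map_map, map_neg_atBot]
    congr 1
    exact (OrderIso.addRight (u + s)).map_atTop
  refine ⟨k, isClosedEmbedding_line hkc hki ?_ ?_, ?_, m₁, m₀⟩
  · rw [Tendsto, m₀]; exact line_tendsto_atTop h₀
  · rw [Tendsto, m₁]; exact line_tendsto_atTop h₁
  · rintro _ ⟨x, rfl⟩
    rcases le_total x t with h | h
    · rw [k₁ h]; exact hgV x h
    · rw [k₂ h]; exact hV₁ ⟨_, (by simp; linarith : v + (x - t) ∈ Ici T), rfl⟩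

end

section

theorem isPreconnected_norm_gt (R : ℝ) : IsPreconnected {z : ℂ | R < ‖z‖} := by
  have h : {z : ℂ | R < ‖z‖} ⊆ {z : ℂ | R < ‖z‖} := subset_rfl
  rcases lt_or_ge R 0 with hR | hR
  · have : {z : ℂ | R < ‖z‖} = univ := eq_univ_of_forall fun z => hR.trans_le (norm_nonneg z)
    rw [this]; exact isPreconnected_univ
  · rcases hR.eq_or_lt with rfl | hR
    · have : {z : ℂ | 0 < ‖z‖} = {0}ᶜ := by ext z; simp
      rw [this]
      exact (isConnected_compl_singleton_of_one_lt_rank (by simp) 0).isPreconnected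
    · have : {z : ℂ | R < ‖z‖} = Complex.exp '' {w | Real.log R < w.re} := by
        ext z
        constructor
        · intro hz
          have hz' : R < ‖z‖ := hz
          have hz0 : z ≠ 0 := norm_pos_iff.1 (hR.trans hz')
          exact ⟨Complex.log z, by simpa [Complex.log_re] using Real.log_lt_log hR hz', Complex.exp_log hz0⟩
        · rintro ⟨w, hw, rfl⟩
          simp only [mem_ofPred_eq, Complex.norm_exp] at hw ⊢
          exact (Real.log_lt_iff_lt_exp hR).1 hw
      rw [this]
      exact (convex_halfSpace_re_gt _).isPreconnected.image _ Complex.continuous_exp.continuousOn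

theorem joinedIn_of_norm_gt {A : Set ℂ} {R : ℝ} (hA : A ⊆ Metric.closedBall 0 R) {x y : ℂ}
    (hx : R < ‖x‖) (hy : R < ‖y‖) : JoinedIn Aᶜ x y := by
  refine (joinedIn_of_isPreconnected (isOpen_lt continuous_const continuous_norm)
    (isPreconnected_norm_gt R) subset_rfl hx hy).mono ?_
  intro z hz hzA
  have h1 : R < ‖z‖ := hz
  have h2 := hA hzA
  rw [mem_closedBall_zero_iff] at h2
  linarith

theorem exists_Icc_of_line {l : ℝ → ℂ} (hl : IsClosedEmbedding l) (R : ℝ) :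
    ∃ T > 0, ∀ t, T ≤ |t| → R < ‖l t‖ := by
  have h : ∀ᶠ z : ℂ in cocompact ℂ, R < ‖z‖ := by
    filter_upwards [(isCompact_closedBall (0:ℂ) R).compl_mem_cocompact] with z hz
    simpa using hz
  obtain ⟨T₁, h₁⟩ := eventually_atTop.1 ((line_tendsto_atTop hl).eventually h)
  obtain ⟨T₂, h₂⟩ := eventually_atBot.1 ((line_tendsto_atBot hl).eventually h)
  refine ⟨max 1 (max T₁ (-T₂)), by positivity, fun t ht => ?_⟩
  have h3 : T₁ ≤ |t| := (le_max_left _ _).trans ((le_max_right _ _).trans ht)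
  have h4 : -T₂ ≤ |t| := (le_max_right _ _).trans ((le_max_right _ _).trans ht)
  rcases abs_cases t with ⟨h, _⟩ | ⟨h, _⟩
  · exact h₁ t (by linarith)
  · exact h₂ t (by linarith)

theorem exists_closedBall {S : Set ℂ} (hS : IsCompact S) : ∃ R, S ⊆ Metric.closedBall 0 R :=
  hS.isBounded.subset_closedBall 0

/-- If the ends of `l` run eventually in a set `S`, then so does `l` outside a compact set. -/
theorem range_subset_closedBall_union {l : ℝ → ℂ} (hl : IsClosedEmbedding l) {S : Set ℂ}
    (h₁ : S ∈ map l atTop) (h₀ : S ∈ map l atBot) :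
    ∃ R, range l ⊆ Metric.closedBall 0 R ∪ S := by
  obtain ⟨T₁, h₁⟩ := mem_atTop_sets.1 h₁
  obtain ⟨T₂, h₂⟩ := mem_atBot_sets.1 h₀
  obtain ⟨R, hR⟩ := exists_closedBall ((isCompact_Icc (a := T₂) (b := T₁)).image hl.continuous)
  refine ⟨R, ?_⟩
  rintro _ ⟨t, rfl⟩
  rcases le_total t T₂ with h | h
  · exact Or.inr (h₂ t h)
  · rcases le_total t T₁ with h' | h'
    · exact Or.inl (hR ⟨t, ⟨h, h'⟩, rfl⟩)
    · exact Or.inr (h₁ t h')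

theorem range_inter_closedBall {l : ℝ → ℂ} (hl : IsClosedEmbedding l) (R : ℝ) :
    ∃ T > 0, ∀ t, l t ∈ Metric.closedBall 0 R → t ∈ Icc (-T) T := by
  obtain ⟨T, hT, h⟩ := exists_Icc_of_line hl R
  refine ⟨T, hT, fun t ht => abs_le.1 ?_⟩
  by_contra h'
  have := h t (not_le.1 h').le
  rw [mem_closedBall_zero_iff] at ht
  linarith

/-- Lines with the same tails separate far away points in the same way. -/
theorem far_side_of_same_ends {l s : ℝ → ℂ} (hl : IsClosedEmbedding l)
    (hs : IsClosedEmbedding s) (h₁ : map l atTop = map s atTop) (h₀ : map l atBot = map s atBot) :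
    ∃ R, ∀ x y, R < ‖x‖ → R < ‖y‖ → x ∉ range l → y ∉ range l → y ∈ side s x → y ∈ side l x := by
  have r1 : range s ∈ map l atTop := by rw [h₁]; exact range_mem_map
  have r0 : range s ∈ map l atBot := by rw [h₀]; exact range_mem_map
  obtain ⟨R₀, hR₀⟩ := range_subset_closedBall_union hl r1 r0
  obtain ⟨T, hT, hTs⟩ := range_inter_closedBall hs R₀
  set A := Metric.closedBall (0:ℂ) R₀ ∪ s '' Icc (-T) T with hA
  have hAc : IsCompact A :=
    (isCompact_closedBall 0 R₀).union (isCompact_Icc.image hs.continuous)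
  obtain ⟨R, hR⟩ := exists_closedBall hAc
  refine ⟨R, fun x y hx hy hxl hyl hxy => ?_⟩
  have hAs : A ∩ range s = s '' Icc (-T) T := by
    ext z
    constructor
    · rintro ⟨h | h, t, rfl⟩
      · exact ⟨t, hTs t h, rfl⟩
      · exact h
    · intro h; exact ⟨Or.inr h, image_subset_range _ _ h⟩
  have hxs : x ∉ range s := by
    intro h
    rw [side, connectedComponentIn_eq_empty (by simpa using h)] at hxy
    exact hxy
  have j := joinedIn_union_compl hAc hs.isClosed_range
    (by rw [hAs]; exact isPreconnected_Icc.image _ hs.continuous.continuousOn)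
    (joinedIn_of_norm_gt hR hx hy) ((joinedIn_compl_iff hs.isClosed_range hxs).2 hxy)
  refine (joinedIn_compl_iff hl.isClosed_range hxl).1 (j.mono ?_)
  rw [compl_subset_compl]
  exact hR₀.trans (union_subset_union_left _ subset_union_left)

/-- A line inside a side of another line can be pushed, fixing its tails, off a disc meeting
that side. -/
theorem exists_bypass {l₀ l : ℝ → ℂ} (h₀ : IsClosedEmbedding l₀) (hl : IsClosedEmbedding l)
    {w : ℂ} (hw : w ∉ range l₀) (hll : range l ⊆ side l₀ w) {R : ℝ} (hwR : ‖w‖ ≤ R) :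
    ∃ s : ℝ → ℂ, IsClosedEmbedding s ∧ range s ⊆ side l₀ w \ Metric.closedBall 0 R ∧
      map s atTop = map l atTop ∧ map s atBot = map l atBot := by
  obtain ⟨T, hT, hTl⟩ := range_inter_closedBall h₀ R
  set M := Metric.closedBall (0:ℂ) R
  set A := M ∪ l₀ '' Icc (-T) T with hA
  have hAc : IsCompact A := (isCompact_closedBall 0 R).union (isCompact_Icc.image h₀.continuous)
  obtain ⟨R', hR'⟩ := exists_closedBall hAc
  set B := (side l₀ w)ᶜ with hB
  have hBc : IsClosed B := (isOpen_side h₀ w).isClosed_compl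
  have hlB : range l₀ ⊆ B := fun z hz hz' => side_subset_compl _ _ hz' hz
  have himg : IsPreconnected (l₀ '' Icc (-T) T) :=
    isPreconnected_Icc.image _ h₀.continuous.continuousOn
  have hsubA : l₀ '' Icc (-T) T ⊆ A ∩ B :=
    fun z hz => ⟨Or.inr hz, hlB (image_subset_range _ _ hz)⟩
  have h0mem : l₀ 0 ∈ l₀ '' Icc (-T) T := ⟨0, ⟨by linarith, hT.le⟩, rfl⟩
  have hAB : IsPreconnected (A ∩ B) := by
    apply isPreconnected_of_forall (l₀ 0)
    rintro z ⟨hzA | hzA, hzB⟩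
    · set p : ℝ → ℂ := fun t => z + (t : ℂ) * (w - z) with hp
      have hpc : Continuous p := by fun_prop
      have hpM : ∀ t ∈ Icc (0:ℝ) 1, p t ∈ M := by
        intro t ht
        apply (convex_closedBall (0:ℂ) R).segment_subset hzA (by simpa using hwR)
        rw [segment_eq_image']
        exact ⟨t, ht, by simp [hp]⟩
      have hp1 : p 1 = w := by simp [hp]
      have hp0 : p 0 = z := by simp [hp]
      have hex : ∃ t ∈ Icc (0:ℝ) 1, p t ∈ range l₀ := by
        by_contra! hno
        apply hzB
        refine subset_side (s := p '' Icc 0 1) (x := w)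
          (isPreconnected_Icc.image _ hpc.continuousOn) ?_ ?_ (mem_side hw) ?_
        · rw [disjoint_left]; rintro _ ⟨t, ht, rfl⟩; exact hno t ht
        · exact ⟨1, by simp, hp1⟩
        · exact ⟨0, by simp, hp0⟩
      obtain ⟨t₀, ht₀, hpt₀⟩ := hex
      obtain ⟨s, hs, hsl, hsn⟩ := exists_first_hit hpc.continuousOn h₀.isClosed_range ht₀ hpt₀
      have hsub : p '' Icc 0 s ⊆ A ∩ B := by
        rintro _ ⟨t, ht, rfl⟩
        refine ⟨Or.inl (hpM t ⟨ht.1, ht.2.trans hs.2⟩), ?_⟩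
        rcases ht.2.eq_or_lt with rfl | hlt
        · exact hlB hsl
        · intro hside
          apply hzB
          refine subset_side (s := p '' Ico 0 s) (x := p t)
            (isPreconnected_Ico.image _ hpc.continuousOn) ?_ ⟨t, ⟨ht.1, hlt⟩, rfl⟩ hside
            ⟨0, ⟨le_rfl, ht.1.trans_lt hlt⟩, hp0⟩
          rw [disjoint_left]; rintro _ ⟨t, ht, rfl⟩; exact hsn t ht
      refine ⟨p '' Icc 0 s ∪ l₀ '' Icc (-T) T, union_subset hsub hsubA, Or.inr h0mem,
        Or.inl ⟨0, ⟨le_rfl, hs.1⟩, hp0⟩, ?_⟩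
      obtain ⟨v, hv⟩ := hsl
      refine IsPreconnected.union (p s) ⟨s, ⟨hs.1, le_rfl⟩, rfl⟩
        ⟨v, hTl v (hv ▸ hpM s hs), hv⟩ (isPreconnected_Icc.image _ hpc.continuousOn) himg
    · exact ⟨_, hsubA, h0mem, hzA, himg⟩
  obtain ⟨T', hT', hfar⟩ := exists_Icc_of_line hl R'
  have hV : IsOpen (A ∪ B)ᶜ := (hAc.isClosed.union hBc).isOpen_compl
  have htail : ∀ t, T' ≤ |t| → l t ∈ (A ∪ B)ᶜ := by
    rintro t ht (h | h)
    · have h1 := hR' h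
      rw [mem_closedBall_zero_iff] at h1
      linarith [hfar t ht]
    · exact h (hll ⟨t, rfl⟩)
  have hj : JoinedIn (A ∪ B)ᶜ (l (-T')) (l T') := by
    apply joinedIn_union_compl hAc hBc hAB
    · exact joinedIn_of_norm_gt hR' (hfar _ (by rw [abs_neg]; exact le_abs_self _))
        (hfar _ (le_abs_self _))
    · rw [hB, compl_compl]
      exact joinedIn_of_isPreconnected (isOpen_side h₀ w) (isPreconnected_side l₀ w) subset_rfl
        (hll ⟨_, rfl⟩) (hll ⟨_, rfl⟩)
  obtain ⟨s, hs, hsV, m₁, m₀⟩ := exists_line_of_tails hV (isClosedEmbedding_comp_neg hl) hl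
    (T := T') (by
      rintro _ ⟨t, ht, rfl⟩
      exact htail _ (by rw [abs_neg]; exact (le_abs_self t).trans' ht)) (by
      rintro _ ⟨t, ht, rfl⟩
      exact htail _ ((le_abs_self t).trans' ht)) (by
      rw [disjoint_left]
      rintro _ ⟨t, ht, rfl⟩ ⟨u, hu, hut⟩
      have := hl.injective hut
      have h1 : T' ≤ t := ht
      have h2 : T' ≤ u := hu
      linarith) hj
  refine ⟨s, hs, ?_, m₁, ?_⟩
  · intro z hz
    have := hsV hz
    simp only [mem_compl_iff, mem_union, not_or, hB, not_not, hA] at this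
    exact ⟨this.2, this.1.1⟩
  · rw [m₀, ← map_neg_atTop, map_map]; rfl

end

section

variable {X : Type*} [TopologicalSpace X] {ψ : ℂ → X}

theorem tendsto_cocompact_of_notMem_range [T3Space X] (hψ : IsOpenEmbedding ψ) {T : Type*} {F : Filter T}
    {u : T → ℂ} {y : X} (hy : y ∉ range ψ) (h : Tendsto (ψ ∘ u) F (𝓝 y)) :
    Tendsto u F (cocompact ℂ) := by
  refine (hasBasis_cocompact.tendsto_right_iff).2 fun K hK => ?_
  have h1 : (ψ '' K)ᶜ ∈ 𝓝 y :=
    (hK.image hψ.continuous).isClosed.isOpen_compl.mem_nhds fun ⟨x, _, hx⟩ => hy ⟨x, hx⟩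
  filter_upwards [h h1] with t ht hK using ht ⟨_, hK, rfl⟩

/-- The ends of the line `l`, drawn in `X` through `ψ`, converge to `a` and `b`, and each side
of it accumulates at some other point of the complement of the range of `ψ`. -/
structure IsCC (ψ : ℂ → X) (l : ℝ → ℂ) (a b : X) : Prop where
  line : IsClosedEmbedding l
  tendsto_atBot : Tendsto (ψ ∘ l) atBot (𝓝 a)
  tendsto_atTop : Tendsto (ψ ∘ l) atTop (𝓝 b)
  notMem_left : a ∉ range ψ
  notMem_right : b ∉ range ψ
  exists_mem : ∀ p, p ∉ range l → ∃ y, y ∉ range ψ ∧ y ≠ a ∧ y ≠ b ∧ y ∈ closure (ψ '' side l p)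

theorem exists_line_of_Ioo [T3Space X] (hψ : IsOpenEmbedding ψ) {g : ℝ → X} {s t : ℝ} (hst : s < t)
    (hg : ContinuousOn g (Icc s t)) (hi : InjOn g (Ioo s t)) (hU : ∀ x ∈ Ioo s t, g x ∈ range ψ)
    (hs : g s ∉ range ψ) (ht : g t ∉ range ψ) :
    ∃ l : ℝ → ℂ, IsClosedEmbedding l ∧ ψ '' range l = g '' Ioo s t ∧
      Tendsto (ψ ∘ l) atBot (𝓝 (g s)) ∧ Tendsto (ψ ∘ l) atTop (𝓝 (g t)) := by
  let σ : ℝ → ℝ := fun x => s + (t - s) * Real.sigmoid x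
  have hσ : ∀ x, σ x ∈ Ioo s t := fun x => by
    have h1 := Real.sigmoid_pos x
    have h2 := Real.sigmoid_lt_one x
    constructor <;> simp only [σ] <;> nlinarith
  have hσc : Continuous σ := by have := _root_.continuous_sigmoid; fun_prop
  have hσi : Function.Injective σ := fun x y h => by
    simp only [σ, add_right_inj, mul_eq_mul_left_iff, sub_eq_zero, hst.ne', or_false] at h
    exact Real.sigmoid_injective h
  have hσr : range σ = Ioo s t := by
    apply Subset.antisymm
    · rintro _ ⟨x, rfl⟩; exact hσ x
    · intro y hy
      have : (y - s) / (t - s) ∈ range Real.sigmoid := by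
        have : 0 < t - s := sub_pos.2 hst
        rw [Real.range_sigmoid]
        refine ⟨div_pos (sub_pos.2 hy.1) this, ?_⟩
        rw [div_lt_one this]; linarith [hy.2]
      obtain ⟨x, hx⟩ := this
      refine ⟨x, ?_⟩
      simp only [σ, hx]
      field_simp [sub_ne_zero.2 hst.ne']; ring
  choose l hl using fun x => hU _ (hσ x)
  have hl' : ψ ∘ l = g ∘ σ := funext hl
  have hgσ : Continuous (ψ ∘ l) := by
    rw [hl', ← continuousOn_univ]
    exact hg.comp hσc.continuousOn fun x _ => Ioo_subset_Icc_self (hσ x)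
  have h0 : Tendsto (ψ ∘ l) atBot (𝓝 (g s)) := by
    rw [hl']
    refine (hg s (left_mem_Icc.2 hst.le)).tendsto.comp (tendsto_nhdsWithin_iff.2 ⟨?_, ?_⟩)
    · have := (Real.tendsto_sigmoid_atBot.const_mul (t - s)).const_add s
      simpa [σ] using this
    · exact Eventually.of_forall fun x => Ioo_subset_Icc_self (hσ x)
  have h1 : Tendsto (ψ ∘ l) atTop (𝓝 (g t)) := by
    rw [hl']
    refine (hg t (right_mem_Icc.2 hst.le)).tendsto.comp (tendsto_nhdsWithin_iff.2 ⟨?_, ?_⟩)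
    · have := (Real.tendsto_sigmoid_atTop.const_mul (t - s)).const_add s
      simpa [σ] using this
    · exact Eventually.of_forall fun x => Ioo_subset_Icc_self (hσ x)
  refine ⟨l, isClosedEmbedding_line (hψ.isInducing.continuous_iff.2 hgσ) ?_ ?_ ?_, ?_, h0, h1⟩
  · intro x y h
    exact hσi (hi (hσ x) (hσ y) (by rw [← hl, ← hl, h]))
  · exact tendsto_cocompact_of_notMem_range hψ hs h0
  · exact tendsto_cocompact_of_notMem_range hψ ht h1
  · rw [← range_comp, hl', range_comp, hσr]

theorem exists_arc_of_line [T3Space X] {l : ℝ → ℂ} (hψ : IsOpenEmbedding ψ) (hl : IsClosedEmbedding l)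
    {a b : X} (ha : Tendsto (ψ ∘ l) atBot (𝓝 a)) (hb : Tendsto (ψ ∘ l) atTop (𝓝 b)) :
    ∃ g : ℝ → X, ContinuousOn g (Icc 0 1) ∧ InjOn g (Ioo 0 1) ∧ ψ '' range l = g '' Ioo 0 1 ∧
      g 0 = a ∧ g 1 = b := by
  have hr : range Real.sigmoid = Ioo 0 1 := Real.range_sigmoid
  let τ : ℝ → ℝ := fun x => Real.log x - Real.log (1 - x)
  have hτ : ∀ x ∈ Ioo (0:ℝ) 1, Real.sigmoid (τ x) = x := fun x hx => by
    have h1 : 0 < 1 - x := sub_pos.2 hx.2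
    rw [Real.sigmoid_def]
    simp only [τ, neg_sub, Real.exp_sub, Real.exp_log hx.1, Real.exp_log h1]
    field_simp [hx.1.ne']; ring
  have hτ' : ∀ y, τ (Real.sigmoid y) = y := fun y =>
    Real.sigmoid_injective (hτ _ ⟨Real.sigmoid_pos y, Real.sigmoid_lt_one y⟩)
  have hτc : ContinuousOn τ (Ioo 0 1) := by
    refine ContinuousOn.sub (Real.continuousOn_log.mono fun x hx => hx.1.ne') ?_
    exact ContinuousOn.log (by fun_prop) fun x hx => (sub_pos.2 hx.2).ne'
  have ht0 : Tendsto τ (𝓝[>] 0) atBot := by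
    have h2 : Tendsto (fun x : ℝ => Real.log (1 - x)) (𝓝[>] 0) (𝓝 0) := by
      have : ContinuousAt (fun x : ℝ => Real.log (1 - x)) 0 :=
        ContinuousAt.log (by fun_prop) (by norm_num)
      simpa using this.tendsto.mono_left nhdsWithin_le_nhds
    simpa [τ, sub_eq_add_neg] using Real.tendsto_log_nhdsGT_zero.atBot_add h2.neg
  have ht1 : Tendsto τ (𝓝[<] 1) atTop := by
    have h2 : Tendsto (fun x : ℝ => Real.log x) (𝓝[<] 1) (𝓝 0) := by
      have : ContinuousAt (fun x : ℝ => Real.log x) 1 := Real.continuousAt_log one_ne_zero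
      simpa using this.tendsto.mono_left nhdsWithin_le_nhds
    have h3 : Tendsto (fun x : ℝ => 1 - x) (𝓝[<] 1) (𝓝[>] 0) := by
      refine tendsto_nhdsWithin_iff.2 ⟨?_, ?_⟩
      · have : Continuous fun x : ℝ => 1 - x := by fun_prop
        simpa using (this.tendsto 1).mono_left (nhdsWithin_le_nhds (s := Iio 1))
      · filter_upwards [self_mem_nhdsWithin] with x hx using sub_pos.2 (mem_Iio.1 hx)
    have h4 := (Real.tendsto_log_nhdsGT_zero.comp h3)
    have h5 : Tendsto (fun x : ℝ => - Real.log (1 - x)) (𝓝[<] 1) atTop :=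
      tendsto_neg_atBot_atTop.comp h4
    simpa [τ, sub_eq_add_neg, add_comm] using h5.atTop_add h2
  have hc : ContinuousOn (ψ ∘ l ∘ τ) (Ioo 0 1) :=
    (hψ.continuous.comp hl.continuous).comp_continuousOn hτc
  have l0 : Tendsto (ψ ∘ l ∘ τ) (𝓝[>] 0) (𝓝 a) := ha.comp ht0
  have l1 : Tendsto (ψ ∘ l ∘ τ) (𝓝[<] 1) (𝓝 b) := hb.comp ht1
  have he : EqOn (extendFrom (Ioo 0 1) (ψ ∘ l ∘ τ)) (ψ ∘ l ∘ τ) (Ioo (0:ℝ) 1) := fun x hx =>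
    extendFrom_eq (subset_closure hx) (hc x hx)
  refine ⟨extendFrom (Ioo 0 1) (ψ ∘ l ∘ τ), ?_, ?_, ?_, ?_, ?_⟩
  · exact continuousOn_Icc_extendFrom_Ioo hc l0 l1
  · refine InjOn.congr ?_ he.symm
    intro x hx y hy h
    rw [← hτ x hx, ← hτ y hy, hl.injective (hψ.injective h)]
  · rw [he.image_eq, ← range_comp, ← hr, ← range_comp]
    congr 1
    funext y
    simp [hτ' y]
  · exact eq_lim_at_left_extendFrom_Ioo zero_lt_one l0
  · exact eq_lim_at_right_extendFrom_Ioo zero_lt_one l1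

theorem image_connectedComponentIn_of_isOpenEmbedding (hψ : IsOpenEmbedding ψ) {S : Set ℂ} {p : ℂ}
    (hp : p ∈ S) : connectedComponentIn (ψ '' S) (ψ p) = ψ '' connectedComponentIn S p := by
  apply Subset.antisymm
  · have hsub := connectedComponentIn_subset (ψ '' S) (ψ p)
    have h1 : IsPreconnected (ψ ⁻¹' connectedComponentIn (ψ '' S) (ψ p)) :=
      isPreconnected_connectedComponentIn.preimage_of_isOpenMap hψ.injective hψ.isOpenMap
        (hsub.trans (image_subset_range _ _))
    have h2 : ψ ⁻¹' connectedComponentIn (ψ '' S) (ψ p) ⊆ S := fun x hx => by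
      obtain ⟨y, hy, hxy⟩ := hsub hx
      exact hψ.injective hxy ▸ hy
    have h3 := h1.subset_connectedComponentIn
      (mem_preimage.2 (mem_connectedComponentIn (mem_image_of_mem ψ hp))) h2
    intro y hy
    obtain ⟨x, _, rfl⟩ := hsub hy
    exact ⟨x, h3 hy, rfl⟩
  · exact (isPreconnected_connectedComponentIn.image ψ hψ.continuous.continuousOn)
      |>.subset_connectedComponentIn (mem_image_of_mem ψ (mem_connectedComponentIn hp))
      (image_mono (connectedComponentIn_subset _ _))

theorem isCompOf_iff (hψ : IsOpenEmbedding ψ) {l : ℝ → ℂ} {D : Set X} :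
    IsCompOf (range ψ \ ψ '' range l) D ↔ ∃ p, p ∉ range l ∧ D = ψ '' side l p := by
  rw [← image_compl_eq_range_sdiff_image hψ.injective, IsCompOf]
  constructor
  · rintro ⟨_, ⟨p, hp, rfl⟩, rfl⟩
    exact ⟨p, hp, image_connectedComponentIn_of_isOpenEmbedding hψ hp⟩
  · rintro ⟨p, hp, rfl⟩
    exact ⟨_, ⟨p, hp, rfl⟩, (image_connectedComponentIn_of_isOpenEmbedding hψ hp).symm⟩

theorem exists_notMem_line {l : ℝ → ℂ} (hl : IsClosedEmbedding l) : ∃ p, p ∉ range l := by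
  by_contra! h
  apply line_separates hl
  rw [show (range l)ᶜ = ∅ by rw [compl_empty_iff]; exact eq_univ_of_forall h]
  exact isPreconnected_empty

theorem isOpen_image_side (hψ : IsOpenEmbedding ψ) {l : ℝ → ℂ} (hl : IsClosedEmbedding l) (p : ℂ) :
    IsOpen (ψ '' side l p) := hψ.isOpenMap _ (isOpen_side hl p)

theorem image_Icc_eq {X : Type*} (g : ℝ → X) : g '' Icc 0 1 = insert (g 0) (insert (g 1) (g '' Ioo 0 1)) := by
  rw [← image_insert_eq, ← image_insert_eq]
  congr 1
  ext x
  simp only [mem_Icc, mem_insert_iff, mem_Ioo]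
  constructor
  · rintro ⟨h0, h1⟩
    rcases eq_or_lt_of_le h0 with h | h
    · exact Or.inl h.symm
    rcases eq_or_lt_of_le h1 with h' | h'
    · exact Or.inr (Or.inl h')
    · exact Or.inr (Or.inr ⟨h, h'⟩)
  · rintro (rfl | rfl | h)
    · norm_num
    · norm_num
    · exact ⟨h.1.le, h.2.le⟩

theorem IsCC.isCrossCut [T3Space X] (hψ : IsOpenEmbedding ψ) {l : ℝ → ℂ} {a b : X} (h : IsCC ψ l a b) :
    IsCrossCut (range ψ) (ψ '' range l) := by
  obtain ⟨g, hg, hi, hr, h0, h1⟩ := exists_arc_of_line hψ h.line h.tendsto_atBot h.tendsto_atTop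
  have hfr : ∀ {y : X}, y ∉ range ψ → (∃ S, S ⊆ range ψ ∧ y ∈ closure S) →
      y ∈ frontier (range ψ) := by
    rintro y hy ⟨S, hS, hyS⟩
    rw [hψ.isOpen_range.frontier_eq]
    exact ⟨closure_mono hS hyS, hy⟩
  have hfr' : ∀ {F : Filter ℝ} [NeBot F] {y : X}, y ∉ range ψ → Tendsto (ψ ∘ l) F (𝓝 y) →
      y ∈ frontier (range ψ) := fun hy ht => hfr hy
        ⟨range ψ, Subset.rfl, mem_closure_of_tendsto ht (Eventually.of_forall fun x => ⟨l x, rfl⟩)⟩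
  obtain ⟨p, hp⟩ := exists_notMem_line h.line
  obtain ⟨q, hq⟩ := out_nonempty h.line hp
  have hq' : q ∉ range l := notMem_range_of_mem_out hq
  have key : ∀ p, p ∉ range l →
      (frontier (ψ '' side l p) ∩ (frontier (range ψ) \ g '' Icc 0 1)).Nonempty := by
    intro p hp
    obtain ⟨y, hy, hya, hyb, hyc⟩ := h.exists_mem p hp
    refine ⟨y, ?_, hfr hy ⟨_, image_subset_range _ _, hyc⟩, ?_⟩
    · rw [(isOpen_image_side hψ h.line p).frontier_eq]
      exact ⟨hyc, fun h => hy (image_subset_range _ _ h)⟩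
    · rw [image_Icc_eq, ← hr, h0, h1]
      rintro (h | h | h)
      · exact hya h
      · exact hyb h
      · exact hy (image_subset_range _ _ h)
  refine ⟨g, hg, hi, ?_, h0 ▸ hfr' h.notMem_left h.tendsto_atBot, h1 ▸ hfr' h.notMem_right h.tendsto_atTop, hr, ψ '' side l p, ψ '' side l q,
    ⟨(isCompOf_iff hψ).2 ⟨p, hp, rfl⟩, (isCompOf_iff hψ).2 ⟨q, hq', rfl⟩, ?_, ?_⟩, key p hp, key q hq'⟩
  · intro t ht
    have : g t ∈ ψ '' range l := hr ▸ mem_image_of_mem g ht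
    exact image_subset_range _ _ this
  · intro he
    have : q ∈ side l p := hψ.injective.image_injective he ▸ mem_side hq'
    exact hq (Or.inr this)
  · intro x hx
    obtain ⟨z, hz, hxz⟩ := (isCompOf_iff hψ).1 ⟨x, hx, rfl⟩
    rw [hxz]
    rcases side_or_out (c := p) hz with h1 | h1
    · exact Or.inl (by rw [side_eq h1])
    · right; rw [← out_eq_side h.line hp h1, out_eq_side h.line hp hq]

theorem IsCrossCut.exists_isCC [T3Space X] (hψ : IsOpenEmbedding ψ) {γ : Set X} (h : IsCrossCut (range ψ) γ) :
    ∃ l a b, IsCC ψ l a b ∧ γ = ψ '' range l := by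
  obtain ⟨g, hg, hi, hU, h0, h1, rfl, D₁, D₂, ⟨hD₁, hD₂, hne, hD⟩, hy₁, hy₂⟩ := h
  rw [hψ.isOpen_range.frontier_eq] at h0 h1 hy₁ hy₂
  obtain ⟨l, hl, hr, ha, hb⟩ := exists_line_of_Ioo hψ zero_lt_one hg hi hU h0.2 h1.2
  refine ⟨l, g 0, g 1, ⟨hl, ha, hb, h0.2, h1.2, fun p hp => ?_⟩, hr.symm⟩
  rw [← hr] at hD
  have key : ∀ {D}, (frontier D ∩ ((closure (range ψ) \ range ψ) \ g '' Icc 0 1)).Nonempty →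
      D = ψ '' side l p → ∃ y, y ∉ range ψ ∧ y ≠ g 0 ∧ y ≠ g 1 ∧ y ∈ closure (ψ '' side l p) := by
    rintro D ⟨y, hy, hy', hyg⟩ rfl
    exact ⟨y, hy'.2, fun h => hyg ⟨0, by simp, h.symm⟩, fun h => hyg ⟨1, by simp, h.symm⟩,
      frontier_subset_closure hy⟩
  have hmem : ψ p ∈ range ψ \ ψ '' range l :=
    ⟨⟨p, rfl⟩, fun ⟨x, hx, hxp⟩ => hp (hψ.injective hxp ▸ hx)⟩
  have hcomp : connectedComponentIn (range ψ \ ψ '' range l) (ψ p) = ψ '' side l p := by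
    rw [← image_compl_eq_range_sdiff_image hψ.injective,
      image_connectedComponentIn_of_isOpenEmbedding hψ hp]; rfl
  rcases hD _ hmem with h | h
  · exact key hy₁ (h.symm.trans hcomp)
  · exact key hy₂ (h.symm.trans hcomp)

/-- Cross-sections of the range of `ψ` are the images of the sides of cross-cut lines. -/
theorem isCrossSection_iff [T3Space X] (hψ : IsOpenEmbedding ψ) {D : Set X} :
    IsCrossSection (range ψ) D ↔ ∃ l a b p, IsCC ψ l a b ∧ p ∉ range l ∧ D = ψ '' side l p := by
  constructor
  · rintro ⟨γ, hγ, hD⟩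
    obtain ⟨l, a, b, h, rfl⟩ := hγ.exists_isCC hψ
    obtain ⟨p, hp, rfl⟩ := (isCompOf_iff hψ).1 hD
    exact ⟨l, a, b, p, h, hp, rfl⟩
  · rintro ⟨l, a, b, p, h, hp, rfl⟩
    exact ⟨_, h.isCrossCut hψ, (isCompOf_iff hψ).2 ⟨p, hp, rfl⟩⟩

theorem closure_inter_range (hψ : IsOpenEmbedding ψ) (S : Set ℂ) :
    closure (ψ '' S) ∩ range ψ = ψ '' closure S := by
  ext x
  constructor
  · rintro ⟨hx, z, rfl⟩
    refine ⟨z, ?_, rfl⟩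
    rw [← preimage_image_eq S hψ.injective, ← hψ.isOpenMap.preimage_closure_eq_closure_preimage
      hψ.continuous]
    exact hx
  · rintro ⟨z, hz, rfl⟩
    exact ⟨image_closure_subset_closure_image hψ.continuous ⟨z, hz, rfl⟩, z, rfl⟩

theorem bdIn_side (hψ : IsOpenEmbedding ψ) {l : ℝ → ℂ} (hl : IsClosedEmbedding l) {p : ℂ}
    (hp : p ∉ range l) : bdIn (range ψ) (ψ '' side l p) = ψ '' range l := by
  rw [bdIn, inter_comm, ← inter_sdiff_assoc, inter_comm, closure_inter_range hψ, closure_side hl hp,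
    ← image_sdiff hψ.injective, union_sdiff_left,
    (disjoint_side_range (l := l) p).symm.sdiff_eq_left]

theorem closure_image_line [T3Space X] (hψ : IsOpenEmbedding ψ) {l : ℝ → ℂ} (hl : IsClosedEmbedding l)
    {a b : X} (ha : Tendsto (ψ ∘ l) atBot (𝓝 a)) (hb : Tendsto (ψ ∘ l) atTop (𝓝 b)) :
    closure (ψ '' range l) = insert a (insert b (ψ '' range l)) := by
  obtain ⟨g, hg, hi, hr, h0, h1⟩ := exists_arc_of_line hψ hl ha hb
  apply Subset.antisymm
  · refine closure_minimal ((subset_insert _ _).trans (subset_insert _ _)) ?_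
    rw [hr, ← h0, ← h1, ← image_Icc_eq]
    exact (isCompact_Icc.image_of_continuousOn hg).isClosed
  · refine insert_subset ?_ (insert_subset ?_ subset_closure)
    · exact mem_closure_of_tendsto ha (Eventually.of_forall fun x => ⟨l x, ⟨x, rfl⟩, rfl⟩)
    · exact mem_closure_of_tendsto hb (Eventually.of_forall fun x => ⟨l x, ⟨x, rfl⟩, rfl⟩)

end

section

variable {X : Type*} [TopologicalSpace X] [T3Space X] {ψ : ℂ → X}

theorem isCC_of_exists_isPreconnected (hψ : IsOpenEmbedding ψ) {l : ℝ → ℂ}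
    (hl : IsClosedEmbedding l) {a b : X} (ha : Tendsto (ψ ∘ l) atBot (𝓝 a))
    (hb : Tendsto (ψ ∘ l) atTop (𝓝 b)) (haU : a ∉ range ψ) (hbU : b ∉ range ψ)
    (h : ∀ p, p ∉ range l → ∃ P : Set X, IsPreconnected P ∧ a ∉ P ∧ b ∉ P ∧
      Disjoint P (ψ '' range l) ∧ ψ p ∈ P ∧ ¬ P ⊆ ψ '' side l p) : IsCC ψ l a b := by
  refine ⟨hl, ha, hb, haU, hbU, fun p hp => ?_⟩
  obtain ⟨P, hP, haP, hbP, hPl, hpP, hne⟩ := h p hp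
  by_contra! hcon
  refine hne (hP.subset_of_closure_inter_subset (isOpen_image_side hψ hl p)
    ⟨ψ p, hpP, mem_image_of_mem _ (mem_side hp)⟩ ?_)
  rintro y ⟨hy, hyP⟩
  by_cases hyU : y ∈ range ψ
  · have : y ∈ ψ '' closure (side l p) := closure_inter_range hψ _ ▸ ⟨hy, hyU⟩
    rw [closure_side hl hp, image_union] at this
    exact this.resolve_right fun h => hPl.ne_of_mem hyP h rfl
  · exact absurd hy (hcon y hyU (fun h => haP (h ▸ hyP)) (fun h => hbP (h ▸ hyP)))

theorem isPreconnected_compl_arc (e : X ≃ₜ ℂ) {g : ℝ → X} (hg : ContinuousOn g (Icc 0 1))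
    (hi : InjOn g (Icc 0 1)) : IsPreconnected (g '' Icc 0 1)ᶜ := by
  have h1 : IsPreconnected ((e ∘ g) '' Icc (0:ℝ) 1)ᶜ :=
    isConnected_compl_of_joinedIn fun p q hp hq => arc_joinedIn_compl zero_le_one
      (e.continuous.comp_continuousOn hg) (e.injective.comp_injOn hi) hp hq
  have h2 := h1.image e.symm e.symm.continuous.continuousOn
  rwa [image_comp, e.image_symm, preimage_compl, e.preimage_image] at h2

theorem isCC_of_ne (hψ : IsOpenEmbedding ψ) (e : X ≃ₜ ℂ) {l : ℝ → ℂ}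
    (hl : IsClosedEmbedding l) {a b : X} (ha : Tendsto (ψ ∘ l) atBot (𝓝 a))
    (hb : Tendsto (ψ ∘ l) atTop (𝓝 b)) (haU : a ∉ range ψ) (hbU : b ∉ range ψ)
    (hab : a ≠ b) : IsCC ψ l a b := by
  obtain ⟨g, hg, hi, hr, h0, h1⟩ := exists_arc_of_line hψ hl ha hb
  have hC : g '' Icc 0 1 = insert a (insert b (ψ '' range l)) := by rw [image_Icc_eq, hr, h0, h1]
  have hin : ∀ t ∈ Ioo (0:ℝ) 1, g t ∈ range ψ := fun t ht =>
    image_subset_range ψ _ (hr ▸ mem_image_of_mem g ht : g t ∈ ψ '' range l)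
  have hinj : InjOn g (Icc 0 1) := by
    have hsp : ∀ t ∈ Icc (0:ℝ) 1, t = 0 ∨ t = 1 ∨ t ∈ Ioo (0:ℝ) 1 := by
      intro t ht
      rcases eq_or_lt_of_le ht.1 with h | h
      · exact Or.inl h.symm
      rcases eq_or_lt_of_le ht.2 with h' | h'
      · exact Or.inr (Or.inl h')
      · exact Or.inr (Or.inr ⟨h, h'⟩)
    intro s hs t ht hst
    rcases hsp s hs with rfl | rfl | hs <;> rcases hsp t ht with rfl | rfl | ht
    · rfl
    · exact absurd (h0.symm.trans (hst.trans h1)) hab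
    · exact absurd (hin t ht) (hst ▸ h0 ▸ haU)
    · exact absurd (h0.symm.trans (hst.symm.trans h1)) hab
    · rfl
    · exact absurd (hin t ht) (hst ▸ h1 ▸ hbU)
    · exact absurd (hin s hs) (hst ▸ h0 ▸ haU)
    · exact absurd (hin s hs) (hst ▸ h1 ▸ hbU)
    · exact hi hs ht hst
  have hmem : ∀ {p}, p ∉ range l → ψ p ∈ (g '' Icc 0 1)ᶜ := by
    intro p hp
    rw [hC]
    rintro (h | h | ⟨x, hx, h⟩)
    · exact haU ⟨p, h⟩
    · exact hbU ⟨p, h⟩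
    · exact hp (hψ.injective h ▸ hx)
  refine isCC_of_exists_isPreconnected hψ hl ha hb haU hbU fun p hp =>
    ⟨(g '' Icc 0 1)ᶜ, isPreconnected_compl_arc e hg hinj, ?_, ?_, ?_, hmem hp, ?_⟩
  · simp [hC]
  · simp [hC]
  · rw [hC, ← le_compl_iff_disjoint_right]
    exact compl_subset_compl.2 ((subset_insert _ _).trans (subset_insert _ _))
  · obtain ⟨q, hq⟩ := out_nonempty hl hp
    intro h
    obtain ⟨x, hx, hxq⟩ := h (hmem (notMem_range_of_mem_out hq))
    exact hq (Or.inr (hψ.injective hxq ▸ hx))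

theorem exists_line_of_mem (hψ : IsOpenEmbedding ψ) {g : ℝ → X} (hg : ContinuousOn g (Icc 0 1))
    (hi : InjOn g (Ioo 0 1)) (h0 : g 0 ∉ range ψ) (h1 : g 1 ∉ range ψ) {z : ℂ}
    (hz : ψ z ∈ g '' Icc 0 1) :
    ∃ (s t : ℝ) (l : ℝ → ℂ), 0 ≤ s ∧ s < t ∧ t ≤ 1 ∧ IsClosedEmbedding l ∧ z ∈ range l ∧
      ψ '' range l = g '' Ioo s t ∧ g s ∉ range ψ ∧ g t ∉ range ψ ∧
      Tendsto (ψ ∘ l) atBot (𝓝 (g s)) ∧ Tendsto (ψ ∘ l) atTop (𝓝 (g t)) ∧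
      ∃ O, IsOpen O ∧ O ∩ ψ ⁻¹' (g '' Icc 0 1) = range l := by
  obtain ⟨τ, hτ, hτz⟩ := hz
  have hτ0 : τ ≠ 0 := fun h => h0 ⟨z, by rw [← hτz, h]⟩
  have hτ1 : τ ≠ 1 := fun h => h1 ⟨z, by rw [← hτz, h]⟩
  have hcl : IsClosed (range ψ)ᶜ := hψ.isOpen_range.isClosed_compl
  obtain ⟨s, hs, hsU, hs'⟩ := exists_last_hit (hg.mono (Icc_subset_Icc_right hτ.2)) hcl
    (left_mem_Icc.2 hτ.1) h0
  obtain ⟨t, ht, htU, ht'⟩ := exists_first_hit (hg.mono (Icc_subset_Icc_left hτ.1)) hcl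
    (right_mem_Icc.2 hτ.2) h1
  have hsτ : s < τ := lt_of_le_of_ne hs.2 fun h => hsU ⟨z, by rw [← hτz, h]⟩
  have hτt : τ < t := lt_of_le_of_ne ht.1 fun h => htU ⟨z, by rw [← hτz, h]⟩
  have hst : s < t := hsτ.trans hτt
  have hU : ∀ x ∈ Ioo s t, g x ∈ range ψ := fun x hx => by
    rcases le_total x τ with h | h
    · exact not_not.1 (hs' x ⟨hx.1, h⟩)
    · exact not_not.1 (ht' x ⟨h, hx.2⟩)
  have hsub : Ioo s t ⊆ Ioo 0 1 := Ioo_subset_Ioo hs.1 ht.2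
  obtain ⟨l, hl, hr, ha, hb⟩ := exists_line_of_Ioo hψ hst (hg.mono (Icc_subset_Icc hs.1 ht.2))
    (hi.mono hsub) hU hsU htU
  refine ⟨s, t, l, hs.1, hst, ht.2, hl, ?_, hr, hsU, htU, ha, hb,
    ψ ⁻¹' (g '' Icc 0 s ∪ g '' Icc t 1)ᶜ, ?_, ?_⟩
  · have : ψ z ∈ ψ '' range l := hr ▸ hτz ▸ mem_image_of_mem g ⟨hsτ, hτt⟩
    exact (hψ.injective.mem_set_image).1 this
  · refine IsClosed.isOpen_compl (self := ?_) |>.preimage hψ.continuous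
    exact ((isCompact_Icc.image_of_continuousOn (hg.mono (Icc_subset_Icc_right (hst.le.trans ht.2)))).union
      (isCompact_Icc.image_of_continuousOn (hg.mono (Icc_subset_Icc_left (hs.1.trans hst.le))))).isClosed
  · ext w
    rw [← hψ.injective.mem_set_image (s := range l), hr]
    constructor
    · rintro ⟨hw, x, hx, hxw⟩
      refine ⟨x, ⟨?_, ?_⟩, hxw⟩
      · exact not_le.1 fun h => hw (Or.inl ⟨x, ⟨hx.1, h⟩, hxw⟩)
      · exact not_le.1 fun h => hw (Or.inr ⟨x, ⟨h, hx.2⟩, hxw⟩)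
    · rintro ⟨x, hx, hxw⟩
      have hkey : ∀ x' ∈ Icc (0:ℝ) 1, g x' = ψ w → x' = x := fun x' hx' h => by
        refine hi ⟨lt_of_le_of_ne hx'.1 ?_, lt_of_le_of_ne hx'.2 ?_⟩ (hsub hx) (h.trans hxw.symm)
        · rintro rfl; exact h0 ⟨w, h.symm⟩
        · rintro rfl; exact h1 ⟨w, h.symm⟩
      refine ⟨?_, x, Ioo_subset_Icc_self (hsub hx), hxw⟩
      rintro (⟨x', hx', h⟩ | ⟨x', hx', h⟩)
      · have := hkey x' ⟨hx'.1, hx'.2.trans (hst.le.trans ht.2)⟩ h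
        exact absurd hx.1 (by rw [← this]; exact not_lt.2 hx'.2)
      · have := hkey x' ⟨(hs.1.trans hst.le).trans hx'.1, hx'.2⟩ h
        exact absurd hx.2 (by rw [← this]; exact not_lt.2 hx'.1)

/-- A compact set meeting the range of `ψ` in a locally finite union of cross-cuts. -/
structure IsBlocker (ψ : ℂ → X) (B : Set X) : Prop where
  isCompact : IsCompact B
  exists_line : ∀ z, ψ z ∈ B → ∃ l a b, IsCC ψ l a b ∧ z ∈ range l ∧ ψ '' range l ⊆ B ∧
    a ∈ B ∧ b ∈ B ∧ ∃ O, IsOpen O ∧ O ∩ ψ ⁻¹' B = range l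

theorem isBlocker_arc (hψ : IsOpenEmbedding ψ) (e : X ≃ₜ ℂ) {g : ℝ → X}
    (hg : ContinuousOn g (Icc 0 1)) (hi : InjOn g (Icc 0 1)) (h0 : g 0 ∉ range ψ)
    (h1 : g 1 ∉ range ψ) : IsBlocker ψ (g '' Icc 0 1) := by
  refine ⟨isCompact_Icc.image_of_continuousOn hg, fun z hz => ?_⟩
  obtain ⟨s, t, l, hs, hst, ht, hl, hzl, hr, hsU, htU, ha, hb, hO⟩ :=
    exists_line_of_mem hψ hg (hi.mono Ioo_subset_Icc_self) h0 h1 hz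
  have hs' : s ∈ Icc (0:ℝ) 1 := ⟨hs, hst.le.trans ht⟩
  have ht' : t ∈ Icc (0:ℝ) 1 := ⟨hs.trans hst.le, ht⟩
  refine ⟨l, g s, g t, isCC_of_ne hψ e hl ha hb hsU htU fun h => hst.ne (hi hs' ht' h), hzl, ?_,
    mem_image_of_mem g hs', mem_image_of_mem g ht', hO⟩
  rw [hr]
  exact image_mono fun x hx => ⟨hs.trans hx.1.le, hx.2.le.trans ht⟩

theorem exists_notMem_circle (hψ : IsOpenEmbedding ψ) (e : X ≃ₜ ℂ) {b : X} (hb : b ∉ range ψ)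
    {r : ℝ} (hr : 0 < r) : ∃ x, ‖e x - e b‖ = r ∧ x ∉ range ψ := by
  by_contra! h
  have hne : ∀ z, e (ψ z) - e b ≠ 0 := fun z hz =>
    hb ⟨z, e.injective (sub_eq_zero.1 hz)⟩
  obtain ⟨L, hL, hLe⟩ := exists_log_of_module (g := fun z => e (ψ z) - e b)
    ((e.continuous.comp hψ.continuous).sub continuous_const) hne
  have hmem : ∀ w ∈ Metric.sphere (0:ℂ) r, e.symm (e b + w) ∈ range ψ := fun w hw =>
    h _ (by simpa using hw)
  let k : X → ℂ := Function.invFun ψ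
  have hk : ∀ w ∈ Metric.sphere (0:ℂ) r, ψ (k (e.symm (e b + w))) = e.symm (e b + w) :=
    fun w hw => Function.invFun_eq (hmem w hw)
  refine no_log_sphere (q := 0) (R := r) (by simpa using hr) (fun w => L (k (e.symm (e b + w)))) ?_ ?_
  · refine hL.comp_continuousOn ?_
    refine hψ.isInducing.continuousOn_iff.2 ?_
    refine ContinuousOn.congr (f := fun w => e.symm (e b + w)) ?_ hk
    exact (e.symm.continuous.comp (continuous_const.add continuous_id)).continuousOn
  · intro w hw
    simp only [hLe, hk w hw]
    simp

theorem exists_circle_param (e : X ≃ₜ ℂ) (b : X) {r : ℝ} (hr : 0 < r) {x : X} (hx : ‖e x - e b‖ = r) :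
    ∃ g : ℝ → X, Continuous g ∧ (∀ s t, 0 ≤ s → s < t → t ≤ 1 → g s = g t → s = 0 ∧ t = 1) ∧
      g 0 = x ∧ g 1 = x ∧ g '' Icc 0 1 = {y | ‖e y - e b‖ = r} := by
  have hx0 : e x - e b ≠ 0 := by rw [← norm_pos_iff, hx]; exact hr
  let w : ℝ → ℂ := fun t => Complex.exp (t * (2 * Real.pi * Complex.I))
  have hw : Continuous w := by fun_prop
  have hw1 : w 1 = 1 := by simp [w, Complex.exp_two_pi_mul_I]
  have hw0 : w 0 = 1 := by simp [w]
  have hwn : ∀ t, ‖w t‖ = 1 := fun t => by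
    simp only [w]; rw [Complex.norm_exp]; simp
  refine ⟨fun t => e.symm (e b + (e x - e b) * w t), e.symm.continuous.comp (by fun_prop), ?_, ?_, ?_, ?_⟩
  · intro s t hs hst ht h
    have h1 : w s = w t := mul_left_cancel₀ hx0 (add_left_cancel (e.symm.injective h))
    obtain ⟨n, hn⟩ := Complex.exp_eq_exp_iff_exists_int.1 h1
    have hpi : (2 * Real.pi * Complex.I : ℂ) ≠ 0 := Complex.two_pi_I_ne_zero
    have h2 : (s : ℂ) = t + n := by
      apply mul_right_cancel₀ hpi; rw [hn]; ring
    have h3 : s = t + n := by exact_mod_cast h2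
    have h4 : (n : ℝ) < 0 := by linarith
    have h5 : (n : ℝ) ≤ -1 := by
      have : n ≤ -1 := by have : n < 0 := by exact_mod_cast h4
                          omega
      exact_mod_cast this
    constructor <;> linarith
  · simp [hw0]
  · simp [hw1]
  · ext y
    constructor
    · rintro ⟨t, _, rfl⟩
      simp [hwn, hx]
    · intro hy
      have hy' : ‖e y - e b‖ = r := hy
      set v := (e y - e b) / (e x - e b) with hv
      have hvn : ‖v‖ = 1 := by rw [hv, norm_div, hx, hy', div_self hr.ne']
      have hpi : 0 < 2 * Real.pi := Real.two_pi_pos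
      refine ⟨Int.fract (v.arg / (2 * Real.pi)), ⟨Int.fract_nonneg _, (Int.fract_lt_one _).le⟩, ?_⟩
      have : w (Int.fract (v.arg / (2 * Real.pi))) = v := by
        rw [Int.fract]
        simp only [w]
        push_cast
        rw [sub_mul, Complex.exp_sub, Complex.exp_int_mul_two_pi_mul_I, div_one]
        have h3 : (v.arg / (2 * Real.pi) * (2 * Real.pi * Complex.I) : ℂ) = v.arg * Complex.I := by
          have : (Real.pi : ℂ) ≠ 0 := by exact_mod_cast Real.pi_ne_zero
          field_simp
        rw [h3]
        have := Complex.norm_mul_exp_arg_mul_I v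
        rwa [hvn, Complex.ofReal_one, one_mul] at this
      simp only [this]
      rw [hv, mul_div_cancel₀ _ hx0]
      simp

theorem isPreconnected_norm_sub_gt (c : ℂ) (r : ℝ) : IsPreconnected {z : ℂ | r < ‖z - c‖} := by
  have := (isPreconnected_norm_gt r).image (fun z => z + c) (by fun_prop)
  convert this using 1
  ext z
  constructor
  · intro h; exact ⟨z - c, h, by simp⟩
  · rintro ⟨y, hy, rfl⟩; simpa using hy

theorem isBlocker_circle (hψ : IsOpenEmbedding ψ) (e : X ≃ₜ ℂ) {b c : X} (hb : b ∉ range ψ)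
    (hc : c ∉ range ψ) {r : ℝ} (hr : 0 < r) (hbc : r < ‖e c - e b‖) :
    IsBlocker ψ {y | ‖e y - e b‖ = r} := by
  obtain ⟨x, hx, hxU⟩ := exists_notMem_circle hψ e hb hr
  obtain ⟨g, hg, hi, h0, h1, him⟩ := exists_circle_param e b hr hx
  have hi' : InjOn g (Ioo 0 1) := by
    intro s hs t ht h
    rcases lt_trichotomy s t with hst | hst | hst
    · exact absurd (hi s t hs.1.le hst ht.2.le h).1 hs.1.ne'
    · exact hst
    · exact absurd (hi t s ht.1.le hst hs.2.le h.symm).1 ht.1.ne'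
  rw [← him]
  refine ⟨isCompact_Icc.image hg, fun z hz => ?_⟩
  obtain ⟨s, t, l, hs, hst, ht, hl, hzl, hr', hsU, htU, hla, hlb, hO⟩ :=
    exists_line_of_mem hψ hg.continuousOn hi' (h0 ▸ hxU) (h1 ▸ hxU) hz
  have hs' : s ∈ Icc (0:ℝ) 1 := ⟨hs, hst.le.trans ht⟩
  have ht' : t ∈ Icc (0:ℝ) 1 := ⟨hs.trans hst.le, ht⟩
  have hsub : ψ '' range l ⊆ g '' Icc 0 1 := by
    rw [hr']; exact image_mono fun x hx => ⟨hs.trans hx.1.le, hx.2.le.trans ht⟩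
  refine ⟨l, g s, g t, ?_, hzl, hsub, mem_image_of_mem g hs', mem_image_of_mem g ht', hO⟩
  by_cases hst' : g s = g t
  · obtain ⟨rfl, rfl⟩ := hi s t hs hst ht hst'
    have hball : IsPreconnected {y | ‖e y - e b‖ < r} := by
      have := (convex_ball (e b) r).isPreconnected.image e.symm e.symm.continuous.continuousOn
      rw [e.image_symm] at this
      convert this using 1
      ext y; simp [dist_eq_norm]
    have hext : IsPreconnected {y | r < ‖e y - e b‖} := by
      have := (isPreconnected_norm_sub_gt (e b) r).image e.symm e.symm.continuous.continuousOn
      rw [e.image_symm] at this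
      exact this
    have hcirc : ∀ y ∈ g '' Icc 0 1, ‖e y - e b‖ = r := fun y hy => by rw [him] at hy; exact hy
    refine isCC_of_exists_isPreconnected hψ hl hla hlb hsU htU fun p hp => ?_
    have hp' : ψ p ∉ g '' Icc 0 1 := by
      rw [image_Icc_eq, ← hr']
      rintro (h | h | h)
      · exact hsU ⟨p, h⟩
      · exact htU ⟨p, h⟩
      · exact hp (hψ.injective.mem_set_image.1 h)
    rw [him] at hp'
    rcases lt_or_gt_of_ne hp' with h | h
    · refine ⟨_, hball, ?_, ?_, ?_, h, fun hh => hb (image_subset_range _ _ (hh ?_))⟩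
      · exact fun h => (ne_of_lt h) (hcirc _ (mem_image_of_mem g hs'))
      · exact fun h => (ne_of_lt h) (hcirc _ (mem_image_of_mem g ht'))
      · exact Set.disjoint_left.2 fun y hy hy' => (ne_of_lt hy) (hcirc _ (hsub hy'))
      · simpa using hr
    · refine ⟨_, hext, ?_, ?_, ?_, h, fun hh => hc (image_subset_range _ _ (hh hbc))⟩
      · exact fun h => (ne_of_gt h) (hcirc _ (mem_image_of_mem g hs'))
      · exact fun h => (ne_of_gt h) (hcirc _ (mem_image_of_mem g ht'))
      · exact Set.disjoint_left.2 fun y hy hy' => (ne_of_gt hy) (hcirc _ (hsub hy'))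
  · exact isCC_of_ne hψ e hl hla hlb hsU htU hst'

end

section

variable {X : Type u} [TopologicalSpace X] [T3Space X] {ψ : ℂ → X}

theorem exists_seq_of_forall {α : Type*} {p : α → Prop} {R : α → α → Prop} {a : α} (ha : p a)
    (h : ∀ a, p a → ∃ b, p b ∧ R a b) : ∃ u : ℕ → α, u 0 = a ∧ (∀ n, p (u n)) ∧ ∀ n, R (u n) (u (n + 1)) := by
  choose s hs using fun a : {a // p a} => h a.1 a.2
  let u : ℕ → {a // p a} := fun n => Nat.rec ⟨a, ha⟩ (fun _ x => ⟨s x, (hs x).1⟩) n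
  exact ⟨fun n => (u n).1, rfl, fun n => (u n).2, fun n => (hs (u n)).2⟩

/-- A filter on the model plane which converges, through `ψ`, to a point `b` outside the range. -/
structure IsGerm (ψ : ℂ → X) (𝓕 : Filter ℂ) (b : X) : Prop where
  neBot : NeBot 𝓕
  tendsto : Tendsto ψ 𝓕 (𝓝 b)
  notMem : b ∉ range ψ
  exists_isPreconnected : ∀ S ∈ 𝓕, ∃ T ∈ 𝓕, T ⊆ S ∧ IsPreconnected T

theorem IsCC.isGerm_atTop {l : ℝ → ℂ} {a b : X} (h : IsCC ψ l a b) : IsGerm ψ (map l atTop) b := by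
  refine ⟨inferInstance, tendsto_map'_iff.2 h.tendsto_atTop, h.notMem_right, fun S hS => ?_⟩
  obtain ⟨T, hT⟩ := mem_atTop_sets.1 (mem_map.1 hS)
  exact ⟨l '' Ici T, image_mem_map (Ici_mem_atTop T), image_subset_iff.2 hT,
    isPreconnected_Ici.image l h.line.continuous.continuousOn⟩

theorem IsCC.isGerm_atBot {l : ℝ → ℂ} {a b : X} (h : IsCC ψ l a b) : IsGerm ψ (map l atBot) a := by
  refine ⟨inferInstance, tendsto_map'_iff.2 h.tendsto_atBot, h.notMem_left, fun S hS => ?_⟩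
  obtain ⟨T, hT⟩ := mem_atBot_sets.1 (mem_map.1 hS)
  exact ⟨l '' Iic T, image_mem_map (Iic_mem_atBot T), image_subset_iff.2 hT,
    isPreconnected_Iic.image l h.line.continuous.continuousOn⟩

theorem IsCC.closure_range (hψ : IsOpenEmbedding ψ) {l : ℝ → ℂ} {a b : X} (h : IsCC ψ l a b) :
    closure (ψ '' range l) = insert a (insert b (ψ '' range l)) :=
  closure_image_line hψ h.line h.tendsto_atBot h.tendsto_atTop

theorem exists_pos_of_notMem_closure (e : X ≃ₜ ℂ) {S : Set X} {b : X} (hb : b ∉ closure S) :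
    ∃ ρ > 0, ∀ y ∈ S, ρ ≤ ‖e y - e b‖ := by
  have h1 : e b ∉ closure (e '' S) := by
    rw [← e.image_closure]; rintro ⟨y, hy, h⟩; exact hb (e.injective h ▸ hy)
  rw [Metric.mem_closure_iff] at h1
  push Not at h1
  obtain ⟨ρ, hρ, h⟩ := h1
  refine ⟨ρ, hρ, fun y hy => ?_⟩
  have := h _ (mem_image_of_mem e hy)
  rwa [dist_comm, dist_eq_norm] at this

/-- `l` is a cross-cut line contained in the circle of radius `r` around `b`, not through `c`. -/
structure IsCircleLine (ψ : ℂ → X) (e : X ≃ₜ ℂ) (b : X) (c : ℂ) (r : ℝ) (l : ℝ → ℂ) : Prop where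
  exists_isCC : ∃ a a', IsCC ψ l a a'
  norm_eq : ∀ y ∈ closure (ψ '' range l), ‖e y - e b‖ = r
  notMem : c ∉ range l

theorem subset_side_of_small (hψ : IsOpenEmbedding ψ) (e : X ≃ₜ ℂ) {b : X} (hb : b ∉ range ψ)
    (c : ℂ) {S : Set ℂ} (hS : IsPreconnected S) (hSb : b ∉ closure (ψ '' S)) :
    ∃ ρ > 0, ∀ r < ρ, ∀ l, IsCircleLine ψ e b c r l → S ⊆ side l c := by
  rcases S.eq_empty_or_nonempty with rfl | ⟨z, hz⟩
  · exact ⟨1, one_pos, fun _ _ _ _ => empty_subset _⟩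
  set S' := S ∪ segment ℝ z c with hS'
  have hS'c : IsPreconnected S' :=
    hS.union z hz (left_mem_segment _ _ _) (convex_segment z c).isPreconnected
  have hseg : IsCompact (segment ℝ z c) := by
    rw [segment_eq_image_lineMap]
    exact isCompact_Icc.image (AffineMap.lineMap_continuous)
  have hb' : b ∉ closure (ψ '' S') := by
    rw [hS', image_union, closure_union, (hseg.image hψ.continuous).isClosed.closure_eq]
    rintro (h | h)
    · exact hSb h
    · exact hb (image_subset_range _ _ h)
  obtain ⟨ρ, hρ, h⟩ := exists_pos_of_notMem_closure e hb'
  refine ⟨ρ, hρ, fun r hr l hl => ?_⟩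
  have hd : Disjoint S' (range l) := Set.disjoint_left.2 fun x hx hxl => by
    have h1 := h _ (mem_image_of_mem ψ hx)
    rw [hl.norm_eq _ (subset_closure (mem_image_of_mem ψ hxl))] at h1
    exact absurd hr (not_lt.2 h1)
  have := subset_side hS'c hd (Or.inr (right_mem_segment ℝ z c)) (mem_side hl.notMem)
  exact subset_union_left.trans this

theorem IsGerm.exists_circleLine (hψ : IsOpenEmbedding ψ) (e : X ≃ₜ ℂ) {𝓕 : Filter ℂ} {b : X}
    (h𝓕 : IsGerm ψ 𝓕 b) (hU : (range ψ)ᶜ.Nontrivial) (c : ℂ) :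
    ∃ r₀ > 0, ∀ r, 0 < r → r < r₀ → ∃ l, IsCircleLine ψ e b c r l ∧ out l c ∈ 𝓕 := by
  have := h𝓕.neBot
  obtain ⟨c', hc', hc'b⟩ := hU.exists_ne b
  have h1 : 0 < ‖e c' - e b‖ := norm_pos_iff.2 (sub_ne_zero.2 (e.injective.ne hc'b))
  have h2 : 0 < ‖e (ψ c) - e b‖ :=
    norm_pos_iff.2 (sub_ne_zero.2 (e.injective.ne fun h => h𝓕.notMem ⟨c, h⟩))
  refine ⟨min ‖e c' - e b‖ ‖e (ψ c) - e b‖, lt_min h1 h2, fun r hr hr' => ?_⟩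
  have hB := isBlocker_circle hψ e h𝓕.notMem hc' hr (hr'.trans_le (min_le_left _ _))
  set B : Set X := {y | ‖e y - e b‖ = r} with hBdef
  have hrc : r < ‖e (ψ c) - e b‖ := hr'.trans_le (min_le_right _ _)
  have hopen : IsOpen {y | ‖e y - e b‖ < r} :=
    isOpen_lt ((e.continuous.sub continuous_const).norm) continuous_const
  have hball : ψ ⁻¹' {y | ‖e y - e b‖ < r} ∈ 𝓕 :=
    h𝓕.tendsto (hopen.mem_nhds (by simpa using hr))
  obtain ⟨T, hT, hTb, hTc⟩ := h𝓕.exists_isPreconnected _ hball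
  obtain ⟨q, hq⟩ := h𝓕.neBot.nonempty_of_mem hT
  have hcl : IsClosed (ψ ⁻¹' B) := hB.isCompact.isClosed.preimage hψ.continuous
  have hnot : ¬ JoinedIn (ψ ⁻¹' B)ᶜ c q := by
    rintro ⟨γ, hγ⟩
    have hc : Continuous fun t => ‖e (ψ (γ t)) - e b‖ :=
      ((e.continuous.comp (hψ.continuous.comp γ.continuous)).sub continuous_const).norm
    have h0 : r ≤ ‖e (ψ (γ 0)) - e b‖ := by rw [γ.source]; exact hrc.le
    have h1 : ‖e (ψ (γ 1)) - e b‖ ≤ r := by rw [γ.target]; exact le_of_lt (hTb hq)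
    obtain ⟨t, ht⟩ := mem_range_of_exists_le_of_exists_ge hc ⟨1, h1⟩ ⟨0, h0⟩
    exact hγ t ht
  have hcB : c ∉ ψ ⁻¹' B := fun h => (ne_of_gt hrc) h
  have hTB : ∀ z ∈ T, z ∉ ψ ⁻¹' B := fun z hz h => (ne_of_lt (hTb hz)) h
  by_contra! hcon
  refine hnot (joinedIn_compl_of_pieces hcl hcB (hTB q hq) fun z hz => ?_)
  obtain ⟨l, a, a', hl, hzl, hlB, ha, ha', hO⟩ := hB.exists_line z hz
  have hcl' : c ∉ range l := fun h => hcB (hlB (mem_image_of_mem ψ h))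
  have hlB' : range l ⊆ ψ ⁻¹' B := image_subset_iff.1 hlB
  refine ⟨range l, hzl, hlB', hl.line.isClosed_range, isPreconnected_line hl.line, hO, ?_⟩
  rw [joinedIn_compl_iff hl.line.isClosed_range hcl']
  by_contra hqs
  have hql : q ∈ out l c := mem_out_of_notMem (fun h => hTB q hq (hlB' h)) hqs
  refine hcon l ⟨⟨a, a', hl⟩, ?_, hcl'⟩ (mem_of_superset hT
    (subset_out hl.line hcl' hTc (Set.disjoint_left.2 fun x hx hxl => hTB x hx (hlB' hxl)) hq hql))
  rw [hl.closure_range hψ]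
  rintro y (rfl | rfl | hy)
  · exact ha
  · exact ha'
  · exact hlB hy

/-- A nested sequence of circle lines shrinking to the germ `𝓕`. -/
structure IsGermChain (ψ : ℂ → X) (e : X ≃ₜ ℂ) (𝓕 : Filter ℂ) (b : X) (c : ℂ) (r : ℕ → ℝ)
    (l : ℕ → ℝ → ℂ) : Prop where
  circleLine : ∀ i, IsCircleLine ψ e b c (r i) (l i)
  pos : ∀ i, 0 < r i
  lt_half : ∀ i, r (i + 1) < r i / 2
  mem : ∀ i, out (l i) c ∈ 𝓕
  nested : ∀ i, out (l (i + 1)) c ∪ range (l (i + 1)) ⊆ out (l i) c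

theorem IsGerm.exists_chain (hψ : IsOpenEmbedding ψ) (e : X ≃ₜ ℂ) {𝓕 : Filter ℂ} {b : X}
    (h𝓕 : IsGerm ψ 𝓕 b) (hU : (range ψ)ᶜ.Nontrivial) (c : ℂ) :
    ∃ r l, IsGermChain ψ e 𝓕 b c r l := by
  have := h𝓕.neBot
  obtain ⟨r₀, hr₀, H⟩ := h𝓕.exists_circleLine hψ e hU c
  obtain ⟨l₀, hl₀⟩ := H (r₀ / 2) (by linarith) (by linarith)
  let p : ℝ × (ℝ → ℂ) → Prop := fun x => (0 < x.1 ∧ x.1 < r₀) ∧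
    IsCircleLine ψ e b c x.1 x.2 ∧ out x.2 c ∈ 𝓕
  let R : ℝ × (ℝ → ℂ) → ℝ × (ℝ → ℂ) → Prop := fun x y => y.1 < x.1 / 2 ∧
    out y.2 c ∪ range y.2 ⊆ out x.2 c
  obtain ⟨u, -, hu, huR⟩ := exists_seq_of_forall (p := p) (R := R) (a := (r₀ / 2, l₀))
    ⟨⟨by simp only; linarith, by simp only; linarith⟩, hl₀⟩ (by
      rintro ⟨r, l⟩ ⟨⟨hr, hr'⟩, hl, hlm⟩
      simp only at hr hr' hl hlm
      obtain ⟨a, a', hcc⟩ := hl.exists_isCC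
      have hbl : b ∉ closure (ψ '' range l) := fun h => by
        have := hl.norm_eq b h; simp at this; exact hr.ne this
      obtain ⟨ρ, hρ, hsm⟩ := subset_side_of_small hψ e h𝓕.notMem c
        (isPreconnected_line hcc.line) hbl
      have hm : 0 < min (r / 2) ρ := lt_min (by linarith) hρ
      obtain ⟨l', hl', hlm'⟩ := H (min (r / 2) ρ / 2) (by linarith)
        (by linarith [min_le_left (r / 2) ρ])
      have hs := hsm (min (r / 2) ρ / 2) (by linarith [min_le_right (r / 2) ρ]) l' hl'
      obtain ⟨a₁, a₁', hcc'⟩ := hl'.exists_isCC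
      refine ⟨(min (r / 2) ρ / 2, l'), ⟨⟨by simp only; linarith, ?_⟩, hl', hlm'⟩, ?_, ?_⟩
      · simp only; linarith [min_le_left (r / 2) ρ]
      · simp only; linarith [min_le_left (r / 2) ρ]
      · have hd : Disjoint (range l) (range l') :=
          (disjoint_side_range (l := l') c).mono_left hs
        rcases out_nested hcc.line hcc'.line hl.notMem hl'.notMem hd with h | h | h
        · exact h
        · exact absurd (h (Or.inr ⟨0, rfl⟩)) fun h' => h' (Or.inr (hs ⟨0, rfl⟩))
        · obtain ⟨z, hz, hz'⟩ := h𝓕.neBot.nonempty_of_mem (inter_mem hlm hlm')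
          exact absurd rfl (h.ne_of_mem (Or.inl hz) (Or.inl hz')))
  exact ⟨fun n => (u n).1, fun n => (u n).2, fun i => (hu i).2.1, fun i => (hu i).1.1,
    fun i => (huR i).1, fun i => (hu i).2.2, fun i => (huR i).2⟩

namespace IsGermChain

variable {e : X ≃ₜ ℂ} {𝓕 : Filter ℂ} {b : X} {c : ℂ} {r : ℕ → ℝ} {l : ℕ → ℝ → ℂ}

theorem line (h : IsGermChain ψ e 𝓕 b c r l) (i : ℕ) : IsClosedEmbedding (l i) := by
  obtain ⟨_, _, hc⟩ := (h.circleLine i).exists_isCC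
  exact hc.line

theorem strictAnti (h : IsGermChain ψ e 𝓕 b c r l) : StrictAnti r :=
  strictAnti_nat_of_succ_lt fun n => by linarith [h.lt_half n, h.pos n]

theorem antitone (h : IsGermChain ψ e 𝓕 b c r l) : Antitone fun i => out (l i) c :=
  antitone_nat_of_succ_le fun n => subset_union_left.trans (h.nested n)

theorem exists_lt (h : IsGermChain ψ e 𝓕 b c r l) {ρ : ℝ} (hρ : 0 < ρ) :
    ∃ N, ∀ i ≥ N, r i < ρ := by
  have h1 : ∀ n, r n ≤ r 0 * (1 / 2) ^ n := fun n => by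
    induction n with
    | zero => simp
    | succ n ih => rw [pow_succ]; linarith [h.lt_half n]
  have h2 : Tendsto (fun n => r 0 * (1 / 2 : ℝ) ^ n) atTop (𝓝 (r 0 * 0)) :=
    (tendsto_pow_atTop_nhds_zero_of_lt_one (by norm_num) (by norm_num)).const_mul _
  rw [mul_zero] at h2
  obtain ⟨N, hN⟩ := eventually_atTop.1 (h2.eventually (gt_mem_nhds hρ))
  exact ⟨N, fun i hi => (h1 i).trans_lt (hN i hi)⟩

theorem exists_subset_side (h : IsGermChain ψ e 𝓕 b c r l) (hψ : IsOpenEmbedding ψ)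
    (hb : b ∉ range ψ) {S : Set ℂ} (hS : IsPreconnected S) (hSb : b ∉ closure (ψ '' S)) :
    ∃ N, ∀ i ≥ N, S ⊆ side (l i) c := by
  obtain ⟨ρ, hρ, hs⟩ := subset_side_of_small hψ e hb c hS hSb
  obtain ⟨N, hN⟩ := h.exists_lt hρ
  exact ⟨N, fun i hi => hs _ (hN i hi) _ (h.circleLine i)⟩

theorem exists_side_eq (h : IsGermChain ψ e 𝓕 b c r l) (i : ℕ) :
    ∃ p, p ∉ range (l i) ∧ out (l i) c = side (l i) p := by
  obtain ⟨p, hp⟩ := out_nonempty (h.line i) (h.circleLine i).notMem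
  exact ⟨p, notMem_range_of_mem_out hp, out_eq_side (h.line i) (h.circleLine i).notMem hp⟩

theorem isCrossSection (h : IsGermChain ψ e 𝓕 b c r l) (hψ : IsOpenEmbedding ψ) (i : ℕ) :
    IsCrossSection (range ψ) (ψ '' out (l i) c) := by
  obtain ⟨p, hp, hpe⟩ := h.exists_side_eq i
  obtain ⟨a, a', hcc⟩ := (h.circleLine i).exists_isCC
  exact (isCrossSection_iff hψ).2 ⟨l i, a, a', p, hcc, hp, by rw [hpe]⟩

theorem isPEChain (h : IsGermChain ψ e 𝓕 b c r l) (hψ : IsOpenEmbedding ψ) :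
    IsPEChain (range ψ) fun i => ψ '' out (l i) c := by
  refine ⟨h.isCrossSection hψ, fun i j hij => image_mono (h.antitone hij), fun i j hij => ?_⟩
  have hbd : ∀ i, bdIn (range ψ) (ψ '' out (l i) c) = ψ '' range (l i) := fun i => by
    obtain ⟨p, hp, hpe⟩ := h.exists_side_eq i
    rw [hpe, bdIn_side hψ (h.line i) hp]
  rw [hbd, hbd, ← disjoint_iff_inter_eq_empty, Set.disjoint_left]
  intro y hy hy'
  exact hij (h.strictAnti.injective (((h.circleLine i).norm_eq y hy).symm.trans
    ((h.circleLine j).norm_eq y hy')))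

theorem exists_out_subset (h : IsGermChain ψ e 𝓕 b c r l) (hψ : IsOpenEmbedding ψ)
    (hb : b ∉ range ψ) {m : ℝ → ℂ} (hm : IsClosedEmbedding m)
    (hmb : b ∉ closure (ψ '' range m)) {p : ℂ}
    (hmeet : ∀ i, (out (l i) c ∩ side m p).Nonempty) :
    ∃ N, ∀ i ≥ N, out (l i) c ⊆ side m p := by
  obtain ⟨N, hN⟩ := h.exists_subset_side hψ hb (isPreconnected_line hm) hmb
  refine ⟨N, fun i hi => ?_⟩
  obtain ⟨x, hx, hxp⟩ := hmeet i
  exact subset_side (isPreconnected_out (h.line i) (h.circleLine i).notMem)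
    ((disjoint_out_side c).mono_right (hN i hi)) hx hxp

theorem exists_subset_of_chain (h : IsGermChain ψ e 𝓕 b c r l) (hψ : IsOpenEmbedding ψ)
    (hb : b ∉ range ψ) {D : ℕ → Set X} (hD : IsPEChain (range ψ) D)
    (hmeet : ∀ n i, (ψ '' out (l i) c ∩ D n).Nonempty) (n : ℕ) :
    ∃ m, ψ '' out (l m) c ⊆ D n := by
  have key : ∀ n, b ∉ closure (bdIn (range ψ) (D n)) → ∃ m, ψ '' out (l m) c ⊆ D n := by
    intro n hn
    obtain ⟨m, a, a', p, hm, hp, hDn⟩ := (isCrossSection_iff hψ).1 (hD.1 n)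
    rw [hDn, bdIn_side hψ hm.line hp] at hn
    obtain ⟨N, hN⟩ := h.exists_out_subset hψ hb hm.line hn (p := p) fun i => by
      obtain ⟨_, ⟨x, hx, rfl⟩, hx'⟩ := hmeet n i
      rw [hDn, hψ.injective.mem_set_image] at hx'
      exact ⟨x, hx, hx'⟩
    exact ⟨N, hDn ▸ image_mono (hN N le_rfl)⟩
  by_cases hn : b ∈ closure (bdIn (range ψ) (D n))
  · have hn' : b ∉ closure (bdIn (range ψ) (D (n + 1))) := fun h' => by
      have := hD.2.2 n (n + 1) (by omega)
      exact (this ▸ ⟨hn, h'⟩ : b ∈ (∅ : Set X))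
    obtain ⟨m, hm⟩ := key _ hn'
    exact ⟨m, hm.trans (hD.2.1 _ _ n.le_succ)⟩
  · exact key n hn

theorem _root_.IsCrossSection.nonempty {U D : Set X} (h : IsCrossSection U D) : D.Nonempty := by
  obtain ⟨γ, _, x, hx, rfl⟩ := h
  exact ⟨x, mem_connectedComponentIn hx⟩

theorem isPrimeChain (h : IsGermChain ψ e 𝓕 b c r l) (hψ : IsOpenEmbedding ψ)
    (hb : b ∉ range ψ) : IsPrimeChain (range ψ) fun i => ψ '' out (l i) c := by
  refine ⟨h.isPEChain hψ, fun D hD hdiv n => h.exists_subset_of_chain hψ hb hD (fun n i => ?_) n⟩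
  obtain ⟨m, hm⟩ := hdiv i
  obtain ⟨x, hx⟩ := (hD.1 (max m n)).nonempty
  exact ⟨x, hm (hD.2.1 _ _ (le_max_left m n) hx), hD.2.1 _ _ (le_max_right m n) hx⟩

end IsGermChain

/-- The germ `𝓕` is eventually in every cross-section dividing `p`. -/
def Lands (𝓕 : Filter ℂ) (p : PrimeEnd (range ψ)) : Prop :=
  ∀ E, IsCrossSection (range ψ) E → PrimeEndDivides p E → ψ ⁻¹' E ∈ 𝓕

theorem ChainDivides.trans {D E F : ℕ → Set X} (h : ChainDivides D E) (h' : ChainDivides E F) :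
    ChainDivides D F := fun n => by
  obtain ⟨m, hm⟩ := h' n
  obtain ⟨k, hk⟩ := h m
  exact ⟨k, hk.trans hm⟩

theorem ChainDivides.refl (D : ℕ → Set X) : ChainDivides D D := fun n => ⟨n, Subset.rfl⟩

theorem primeEnd_mk_eq {U : Set X} {C C' : PrimeChain U} :
    (Quot.mk _ C : PrimeEnd U) = Quot.mk _ C' ↔ ChainDivides C.1 C'.1 ∧ ChainDivides C'.1 C.1 := by
  constructor
  · intro h
    have he : Equivalence fun C C' : PrimeChain U => ChainDivides C.1 C'.1 ∧ ChainDivides C'.1 C.1 :=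
      ⟨fun C => ⟨.refl _, .refl _⟩, fun h => ⟨h.2, h.1⟩,
        fun h h' => ⟨h.1.trans h'.1, h'.2.trans h.2⟩⟩
    exact Equivalence.eqvGen_iff he |>.1 (Quot.eqvGen_exact h)
  · exact fun h => Quot.sound h

theorem primeEndDivides_mk_iff {U : Set X} {C : PrimeChain U} {E : Set X} :
    PrimeEndDivides (Quot.mk _ C : PrimeEnd U) E ↔ ∃ n, C.1 n ⊆ E := by
  constructor
  · rintro ⟨C', hC', N, hN⟩
    obtain ⟨m, hm⟩ := (primeEnd_mk_eq.1 hC').2 N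
    exact ⟨m, hm.trans (hN N le_rfl)⟩
  · rintro ⟨n, hn⟩
    exact ⟨C, rfl, n, fun i hi => (C.2.1.2.1 i n hi).trans hn⟩

theorem PrimeEndDivides.mono {U : Set X} {p : PrimeEnd U} {E E' : Set X} (h : PrimeEndDivides p E)
    (hE : E ⊆ E') : PrimeEndDivides p E' := by
  obtain ⟨C, hC, N, hN⟩ := h
  exact ⟨C, hC, N, fun i hi => (hN i hi).trans hE⟩

section
variable {e : X ≃ₜ ℂ} {𝓕 : Filter ℂ} {b : X} {c : ℂ} {r : ℕ → ℝ} {l : ℕ → ℝ → ℂ}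

theorem IsGermChain.lands_mk (h : IsGermChain ψ e 𝓕 b c r l) (hψ : IsOpenEmbedding ψ)
    (hb : b ∉ range ψ) : Lands 𝓕 (Quot.mk _ ⟨_, h.isPrimeChain hψ hb⟩ : PrimeEnd (range ψ)) := by
  intro E _ hE
  obtain ⟨n, hn⟩ := primeEndDivides_mk_iff.1 hE
  exact mem_of_superset (h.mem n) (image_subset_iff.1 hn)

theorem IsGermChain.eq_mk (h : IsGermChain ψ e 𝓕 b c r l) (hψ : IsOpenEmbedding ψ)
    (hn : NeBot 𝓕) (hb : b ∉ range ψ) {p : PrimeEnd (range ψ)} (hp : Lands 𝓕 p) :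
    p = Quot.mk _ ⟨_, h.isPrimeChain hψ hb⟩ := by
  induction p using Quot.ind with | mk C => ?_
  have h1 : ChainDivides (fun i => ψ '' out (l i) c) C.1 :=
    h.exists_subset_of_chain hψ hb C.2.1 fun n i => by
      have h1 := hp _ (C.2.1.1 n) (primeEndDivides_mk_iff.2 ⟨n, Subset.rfl⟩)
      obtain ⟨x, hx, hx'⟩ := hn.nonempty_of_mem (inter_mem (h.mem i) h1)
      exact ⟨ψ x, ⟨x, hx, rfl⟩, hx'⟩
  exact primeEnd_mk_eq.2 ⟨C.2.2 _ (h.isPEChain hψ) h1, h1⟩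

theorem IsGermChain.divides (h : IsGermChain ψ e 𝓕 b c r l) (hψ : IsOpenEmbedding ψ)
    (hn : NeBot 𝓕) (hb : b ∉ range ψ) {p : PrimeEnd (range ψ)} (hp : Lands 𝓕 p) (i : ℕ) :
    PrimeEndDivides p (ψ '' out (l i) c) := by
  rw [h.eq_mk hψ hn hb hp]
  exact primeEndDivides_mk_iff.2 ⟨i, Subset.rfl⟩

theorem IsGerm.exists_lands (hψ : IsOpenEmbedding ψ) (e : X ≃ₜ ℂ) (h𝓕 : IsGerm ψ 𝓕 b)
    (hU : (range ψ)ᶜ.Nontrivial) : ∃ p : PrimeEnd (range ψ), Lands 𝓕 p := by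
  obtain ⟨r, l, h⟩ := h𝓕.exists_chain hψ e hU 0
  exact ⟨_, h.lands_mk hψ h𝓕.notMem⟩

theorem IsGerm.lands_unique (hψ : IsOpenEmbedding ψ) (e : X ≃ₜ ℂ) (h𝓕 : IsGerm ψ 𝓕 b)
    (hU : (range ψ)ᶜ.Nontrivial) {p p' : PrimeEnd (range ψ)} (hp : Lands 𝓕 p) (hp' : Lands 𝓕 p') :
    p = p' := by
  obtain ⟨r, l, h⟩ := h𝓕.exists_chain hψ e hU 0
  rw [h.eq_mk hψ h𝓕.neBot h𝓕.notMem hp, h.eq_mk hψ h𝓕.neBot h𝓕.notMem hp']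

theorem IsGerm.eq_of_lands (hψ : IsOpenEmbedding ψ) (e : X ≃ₜ ℂ) (h𝓕 : IsGerm ψ 𝓕 b)
    (hU : (range ψ)ᶜ.Nontrivial) {𝓕' : Filter ℂ} {b' : X} (h𝓕' : IsGerm ψ 𝓕' b')
    {p : PrimeEnd (range ψ)} (hp : Lands 𝓕 p) (hp' : Lands 𝓕' p) : b = b' := by
  by_contra hne
  obtain ⟨r, l, h⟩ := h𝓕.exists_chain hψ e hU 0
  obtain ⟨V, hV, hbV⟩ : ∃ V ∈ 𝓝 b', b ∉ closure V := by
    obtain ⟨u, hu, huo, v, hv, hvo, huv⟩ := exists_open_nhds_disjoint_closure (Ne.symm hne)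
    exact ⟨u, huo.mem_nhds hu, fun h => huv.le_bot ⟨h, subset_closure hv⟩⟩
  obtain ⟨T, hT, hTV, hTc⟩ := h𝓕'.exists_isPreconnected _ (h𝓕'.tendsto hV)
  obtain ⟨N, hN⟩ := h.exists_subset_side hψ h𝓕.notMem hTc
    fun h => hbV (closure_mono (image_subset_iff.2 hTV) h)
  have h1 := hp' _ (h.isCrossSection hψ N) (h.divides hψ h𝓕.neBot h𝓕.notMem hp N)
  rw [preimage_image_eq _ hψ.injective] at h1
  obtain ⟨x, hx, hx'⟩ := h𝓕'.neBot.nonempty_of_mem (inter_mem hT h1)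
  exact (disjoint_out_side (l := l N) 0).ne_of_mem hx' (hN N le_rfl hx) rfl

end

end

section

variable {X : Type u} [TopologicalSpace X] [T3Space X] {ψ : ℂ → X}

/-- A chain of cross-sections written through the cross-cut lines bounding them. -/
structure IsLineChain (ψ : ℂ → X) (D : ℕ → Set X) (m : ℕ → ℝ → ℂ) (a b : ℕ → X) (p : ℕ → ℂ) :
    Prop where
  isCC : ∀ n, IsCC ψ (m n) (a n) (b n)
  notMem : ∀ n, p n ∉ range (m n)
  eq : ∀ n, D n = ψ '' side (m n) (p n)
  anti : ∀ i j, j ≤ i → side (m i) (p i) ⊆ side (m j) (p j)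
  disjoint : ∀ i j, i ≠ j → Disjoint (closure (ψ '' range (m i))) (closure (ψ '' range (m j)))

theorem IsPEChain.exists_isLineChain (hψ : IsOpenEmbedding ψ) {D : ℕ → Set X}
    (h : IsPEChain (range ψ) D) : ∃ m a b p, IsLineChain ψ D m a b p := by
  choose m a b p hm hp hD using fun n => (isCrossSection_iff hψ).1 (h.1 n)
  refine ⟨m, a, b, p, hm, hp, hD, fun i j hij => ?_, fun i j hij => ?_⟩
  · have := h.2.1 i j hij
    rwa [hD, hD, image_subset_image_iff hψ.injective] at this
  · have := h.2.2 i j hij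
    rwa [hD, hD, bdIn_side hψ (hm i).line (hp i), bdIn_side hψ (hm j).line (hp j),
      ← disjoint_iff_inter_eq_empty] at this

namespace IsLineChain

variable {D : ℕ → Set X} {m : ℕ → ℝ → ℂ} {a b : ℕ → X} {p : ℕ → ℂ}

theorem disjoint_range (h : IsLineChain ψ D m a b p) (hψ : IsOpenEmbedding ψ) {i j : ℕ}
    (hij : i ≠ j) : Disjoint (range (m i)) (range (m j)) :=
  (disjoint_image_iff hψ.injective).1
    ((h.disjoint i j hij).mono subset_closure subset_closure)

theorem union_subset (h : IsLineChain ψ D m a b p) (hψ : IsOpenEmbedding ψ) {i j : ℕ}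
    (hij : j < i) : side (m i) (p i) ∪ range (m i) ⊆ side (m j) (p j) :=
  side_union_subset (h.isCC j).line (h.isCC i).line (h.notMem j) (h.notMem i)
    (h.disjoint_range hψ hij.ne) (h.anti i j hij.le)

theorem ends (h : IsLineChain ψ D m a b p) (hψ : IsOpenEmbedding ψ) {i j : ℕ} (hij : i ≠ j) :
    a i ≠ a j ∧ a i ≠ b j := by
  have := h.disjoint i j hij
  rw [(h.isCC i).closure_range hψ, (h.isCC j).closure_range hψ] at this
  exact ⟨this.ne_of_mem (by simp) (by simp), this.ne_of_mem (by simp) (by simp)⟩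

end IsLineChain

theorem IsCC.congr_ends {l s : ℝ → ℂ} {a b : X} (h : IsCC ψ l a b) (hs : IsClosedEmbedding s)
    (h₁ : map s atTop = map l atTop) (h₀ : map s atBot = map l atBot)
    (hy : ∀ p, p ∉ range s → ∃ y, y ∉ range ψ ∧ y ≠ a ∧ y ≠ b ∧ y ∈ closure (ψ '' side s p)) :
    IsCC ψ s a b where
  line := hs
  tendsto_atBot := by
    have := h.tendsto_atBot
    rwa [← tendsto_map'_iff, ← h₀, tendsto_map'_iff] at this
  tendsto_atTop := by
    have := h.tendsto_atTop
    rwa [← tendsto_map'_iff, ← h₁, tendsto_map'_iff] at this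
  notMem_left := h.notMem_left
  notMem_right := h.notMem_right
  exists_mem := hy

theorem IsCC.left_mem_closure {l : ℝ → ℂ} {a b : X} (h : IsCC ψ l a b) :
    a ∈ closure (ψ '' range l) :=
  mem_closure_of_tendsto h.tendsto_atBot (Eventually.of_forall fun t => ⟨l t, ⟨t, rfl⟩, rfl⟩)

theorem IsPrimeChain.iInter_eq_empty (hψ : IsOpenEmbedding ψ) {D : ℕ → Set X}
    (hD : IsPrimeChain (range ψ) D) : ⋂ n, D n = ∅ := by
  by_contra hne
  obtain ⟨_, hw⟩ := nonempty_iff_ne_empty.2 hne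
  rw [mem_iInter] at hw
  obtain ⟨m, a, b, p, h⟩ := hD.1.exists_isLineChain hψ
  obtain ⟨w, -, rfl⟩ := (h.eq 0) ▸ hw 0
  have hws : ∀ n, w ∈ side (m n) (p n) := fun n => by
    have := hw n
    rwa [h.eq, hψ.injective.mem_set_image] at this
  have hside : ∀ n, side (m n) (p n) = side (m n) w := fun n => side_eq (hws n)
  have hwm : ∀ n, w ∉ range (m n) := fun n hr =>
    (disjoint_side_range (l := m n) (p n)).ne_of_mem (hws n) hr rfl
  obtain ⟨c, hc⟩ := out_nonempty (h.isCC 0).line (hwm 0)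
  have hc0 : c ∉ side (m 0) (p 0) := by
    rw [hside]; exact fun hs => (disjoint_out_side (l := m 0) w).ne_of_mem hc hs rfl
  have hcm : ∀ n, c ∉ range (m n) := fun n => by
    rcases n.eq_zero_or_pos with rfl | hn
    · exact notMem_range_of_mem_out hc
    · exact fun hr => hc0 (h.union_subset hψ hn (Or.inr hr))
  have hcs : ∀ n, out (m n) c = side (m n) w := fun n => by
    refine out_symm (h.isCC n).line (hwm n) (mem_out_of_notMem (hcm n) fun hs => hc0 ?_)
    rw [← hside] at hs
    exact h.anti n 0 n.zero_le hs
  -- the bypasses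
  let P : ℕ × (ℝ → ℂ) → Prop := fun x => IsClosedEmbedding x.2 ∧
    range x.2 ⊆ side (m x.1) w \ Metric.closedBall 0 (max ‖w‖ ‖c‖) ∧
    map x.2 atTop = map (m (x.1 + 1)) atTop ∧ map x.2 atBot = map (m (x.1 + 1)) atBot
  have hbyp : ∀ n R, max ‖w‖ ‖c‖ ≤ R → ∃ s : ℝ → ℂ, IsClosedEmbedding s ∧
      range s ⊆ side (m n) w \ Metric.closedBall 0 R ∧
      map s atTop = map (m (n + 1)) atTop ∧ map s atBot = map (m (n + 1)) atBot := fun n R hR =>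
    exists_bypass (h.isCC n).line (h.isCC (n + 1)).line (hwm n)
      (hside n ▸ subset_union_right.trans (h.union_subset hψ n.lt_succ_self))
      ((le_max_left _ _).trans hR)
  obtain ⟨s₀, hs₀⟩ := hbyp 0 _ le_rfl
  obtain ⟨u, hu0, huP, huR⟩ := exists_seq_of_forall (p := P)
    (R := fun x y => y.1 = x.1 + 1 ∧ Disjoint (range x.2) (range y.2)) (a := (0, s₀)) hs₀ (by
      rintro ⟨n, s⟩ ⟨hs, hsr, hs1, hs0⟩
      simp only at hs hsr hs1 hs0
      obtain ⟨R, hR⟩ := range_subset_closedBall_union hs (S := range (m (n + 1)))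
        (by rw [hs1]; exact range_mem_map) (by rw [hs0]; exact range_mem_map)
      obtain ⟨s', hs', hsr', hs1', hs0'⟩ := hbyp (n + 1) (max R (max ‖w‖ ‖c‖)) (le_max_right _ _)
      refine ⟨(n + 1, s'), ⟨hs', hsr'.trans (sdiff_subset_sdiff_right
        (Metric.closedBall_subset_closedBall (le_max_right _ _))), hs1', hs0'⟩, rfl, ?_⟩
      refine Set.disjoint_left.2 fun x hx hx' => ?_
      rcases hR hx with hxR | hxm
      · exact (hsr' hx').2 (Metric.closedBall_subset_closedBall (le_max_left _ _) hxR)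
      · exact (disjoint_side_range (l := m (n + 1)) w).ne_of_mem (hsr' hx').1 hxm rfl)
  have hu1 : ∀ n, (u n).1 = n := fun n => by
    induction n with
    | zero => rw [hu0]
    | succ n ih => rw [(huR n).1, ih]
  let s : ℕ → ℝ → ℂ := fun n => (u n).2
  have hsl : ∀ n, IsClosedEmbedding (s n) := fun n => (huP n).1
  have hsr : ∀ n, range (s n) ⊆ side (m n) w \ Metric.closedBall 0 (max ‖w‖ ‖c‖) := fun n => by
    have := (huP n).2.1; rwa [hu1] at this
  have hs1 : ∀ n, map (s n) atTop = map (m (n + 1)) atTop := fun n => by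
    have := (huP n).2.2.1; rwa [hu1] at this
  have hs0 : ∀ n, map (s n) atBot = map (m (n + 1)) atBot := fun n => by
    have := (huP n).2.2.2; rwa [hu1] at this
  have hsd : ∀ n, Disjoint (range (s n)) (range (s (n + 1))) := fun n => (huR n).2
  have hcsn : ∀ n, c ∉ range (s n) := fun n hr => by
    have := (hsr n hr).2
    simp at this
  have hwc : ∀ n, w ∈ side (s n) c := fun n => by
    refine subset_side (s := Metric.closedBall 0 (max ‖w‖ ‖c‖)) (convex_closedBall _ _).isPreconnected
      (Set.disjoint_left.2 fun x hx hx' => (hsr n hx').2 hx) (x := c) (by simp) (mem_side (hcsn n))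
      (by simp)
  have hmc : ∀ n, range (m n) ⊆ side (s n) c := fun n => by
    have h1 : IsPreconnected (side (m n) c ∪ range (m n)) :=
      isPreconnected_side_union (h.isCC n).line (hcm n)
    have h2 : Disjoint (side (m n) c ∪ range (m n)) (range (s n)) := by
      rw [Set.disjoint_right]
      intro x hx hx'
      have h3 := (hsr n hx).1
      rw [← hcs] at h3
      rcases hx' with hx' | hx'
      · exact (disjoint_out_side (l := m n) c).ne_of_mem h3 hx' rfl
      · exact (disjoint_out_range (l := m n) c).ne_of_mem h3 hx' rfl
    exact subset_union_right.trans
      (subset_side h1 h2 (Or.inl (mem_side (hcm n))) (mem_side (hcsn n)))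
  have hnest : ∀ n, range (s (n + 1)) ⊆ out (s n) c := fun n => by
    obtain ⟨R, hR⟩ := far_side_of_same_ends (h.isCC (n + 1)).line (hsl n) (hs1 n).symm (hs0 n).symm
    have far : ∀ k, ∀ᶠ t in atTop, R < ‖m k t‖ := fun k => by
      obtain ⟨T, hT, hTm⟩ := exists_Icc_of_line (h.isCC k).line R
      filter_upwards [eventually_ge_atTop T] with t ht using hTm t (ht.trans (le_abs_self t))
    obtain ⟨t, ht⟩ := (far n).exists
    have h1 : ∀ᶠ t in atTop, m (n + 2) t ∈ range (s (n + 1)) := by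
      have : range (s (n + 1)) ∈ map (m (n + 2)) atTop := by
        rw [← hs1 (n + 1)]; exact range_mem_map
      exact this
    obtain ⟨t', ht', hts⟩ := ((far (n + 2)).and h1).exists
    have hx : m n t ∈ out (m (n + 1)) w := by
      rw [out_symm (h.isCC (n + 1)).line (hcm (n + 1)) (hcs (n + 1) ▸ mem_side (hwm (n + 1)))]
      refine subset_side (s := side (m n) c ∪ range (m n))
        (isPreconnected_side_union (h.isCC n).line (hcm n)) ?_ (Or.inl (mem_side (hcm n)))
        (mem_side (hcm _)) (Or.inr ⟨t, rfl⟩)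
      have h4 : range (m (n + 1)) ⊆ out (m n) c := by
        rw [hcs, ← hside]
        exact subset_union_right.trans (h.union_subset hψ n.lt_succ_self)
      exact (disjoint_union_left.2 ⟨(disjoint_out_side c).symm, (disjoint_out_range c).symm⟩).mono_right h4
    have hy : m (n + 2) t' ∈ side (m (n + 1)) w := by
      rw [← hside]
      exact h.union_subset hψ (n + 1).lt_succ_self (Or.inr ⟨t', rfl⟩)
    have hns : m (n + 2) t' ∉ side (s n) (m n t) := fun h5 => by
      have h6 := hR _ _ ht ht' (notMem_range_of_mem_out hx)
        (fun hr => (disjoint_side_range (l := m (n + 1)) w).ne_of_mem hy hr rfl) h5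
      have h7 : side (m (n + 1)) w = side (m (n + 1)) (m n t) := by
        rw [side_eq hy, ← side_eq h6]
      exact (disjoint_out_side (l := m (n + 1)) w).ne_of_mem hx
        (h7 ▸ mem_side (notMem_range_of_mem_out hx)) rfl
    rw [← side_eq (hmc n ⟨t, rfl⟩)] at hns
    have hns' : m (n + 2) t' ∈ out (s n) c :=
      mem_out_of_notMem (fun hr => (hsd n).ne_of_mem hr hts rfl) hns
    exact subset_out (hsl n) (hcsn n) (isPreconnected_line (hsl (n + 1))) (hsd n).symm hts hns'
  have hnest' : ∀ n, out (s (n + 1)) c ∪ range (s (n + 1)) ⊆ out (s n) c := fun n =>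
    out_subset_out (hsl n) (hcsn n) (hcsn (n + 1)) (hnest n)
  have hanti : Antitone fun n => out (s n) c :=
    antitone_nat_of_succ_le fun n => subset_union_left.trans (hnest' n)
  have hcc : ∀ n, IsCC ψ (s n) (a (n + 1)) (b (n + 1)) := fun n => by
    refine (h.isCC (n + 1)).congr_ends (hsl n) (hs1 n) (hs0 n) fun q hq => ?_
    by_cases hqs : q ∈ side (s n) c
    · refine ⟨a n, (h.isCC n).notMem_left, (h.ends hψ (by omega)).1, (h.ends hψ (by omega)).2, ?_⟩
      rw [← side_eq hqs]
      exact closure_mono (image_mono (hmc n)) (h.isCC n).left_mem_closure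
    · refine ⟨a (n + 2), (h.isCC _).notMem_left, (h.ends hψ (by omega)).1,
        (h.ends hψ (by omega)).2, ?_⟩
      rw [← out_eq_side (hsl n) (hcsn n) (mem_out_of_notMem hq hqs)]
      refine closure_mono (image_mono (hnest n)) (mem_closure_of_tendsto (f := ψ ∘ s (n + 1)) (b := atBot) ?_
        (Eventually.of_forall fun t => ⟨_, ⟨t, rfl⟩, rfl⟩))
      rw [← tendsto_map'_iff, hs0, tendsto_map'_iff]
      exact (h.isCC (n + 2)).tendsto_atBot
  have hos : ∀ n, ∃ q, q ∉ range (s n) ∧ out (s n) c = side (s n) q := fun n => by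
    obtain ⟨q, hq⟩ := out_nonempty (hsl n) (hcsn n)
    exact ⟨q, notMem_range_of_mem_out hq, out_eq_side (hsl n) (hcsn n) hq⟩
  have hbd : ∀ n, bdIn (range ψ) (ψ '' out (s n) c) = ψ '' range (s n) := fun n => by
    obtain ⟨q, hq, hqe⟩ := hos n
    rw [hqe, bdIn_side hψ (hsl n) hq]
  have hlt : ∀ i j, i < j → closure (ψ '' range (s i)) ∩ closure (ψ '' range (s j)) = ∅ := by
    intro i j hij
    have h1 := h.disjoint (i + 1) (j + 1) (by omega)
    rw [(h.isCC _).closure_range hψ, (h.isCC _).closure_range hψ] at h1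
    have h2 : Disjoint (range (s i)) (range (s j)) := by
      obtain ⟨k, rfl⟩ : ∃ k, j = k + 1 := ⟨j - 1, by omega⟩
      exact ((disjoint_out_range (l := s i) c).mono_left
        ((hnest k).trans (hanti (by omega : i ≤ k)))).symm
    have h3 := (disjoint_image_iff hψ.injective).2 h2
    rw [(hcc i).closure_range hψ, (hcc j).closure_range hψ, ← disjoint_iff_inter_eq_empty]
    have h4 : ∀ {l : ℝ → ℂ} {x}, x ∉ range ψ → x ∉ ψ '' range l := fun hx h =>
      hx (image_subset_range _ _ h)
    rw [Set.disjoint_left] at h1 h3 ⊢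
    rintro y (rfl | rfl | hy) hy'
    · rcases hy' with hy' | hy' | hy'
      · exact h1 (mem_insert_iff.2 (Or.inl rfl)) (hy' ▸ by simp)
      · exact h1 (mem_insert_iff.2 (Or.inl rfl)) (hy' ▸ by simp)
      · exact h4 (hcc i).notMem_left hy'
    · rcases hy' with hy' | hy' | hy'
      · exact h1 (mem_insert_of_mem _ (mem_insert _ _)) (hy' ▸ by simp)
      · exact h1 (mem_insert_of_mem _ (mem_insert _ _)) (hy' ▸ by simp)
      · exact h4 (hcc i).notMem_right hy'
    · rcases hy' with rfl | rfl | hy'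
      · exact h4 (hcc j).notMem_left hy
      · exact h4 (hcc j).notMem_right hy
      · exact h3 hy hy'
  have hS : IsPEChain (range ψ) fun n => ψ '' out (s n) c := by
    refine ⟨fun n => ?_, fun i j hij => image_mono (hanti hij), fun i j hij => ?_⟩
    · obtain ⟨q, hq, hqe⟩ := hos n
      exact (isCrossSection_iff hψ).2 ⟨_, _, _, q, hcc n, hq, congrArg (ψ '' ·) hqe⟩
    · simp only [hbd]
      rcases hij.lt_or_gt with h | h
      · exact hlt _ _ h
      · rw [inter_comm]; exact hlt _ _ h
  obtain ⟨k, hk⟩ := hD.2 _ hS (fun n => ⟨n, by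
    rw [h.eq, hside, ← hcs]
    refine image_mono (subset_union_left.trans (out_subset_out (h.isCC n).line (hcm n) (hcsn n) ?_))
    rw [hcs]
    exact (hsr n).trans sdiff_subset⟩) 0
  have := hk (hw k)
  rw [hψ.injective.mem_set_image] at this
  exact (disjoint_out_side (l := s 0) c).ne_of_mem this (hwc 0) rfl

theorem peSection_mono {U E E' : Set X} (h : E ⊆ E') : peSection U E ⊆ peSection U E' := by
  rintro _ (⟨x, rfl, hx⟩ | ⟨p, rfl, hp⟩)
  · exact Or.inl ⟨x, rfl, h hx⟩
  · exact Or.inr ⟨p, rfl, hp.mono h⟩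

theorem peEnd_mem_peSection {U E : Set X} {p : PrimeEnd U} :
    peEnd U p ∈ peSection U E ↔ PrimeEndDivides p E := by
  constructor
  · rintro (⟨x, hx, -⟩ | ⟨p', hp', h⟩)
    · cases hx
    · cases hp'; exact h
  · exact fun h => Or.inr ⟨p, rfl, h⟩

theorem pePt_mem_peSection {U E : Set X} {x : ↥U} : pePt U x ∈ peSection U E ↔ (x : X) ∈ E := by
  constructor
  · rintro (⟨y, hy, h⟩ | ⟨p', hp', h⟩)
    · cases hy; exact h
    · cases hp'
  · exact fun h => Or.inl ⟨x, rfl, h⟩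

theorem isOpen_peSection {U E : Set X} (hE : IsCrossSection U E) : IsOpen (peSection U E) :=
  TopologicalSpace.isOpen_generateFrom_of_mem (Or.inr ⟨E, hE, rfl⟩)

theorem exists_peSection_subset {U : Set X} (C : PrimeChain U) {O : Set (PrimeEndComp U)}
    (hO : IsOpen O) (h : peEnd U (Quot.mk _ C) ∈ O) : ∃ n, peSection U (C.1 n) ⊆ O := by
  induction hO with
  | basic s hs =>
    rcases hs with ⟨V, -, -, rfl⟩ | ⟨E, -, rfl⟩
    · obtain ⟨x, hx, -⟩ := h; cases hx
    · obtain ⟨n, hn⟩ := primeEndDivides_mk_iff.1 (peEnd_mem_peSection.1 h)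
      exact ⟨n, peSection_mono hn⟩
  | univ => exact ⟨0, subset_univ _⟩
  | inter s t _ _ ihs iht =>
    obtain ⟨n, hn⟩ := ihs h.1
    obtain ⟨k, hk⟩ := iht h.2
    exact ⟨max n k, subset_inter
      ((peSection_mono (C.2.1.2.1 _ _ (le_max_left n k))).trans hn)
      ((peSection_mono (C.2.1.2.1 _ _ (le_max_right n k))).trans hk)⟩
  | sUnion S _ ih =>
    obtain ⟨s, hs, hps⟩ := h
    obtain ⟨n, hn⟩ := ih s hs hps
    exact ⟨n, hn.trans (subset_sUnion_of_mem hs)⟩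

theorem IsCrossSection.subset {U E : Set X} (h : IsCrossSection U E) : E ⊆ U := by
  obtain ⟨γ, -, x, -, rfl⟩ := h
  exact (connectedComponentIn_subset _ _).trans sdiff_subset

theorem IsPEExtension.divides_preimage {f : X ≃ₜ X} {U : Set X} (hf : ∀ x ∈ U, f x ∈ U)
    {F : PrimeEndComp U ≃ₜ PrimeEndComp U} (hF : IsPEExtension f U F) {p p' : PrimeEnd U}
    (hp : F (peEnd U p) = peEnd U p') {E : Set X} (hE : IsCrossSection U E)
    (h : PrimeEndDivides p' E) : PrimeEndDivides p (f ⁻¹' E) := by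
  induction p using Quot.ind with | mk C => ?_
  obtain ⟨n, hn⟩ := exists_peSection_subset C ((isOpen_peSection hE).preimage F.continuous)
    (show F (peEnd U (Quot.mk _ C)) ∈ _ by rw [hp]; exact peEnd_mem_peSection.2 h)
  refine primeEndDivides_mk_iff.2 ⟨n, fun x hx => ?_⟩
  have hxU := (C.2.1.1 n).subset hx
  have h1 := hn (pePt_mem_peSection (x := ⟨x, hxU⟩).2 hx)
  rw [mem_preimage, hF x hxU (hf x hxU)] at h1
  exact pePt_mem_peSection.1 h1

theorem IsPEExtension.symm {f : X ≃ₜ X} {U : Set X}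
    {F : PrimeEndComp U ≃ₜ PrimeEndComp U} (hF : IsPEExtension f U F) :
    IsPEExtension f.symm U F.symm := by
  intro x hx hfx
  rw [F.symm_apply_eq, hF _ hfx (by simpa using hx)]
  simp

end

section

variable {X : Type u} [TopologicalSpace X] [T3Space X] {ψ : ℂ → X}

theorem range_comp_neg (l : ℝ → ℂ) : range (fun t => l (-t)) = range l :=
  (neg_surjective (G := ℝ)).range_comp l

theorem side_congr {l m : ℝ → ℂ} (h : range l = range m) (p : ℂ) : side l p = side m p := by
  rw [side, side, h]

theorem out_congr {l m : ℝ → ℂ} (h : range l = range m) (p : ℂ) : out l p = out m p := by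
  rw [out, out, h, side_congr h]

theorem map_comp_neg_atTop (l : ℝ → ℂ) : map (fun t => l (-t)) atTop = map l atBot := by
  rw [← map_neg_atTop, map_map]; rfl

theorem IsCC.comp_neg {l : ℝ → ℂ} {a b : X} (h : IsCC ψ l a b) :
    IsCC ψ (fun t => l (-t)) b a where
  line := isClosedEmbedding_comp_neg h.line
  tendsto_atBot := by
    simpa [Function.comp_def] using h.tendsto_atTop.comp tendsto_neg_atBot_atTop
  tendsto_atTop := by
    simpa [Function.comp_def] using h.tendsto_atBot.comp tendsto_neg_atTop_atBot
  notMem_left := h.notMem_right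
  notMem_right := h.notMem_left
  exists_mem p hp := by
    rw [range_comp_neg] at hp
    obtain ⟨y, h1, h2, h3, h4⟩ := h.exists_mem p hp
    exact ⟨y, h1, h3, h2, by rwa [side_congr (range_comp_neg l)]⟩

/-- Every side of a cross-cut is divided by some prime end. -/
theorem IsCC.exists_divides (hψ : IsOpenEmbedding ψ) (e : X ≃ₜ ℂ) (hU : (range ψ)ᶜ.Nontrivial)
    {κ : ℝ → ℂ} {a b : X} (h : IsCC ψ κ a b) {p : ℂ} (hp : p ∉ range κ) :
    ∃ P : PrimeEnd (range ψ), PrimeEndDivides P (ψ '' side κ p) := by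
  obtain ⟨y, hyU, hya, hyb, hy⟩ := h.exists_mem p hp
  have hyκ : y ∉ closure (ψ '' range κ) := by
    rw [h.closure_range hψ]
    rintro (rfl | rfl | hm)
    · exact hya rfl
    · exact hyb rfl
    · exact hyU (image_subset_range _ _ hm)
  obtain ⟨ρ, hρ, hd⟩ := exists_pos_of_notMem_closure e hyκ
  have hO : IsOpen {x | ‖e x - e y‖ < ρ} :=
    isOpen_lt (by fun_prop) continuous_const
  obtain ⟨_, hwρ, w, hw, rfl⟩ := mem_closure_iff.1 hy _ hO (by simpa using hρ)
  set α : ℝ → X := fun s => e.symm (AffineMap.lineMap (e (ψ w)) (e y) s) with hα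
  have hαc : Continuous α := e.symm.continuous.comp AffineMap.lineMap_continuous
  have hαρ : ∀ s ∈ Icc (0 : ℝ) 1, ‖e (α s) - e y‖ < ρ := by
    intro s hs
    have : e (α s) - e y = (1 - s : ℝ) • (e (ψ w) - e y) := by
      simp [hα, AffineMap.lineMap_apply]; ring
    rw [this, norm_smul, Real.norm_of_nonneg (by linarith [hs.2])]
    exact (mul_le_of_le_one_left (norm_nonneg _) (by linarith [hs.1])).trans_lt hwρ
  obtain ⟨s, hs, hsU, hlt⟩ := exists_first_hit (a := 0) (b := 1) hαc.continuousOn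
    hψ.isOpen_range.isClosed_compl (right_mem_Icc.2 zero_le_one) (by simpa [hα] using hyU)
  have hs0 : 0 < s := by
    refine hs.1.lt_of_ne ?_
    rintro rfl
    exact hsU (by simp [hα])
  set β : ℝ → ℂ := fun t => Function.invFun ψ (α t) with hβ
  have hψβ : ∀ t ∈ Ico 0 s, ψ (β t) = α t := fun t ht => by
    obtain ⟨z, hz⟩ := not_not.1 (hlt t ht)
    exact Function.invFun_eq ⟨z, hz⟩
  have hβc : ContinuousOn β (Ico 0 s) := by
    rw [hψ.isInducing.continuousOn_iff]
    exact hαc.continuousOn.congr hψβ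
  have hβκ : ∀ t ∈ Ico 0 s, β t ∉ range κ := fun t ht hm =>
    (hαρ t ⟨ht.1, (ht.2.trans_le hs.2).le⟩).not_ge
      (hψβ t ht ▸ hd _ (mem_image_of_mem ψ hm))
  have hβs : β '' Ico 0 s ⊆ side κ p := by
    refine subset_side (isPreconnected_Ico.image β hβc) ?_ (x := w) ⟨0, ⟨le_rfl, hs0⟩, ?_⟩ hw
    · rw [disjoint_left]
      rintro _ ⟨t, ht, rfl⟩
      exact hβκ t ht
    · exact hψ.injective (by rw [hψβ 0 ⟨le_rfl, hs0⟩]; simp [hα])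
  have hgerm : IsGerm ψ (map β (𝓝[<] s)) (α s) := by
    refine ⟨inferInstance, ?_, hsU, fun S hS => ?_⟩
    · refine tendsto_map'_iff.2 ((hαc.continuousAt.tendsto.mono_left
        nhdsWithin_le_nhds).congr' ?_)
      filter_upwards [Ioo_mem_nhdsLT hs0] with t ht
      exact (hψβ t ⟨ht.1.le, ht.2⟩).symm
    · obtain ⟨r, hr, hrS⟩ := (mem_nhdsLT_iff_exists_Ioo_subset' hs0).1 (mem_map.1 hS)
      refine ⟨β '' Ioo (max r 0) s, image_mem_map (Ioo_mem_nhdsLT (max_lt hr hs0)), ?_,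
        isPreconnected_Ioo.image β (hβc.mono fun t ht => ⟨(le_max_right _ _).trans ht.1.le, ht.2⟩)⟩
      exact image_subset_iff.2 fun t ht => hrS ⟨(le_max_left _ _).trans_lt ht.1, ht.2⟩
  obtain ⟨r, l, hl⟩ := hgerm.exists_chain hψ e hU p
  have hmem : side κ p ∈ map β (𝓝[<] s) := by
    filter_upwards [image_mem_map (m := β) (Ioo_mem_nhdsLT hs0)] with z hz
    exact hβs (image_mono Ioo_subset_Ico_self hz)
  have hsκ : α s ∉ closure (ψ '' range κ) := fun hm => by
    obtain ⟨z, hz, hzm⟩ := mem_closure_iff.1 hm _ hO (hαρ s hs)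
    exact (hd z hzm).not_gt hz
  obtain ⟨N, hN⟩ := hl.exists_out_subset hψ hsU h.line hsκ fun i =>
    Filter.nonempty_of_mem (inter_mem (hl.mem i) hmem)
  exact ⟨Quot.mk _ ⟨_, hl.isPrimeChain hψ hsU⟩,
    primeEndDivides_mk_iff.2 ⟨N, image_mono (hN N le_rfl)⟩⟩

theorem PrimeEndDivides.inter_nonempty {U : Set X} {p : PrimeEnd U} {E E' : Set X}
    (h : PrimeEndDivides p E) (h' : PrimeEndDivides p E') : (E ∩ E').Nonempty := by
  induction p using Quot.ind with | mk C
  obtain ⟨n, hn⟩ := primeEndDivides_mk_iff.1 h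
  obtain ⟨m, hm⟩ := primeEndDivides_mk_iff.1 h'
  obtain ⟨x, hx⟩ := (C.2.1.1 (max n m)).nonempty
  exact ⟨x, hn (C.2.1.2.1 _ _ (le_max_left _ _) hx), hm (C.2.1.2.1 _ _ (le_max_right _ _) hx)⟩

theorem Lands.not_divides {𝓕 : Filter ℂ} (hn : NeBot 𝓕) {p : PrimeEnd (range ψ)} (hp : Lands 𝓕 p)
    (hψ : IsOpenEmbedding ψ) {S : Set ℂ} (hS : IsCrossSection (range ψ) (ψ '' S)) (hS' : Sᶜ ∈ 𝓕) :
    ¬ PrimeEndDivides p (ψ '' S) := fun h => by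
  have := hp _ hS h
  rw [preimage_image_eq _ hψ.injective] at this
  obtain ⟨z, h1, h2⟩ := Filter.nonempty_of_mem (inter_mem this hS')
  exact h2 h1

theorem lands_of_forall_mem (hψ : IsOpenEmbedding ψ) {κ : ℝ → ℂ} {a b : X} (h : IsCC ψ κ a b)
    {C : PrimeChain (range ψ)} (hκ : ∀ n, ∃ t, 0 ≤ t ∧ ψ (κ t) ∈ C.1 n) :
    Lands (map κ atTop) (Quot.mk _ C : PrimeEnd (range ψ)) := by
  intro E hE hCE
  obtain ⟨n, hn⟩ := primeEndDivides_mk_iff.1 hCE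
  obtain ⟨m, a', b', q, hm⟩ := C.2.1.exists_isLineChain hψ
  have hempty : ⋂ n, side (m n) (q n) = ∅ := by
    have := C.2.iInter_eq_empty hψ
    rw [eq_empty_iff_forall_notMem] at this ⊢
    intro z hz
    refine this (ψ z) (mem_iInter.2 fun i => ?_)
    rw [hm.eq]
    exact mem_image_of_mem ψ (mem_iInter.1 hz i)
  have hcl : ∀ i, closure (side (m (i + 1)) (q (i + 1))) ⊆ side (m i) (q i) := fun i => by
    rw [closure_side (hm.isCC _).line (hm.notMem _)]
    exact hm.union_subset hψ (Nat.lt_succ_self i)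
  obtain ⟨k, hkn, hk⟩ : ∃ k ≥ n, b ∉ closure (ψ '' range (m k)) := by
    by_cases hb : b ∈ closure (ψ '' range (m n))
    · exact ⟨n + 1, n.le_succ, disjoint_left.1 (hm.disjoint _ _ n.lt_succ_self.ne) hb⟩
    · exact ⟨n, le_rfl, hb⟩
  have hev : ∀ᶠ t in atTop, κ t ∉ range (m k) := by
    filter_upwards [h.tendsto_atTop (isClosed_closure.isOpen_compl.mem_nhds hk)] with t ht hmem
    exact ht (subset_closure (mem_image_of_mem ψ hmem))
  obtain ⟨T, hT⟩ := eventually_atTop.1 hev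
  obtain ⟨N, hN⟩ : ∃ N, κ '' Icc 0 T ∩ closure (side (m N) (q N)) = ∅ := by
    refine (isCompact_Icc.image h.line.continuous).elim_directed_family_closed
      (fun i => closure (side (m i) (q i))) (fun _ => isClosed_closure) ?_ ?_
    · rw [eq_empty_iff_forall_notMem]
      rintro z ⟨-, hz⟩
      refine (eq_empty_iff_forall_notMem.1 hempty) z (mem_iInter.2 fun i => hcl i ?_)
      exact mem_iInter.1 hz (i + 1)
    · exact Antitone.directed_ge fun i j hij => closure_mono (hm.anti j i hij)
  obtain ⟨t, ht0, ht⟩ := hκ (max k N)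
  rw [hm.eq, hψ.injective.mem_set_image] at ht
  have htT : T < t := by
    by_contra! hle
    exact (eq_empty_iff_forall_notMem.1 hN) (κ t)
      ⟨⟨t, ⟨ht0, hle⟩, rfl⟩, subset_closure (hm.anti _ _ (le_max_right _ _) ht)⟩
  have hsub : κ '' Ici T ⊆ side (m k) (q k) := by
    refine subset_side (isPreconnected_Ici.image κ h.line.continuous.continuousOn) ?_
      (x := κ t) ⟨t, htT.le, rfl⟩ (hm.anti _ _ (le_max_left _ _) ht)
    rw [disjoint_left]
    rintro _ ⟨s, hs, rfl⟩
    exact hT s hs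
  refine mem_map.2 (mem_of_superset (Ici_mem_atTop T) fun s hs => hn ?_)
  rw [hm.eq]
  exact mem_image_of_mem ψ (hm.anti _ _ hkn (hsub ⟨s, hs, rfl⟩))

theorem IsCC.trichotomy (hψ : IsOpenEmbedding ψ) (e : X ≃ₜ ℂ) (hU : (range ψ)ᶜ.Nontrivial)
    {κ : ℝ → ℂ} {a b : X} (h : IsCC ψ κ a b) {c : ℂ} (hc : c ∉ range κ)
    {p₀ p₁ : PrimeEnd (range ψ)} (h₀ : Lands (map κ atBot) p₀) (h₁ : Lands (map κ atTop) p₁)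
    (p : PrimeEnd (range ψ)) :
    PrimeEndDivides p (ψ '' side κ c) ∨ PrimeEndDivides p (ψ '' out κ c) ∨ p = p₀ ∨ p = p₁ := by
  induction p using Quot.ind with | mk C
  by_cases H₁ : ∀ n, ∃ t, 0 ≤ t ∧ ψ (κ t) ∈ C.1 n
  · exact Or.inr (Or.inr (Or.inr
      (h.isGerm_atTop.lands_unique hψ e hU (lands_of_forall_mem hψ h H₁) h₁)))
  by_cases H₀ : ∀ n, ∃ t, 0 ≤ t ∧ ψ (κ (-t)) ∈ C.1 n
  · refine Or.inr (Or.inr (Or.inl ?_))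
    have := lands_of_forall_mem hψ h.comp_neg H₀
    rw [map_comp_neg_atTop] at this
    exact h.isGerm_atBot.lands_unique hψ e hU this h₀
  push Not at H₀ H₁
  obtain ⟨n₀, hn₀⟩ := H₀
  obtain ⟨n₁, hn₁⟩ := H₁
  obtain ⟨m, a', b', q, hm⟩ := C.2.1.exists_isLineChain hψ
  set n := max n₀ n₁
  have hd : Disjoint (side (m n) (q n)) (range κ) := by
    rw [disjoint_right]
    rintro _ ⟨t, rfl⟩ ht
    have hmem : ψ (κ t) ∈ C.1 n := by rw [hm.eq]; exact mem_image_of_mem ψ ht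
    rcases le_total 0 t with h0 | h0
    · exact hn₁ t h0 (C.2.1.2.1 _ _ (le_max_right _ _) hmem)
    · exact hn₀ (-t) (by linarith) (by rw [neg_neg]; exact C.2.1.2.1 _ _ (le_max_left _ _) hmem)
  rcases subset_side_or_out h.line hc (isPreconnected_side _ _) hd with hs | hs
  · exact Or.inl (primeEndDivides_mk_iff.2 ⟨n, by rw [hm.eq]; exact image_mono hs⟩)
  · exact Or.inr (Or.inl (primeEndDivides_mk_iff.2 ⟨n, by rw [hm.eq]; exact image_mono hs⟩))

end

section

variable {X : Type u} [TopologicalSpace X] [T3Space X] {ψ : ℂ → X}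

/-- `π` parametrizes the prime ends of `range ψ` by the universal cover of the circle. -/
structure IsPECircle (π : ℝ → PrimeEnd (range ψ)) : Prop where
  surjective : Function.Surjective π
  eq_iff : ∀ x y, π x = π y ↔ ∃ n : ℤ, y = x + n
  isOpen : ∀ E, IsCrossSection (range ψ) E → IsOpen {t | PrimeEndDivides (π t) E}

theorem exists_add_int_mem_Ico (s t : ℝ) : ∃ n : ℤ, t + n ∈ Ico s (s + 1) := by
  refine ⟨-⌊t - s⌋, ?_, ?_⟩ <;> push_cast
  · linarith [Int.floor_le (t - s)]
  · linarith [Int.lt_floor_add_one (t - s)]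

theorem IsPECircle.add_int {π : ℝ → PrimeEnd (range ψ)} (hπ : IsPECircle π) (t : ℝ) (n : ℤ) :
    π (t + n) = π t := ((hπ.eq_iff _ _).2 ⟨n, rfl⟩).symm

theorem IsCC.isCrossSection (hψ : IsOpenEmbedding ψ) {κ : ℝ → ℂ} {a b : X} (h : IsCC ψ κ a b)
    {c : ℂ} (hc : c ∉ range κ) : IsCrossSection (range ψ) (ψ '' side κ c) :=
  (isCrossSection_iff hψ).2 ⟨κ, a, b, c, h, hc, rfl⟩

theorem IsCC.exists_out_eq {κ : ℝ → ℂ} {a b : X} (h : IsCC ψ κ a b)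
    {c : ℂ} (hc : c ∉ range κ) : ∃ p, p ∉ range κ ∧ out κ c = side κ p := by
  obtain ⟨p, hp⟩ := out_nonempty h.line hc
  exact ⟨p, notMem_range_of_mem_out hp, out_eq_side h.line hc hp⟩

theorem IsCC.isCrossSection_out (hψ : IsOpenEmbedding ψ) {κ : ℝ → ℂ} {a b : X} (h : IsCC ψ κ a b)
    {c : ℂ} (hc : c ∉ range κ) : IsCrossSection (range ψ) (ψ '' out κ c) := by
  obtain ⟨p, hp, hpe⟩ := h.exists_out_eq hc
  exact hpe ▸ h.isCrossSection hψ hp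

theorem IsCC.not_divides_of_lands (hψ : IsOpenEmbedding ψ) {κ : ℝ → ℂ} {a b : X}
    (h : IsCC ψ κ a b) {c : ℂ} (hc : c ∉ range κ) {p : PrimeEnd (range ψ)}
    (hp : Lands (map κ atBot) p ∨ Lands (map κ atTop) p) : ¬ PrimeEndDivides p (ψ '' side κ c) := by
  have hmem : ∀ l : Filter ℝ, (side κ c)ᶜ ∈ map κ l := fun l =>
    mem_map.2 (univ_mem' fun t ht => side_subset_compl κ c ht ⟨t, rfl⟩)
  rcases hp with hp | hp
  · exact hp.not_divides inferInstance hψ (h.isCrossSection hψ hc) (hmem _)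
  · exact hp.not_divides inferInstance hψ (h.isCrossSection hψ hc) (hmem _)

theorem IsCC.not_divides_out_of_lands (hψ : IsOpenEmbedding ψ) {κ : ℝ → ℂ} {a b : X}
    (h : IsCC ψ κ a b) {c : ℂ} (hc : c ∉ range κ) {p : PrimeEnd (range ψ)}
    (hp : Lands (map κ atBot) p ∨ Lands (map κ atTop) p) : ¬ PrimeEndDivides p (ψ '' out κ c) := by
  obtain ⟨p, hp, hpe⟩ := h.exists_out_eq hc
  rw [hpe]
  exact h.not_divides_of_lands hψ hp ‹_›

/-- A cross-cut cuts the circle of prime ends into two arcs. -/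
theorem IsPECircle.exists_arcs {π : ℝ → PrimeEnd (range ψ)} (hπ : IsPECircle π)
    (hψ : IsOpenEmbedding ψ) (e : X ≃ₜ ℂ) (hU : (range ψ)ᶜ.Nontrivial)
    {κ : ℝ → ℂ} {a b : X} (h : IsCC ψ κ a b) {c : ℂ} (hc : c ∉ range κ)
    {p₀ p₁ : PrimeEnd (range ψ)} (h₀ : Lands (map κ atBot) p₀) (h₁ : Lands (map κ atTop) p₁) :
    ∃ u v, u < v ∧ v < u + 1 ∧ (π u = p₀ ∧ π v = p₁ ∨ π u = p₁ ∧ π v = p₀) ∧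
      (∀ t ∈ Ioo u v, PrimeEndDivides (π t) (ψ '' side κ c)) ∧
      ∀ t ∈ Ioo v (u + 1), PrimeEndDivides (π t) (ψ '' out κ c) := by
  set O₁ := {t | PrimeEndDivides (π t) (ψ '' side κ c)} with hO₁
  set O₂ := {t | PrimeEndDivides (π t) (ψ '' out κ c)} with hO₂
  have ho₁ : IsOpen O₁ := hπ.isOpen _ (h.isCrossSection hψ hc)
  have ho₂ : IsOpen O₂ := hπ.isOpen _ (h.isCrossSection_out hψ hc)
  have hdis : Disjoint O₁ O₂ := by
    rw [disjoint_left]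
    rintro t ht ht'
    obtain ⟨_, ⟨x, hx, rfl⟩, hx'⟩ := PrimeEndDivides.inter_nonempty ht ht'
    exact disjoint_left.1 (disjoint_out_side (l := κ) c) (hψ.injective.mem_set_image.1 hx') hx
  have per : ∀ (t : ℝ) (n : ℤ), (t + n ∈ O₁ ↔ t ∈ O₁) ∧ (t + n ∈ O₂ ↔ t ∈ O₂) := fun t n => by
    simp only [hO₁, hO₂, mem_ofPred_eq, hπ.add_int, and_self]
  have n₀ : ∀ t, π t = p₀ → t ∉ O₁ ∧ t ∉ O₂ := fun t ht => by
    subst ht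
    exact ⟨h.not_divides_of_lands hψ hc (Or.inl h₀), h.not_divides_out_of_lands hψ hc (Or.inl h₀)⟩
  have n₁ : ∀ t, π t = p₁ → t ∉ O₁ ∧ t ∉ O₂ := fun t ht => by
    subst ht
    exact ⟨h.not_divides_of_lands hψ hc (Or.inr h₁), h.not_divides_out_of_lands hψ hc (Or.inr h₁)⟩
  have ne₁ : O₁.Nonempty := by
    obtain ⟨P, hP⟩ := h.exists_divides hψ e hU hc
    obtain ⟨t, rfl⟩ := hπ.surjective P
    exact ⟨t, hP⟩
  have ne₂ : O₂.Nonempty := by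
    obtain ⟨p, hp, hpe⟩ := h.exists_out_eq hc
    obtain ⟨P, hP⟩ := h.exists_divides hψ e hU hp
    obtain ⟨t, rfl⟩ := hπ.surjective P
    exact ⟨t, by rwa [← hpe] at hP⟩
  have cover : ∀ t, π t ≠ p₀ → π t ≠ p₁ → t ∈ O₁ ∪ O₂ := fun t ht ht' => by
    rcases h.trichotomy hψ e hU hc h₀ h₁ (π t) with H | H | H | H
    · exact Or.inl H
    · exact Or.inr H
    · exact absurd H ht
    · exact absurd H ht'
  have conn : ∀ u v, (∀ t ∈ Ioo u v, π t ≠ p₀ ∧ π t ≠ p₁) → Ioo u v ⊆ O₁ ∨ Ioo u v ⊆ O₂ :=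
    fun u v H => isPreconnected_Ioo.subset_or_subset ho₁ ho₂ hdis
      fun t ht => cover t (H t ht).1 (H t ht).2
  obtain ⟨s₀, hs₀⟩ := hπ.surjective p₀
  obtain ⟨s₁, hs₁⟩ := hπ.surjective p₁
  obtain ⟨n, hn⟩ := exists_add_int_mem_Ico s₀ s₁
  set v := s₁ + n with hv
  have hπv : π v = p₁ := by rw [hv, hπ.add_int, hs₁]
  have shift : ∀ t, π t = p₀ → ∃ k : ℤ, t = s₀ + k := fun t ht =>
    (hπ.eq_iff _ _).1 (hs₀.trans ht.symm)
  have shift' : ∀ t, π t = p₁ → ∃ k : ℤ, t = v + k := fun t ht =>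
    (hπ.eq_iff _ _).1 (hπv.trans ht.symm)
  have no_int : ∀ k : ℤ, ¬ (0 < (k : ℝ) ∧ (k : ℝ) < 1) := fun k ⟨h1, h2⟩ => by
    norm_cast at h1 h2; omega
  have free : ∀ t ∈ Ioo s₀ (s₀ + 1), π t ≠ p₀ := fun t ht hp => by
    obtain ⟨k, rfl⟩ := shift t hp
    exact no_int k ⟨by linarith [ht.1], by linarith [ht.2]⟩
  have free' : ∀ t ∈ Ico s₀ (s₀ + 1), t ≠ v → π t ≠ p₁ := fun t ht htv hp => by
    obtain ⟨k, rfl⟩ := shift' t hp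
    have hk : k ≠ 0 := by rintro rfl; simp at htv
    have h1 : (-1 : ℝ) < k := by linarith [hn.2, ht.1]
    have h2 : (k : ℝ) < 1 := by linarith [hn.1, ht.2]
    norm_cast at h1 h2
    omega
  have left : Ioo s₀ v ⊆ O₁ ∨ Ioo s₀ v ⊆ O₂ := conn _ _ fun t ht =>
    ⟨free t ⟨ht.1, ht.2.trans hn.2⟩, free' t ⟨ht.1.le, ht.2.trans hn.2⟩ ht.2.ne⟩
  have right : Ioo v (s₀ + 1) ⊆ O₁ ∨ Ioo v (s₀ + 1) ⊆ O₂ := conn _ _ fun t ht =>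
    ⟨free t ⟨hn.1.trans_lt ht.1, ht.2⟩, free' t ⟨hn.1.trans ht.1.le, ht.2⟩ ht.1.ne'⟩
  have red : ∀ t, t ∈ O₁ ∪ O₂ → ∃ t' ∈ Ioo s₀ v ∪ Ioo v (s₀ + 1), (t' ∈ O₁ ↔ t ∈ O₁) ∧
      (t' ∈ O₂ ↔ t ∈ O₂) := fun t ht => by
    obtain ⟨k, hk⟩ := exists_add_int_mem_Ico s₀ t
    have hk' : t + k ∈ O₁ ∪ O₂ := ht.imp (per t k).1.2 (per t k).2.2
    refine ⟨t + k, ?_, per t k⟩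
    rcases lt_trichotomy (t + k) v with hlt | heq | hgt
    · refine Or.inl ⟨hk.1.lt_of_ne ?_, hlt⟩
      intro heq
      rw [← heq] at hk'
      exact hk'.elim (n₀ _ hs₀).1 (n₀ _ hs₀).2
    · rw [heq] at hk'
      exact (hk'.elim (n₁ _ hπv).1 (n₁ _ hπv).2).elim
    · exact Or.inr ⟨hgt, hk.2⟩
  have all₁ : ¬ (Ioo s₀ v ⊆ O₁ ∧ Ioo v (s₀ + 1) ⊆ O₁) := fun ⟨hl, hr⟩ => by
    obtain ⟨t, ht⟩ := ne₂
    obtain ⟨t', ht', -, h2⟩ := red t (Or.inr ht)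
    exact disjoint_left.1 hdis (ht'.elim (@hl _) (@hr _)) (h2.2 ht)
  have all₂ : ¬ (Ioo s₀ v ⊆ O₂ ∧ Ioo v (s₀ + 1) ⊆ O₂) := fun ⟨hl, hr⟩ => by
    obtain ⟨t, ht⟩ := ne₁
    obtain ⟨t', ht', h1, -⟩ := red t (Or.inl ht)
    exact disjoint_left.1 hdis (h1.2 ht) (ht'.elim (@hl _) (@hr _))
  have hlt : s₀ < v := by
    refine hn.1.lt_of_ne fun heq => ?_
    have hl : ∀ O : Set ℝ, Ioo s₀ v ⊆ O := fun O => by simp [heq]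
    rcases right with hr | hr
    · exact all₁ ⟨hl _, hr⟩
    · exact all₂ ⟨hl _, hr⟩
  rcases left with hl | hl <;> rcases right with hr | hr
  · exact (all₁ ⟨hl, hr⟩).elim
  · exact ⟨s₀, v, hlt, hn.2, Or.inl ⟨hs₀, hπv⟩, hl, hr⟩
  · refine ⟨v, s₀ + 1, hn.2, by linarith, Or.inr ⟨hπv, ?_⟩, hr, fun t ht => ?_⟩
    · rw [← hs₀]; exact_mod_cast hπ.add_int s₀ 1
    · have : t - 1 ∈ O₂ := hl ⟨by linarith [ht.1], by linarith [ht.2]⟩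
      simpa [hO₂] using (per (t - 1) 1).2.2 this
  · exact (all₂ ⟨hl, hr⟩).elim

/-! ### Dynamics -/

theorem side_image (h : ℂ ≃ₜ ℂ) (l : ℝ → ℂ) (p : ℂ) : side (h ∘ l) (h p) = h '' side l p := by
  by_cases hp : p ∈ range l
  · rw [side, side, connectedComponentIn_eq_empty (by simpa using hp),
      connectedComponentIn_eq_empty (by simpa using hp), image_empty]
  · rw [side, side, Homeomorph.image_connectedComponentIn h hp, range_comp, image_compl_eq h.bijective]

theorem out_image (h : ℂ ≃ₜ ℂ) (l : ℝ → ℂ) (p : ℂ) : out (h ∘ l) (h p) = h '' out l p := by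
  rw [out, out, side_image, range_comp, ← image_union, image_compl_eq h.bijective]

theorem notMem_range_comp (h : ℂ ≃ₜ ℂ) {l : ℝ → ℂ} {p : ℂ} :
    h p ∉ range (h ∘ l) ↔ p ∉ range l := by
  rw [range_comp, h.injective.mem_set_image]

/-- `h` is a model of `f` on `range ψ`. -/
def IsModel (ψ : ℂ → X) (f : X ≃ₜ X) (h : ℂ ≃ₜ ℂ) : Prop := ∀ z, ψ (h z) = f (ψ z)

namespace IsModel

variable {f f' : X ≃ₜ X} {h h' : ℂ ≃ₜ ℂ}

theorem image (H : IsModel ψ f h) (S : Set ℂ) : f '' (ψ '' S) = ψ '' (h '' S) := by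
  simp only [image_image, H _]

theorem mem_range_iff (H : IsModel ψ f h) {x : X} : f x ∈ range ψ ↔ x ∈ range ψ := by
  constructor
  · rintro ⟨z, hz⟩
    refine ⟨h.symm z, f.injective ?_⟩
    rw [← H, h.apply_symm_apply, hz]
  · rintro ⟨z, rfl⟩
    exact ⟨h z, H z⟩

theorem isCC (H : IsModel ψ f h) {l : ℝ → ℂ} {a b : X} (hl : IsCC ψ l a b) :
    IsCC ψ (h ∘ l) (f a) (f b) where
  line := h.isClosedEmbedding.comp hl.line
  tendsto_atBot := by
    have := (f.continuous.tendsto a).comp hl.tendsto_atBot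
    simpa only [Function.comp_def, H _] using this
  tendsto_atTop := by
    have := (f.continuous.tendsto b).comp hl.tendsto_atTop
    simpa only [Function.comp_def, H _] using this
  notMem_left := mt H.mem_range_iff.1 hl.notMem_left
  notMem_right := mt H.mem_range_iff.1 hl.notMem_right
  exists_mem p hp := by
    obtain ⟨p, rfl⟩ := h.surjective p
    obtain ⟨y, h1, h2, h3, h4⟩ := hl.exists_mem p ((notMem_range_comp h).1 hp)
    refine ⟨f y, mt H.mem_range_iff.1 h1, f.injective.ne h2, f.injective.ne h3, ?_⟩
    rw [side_image, ← H.image, ← f.image_closure]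
    exact mem_image_of_mem f h4

theorem isCrossSection (hψ : IsOpenEmbedding ψ) (H : IsModel ψ f h) {E : Set X}
    (hE : IsCrossSection (range ψ) E) : IsCrossSection (range ψ) (f '' E) := by
  obtain ⟨l, a, b, p, hl, hp, rfl⟩ := (isCrossSection_iff hψ).1 hE
  rw [H.image, ← side_image]
  exact (H.isCC hl).isCrossSection hψ ((notMem_range_comp h).2 hp)

protected theorem one : IsModel ψ 1 1 := fun _ => rfl

protected theorem mul (H : IsModel ψ f h) (H' : IsModel ψ f' h') :
    IsModel ψ (f * f') (h * h') := fun z => by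
  change ψ (h (h' z)) = f (f' (ψ z))
  rw [H, H']

protected theorem inv (H : IsModel ψ f h) : IsModel ψ f⁻¹ h⁻¹ := fun z => by
  apply f.injective
  rw [← H]
  change ψ (h (h.symm z)) = f (f.symm (ψ z))
  simp

end IsModel

/-- `h` is a model of `f` on `range ψ`, whose action on prime ends lifts to `G`. -/
structure IsLift (f : X ≃ₜ X) (h : ℂ ≃ₜ ℂ) (π : ℝ → PrimeEnd (range ψ)) (G : CircleDeg1Liftˣ) :
    Prop where
  conj : IsModel ψ f h
  divides : ∀ t E, IsCrossSection (range ψ) E →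
    (PrimeEndDivides (π t) E ↔ PrimeEndDivides (π ((G : CircleDeg1Lift) t)) (f '' E))

namespace IsLift

variable {f f' : X ≃ₜ X} {h h' : ℂ ≃ₜ ℂ} {π : ℝ → PrimeEnd (range ψ)} {G G' : CircleDeg1Liftˣ}

protected theorem one : IsLift (1 : X ≃ₜ X) (1 : ℂ ≃ₜ ℂ) π 1 where
  conj := IsModel.one
  divides t E _ := by
    have : (⇑(1 : X ≃ₜ X)) '' E = E := image_id E
    rw [this]; rfl

protected theorem mul (hψ : IsOpenEmbedding ψ) (H : IsLift f h π G) (H' : IsLift f' h' π G') :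
    IsLift (f * f') (h * h') π (G * G') where
  conj := H.conj.mul H'.conj
  divides t E hE := by
    rw [H'.divides t E hE, H.divides _ _ (H'.conj.isCrossSection hψ hE)]
    have : (⇑(f * f')) '' E = f '' (f' '' E) := (image_image f f' E).symm
    rw [this]; rfl

protected theorem pow (hψ : IsOpenEmbedding ψ) (H : IsLift f h π G) (n : ℕ) :
    IsLift (f ^ n) (h ^ n) π (G ^ n) := by
  induction n with
  | zero => simpa only [pow_zero] using IsLift.one
  | succ n ih => simpa only [pow_succ] using ih.mul hψ H

theorem image_inv_image (f : X ≃ₜ X) (E : Set X) : f '' ((f⁻¹ : X ≃ₜ X) '' E) = E :=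
  f.toEquiv.image_symm_image E

protected theorem inv (hψ : IsOpenEmbedding ψ) (H : IsLift f h π G) : IsLift f⁻¹ h⁻¹ π G⁻¹ where
  conj := H.conj.inv
  divides t E hE := by
    have := H.divides (((G⁻¹ : CircleDeg1Liftˣ) : CircleDeg1Lift) t)
      _ (H.conj.inv.isCrossSection hψ hE)
    rw [image_inv_image, CircleDeg1Lift.units_apply_inv_apply] at this
    exact this.symm

theorem lands (hψ : IsOpenEmbedding ψ) (H : IsLift f h π G) {𝓕 : Filter ℂ} {t : ℝ}
    (hp : Lands 𝓕 (π t)) : Lands (map h 𝓕) (π ((G : CircleDeg1Lift) t)) := by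
  intro E hE hd
  have hE' := H.conj.inv.isCrossSection hψ hE
  have := hp _ hE' ((H.divides _ _ hE').2 (by rwa [image_inv_image]))
  refine mem_map.2 (mem_of_superset this ?_)
  rintro z ⟨y, hy, hyz⟩
  change ψ (h z) ∈ E
  rw [H.conj, ← hyz]
  change f (f.symm y) ∈ E
  simpa using hy

end IsLift

end

section

namespace CircleDeg1Lift

theorem translationNumber_le_of_commute {f g : CircleDeg1Lift} (h : Commute f g) {x : ℝ}
    (hx : f x ≤ g x) : translationNumber f ≤ translationNumber g := by
  refine le_of_tendsto_of_tendsto' (tendsto_translationNumber f x) (tendsto_translationNumber g x)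
    fun n => ?_
  have := (commute_iff_commute.1 h).iterate_le_of_map_le f.monotone g.monotone hx n
  rw [coe_pow, coe_pow]
  gcongr

theorem commute_translate_int (f : CircleDeg1Lift) (k : ℤ) :
    Commute (translate (Multiplicative.ofAdd (k : ℝ)) : CircleDeg1Lift) f := by
  rw [commute_iff_commute]
  intro x
  simp

theorem translationNumber_add_int_le {f g : CircleDeg1Lift} (h : Commute f g) {x : ℝ} {k : ℤ}
    (hx : f x + k ≤ g x) : translationNumber f + k ≤ translationNumber g := by
  have hc := commute_translate_int f k
  have : translationNumber (translate (Multiplicative.ofAdd (k : ℝ)) * f) =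
      translationNumber f + k := by
    rw [translationNumber_mul_of_commute hc, translationNumber_translate, add_comm]
  rw [← this]
  refine translationNumber_le_of_commute (x := x) ((commute_translate_int g k).mul_left h) ?_
  simpa [add_comm] using hx

end CircleDeg1Lift

open CircleDeg1Lift

/-- The arithmetic relation between a translation number and the return time `q`. -/
structure IsGoodTime (τ : ℝ) (q : ℕ) (l m : ℤ) : Prop where
  int_lt : (l : ℝ) < τ
  lt_int : τ < l + 1
  dist_lt : |q * τ - m| < τ - l
  dist_lt' : |q * τ - m| < l + 1 - τ
  rat : ∀ (n : ℕ) (j : ℤ), 0 < n → τ = j / n → q * τ = m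

theorem IsGoodTime.fixed {G : CircleDeg1Lift} {q : ℕ} {l m : ℤ}
    (h : IsGoodTime (translationNumber G) q l m) {n : ℕ} (hn : 0 < n) {z : ℝ} {j : ℤ}
    (hz : (G ^ n) z = z + j) : (G ^ q) z = z + m := by
  have hτ := translationNumber_of_map_pow_eq_add_int G hz hn
  have hqm := h.rat n j hn hτ
  have hn' : (n : ℝ) ≠ 0 := by positivity
  have hqj : (q : ℝ) * j = n * m := by
    rw [← hqm, hτ]; field_simp
  have h1 : (⇑(G ^ n))^[q] z = z + q * j := iterate_eq_of_map_eq_add_int _ hz q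
  refine ((G ^ q).iterate_pos_eq_iff hn).1 ?_
  rw [← hqj, ← h1, ← coe_pow, ← coe_pow, ← pow_mul, ← pow_mul, mul_comm]

theorem IsGoodTime.linked {G : CircleDeg1Lift} {q : ℕ} {l m : ℤ}
    (h : IsGoodTime (translationNumber G) q l m) (hG : StrictMono G) {x : ℝ}
    (hx : (G ^ q) x ≠ x + m) :
    (x < (G ^ q) x - m ∧ (G ^ q) x - m < G x - l ∧
        G x - l < G ((G ^ q) x) - m - l ∧ G ((G ^ q) x) - m - l < x + 1) ∨
      (G x - l - 1 < (G ^ q) x - m ∧ (G ^ q) x - m < x ∧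
        x < G ((G ^ q) x) - m - l ∧ G ((G ^ q) x) - m - l < G x - l) := by
  have hq : translationNumber (G ^ q) = q * translationNumber G := translationNumber_pow G q
  have hq1 : translationNumber (G * G ^ q) = (q + 1) * translationNumber G := by
    rw [← pow_succ', translationNumber_pow]; push_cast; ring
  have c1 : Commute G (G ^ q) := (Commute.refl G).pow_right q
  have c2 : Commute 1 (G * G ^ q) := Commute.one_left _
  have c2' : Commute (G * G ^ q) 1 := Commute.one_right _
  have ha := abs_lt.1 h.dist_lt
  have hb := abs_lt.1 h.dist_lt'
  have e1 : (1 : CircleDeg1Lift) x = x := rfl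
  have e2 : (G * G ^ q) x = G ((G ^ q) x) := rfl
  rcases lt_or_gt_of_ne hx with hlt | hgt
  · right
    refine ⟨?_, by linarith, ?_, ?_⟩
    · by_contra! hle
      have := translationNumber_add_int_le c1.symm (x := x) (k := l + 1 - m)
        (by push_cast; linarith)
      push_cast at this
      linarith
    · by_contra! hle
      have := translationNumber_add_int_le c2' (x := x) (k := - m - l)
        (by push_cast; rw [e1, e2]; linarith)
      rw [translationNumber_one, hq1] at this
      push_cast at this
      linarith
    · have := hG hlt
      rw [map_add_int] at this
      linarith
  · left
    refine ⟨by linarith, ?_, ?_, ?_⟩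
    · by_contra! hle
      have := translationNumber_add_int_le c1 (x := x) (k := m - l) (by push_cast; linarith)
      push_cast at this
      linarith
    · have := hG hgt
      rw [map_add_int] at this
      linarith
    · by_contra! hle
      have := translationNumber_add_int_le c2 (x := x) (k := m + l + 1)
        (by push_cast; rw [e1, e2]; linarith)
      rw [translationNumber_one, hq1] at this
      push_cast at this
      linarith

variable {X : Type u} [TopologicalSpace X] [T3Space X] {ψ : ℂ → X}

/-- A cross-cut from an accessible prime end to its image separates the `q`-th iterates of these
two prime ends. -/
theorem IsPECircle.separates {π : ℝ → PrimeEnd (range ψ)} (hπ : IsPECircle π)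
    (hψ : IsOpenEmbedding ψ) (e : X ≃ₜ ℂ) (hU : (range ψ)ᶜ.Nontrivial) {G : CircleDeg1Lift}
    (hG : StrictMono G) {q : ℕ} {l m : ℤ} (h : IsGoodTime (translationNumber G) q l m) {x : ℝ}
    (hx : π ((G ^ q) x) ≠ π x) {κ : ℝ → ℂ} {a b : X} (hκ : IsCC ψ κ a b) {c : ℂ}
    (hc : c ∉ range κ) (h₀ : Lands (map κ atBot) (π x)) (h₁ : Lands (map κ atTop) (π (G x))) :
    (PrimeEndDivides (π ((G ^ q) x)) (ψ '' side κ c) ∧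
        PrimeEndDivides (π ((G ^ (q + 1)) x)) (ψ '' out κ c)) ∨
      (PrimeEndDivides (π ((G ^ q) x)) (ψ '' out κ c) ∧
        PrimeEndDivides (π ((G ^ (q + 1)) x)) (ψ '' side κ c)) := by
  have hxm : (G ^ q) x ≠ x + m := fun H => hx (by rw [H, hπ.add_int])
  have hlink := h.linked hG hxm
  have hs : (G ^ (q + 1)) x = G ((G ^ q) x) := by rw [pow_succ']; rfl
  rw [hs]
  set y := (G ^ q) x
  have hy : ∀ k : ℤ, π (y - m + k) = π y := fun k => by
    rw [show y - m + k = y + ((k - m : ℤ) : ℝ) by push_cast; ring, hπ.add_int]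
  have hGy : ∀ k : ℤ, π (G y - m - l + k) = π (G y) := fun k => by
    rw [show G y - m - l + k = G y + ((k - m - l : ℤ) : ℝ) by push_cast; ring, hπ.add_int]
  obtain ⟨u, v, huv, hvu, hends, hside, hout⟩ := hπ.exists_arcs hψ e hU hκ hc h₀ h₁
  have hG1 : x < G x - l ∧ G x - l < x + 1 :=
    ⟨by linarith [lt_map_of_int_lt_translationNumber G h.int_lt x],
      by
        have := map_lt_of_translationNumber_lt_int G (n := l + 1) (by exact_mod_cast h.lt_int) x
        push_cast at this
        linarith⟩
  rcases hends with ⟨hu, hv⟩ | ⟨hu, hv⟩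
  · obtain ⟨n, rfl⟩ := (hπ.eq_iff _ _).1 hu.symm
    obtain ⟨k, rfl⟩ := (hπ.eq_iff _ _).1 hv.symm
    have hk : k = n - l := by
      have h1 : ((n - l - 1 : ℤ) : ℝ) < k := by push_cast; linarith
      have h2 : (k : ℝ) < ((n - l + 1 : ℤ) : ℝ) := by push_cast; linarith
      norm_cast at h1 h2; omega
    subst hk
    push_cast at *
    rcases hlink with ⟨i1, i2, i3, i4⟩ | ⟨i1, i2, i3, i4⟩
    · left
      rw [← hy n, ← hGy n]
      exact ⟨hside _ ⟨by linarith, by linarith⟩, hout _ ⟨by linarith, by linarith⟩⟩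
    · right
      rw [← hy (n + 1), ← hGy n]
      push_cast
      exact ⟨hout _ ⟨by linarith, by linarith⟩, hside _ ⟨by linarith, by linarith⟩⟩
  · obtain ⟨n, rfl⟩ := (hπ.eq_iff _ _).1 hu.symm
    obtain ⟨k, rfl⟩ := (hπ.eq_iff _ _).1 hv.symm
    have hk : k = n + l + 1 := by
      have h1 : ((n + l : ℤ) : ℝ) < k := by push_cast; linarith
      have h2 : (k : ℝ) < ((n + l + 2 : ℤ) : ℝ) := by push_cast; linarith
      norm_cast at h1 h2; omega
    subst hk
    push_cast at *
    rcases hlink with ⟨i1, i2, i3, i4⟩ | ⟨i1, i2, i3, i4⟩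
    · right
      rw [← hy (n + l + 1), ← hGy (n + l)]
      push_cast
      exact ⟨hout _ ⟨by linarith, by linarith⟩, hside _ ⟨by linarith, by linarith⟩⟩
    · left
      rw [← hy (n + l + 1), ← hGy (n + l + 1)]
      push_cast
      exact ⟨hside _ ⟨by linarith, by linarith⟩, hout _ ⟨by linarith, by linarith⟩⟩

end

section

section ZPow

variable {Y : Type u} [TopologicalSpace Y]

theorem image_zpow_add (h : Y ≃ₜ Y) (i j : ℤ) (A : Set Y) :
    (h ^ (i + j) : Y ≃ₜ Y) '' A = (h ^ i : Y ≃ₜ Y) '' ((h ^ j : Y ≃ₜ Y) '' A) := by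
  rw [zpow_add, image_image]
  rfl

theorem image_zpow_zero (h : Y ≃ₜ Y) (A : Set Y) : (h ^ (0 : ℤ) : Y ≃ₜ Y) '' A = A := by
  rw [zpow_zero]
  exact image_id A

theorem image_zpow_subset (h : Y ≃ₜ Y) {i : ℤ} (j : ℤ) {A C : Set Y}
    (H : (h ^ i : Y ≃ₜ Y) '' A ⊆ C) : (h ^ (j + i) : Y ≃ₜ Y) '' A ⊆ (h ^ j : Y ≃ₜ Y) '' C := by
  rw [image_zpow_add]
  exact image_mono H

theorem image_zpow_subset_iff (h : Y ≃ₜ Y) {i j : ℤ} {A C : Set Y} :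
    (h ^ i : Y ≃ₜ Y) '' A ⊆ (h ^ j : Y ≃ₜ Y) '' C ↔ (h ^ (i - j) : Y ≃ₜ Y) '' A ⊆ C := by
  constructor
  · intro H
    have := image_zpow_subset h (-j) H
    rwa [← image_zpow_add, neg_add_cancel, image_zpow_zero, neg_add_eq_sub] at this
  · intro H
    have := image_zpow_subset h j H
    rwa [add_sub_cancel] at this

theorem disjoint_image_zpow_iff (h : Y ≃ₜ Y) {i j : ℤ} {A C : Set Y} :
    Disjoint ((h ^ i : Y ≃ₜ Y) '' A) ((h ^ j : Y ≃ₜ Y) '' C) ↔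
      Disjoint ((h ^ (i - j) : Y ≃ₜ Y) '' A) C := by
  have : (h ^ i : Y ≃ₜ Y) '' A = (h ^ j : Y ≃ₜ Y) '' ((h ^ (i - j) : Y ≃ₜ Y) '' A) := by
    rw [← image_zpow_add, add_sub_cancel]
  rw [this, disjoint_image_iff (Homeomorph.injective _)]

theorem wandering_of_pos (h : Y ≃ₜ Y) {A : Set Y}
    (H : ∀ n : ℤ, 0 < n → Disjoint ((h ^ n : Y ≃ₜ Y) '' A) A) (n : ℤ) (hn : n ≠ 0) :
    Disjoint ((h ^ n : Y ≃ₜ Y) '' A) A := by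
  rcases lt_or_gt_of_ne hn with h0 | h0
  · have := H (-n) (by omega)
    have h2 := (disjoint_image_zpow_iff h (i := 0) (j := n) (A := A) (C := A)).2
      (by rwa [zero_sub])
    rw [image_zpow_zero] at h2
    exact h2.symm
  · exact H n h0

/-- A family of sets in the plane behaving like the sections cut off by disjoint cross-cuts. -/
structure IsSectionSystem (h : Y ≃ₜ Y) (L : ℤ) (M : Set Y) (𝒮 : Set (Set Y)) : Prop where
  one_le : 1 ≤ L
  nonempty : ∀ A ∈ 𝒮, A.Nonempty
  finite : ∀ w, {A | A ∈ 𝒮 ∧ w ∈ A}.Finite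
  nested : ∀ A ∈ 𝒮, ∀ A' ∈ 𝒮, ∀ k : ℤ, |k| ≤ L →
    (h ^ k : Y ≃ₜ Y) '' A ⊆ A' ∨ A' ⊆ (h ^ k : Y ≃ₜ Y) '' A ∨ Disjoint ((h ^ k : Y ≃ₜ Y) '' A) A'
  ne : ∀ A ∈ 𝒮, ∀ A' ∈ 𝒮, ∀ k : ℤ, k ≠ 0 → |k| ≤ L → (h ^ k : Y ≃ₜ Y) '' A ≠ A'
  not_subset : ∀ A ∈ 𝒮, ∀ n : ℤ, n ≠ 0 → ¬ (h ^ n : Y ≃ₜ Y) '' A ⊆ A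
  disj : ∀ A ∈ 𝒮, ∀ k : ℤ, |k| ≤ L → Disjoint ((h ^ k : Y ≃ₜ Y) '' A) M
  wander : ∀ A ∈ 𝒮, (∀ k : ℤ, k ≠ 0 → Disjoint ((h ^ k : Y ≃ₜ Y) '' A) A) →
    (∃ k : ℤ, 0 < k ∧ ¬ Disjoint ((h ^ k : Y ≃ₜ Y) '' A) M) ∧
      ∃ k : ℤ, k < 0 ∧ ¬ Disjoint ((h ^ k : Y ≃ₜ Y) '' A) M

namespace IsSectionSystem

variable {h : Y ≃ₜ Y} {L : ℤ} {M : Set Y} {𝒮 : Set (Set Y)}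

theorem inv (H : IsSectionSystem h L M 𝒮) : IsSectionSystem h⁻¹ L M 𝒮 where
  one_le := H.one_le
  nonempty := H.nonempty
  finite := H.finite
  nested A hA A' hA' k hk := by
    rw [inv_zpow']
    exact H.nested A hA A' hA' (-k) (by rwa [abs_neg])
  ne A hA A' hA' k h0 hk := by
    rw [inv_zpow']
    exact H.ne A hA A' hA' (-k) (by omega) (by rwa [abs_neg])
  not_subset A hA n hn := by
    rw [inv_zpow']
    exact H.not_subset A hA (-n) (by omega)
  disj A hA k hk := by
    rw [inv_zpow']
    exact H.disj A hA (-k) (by rwa [abs_neg])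
  wander A hA hw := by
    obtain ⟨⟨k, hk, h1⟩, l, hl, h2⟩ := H.wander A hA fun k hk => by
      have := hw (-k) (by omega)
      rwa [inv_zpow', neg_neg] at this
    refine ⟨⟨-l, by omega, ?_⟩, -k, by omega, ?_⟩
    · rwa [inv_zpow', neg_neg]
    · rwa [inv_zpow', neg_neg]

theorem exists_maximal (H : IsSectionSystem h L M 𝒮) {𝒟 : Set (Set Y)} (h𝒟 : 𝒟 ⊆ 𝒮) {A : Set Y}
    (hA : A ∈ 𝒟) (n : ℕ) : ∃ A' ∈ 𝒟, ∃ j : ℤ, 0 ≤ j ∧ j ≤ n ∧ A ⊆ (h ^ j : Y ≃ₜ Y) '' A' ∧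
      ∀ A'' ∈ 𝒟, ∀ i : ℤ, 0 ≤ i → i ≤ n → (h ^ j : Y ≃ₜ Y) '' A' ⊆ (h ^ i : Y ≃ₜ Y) '' A'' →
        (h ^ i : Y ≃ₜ Y) '' A'' ⊆ (h ^ j : Y ≃ₜ Y) '' A' := by
  obtain ⟨w, hw⟩ := H.nonempty A (h𝒟 hA)
  set T : Set (Set Y) := {C | w ∈ C ∧ ∃ A' ∈ 𝒟, ∃ j : ℤ, (0 ≤ j ∧ j ≤ n) ∧
    C = (h ^ j : Y ≃ₜ Y) '' A'} with hT
  have hfin : T.Finite := by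
    have h1 : (⋃ j ∈ Icc (0 : ℤ) n, (fun A' => (h ^ j : Y ≃ₜ Y) '' A') ''
        {A' | A' ∈ 𝒮 ∧ (h ^ (-j) : Y ≃ₜ Y) w ∈ A'}).Finite :=
      (finite_Icc (0 : ℤ) n).biUnion fun j _ => (H.finite _).image _
    refine h1.subset ?_
    rintro C ⟨hwC, A', hA', j, hj, rfl⟩
    refine mem_biUnion (show j ∈ Icc (0 : ℤ) n from hj) ⟨A', ⟨h𝒟 hA', ?_⟩, rfl⟩
    obtain ⟨a, ha, rfl⟩ := hwC
    have : (h ^ (-j) : Y ≃ₜ Y) ((h ^ j : Y ≃ₜ Y) a) = (h ^ (-j + j) : Y ≃ₜ Y) a := by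
      rw [zpow_add]
      rfl
    rw [this, neg_add_cancel, zpow_zero]
    exact ha
  have hAT : A ∈ T := ⟨hw, A, hA, 0, ⟨le_rfl, by omega⟩, (image_zpow_zero h A).symm⟩
  obtain ⟨C, hAC, hC⟩ := hfin.exists_le_maximal hAT
  obtain ⟨hwC, A', hA', j, hj, rfl⟩ := hC.prop
  refine ⟨A', hA', j, hj.1, hj.2, hAC, fun A'' hA'' i hi hin hsub => ?_⟩
  exact hC.le_of_ge ⟨hsub hwC, A'', hA'', i, ⟨hi, hin⟩, rfl⟩ hsub

theorem not_forward (H : IsSectionSystem h L M 𝒮) {𝒟 : Set (Set Y)} (h𝒟 : 𝒟 ⊆ 𝒮)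
    (hne : 𝒟.Nonempty) : ∃ A ∈ 𝒟, ∀ A' ∈ 𝒟, ∀ k : ℤ, 1 ≤ k → k ≤ L →
      ¬ (h ^ k : Y ≃ₜ Y) '' A ⊆ A' := by
  by_contra! hcon
  obtain ⟨A₀, hA₀⟩ := hne
  obtain ⟨n, hn⟩ := Int.eq_ofNat_of_zero_le (show 0 ≤ L by have := H.one_le; omega)
  obtain ⟨A, hA, j, hj0, hjn, -, hmax⟩ := H.exists_maximal h𝒟 hA₀ n
  have step : ∀ A ∈ 𝒟, ∀ i : ℤ, 0 ≤ i → i ≤ L → ∃ A' ∈ 𝒟, ∃ i' : ℤ, 0 ≤ i' ∧ i' ≤ L ∧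
      (h ^ (1 + i) : Y ≃ₜ Y) '' A ⊆ (h ^ i' : Y ≃ₜ Y) '' A' := by
    intro A hA i hi hiL
    rcases eq_or_lt_of_le hiL with rfl | hlt
    · obtain ⟨A', hA', k, hk, hkL, hs⟩ := hcon A hA
      refine ⟨A', hA', 1 + i - k, by omega, by omega, ?_⟩
      have := image_zpow_subset h (1 + i - k) hs
      rwa [sub_add_cancel] at this
    · exact ⟨A, hA, 1 + i, by omega, by omega, Subset.rfl⟩
  have orbit : ∀ m : ℕ, ∃ A' ∈ 𝒟, ∃ i : ℤ, 0 ≤ i ∧ i ≤ L ∧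
      (h ^ (m + j) : Y ≃ₜ Y) '' A ⊆ (h ^ i : Y ≃ₜ Y) '' A' := by
    intro m
    induction m with
    | zero => exact ⟨A, hA, j, hj0, by omega, by simp⟩
    | succ m ih =>
      obtain ⟨A', hA', i, hi, hiL, hs⟩ := ih
      obtain ⟨A'', hA'', i', hi', hiL', hs'⟩ := step A' hA' i hi hiL
      refine ⟨A'', hA'', i', hi', hiL', Subset.trans ?_ hs'⟩
      have := image_zpow_subset h 1 hs
      rw [← image_zpow_add] at this
      convert this using 3
      push_cast
      ring_nf
  have hw : ∀ n : ℤ, 0 < n → Disjoint ((h ^ n : Y ≃ₜ Y) '' A) A := by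
    intro k hk
    obtain ⟨m, rfl⟩ := Int.eq_ofNat_of_zero_le hk.le
    by_contra hd
    obtain ⟨A', hA', i, hi, hiL, hs⟩ := orbit m
    have hsub : (h ^ (m + j) : Y ≃ₜ Y) '' A ⊆ (h ^ j : Y ≃ₜ Y) '' A := by
      have hnd : ¬ Disjoint ((h ^ i : Y ≃ₜ Y) '' A') ((h ^ j : Y ≃ₜ Y) '' A) := fun h' => by
        have h2 := h'.mono_left hs
        rw [disjoint_image_zpow_iff, add_sub_cancel_right] at h2
        exact hd h2
      rw [disjoint_image_zpow_iff] at hnd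
      refine hs.trans ?_
      rcases H.nested A' (h𝒟 hA') A (h𝒟 hA) (i - j) (by rw [abs_le]; omega) with h1 | h1 | h1
      · exact image_zpow_subset_iff h |>.2 h1
      · refine hmax A' hA' i hi (by omega) ?_
        have := image_zpow_subset h (i := 0) (A := A) (C := (h ^ (i - j) : Y ≃ₜ Y) '' A') j
          (by rw [image_zpow_zero]; exact h1)
        rw [← image_zpow_add, add_zero, add_sub_cancel] at this
        exact this
      · exact absurd h1 hnd
    rw [image_zpow_subset_iff, add_sub_cancel_right] at hsub
    exact H.not_subset A (h𝒟 hA) m (by omega) hsub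
  obtain ⟨⟨k, hk, hkM⟩, -⟩ := H.wander A (h𝒟 hA) (wandering_of_pos h hw)
  apply hkM
  by_cases hkj : j ≤ k
  · obtain ⟨m, hm⟩ := Int.eq_ofNat_of_zero_le (show 0 ≤ k - j by omega)
    obtain ⟨A', hA', i, hi, hiL, hs⟩ := orbit m
    rw [← hm, sub_add_cancel] at hs
    exact (H.disj A' (h𝒟 hA') i (by rw [abs_le]; omega)).mono_left hs
  · exact H.disj A (h𝒟 hA) k (by rw [abs_le]; omega)

theorem exists_isolated (H : IsSectionSystem h L M 𝒮) (hne : 𝒮.Nonempty) :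
    ∃ A ∈ 𝒮, ∀ A' ∈ 𝒮, ∀ k : ℤ, k ≠ 0 → |k| ≤ L → ¬ (h ^ k : Y ≃ₜ Y) '' A ⊆ A' := by
  set 𝒟 : Set (Set Y) := {A | A ∈ 𝒮 ∧ ∀ A' ∈ 𝒮, A ⊆ A' → A' ⊆ A} with h𝒟
  have hmax : ∀ A ∈ 𝒮, ∃ A' ∈ 𝒟, A ⊆ A' := by
    intro A hA
    obtain ⟨A', hA', j, hj, hj0, hAA, hm⟩ := H.exists_maximal Subset.rfl hA 0
    obtain rfl : j = 0 := by push_cast at hj0; omega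
    rw [image_zpow_zero] at hAA hm
    refine ⟨A', ⟨hA', fun A'' hA'' hs => ?_⟩, hAA⟩
    have := hm A'' hA'' 0 le_rfl (by simp)
    rw [image_zpow_zero] at this
    exact this hs
  set 𝒟f : Set (Set Y) := {A | A ∈ 𝒟 ∧ ∀ A' ∈ 𝒮, ∀ k : ℤ, 1 ≤ k → k ≤ L →
      ¬ (h ^ k : Y ≃ₜ Y) '' A ⊆ A'} with h𝒟f
  have hfne : 𝒟f.Nonempty := by
    obtain ⟨A₀, hA₀⟩ := hne
    obtain ⟨A₁, hA₁, -⟩ := hmax A₀ hA₀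
    obtain ⟨A, hA, hAf⟩ := H.not_forward (𝒟 := 𝒟) (fun _ h => h.1) ⟨A₁, hA₁⟩
    refine ⟨A, hA, fun A' hA' k hk hkL hs => ?_⟩
    obtain ⟨A'', hA'', hs'⟩ := hmax A' hA'
    exact hAf A'' hA'' k hk hkL (hs.trans hs')
  by_contra! hcon
  have hback : ∀ A ∈ 𝒟f, ∃ A' ∈ 𝒟f, ∃ k : ℤ, 1 ≤ k ∧ k ≤ L ∧ (h⁻¹ ^ k : Y ≃ₜ Y) '' A ⊆ A' := by
    intro A hA
    have hex : ∃ k : ℕ, ∃ A' ∈ 𝒟, 1 ≤ k ∧ (k : ℤ) ≤ L ∧ (h ^ (-k : ℤ) : Y ≃ₜ Y) '' A ⊆ A' := by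
      obtain ⟨A', hA', k, hk, hkL, hs⟩ := hcon A hA.1.1
      rw [abs_le] at hkL
      have hkneg : k < 0 := by
        by_contra hpos
        exact hA.2 A' hA' k (by omega) hkL.2 hs
      obtain ⟨A'', hA'', hs'⟩ := hmax A' hA'
      obtain ⟨m, hm⟩ := Int.eq_ofNat_of_zero_le (show 0 ≤ -k by omega)
      refine ⟨m, A'', hA'', by omega, by omega, ?_⟩
      rw [← hm, neg_neg]
      exact hs.trans hs'
    classical
    obtain ⟨A', hA', hk, hkL, hs⟩ := Nat.find_spec hex
    have hmin := fun m => Nat.find_min hex (m := m)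
    set k := Nat.find hex
    refine ⟨A', ⟨hA', fun A'' hA'' i hi hiL hs' => ?_⟩, k, by omega, hkL, by rwa [inv_zpow']⟩
    have hs2 : (h ^ (i - k : ℤ) : Y ≃ₜ Y) '' A ⊆ A'' := by
      have := image_zpow_subset h i hs
      exact (by simpa [sub_eq_add_neg] using this.trans hs')
    rcases lt_trichotomy i k with hlt | heq | hgt
    · obtain ⟨A₃, hA₃, hs₃⟩ := hmax A'' hA''
      obtain ⟨m, hm⟩ := Int.eq_ofNat_of_zero_le (show 0 ≤ (k : ℤ) - i by omega)
      refine hmin m (by omega) ⟨A₃, hA₃, by omega, by omega, ?_⟩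
      rw [← hm, neg_sub]
      exact hs2.trans hs₃
    · subst heq
      rw [sub_self, image_zpow_zero] at hs2
      have h1 := hA.1.2 A'' hA'' hs2
      refine H.ne A' hA'.1 A hA.1.1 k (by omega) (by rw [abs_le]; omega) ?_ |>.elim
      · refine (hs'.trans h1).antisymm ?_
        have := image_zpow_subset h k hs
        rwa [add_neg_cancel, image_zpow_zero] at this
    · exact hA.2 A'' hA'' (i - k) (by omega) (by omega) hs2
  obtain ⟨A, hA, hAb⟩ := H.inv.not_forward (𝒟 := 𝒟f) (fun _ h => h.1.1) hfne
  obtain ⟨A', hA', k, hk, hkL, hs⟩ := hback A hA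
  exact hAb A' hA' k hk hkL hs

end IsSectionSystem

end ZPow

end

section

variable {X : Type u} [TopologicalSpace X] [T3Space X] {ψ : ℂ → X}

theorem IsLift.zpow {f : X ≃ₜ X} {h : ℂ ≃ₜ ℂ} {π : ℝ → PrimeEnd (range ψ)} {G : CircleDeg1Liftˣ}
    (hψ : IsOpenEmbedding ψ) (H : IsLift f h π G) (n : ℤ) : IsLift (f ^ n) (h ^ n) π (G ^ n) := by
  obtain ⟨n, rfl | rfl⟩ := n.eq_nat_or_neg
  · simpa only [zpow_natCast] using H.pow hψ n
  · simpa only [zpow_neg, zpow_natCast] using (H.pow hψ n).inv hψ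

/-- `σ` is one of the cross-cuts making up `B ∩ range ψ`. -/
structure IsPiece (ψ : ℂ → X) (B : Set X) (σ : ℝ → ℂ) (a b : X) : Prop where
  isCC : IsCC ψ σ a b
  subset : ψ '' range σ ⊆ B
  left_mem : a ∈ B
  right_mem : b ∈ B
  exists_isOpen : ∃ O, IsOpen O ∧ O ∩ ψ ⁻¹' B = range σ

theorem IsBlocker.exists_piece {B : Set X} (hB : IsBlocker ψ B) {z : ℂ} (hz : ψ z ∈ B) :
    ∃ σ a b, IsPiece ψ B σ a b ∧ z ∈ range σ := by
  obtain ⟨l, a, b, h, hzl, hs, ha, hb, hO⟩ := hB.exists_line z hz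
  exact ⟨l, a, b, ⟨h, hs, ha, hb, hO⟩, hzl⟩

namespace IsPiece

variable {B : Set X} {σ τ : ℝ → ℂ} {a b a' b' : X}

theorem subset_preimage (h : IsPiece ψ B σ a b) : range σ ⊆ ψ ⁻¹' B := image_subset_iff.1 h.subset

theorem range_subset_of_mem (h : IsPiece ψ B σ a b) (h' : IsPiece ψ B τ a' b') {z : ℂ}
    (hz : z ∈ range σ) (hz' : z ∈ range τ) : range σ ⊆ range τ := by
  obtain ⟨O, hO, hOB⟩ := h'.exists_isOpen
  have hcov : range σ ⊆ O ∪ (range τ)ᶜ := fun y _ => by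
    by_cases hyτ : y ∈ range τ
    · exact Or.inl (hOB.symm ▸ hyτ : y ∈ O ∩ ψ ⁻¹' B).1
    · exact Or.inr hyτ
  have hemp : range σ ∩ (O ∩ (range τ)ᶜ) = ∅ := by
    rw [eq_empty_iff_forall_notMem]
    rintro y ⟨hy, hyO, hyτ⟩
    exact hyτ (hOB ▸ ⟨hyO, h.subset_preimage hy⟩)
  rcases isPreconnected_iff_subset_of_disjoint.1 (isPreconnected_line h.isCC.line) O (range τ)ᶜ hO
    h'.isCC.line.isClosed_range.isOpen_compl hcov hemp with h1 | h1
  · exact fun y hy => hOB ▸ ⟨h1 hy, h.subset_preimage hy⟩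
  · exact absurd hz' (h1 hz)

theorem range_eq_or_disjoint (h : IsPiece ψ B σ a b) (h' : IsPiece ψ B τ a' b') :
    range σ = range τ ∨ Disjoint (range σ) (range τ) := by
  by_cases hd : Disjoint (range σ) (range τ)
  · exact Or.inr hd
  · obtain ⟨z, hz, hz'⟩ := not_disjoint_iff.1 hd
    exact Or.inl ((h.range_subset_of_mem h' hz hz').antisymm (h'.range_subset_of_mem h hz' hz))

end IsPiece

/-- The standing assumptions on a blocker `B` whose iterates are disjoint, with a homeomorphism
`f` modelled by `h` on the plane and acting on prime ends with lift `G`. -/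
structure IsCore (ψ : ℂ → X) (f : X ≃ₜ X) (h : ℂ ≃ₜ ℂ) (π : ℝ → PrimeEnd (range ψ))
    (G : CircleDeg1Liftˣ) (q : ℕ) (c : ℂ) (M : Set ℂ) (B : Set X) : Prop where
  emb : IsOpenEmbedding ψ
  compl : (range ψ)ᶜ.Nontrivial
  circle : IsPECircle π
  lift : IsLift f h π G
  pos : 0 < q
  fixed : ∀ (n : ℤ) (z : ℝ) (j : ℤ), n ≠ 0 → ((G ^ n : CircleDeg1Liftˣ) : CircleDeg1Lift) z = z + j →
    ∃ m : ℤ, ((G ^ (q : ℤ) : CircleDeg1Liftˣ) : CircleDeg1Lift) z = z + m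
  preconnected : IsPreconnected M
  mem : ∀ j : ℤ, |j| ≤ q + 1 → (h ^ j : ℂ ≃ₜ ℂ) c ∈ M
  wander : ∀ n : ℤ, n = 1 ∨ n = q → ∀ S : Set ℂ, IsCrossSection (range ψ) (ψ '' S) →
    (∀ k : ℤ, k ≠ 0 → Disjoint ((h ^ (n * k) : ℂ ≃ₜ ℂ) '' S) S) →
    (∃ k : ℤ, 0 < k ∧ ¬ Disjoint ((h ^ (n * k) : ℂ ≃ₜ ℂ) '' S) M) ∧
      ∃ k : ℤ, k < 0 ∧ ¬ Disjoint ((h ^ (n * k) : ℂ ≃ₜ ℂ) '' S) M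
  blocker : IsBlocker ψ B
  disjoint_core : ∀ j : ℤ, |j| ≤ q + 1 → Disjoint ((h ^ j : ℂ ≃ₜ ℂ) '' (ψ ⁻¹' B)) M
  disjoint_iterate : ∀ j : ℤ, j ≠ 0 → |j| ≤ q + 1 →
    Disjoint ((h ^ j : ℂ ≃ₜ ℂ) '' (ψ ⁻¹' B)) (ψ ⁻¹' B)
  disjoint_q : Disjoint ((f ^ (q : ℤ) : X ≃ₜ X) '' B) B

namespace IsCore

variable {f : X ≃ₜ X} {h : ℂ ≃ₜ ℂ} {π : ℝ → PrimeEnd (range ψ)} {G : CircleDeg1Liftˣ}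
  {q : ℕ} {c : ℂ} {M : Set ℂ} {B : Set X} {σ τ : ℝ → ℂ} {a b a' b' : X}

theorem zero_mem (H : IsCore ψ f h π G q c M B) : c ∈ M := by
  simpa using H.mem 0 (by simp; omega)

theorem range_comp_subset (h : ℂ ≃ₜ ℂ) (j : ℤ) (hσ : IsPiece ψ B σ a b) :
    range ((h ^ j : ℂ ≃ₜ ℂ) ∘ σ) ⊆ (h ^ j : ℂ ≃ₜ ℂ) '' (ψ ⁻¹' B) := by
  rw [range_comp]
  exact image_mono hσ.subset_preimage

theorem isCC_zpow (H : IsCore ψ f h π G q c M B) (hσ : IsPiece ψ B σ a b) (j : ℤ) :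
    IsCC ψ ((h ^ j : ℂ ≃ₜ ℂ) ∘ σ) ((f ^ j : X ≃ₜ X) a) ((f ^ j : X ≃ₜ X) b) :=
  (H.lift.zpow H.emb j).conj.isCC hσ.isCC

theorem disjoint_range (H : IsCore ψ f h π G q c M B) (hσ : IsPiece ψ B σ a b) {j : ℤ}
    (hj : |j| ≤ q + 1) : Disjoint (range ((h ^ j : ℂ ≃ₜ ℂ) ∘ σ)) M :=
  (H.disjoint_core j hj).mono_left (range_comp_subset h j hσ)

theorem core_subset_side (H : IsCore ψ f h π G q c M B) (hσ : IsPiece ψ B σ a b) {j : ℤ}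
    (hj : |j| ≤ q + 1) {p : ℂ} (hp : p ∈ M) : M ⊆ side ((h ^ j : ℂ ≃ₜ ℂ) ∘ σ) p :=
  subset_side H.preconnected (H.disjoint_range hσ hj).symm hp
    (mem_side (disjoint_right.1 (H.disjoint_range hσ hj) hp))

theorem out_zpow (H : IsCore ψ f h π G q c M B) (hσ : IsPiece ψ B σ a b) {j : ℤ}
    (hj : |j| ≤ q + 1) : out ((h ^ j : ℂ ≃ₜ ℂ) ∘ σ) c = (h ^ j : ℂ ≃ₜ ℂ) '' out σ c := by
  rw [← out_image, out, out, side_eq (H.core_subset_side hσ hj H.zero_mem (H.mem j hj))]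

theorem notMem_range (H : IsCore ψ f h π G q c M B) (hσ : IsPiece ψ B σ a b) {j : ℤ}
    (hj : |j| ≤ q + 1) : c ∉ range ((h ^ j : ℂ ≃ₜ ℂ) ∘ σ) :=
  disjoint_right.1 (H.disjoint_range hσ hj) H.zero_mem

theorem notMem (H : IsCore ψ f h π G q c M B) (hσ : IsPiece ψ B σ a b) : c ∉ range σ := by
  simpa using H.notMem_range hσ (j := 0) (by simp; omega)

theorem disjoint_out (H : IsCore ψ f h π G q c M B) (hσ : IsPiece ψ B σ a b) {j : ℤ}
    (hj : |j| ≤ q + 1) : Disjoint ((h ^ j : ℂ ≃ₜ ℂ) '' out σ c) M := by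
  rw [← H.out_zpow hσ hj]
  exact (disjoint_out_side c).mono_right (H.core_subset_side hσ hj H.zero_mem)

theorem nested (H : IsCore ψ f h π G q c M B) (hσ : IsPiece ψ B σ a b) (hτ : IsPiece ψ B τ a' b')
    {k : ℤ} (hk0 : k ≠ 0) (hk : |k| ≤ q + 1) :
    (h ^ k : ℂ ≃ₜ ℂ) '' (out σ c ∪ range σ) ⊆ out τ c ∨
      out τ c ∪ range τ ⊆ (h ^ k : ℂ ≃ₜ ℂ) '' out σ c ∨
      Disjoint ((h ^ k : ℂ ≃ₜ ℂ) '' out σ c) (out τ c) := by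
  have hd : Disjoint (range τ) (range ((h ^ k : ℂ ≃ₜ ℂ) ∘ σ)) :=
    ((H.disjoint_iterate k hk0 hk).mono (range_comp_subset h k hσ) hτ.subset_preimage).symm
  have := out_nested hτ.isCC.line (H.isCC_zpow hσ k).line (H.notMem hτ) (H.notMem_range hσ hk) hd
  rw [H.out_zpow hσ hk, range_comp, ← image_union] at this
  refine this.imp_right (Or.imp_right fun h' => ?_)
  exact (h'.mono subset_union_left (image_mono subset_union_left)).symm

theorem nested_zero (H : IsCore ψ f h π G q c M B) (hσ : IsPiece ψ B σ a b)
    (hτ : IsPiece ψ B τ a' b') :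
    out σ c ⊆ out τ c ∨ out τ c ⊆ out σ c ∨ Disjoint (out σ c) (out τ c) := by
  rcases hσ.range_eq_or_disjoint hτ with h1 | h1
  · exact Or.inl (out_congr h1 c).subset
  · rcases out_nested hσ.isCC.line hτ.isCC.line (H.notMem hσ) (H.notMem hτ) h1 with h2 | h2 | h2
    · exact Or.inr (Or.inl (subset_union_left.trans h2))
    · exact Or.inl (subset_union_left.trans h2)
    · exact Or.inr (Or.inr (h2.mono subset_union_left subset_union_left))

theorem finite_out (H : IsCore ψ f h π G q c M B) (w : ℂ) :
    {A | (∃ σ a b, IsPiece ψ B σ a b ∧ A = out σ c) ∧ w ∈ A}.Finite := by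
  have hcl : IsClosed (ψ ⁻¹' B) := H.blocker.isCompact.isClosed.preimage H.emb.continuous
  have hcomp : IsCompact (segment ℝ w c ∩ ψ ⁻¹' B) := by
    refine IsCompact.inter_right ?_ hcl
    rw [← convexHull_pair]
    exact (toFinite {w, c}).isCompact_convexHull ℝ
  choose! σ a b hσ hzσ using fun z (hz : z ∈ ψ ⁻¹' B) => H.blocker.exists_piece hz
  choose! O hO hOB using fun z (hz : z ∈ ψ ⁻¹' B) => (hσ z hz).exists_isOpen
  obtain ⟨t, ht, htf, htc⟩ := hcomp.elim_finite_subcover_image (b := segment ℝ w c ∩ ψ ⁻¹' B)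
    (c := O) (fun z hz => hO z hz.2) fun z hz =>
      mem_biUnion hz (hOB z hz.2 ▸ hzσ z hz.2 : z ∈ O z ∩ ψ ⁻¹' B).1
  refine (htf.image fun z => out (σ z) c).subset ?_
  rintro A ⟨⟨ρ, a', b', hρ, rfl⟩, hw⟩
  obtain ⟨y, hyS, hyρ⟩ : ∃ y ∈ segment ℝ w c, y ∈ range ρ := by
    by_contra! hno
    have hd : Disjoint (segment ℝ w c) (range ρ) := disjoint_left.2 hno
    have := subset_out hρ.isCC.line (H.notMem hρ) (convex_segment w c).isPreconnected hd
      (left_mem_segment ℝ w c) hw (right_mem_segment ℝ w c)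
    exact disjoint_left.1 (disjoint_out_side c) this (mem_side (H.notMem hρ))
  have hyB := hρ.subset_preimage hyρ
  obtain ⟨z, hz, hyz⟩ := mem_iUnion₂.1 (htc ⟨hyS, hyB⟩)
  have hzB := (ht hz).2
  refine ⟨z, hz, out_congr ?_ c⟩
  have hyz' : y ∈ range (σ z) := hOB z hzB ▸ ⟨hyz, hyB⟩
  exact ((hσ z hzB).range_subset_of_mem hρ hyz' hyρ).antisymm
    (hρ.range_subset_of_mem (hσ z hzB) hyρ hyz')

end IsCore

end

section

theorem exists_eq_add_int {P : ℝ → ℝ} (hP : Continuous P) (hmono : Monotone P) {u v : ℝ}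
    (huv : u < v) (hvu : v < u + 1) (hmap : ∀ t ∈ Ioo u v, ∃ k : ℤ, P t ∈ Ioo (u + k) (v + k)) :
    ∃ z ∈ Icc u v, ∃ j : ℤ, P z = z + j := by
  obtain ⟨w, hw⟩ := exists_between huv
  obtain ⟨j, hj⟩ := hmap w hw
  have hlt : ∀ t ∈ Ioo u v, P t < v + j := by
    intro t ht
    by_contra! hge
    have hwt : w ≤ t := by
      by_contra! hlt
      linarith [hmono hlt.le, hj.2]
    obtain ⟨s, hs, hsP⟩ := intermediate_value_Icc hwt hP.continuousOn ⟨hj.2.le, hge⟩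
    obtain ⟨k, hk⟩ := hmap s ⟨hw.1.trans_le hs.1, hs.2.trans_lt ht.2⟩
    rw [hsP] at hk
    have h1 : (j : ℝ) < k := by linarith [hk.2]
    have h2 : (k : ℝ) < j + 1 := by linarith [hk.1]
    norm_cast at h1 h2
    omega
  have hgt : ∀ t ∈ Ioo u v, u + j < P t := by
    intro t ht
    by_contra! hge
    have hwt : t ≤ w := by
      by_contra! hlt
      linarith [hmono hlt.le, hj.1]
    obtain ⟨s, hs, hsP⟩ := intermediate_value_Icc hwt hP.continuousOn ⟨hge, hj.1.le⟩
    obtain ⟨k, hk⟩ := hmap s ⟨ht.1.trans_le hs.1, hs.2.trans_lt hw.2⟩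
    rw [hsP] at hk
    have h1 : (k : ℝ) < j := by linarith [hk.1]
    have h2 : (j : ℝ) < k + 1 := by linarith [hk.2]
    norm_cast at h1 h2
    omega
  have hu : u + j ≤ P u := by
    refine ge_of_tendsto (hP.continuousWithinAt (s := Ioi u)) ?_
    filter_upwards [Ioo_mem_nhdsGT huv] with t ht using (hgt t ht).le
  have hv : P v ≤ v + j := by
    refine le_of_tendsto (hP.continuousWithinAt (s := Iio v)) ?_
    filter_upwards [Ioo_mem_nhdsLT huv] with t ht using (hlt t ht).le
  have hcont : ContinuousOn (fun z => P z - z - j) (Icc u v) := by fun_prop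
  obtain ⟨z, hz, hz0⟩ := intermediate_value_Icc' huv.le hcont
    (show (0 : ℝ) ∈ Icc (P v - v - j) (P u - u - j) by constructor <;> linarith)
  exact ⟨z, hz, j, by simp only at hz0; linarith⟩

theorem CircleDeg1Lift.continuous_units (G : CircleDeg1Liftˣ) : Continuous (G : CircleDeg1Lift) :=
  (CircleDeg1Lift.toOrderIso G).continuous

variable {X : Type u} [TopologicalSpace X] [T3Space X] {ψ : ℂ → X}

namespace IsPECircle

variable {π : ℝ → PrimeEnd (range ψ)}

theorem exists_interval (hπ : IsPECircle π)
    (hψ : IsOpenEmbedding ψ) (e : X ≃ₜ ℂ) (hU : (range ψ)ᶜ.Nontrivial)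
    {κ : ℝ → ℂ} {a b : X} (h : IsCC ψ κ a b) {c : ℂ} (hc : c ∉ range κ) :
    ∃ u v, u < v ∧ v < u + 1 ∧
      (Lands (map κ atBot) (π u) ∧ Lands (map κ atTop) (π v) ∨
        Lands (map κ atTop) (π u) ∧ Lands (map κ atBot) (π v)) ∧
      (∀ t ∈ Ioo u v, PrimeEndDivides (π t) (ψ '' out κ c)) ∧
      ∀ t, PrimeEndDivides (π t) (ψ '' out κ c) → ∃ k : ℤ, t ∈ Ioo (u + k) (v + k) := by
  obtain ⟨p, hp, hout⟩ := h.exists_out_eq hc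
  have hpc : p ∈ out κ c := hout ▸ mem_side hp
  obtain ⟨p₀, h₀⟩ := h.isGerm_atBot.exists_lands hψ e hU
  obtain ⟨p₁, h₁⟩ := h.isGerm_atTop.exists_lands hψ e hU
  obtain ⟨u, v, huv, hvu, hends, hin, hex⟩ := hπ.exists_arcs hψ e hU h hp h₀ h₁
  rw [out_symm h.line hc hpc] at hex
  refine ⟨u, v, huv, hvu, ?_, fun t ht => hout ▸ hin t ht, fun t ht => ?_⟩
  · rcases hends with ⟨rfl, rfl⟩ | ⟨rfl, rfl⟩
    · exact Or.inl ⟨h₀, h₁⟩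
    · exact Or.inr ⟨h₁, h₀⟩
  · obtain ⟨n, hn⟩ := exists_add_int_mem_Ico u t
    have hdiv : PrimeEndDivides (π (t + n)) (ψ '' out κ c) := by rwa [hπ.add_int]
    have hnot : ∀ s, π s = p₀ ∨ π s = p₁ → ¬ PrimeEndDivides (π s) (ψ '' out κ c) := by
      rintro s (rfl | rfl)
      · exact h.not_divides_out_of_lands hψ hc (Or.inl h₀)
      · exact h.not_divides_out_of_lands hψ hc (Or.inr h₁)
    refine ⟨-n, ?_⟩
    push_cast
    have hu : u ≠ t + n := by
      rintro heq
      refine hnot _ ?_ hdiv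
      rw [← heq]
      rcases hends with ⟨h, -⟩ | ⟨h, -⟩ <;> simp [h]
    have hv : v ≠ t + n := by
      rintro heq
      refine hnot _ ?_ hdiv
      rw [← heq]
      rcases hends with ⟨-, h⟩ | ⟨-, h⟩ <;> simp [h]
    rcases lt_or_gt_of_ne hv with hlt | hgt
    · exfalso
      obtain ⟨x, ⟨y, hy, rfl⟩, z, hz, hzy⟩ := PrimeEndDivides.inter_nonempty hdiv (hex _ ⟨hlt, hn.2⟩)
      rw [hψ.injective hzy] at hz
      exact disjoint_left.1 (disjoint_out_side c) hy hz
    · have := lt_of_le_of_ne hn.1 hu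
      constructor <;> linarith

end IsPECircle


namespace IsCore

variable {f : X ≃ₜ X} {h : ℂ ≃ₜ ℂ} {π : ℝ → PrimeEnd (range ψ)} {G : CircleDeg1Liftˣ}
  {q : ℕ} {c : ℂ} {M : Set ℂ} {B : Set X} {σ τ : ℝ → ℂ} {a b a' b' : X}

theorem disjoint_iterate_q (H : IsCore ψ f h π G q c M B) {s : ℤ} (hs : s = q ∨ s = -q) :
    Disjoint ((f ^ s : X ≃ₜ X) '' B) B := by
  rcases hs with rfl | rfl
  · exact H.disjoint_q
  · have := (disjoint_image_zpow_iff f (i := 0) (j := q) (A := B) (C := B)).1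
      (by rw [image_zpow_zero]; exact H.disjoint_q.symm)
    rwa [zero_sub] at this

theorem not_contract (H : IsCore ψ f h π G q c M B) (e : X ≃ₜ ℂ) (hσ : IsPiece ψ B σ a b) {s : ℤ}
    (hs : s = q ∨ s = -q) {t₀ u v : ℝ} (huv : u < v) (ht₀ : t₀ ∈ Icc u v)
    (hland : Lands (map σ atBot) (π t₀))
    (hdiv : ∀ t ∈ Ioo u v, PrimeEndDivides (π t) (ψ '' out σ c)) :
    ¬ (h ^ s : ℂ ≃ₜ ℂ) '' (out σ c ∪ range σ) ⊆ out σ c := by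
  intro hsub
  rw [image_union, union_subset_iff, ← range_comp] at hsub
  have hsq : |s| ≤ q + 1 := by rw [abs_le]; omega
  have hq := H.pos
  have hcs := H.isCC_zpow hσ s
  have haψ := hσ.isCC.notMem_left
  obtain ⟨r, l, hchain⟩ := hσ.isCC.isGerm_atBot.exists_chain H.emb e H.compl c
  have hacl : a ∉ closure (ψ '' range ((h ^ s : ℂ ≃ₜ ℂ) ∘ σ)) := by
    rw [hcs.closure_range H.emb]
    have hdis := disjoint_right.1 (H.disjoint_iterate_q hs) hσ.left_mem
    rintro (h1 | h1 | ⟨z, -, hz⟩)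
    · exact hdis ⟨a, hσ.left_mem, h1.symm⟩
    · exact hdis ⟨b, hσ.right_mem, h1.symm⟩
    · exact haψ ⟨z, hz⟩
  have hσside : ∀ t, σ t ∈ side ((h ^ s : ℂ ≃ₜ ℂ) ∘ σ) c := by
    intro t
    rcases side_or_out (l := (h ^ s : ℂ ≃ₜ ℂ) ∘ σ) (p := σ t) (c := c) (fun hmem =>
      disjoint_left.1 (disjoint_out_range c) (hsub.2 hmem) (mem_range_self t)) with h1 | h1
    · exact h1
    · rw [H.out_zpow hσ hsq] at h1
      exact absurd (mem_range_self t) (disjoint_left.1 (disjoint_out_range c) (hsub.1 h1))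
  obtain ⟨N, hN⟩ := hchain.exists_out_subset H.emb haψ hcs.line hacl (p := c) fun i => by
    have : ∀ᶠ t in atBot, σ t ∈ out (l i) c := hchain.mem i
    obtain ⟨t, ht⟩ := this.exists
    exact ⟨σ t, ht, hσside t⟩
  have hpi := hchain.divides H.emb hσ.isCC.isGerm_atBot.neBot haψ hland N
  obtain ⟨t, htuv, ht⟩ : ∃ t ∈ Ioo u v, PrimeEndDivides (π t) (ψ '' out (l N) c) := by
    rw [← closure_Ioo huv.ne] at ht₀
    obtain ⟨t, ht, ht'⟩ := mem_closure_iff.1 ht₀ _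
      (H.circle.isOpen _ (hchain.isCrossSection H.emb N)) hpi
    exact ⟨t, ht', ht⟩
  have htD := hdiv t htuv
  generalize π t = P at ht htD
  induction P using Quot.ind with | mk C => ?_
  obtain ⟨n, hn⟩ := primeEndDivides_mk_iff.1 ht
  obtain ⟨m, hm⟩ := primeEndDivides_mk_iff.1 htD
  have hE := C.2.1.1 (max n m)
  replace hn := (C.2.1.2.1 _ _ (le_max_left n m)).trans hn
  replace hm := (C.2.1.2.1 _ _ (le_max_right n m)).trans hm
  generalize C.1 (max n m) = E at hE hn hm
  obtain ⟨S, rfl⟩ : ∃ S, E = ψ '' S := by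
    obtain ⟨l, a, b, p, -, -, rfl⟩ := (isCrossSection_iff H.emb).1 hE
    exact ⟨_, rfl⟩
  rw [image_subset_image_iff H.emb.injective] at hn hm
  have hiter : ∀ k : ℕ, (h ^ (s * k) : ℂ ≃ₜ ℂ) '' out σ c ⊆ out σ c := by
    intro k
    induction k with
    | zero =>
      rw [Nat.cast_zero, mul_zero, image_zpow_zero]
    | succ k ih =>
      have := image_zpow_subset h s ih
      refine (subset_of_eq ?_).trans (this.trans hsub.1)
      congr 3
      push_cast
      ring
  have hiter' : ∀ k : ℕ, 0 < k → (h ^ (s * k) : ℂ ≃ₜ ℂ) '' S ⊆ (h ^ s : ℂ ≃ₜ ℂ) '' out σ c := by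
    intro k hk
    obtain ⟨k, rfl⟩ := Nat.exists_eq_add_of_lt hk
    have := image_zpow_subset h s ((image_mono hm).trans (hiter k))
    refine (subset_of_eq ?_).trans this
    congr 3
    push_cast
    ring
  have hSd : Disjoint ((h ^ s : ℂ ≃ₜ ℂ) '' out σ c) S := by
    rw [← H.out_zpow hσ hsq]
    exact (disjoint_out_side c).mono_right (hn.trans (hN N le_rfl))
  have hpow : ∀ k : ℤ, (h ^ s) ^ k = h ^ (s * k) := fun k => (zpow_mul h s k).symm
  have hw : ∀ k : ℤ, k ≠ 0 → Disjoint ((h ^ (s * k) : ℂ ≃ₜ ℂ) '' S) S := by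
    have := wandering_of_pos (h ^ s) (A := S) fun k hk => by
      obtain ⟨k, rfl⟩ := Int.eq_ofNat_of_zero_le hk.le
      rw [hpow]
      exact hSd.mono_left (hiter' k (by omega))
    simpa only [hpow] using this
  have hM : ∀ k : ℤ, 0 < k → Disjoint ((h ^ (s * k) : ℂ ≃ₜ ℂ) '' S) M := by
    intro k hk
    obtain ⟨k, rfl⟩ := Int.eq_ofNat_of_zero_le hk.le
    exact (H.disjoint_out hσ hsq).mono_left (hiter' k (by omega))
  rcases hs with rfl | rfl
  · obtain ⟨⟨k, hk, hkM⟩, -⟩ := H.wander q (Or.inr rfl) S hE hw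
    exact hkM (hM k hk)
  · obtain ⟨-, k, hk, hkM⟩ := H.wander q (Or.inr rfl) S hE fun k hk => by
      have := hw (-k) (by omega)
      rwa [neg_mul_neg] at this
    have := hM (-k) (by omega)
    rw [neg_mul_neg] at this
    exact hkM this

theorem not_subset (H : IsCore ψ f h π G q c M B) (e : X ≃ₜ ℂ) (hσ : IsPiece ψ B σ a b) {n : ℤ}
    (hn : n ≠ 0) : ¬ (h ^ n : ℂ ≃ₜ ℂ) '' out σ c ⊆ out σ c := by
  intro hsub
  have hc := H.notMem hσ
  have hq := H.pos
  have hD := hσ.isCC.isCrossSection_out H.emb hc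
  obtain ⟨u, v, huv, hvu, hends, hin, hout⟩ :=
    H.circle.exists_interval H.emb e H.compl hσ.isCC hc
  have hdivides : ∀ (n : ℤ) t, PrimeEndDivides (π t) (ψ '' out σ c) → PrimeEndDivides
      (π (((G ^ n : CircleDeg1Liftˣ) : CircleDeg1Lift) t)) (ψ '' ((h ^ n : ℂ ≃ₜ ℂ) '' out σ c)) := by
    intro n t ht
    have := ((H.lift.zpow H.emb n).divides t _ hD).1 ht
    rwa [(H.lift.zpow H.emb n).conj.image] at this
  obtain ⟨z, hz, j, hzj⟩ := exists_eq_add_int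
    (P := ((G ^ n : CircleDeg1Liftˣ) : CircleDeg1Lift)) (CircleDeg1Lift.continuous_units (G ^ n)) ((G ^ n : CircleDeg1Liftˣ) : CircleDeg1Lift).monotone huv hvu
    fun t ht => hout _ ((hdivides n t (hin t ht)).mono (image_mono hsub))
  obtain ⟨m, hm⟩ := H.fixed n z j hn hzj
  have hπ : π (((G ^ (q : ℤ) : CircleDeg1Liftˣ) : CircleDeg1Lift) z) = π z := by
    rw [hm, H.circle.add_int]
  have hqdis := H.disjoint_q
  have hqCC := H.isCC_zpow hσ q
  have hbot : ¬ Lands (map σ atBot) (π z) := fun hl => by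
    have h2 := (H.lift.zpow H.emb q).lands H.emb hl
    rw [hπ] at h2
    have := hσ.isCC.isGerm_atBot.eq_of_lands H.emb e H.compl hqCC.isGerm_atBot hl h2
    exact disjoint_right.1 hqdis hσ.left_mem ⟨a, hσ.left_mem, this.symm⟩
  have htop : ¬ Lands (map σ atTop) (π z) := fun hl => by
    have h2 := (H.lift.zpow H.emb q).lands H.emb hl
    rw [hπ] at h2
    have := hσ.isCC.isGerm_atTop.eq_of_lands H.emb e H.compl hqCC.isGerm_atTop hl h2
    exact disjoint_right.1 hqdis hσ.right_mem ⟨b, hσ.right_mem, this.symm⟩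
  have hzIoo : z ∈ Ioo u v := by
    refine ⟨lt_of_le_of_ne hz.1 ?_, lt_of_le_of_ne hz.2 ?_⟩ <;> rintro rfl <;>
      rcases hends with ⟨h1, h2⟩ | ⟨h1, h2⟩ <;> contradiction
  obtain ⟨t₀, ht₀, hland⟩ : ∃ t₀ ∈ Icc u v, Lands (map σ atBot) (π t₀) := by
    rcases hends with ⟨h1, -⟩ | ⟨-, h1⟩
    · exact ⟨u, left_mem_Icc.2 huv.le, h1⟩
    · exact ⟨v, right_mem_Icc.2 huv.le, h1⟩
  have hmeet : ((h ^ (q : ℤ) : ℂ ≃ₜ ℂ) '' out σ c ∩ out σ c).Nonempty := by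
    have h1 := hdivides q z (hin z hzIoo)
    rw [hπ] at h1
    have := PrimeEndDivides.inter_nonempty h1 (hin z hzIoo)
    rw [← image_inter H.emb.injective] at this
    exact this.of_image
  rcases H.nested hσ hσ (k := q) (by omega) (by rw [abs_le]; omega) with h1 | h1 | h1
  · exact H.not_contract e hσ (Or.inl rfl) huv ht₀ hland hin h1
  · refine H.not_contract e hσ (Or.inr rfl) huv ht₀ hland hin ?_
    have := image_zpow_subset h (i := 0) (A := out σ c ∪ range σ)
      (C := (h ^ (q : ℤ) : ℂ ≃ₜ ℂ) '' out σ c) (-(q : ℤ))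
      (by rw [image_zpow_zero]; exact h1)
    rwa [← image_zpow_add, add_zero, neg_add_cancel, image_zpow_zero] at this
  · exact hmeet.ne_empty h1.inter_eq

theorem isSectionSystem (H : IsCore ψ f h π G q c M B) (e : X ≃ₜ ℂ) :
    IsSectionSystem h (q + 1) M {A | ∃ σ a b, IsPiece ψ B σ a b ∧ A = out σ c} where
  one_le := by omega
  nonempty := by
    rintro A ⟨σ, a, b, hσ, rfl⟩
    exact out_nonempty hσ.isCC.line (H.notMem hσ)
  finite := H.finite_out
  nested := by
    rintro A ⟨σ, a, b, hσ, rfl⟩ A' ⟨τ, a', b', hτ, rfl⟩ k hk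
    rcases eq_or_ne k 0 with rfl | hk0
    · rw [image_zpow_zero]
      exact H.nested_zero hσ hτ
    · rcases H.nested hσ hτ hk0 hk with h1 | h1 | h1
      · exact Or.inl ((image_mono subset_union_left).trans h1)
      · exact Or.inr (Or.inl (subset_union_left.trans h1))
      · exact Or.inr (Or.inr h1)
  ne := by
    rintro A ⟨σ, a, b, hσ, rfl⟩ A' ⟨τ, a', b', hτ, rfl⟩ k hk0 hk heq
    rcases H.nested hσ hτ hk0 hk with h1 | h1 | h1
    · rw [← heq, image_subset_image_iff (Homeomorph.injective _)] at h1
      exact disjoint_left.1 (disjoint_out_range c) (h1 (Or.inr (mem_range_self 0)))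
        (mem_range_self 0)
    · rw [heq] at h1
      exact disjoint_left.1 (disjoint_out_range c) (h1 (Or.inr (mem_range_self 0)))
        (mem_range_self 0)
    · rw [heq, disjoint_self] at h1
      exact (out_nonempty hτ.isCC.line (H.notMem hτ)).ne_empty h1
  not_subset := by
    rintro A ⟨σ, a, b, hσ, rfl⟩ n hn
    exact H.not_subset e hσ hn
  disj := by
    rintro A ⟨σ, a, b, hσ, rfl⟩ k hk
    exact H.disjoint_out hσ hk
  wander := by
    rintro A ⟨σ, a, b, hσ, rfl⟩ hw
    simpa only [one_mul] using H.wander 1 (Or.inl rfl) _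
      (hσ.isCC.isCrossSection_out H.emb (H.notMem hσ)) (by simpa only [one_mul] using hw)

theorem exists_isolated (H : IsCore ψ f h π G q c M B) (e : X ≃ₜ ℂ) (hB : (ψ ⁻¹' B).Nonempty) :
    ∃ σ a b, IsPiece ψ B σ a b ∧ ∀ τ a' b', IsPiece ψ B τ a' b' → ∀ k : ℤ, k ≠ 0 → |k| ≤ q + 1 →
      ¬ (h ^ k : ℂ ≃ₜ ℂ) '' out σ c ⊆ out τ c := by
  obtain ⟨z, hz⟩ := hB
  obtain ⟨ρ, a₀, b₀, hρ, -⟩ := H.blocker.exists_piece hz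
  obtain ⟨A, ⟨σ, a, b, hσ, rfl⟩, hA⟩ :=
    (H.isSectionSystem e).exists_isolated ⟨_, ρ, a₀, b₀, hρ, rfl⟩
  exact ⟨σ, a, b, hσ, fun τ a' b' hτ k hk0 hk => hA _ ⟨τ, a', b', hτ, rfl⟩ k hk0 hk⟩

end IsCore

end

section

variable {X : Type u} [TopologicalSpace X] [T3Space X] {ψ : ℂ → X}

namespace IsCore

variable {f : X ≃ₜ X} {h : ℂ ≃ₜ ℂ} {π : ℝ → PrimeEnd (range ψ)} {G : CircleDeg1Liftˣ}
  {q : ℕ} {c : ℂ} {M : Set ℂ} {B : Set X} {σ τ : ℝ → ℂ} {a b a' b' : X}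

theorem disjoint_images (H : IsCore ψ f h π G q c M B) {i j : ℤ} (hij : i ≠ j)
    (hd : |i - j| ≤ q + 1) :
    Disjoint ((h ^ i : ℂ ≃ₜ ℂ) '' (ψ ⁻¹' B)) ((h ^ j : ℂ ≃ₜ ℂ) '' (ψ ⁻¹' B)) :=
  (disjoint_image_zpow_iff h).2 (H.disjoint_iterate _ (sub_ne_zero.2 hij) hd)

theorem isClosed_image (H : IsCore ψ f h π G q c M B) (i : ℤ) :
    IsClosed ((h ^ i : ℂ ≃ₜ ℂ) '' (ψ ⁻¹' B)) :=
  (Homeomorph.isClosed_image _).2 (H.blocker.isCompact.isClosed.preimage H.emb.continuous)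

theorem apply_mem_side (H : IsCore ψ f h π G q c M B) (hσ : IsPiece ψ B σ a b)
    (hiso : ∀ τ a' b', IsPiece ψ B τ a' b' → ∀ k : ℤ, k ≠ 0 → |k| ≤ q + 1 →
      ¬ (h ^ k : ℂ ≃ₜ ℂ) '' out σ c ⊆ out τ c)
    (hτ : IsPiece ψ B τ a' b') {i j : ℤ} (hij : i ≠ j) (hi : |i| ≤ q + 1) (hj : |j| ≤ q + 1)
    (hd : |i - j| ≤ q + 1) :
    (h ^ j : ℂ ≃ₜ ℂ) (σ 0) ∈ side ((h ^ i : ℂ ≃ₜ ℂ) ∘ τ) c := by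
  have hci := H.notMem_range hτ hi
  have hcj := H.notMem_range hσ hj
  have hdis : Disjoint (range ((h ^ j : ℂ ≃ₜ ℂ) ∘ σ)) (range ((h ^ i : ℂ ≃ₜ ℂ) ∘ τ)) :=
    (H.disjoint_images hij hd).symm.mono (range_comp_subset h j hσ) (range_comp_subset h i hτ)
  have hmem : (h ^ j : ℂ ≃ₜ ℂ) (σ 0) ∈ range ((h ^ j : ℂ ≃ₜ ℂ) ∘ σ) := ⟨0, rfl⟩
  refine (side_or_out (disjoint_left.1 hdis hmem)).resolve_right fun ho => ?_
  have hl := (H.isCC_zpow hτ i).line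
  have hm := (H.isCC_zpow hσ j).line
  have h1 := subset_out hl hci (isPreconnected_line hm) hdis hmem ho
  have h2 := subset_union_left.trans (out_subset_out hl hci hcj h1)
  rw [H.out_zpow hτ hi, H.out_zpow hσ hj, image_zpow_subset_iff] at h2
  exact hiso τ a' b' hτ (j - i) (sub_ne_zero.2 hij.symm) (by rwa [abs_sub_comm]) h2

theorem joinedIn_compl_images (H : IsCore ψ f h π G q c M B) (hσ : IsPiece ψ B σ a b)
    (hiso : ∀ τ a' b', IsPiece ψ B τ a' b' → ∀ k : ℤ, k ≠ 0 → |k| ≤ q + 1 →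
      ¬ (h ^ k : ℂ ≃ₜ ℂ) '' out σ c ⊆ out τ c) {i i' j j' : ℤ}
    (hi : i ∈ Icc 0 (q + 1 : ℤ)) (hi' : i' ∈ Icc 0 (q + 1 : ℤ)) (hj : j ∈ Icc 0 (q + 1 : ℤ))
    (hj' : j' ∈ Icc 0 (q + 1 : ℤ)) (hii : i ≠ i') (hij : i ≠ j) (hij' : i ≠ j') (hi'j : i' ≠ j)
    (hi'j' : i' ≠ j') :
    JoinedIn ((h ^ i : ℂ ≃ₜ ℂ) '' (ψ ⁻¹' B) ∪ (h ^ i' : ℂ ≃ₜ ℂ) '' (ψ ⁻¹' B))ᶜ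
      ((h ^ j : ℂ ≃ₜ ℂ) (σ 0)) ((h ^ j' : ℂ ≃ₜ ℂ) (σ 0)) := by
  simp only [mem_Icc] at hi hi' hj hj'
  have hab : ∀ {x y : ℤ}, 0 ≤ x ∧ x ≤ q + 1 → 0 ≤ y ∧ y ≤ q + 1 → |x - y| ≤ q + 1 := by
    intro x y hx hy; rw [abs_le]; omega
  have hab' : ∀ {x : ℤ}, 0 ≤ x ∧ x ≤ q + 1 → |x| ≤ q + 1 := by
    intro x hx; rw [abs_le]; omega
  have hv : σ 0 ∈ ψ ⁻¹' B := hσ.subset_preimage ⟨0, rfl⟩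
  have hnot : ∀ {x y : ℤ}, 0 ≤ x ∧ x ≤ q + 1 → 0 ≤ y ∧ y ≤ q + 1 → x ≠ y →
      (h ^ y : ℂ ≃ₜ ℂ) (σ 0) ∉ (h ^ x : ℂ ≃ₜ ℂ) '' (ψ ⁻¹' B) := fun hx hy hxy hm =>
    disjoint_left.1 (H.disjoint_images hxy (hab hx hy)) hm (mem_image_of_mem _ hv)
  have key : ∀ {x x' : ℤ}, 0 ≤ x ∧ x ≤ q + 1 → 0 ≤ x' ∧ x' ≤ q + 1 → x ≠ x' → x ≠ j → x ≠ j' →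
      ∀ z ∈ (h ^ x : ℂ ≃ₜ ℂ) '' (ψ ⁻¹' B), ∃ A, z ∈ A ∧
      A ⊆ (h ^ x : ℂ ≃ₜ ℂ) '' (ψ ⁻¹' B) ∪ (h ^ x' : ℂ ≃ₜ ℂ) '' (ψ ⁻¹' B) ∧ IsClosed A ∧
      IsPreconnected A ∧ (∃ O, IsOpen O ∧
        O ∩ ((h ^ x : ℂ ≃ₜ ℂ) '' (ψ ⁻¹' B) ∪ (h ^ x' : ℂ ≃ₜ ℂ) '' (ψ ⁻¹' B)) = A) ∧
      JoinedIn Aᶜ ((h ^ j : ℂ ≃ₜ ℂ) (σ 0)) ((h ^ j' : ℂ ≃ₜ ℂ) (σ 0)) := by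
    rintro x x' hx hx' hxx hxj hxj' _ ⟨z, hz, rfl⟩
    obtain ⟨τ, a', b', hτ, t, rfl⟩ := H.blocker.exists_piece hz
    have hl := (H.isCC_zpow hτ x).line
    obtain ⟨O, hO, hOτ⟩ := hτ.exists_isOpen
    refine ⟨range ((h ^ x : ℂ ≃ₜ ℂ) ∘ τ), ⟨t, rfl⟩,
      (range_comp_subset h x hτ).trans subset_union_left, hl.isClosed_range,
      isPreconnected_line hl, ⟨(h ^ x : ℂ ≃ₜ ℂ) '' O ∩ ((h ^ x' : ℂ ≃ₜ ℂ) '' (ψ ⁻¹' B))ᶜ,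
        ((Homeomorph.isOpen_image _).2 hO).inter (H.isClosed_image x').isOpen_compl, ?_⟩, ?_⟩
    · rw [range_comp, ← hOτ, image_inter (h ^ x : ℂ ≃ₜ ℂ).injective]
      ext w
      constructor
      · rintro ⟨⟨h1, h2⟩, h3 | h3⟩
        · exact ⟨h1, h3⟩
        · exact absurd h3 h2
      · rintro ⟨h1, h2⟩
        exact ⟨⟨h1, disjoint_left.1 (H.disjoint_images hxx (hab hx hx')) h2⟩, Or.inl h2⟩
    · exact joinedIn_of_isPreconnected hl.isClosed_range.isOpen_compl
        (isPreconnected_side _ _) (side_subset_compl _ _)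
        (H.apply_mem_side hσ hiso hτ hxj (hab' hx) (hab' hj) (hab hx hj))
        (H.apply_mem_side hσ hiso hτ hxj' (hab' hx) (hab' hj') (hab hx hj'))
  refine joinedIn_compl_of_pieces ((H.isClosed_image i).union (H.isClosed_image i'))
    (not_or.2 ⟨hnot hi hj hij, hnot hi' hj hi'j⟩) (not_or.2 ⟨hnot hi hj' hij', hnot hi' hj' hi'j'⟩)
    ?_
  rintro z (hz | hz)
  · exact key hi hi' hii hij hij' z hz
  · obtain ⟨A, h1, h2, h3, h4, ⟨O, hO, hOA⟩, h5⟩ := key hi' hi hii.symm hi'j hi'j' z hz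
    exact ⟨A, h1, by rwa [union_comm], h3, h4, ⟨O, hO, by rwa [union_comm]⟩, h5⟩

theorem exists_cut (H : IsCore ψ f h π G q c M B) (e : X ≃ₜ ℂ) (hσ : IsPiece ψ B σ a b)
    (hiso : ∀ τ a' b', IsPiece ψ B τ a' b' → ∀ k : ℤ, k ≠ 0 → |k| ≤ q + 1 →
      ¬ (h ^ k : ℂ ≃ₜ ℂ) '' out σ c ⊆ out τ c)
    {l m : ℤ} (good : IsGoodTime (CircleDeg1Lift.translationNumber (G : CircleDeg1Lift)) q l m)
    (hq : 2 ≤ q) (hb : f b ≠ b) :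
    ∃ κ, IsCC ψ κ b (f b) ∧ range κ ⊆ ((h ^ (q : ℤ) : ℂ ≃ₜ ℂ) '' (ψ ⁻¹' B) ∪
        (h ^ (q + 1 : ℤ) : ℂ ≃ₜ ℂ) '' (ψ ⁻¹' B))ᶜ ∧
      (h ^ (q + 1 : ℤ) : ℂ ≃ₜ ℂ) (σ 0) ∈ out κ ((h ^ (q : ℤ) : ℂ ≃ₜ ℂ) (σ 0)) := by
  have h0 : (h ^ (0 : ℤ) : ℂ ≃ₜ ℂ) = 1 := zpow_zero h
  have h1 : (h ^ (1 : ℤ) : ℂ ≃ₜ ℂ) = h := zpow_one h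
  have hgood := fun (i : ℤ) => range_comp_subset h i hσ
  have hZ0 : range σ ⊆ (h ^ (0 : ℤ) : ℂ ≃ₜ ℂ) '' (ψ ⁻¹' B) := by have := hgood 0; rwa [h0] at this ⊢
  have hZ1 : range (h ∘ σ) ⊆ (h ^ (1 : ℤ) : ℂ ≃ₜ ℂ) '' (ψ ⁻¹' B) := by simpa [h1] using hgood 1
  have hdis : ∀ i j : ℤ, 0 ≤ i → i ≤ q + 1 → 0 ≤ j → j ≤ q + 1 → i ≠ j →
      Disjoint ((h ^ i : ℂ ≃ₜ ℂ) '' (ψ ⁻¹' B)) ((h ^ j : ℂ ≃ₜ ℂ) '' (ψ ⁻¹' B)) :=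
    fun i j hi hi' hj hj' hij => H.disjoint_images hij (abs_le.2 (by omega))
  set V := ((h ^ (q : ℤ) : ℂ ≃ₜ ℂ) '' (ψ ⁻¹' B) ∪ (h ^ (q + 1 : ℤ) : ℂ ≃ₜ ℂ) '' (ψ ⁻¹' B))ᶜ with hV
  have hcc : IsCC ψ (h ∘ σ) (f a) (f b) := by simpa [h1] using H.isCC_zpow hσ 1
  have hsub : ∀ i : ℤ, 0 ≤ i → i < 2 → (h ^ i : ℂ ≃ₜ ℂ) '' (ψ ⁻¹' B) ⊆ V := fun i hi hi' z hz =>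
    not_or.2 ⟨disjoint_left.1 (hdis i q hi (by omega) (by omega) (by omega) (by omega)) hz,
      disjoint_left.1 (hdis i (q + 1) hi (by omega) (by omega) (by omega) (by omega)) hz⟩
  have hj : JoinedIn V (σ 0) ((h ∘ σ) 0) := by
    have := H.joinedIn_compl_images hσ hiso (i := q) (i' := q + 1) (j := 0) (j' := 1)
      ⟨by omega, by omega⟩ ⟨by omega, by omega⟩ ⟨by omega, by omega⟩ ⟨by omega, by omega⟩
      (by omega) (by omega) (by omega) (by omega) (by omega)
    rw [h0, h1] at this
    exact this
  obtain ⟨κ, hκ, hκV, hκt, hκb⟩ := exists_line_of_tails (T := 0)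
    ((H.isClosed_image q).union (H.isClosed_image (q + 1))).isOpen_compl hσ.isCC.line hcc.line
    ((image_subset_range _ _).trans (hZ0.trans (hsub 0 le_rfl (by omega))))
    ((image_subset_range _ _).trans (hZ1.trans (hsub 1 (by omega) (by omega))))
    ((hdis 0 1 (by omega) (by omega) (by omega) (by omega) (by omega)).mono
      ((image_subset_range _ _).trans hZ0) ((image_subset_range _ _).trans hZ1)) hj
  have hκcc : IsCC ψ κ b (f b) := by
    refine isCC_of_ne H.emb e hκ ?_ ?_ hσ.isCC.notMem_right hcc.notMem_right hb.symm
    · rw [← tendsto_map'_iff, hκb, tendsto_map'_iff]; exact hσ.isCC.tendsto_atTop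
    · rw [← tendsto_map'_iff, hκt, tendsto_map'_iff]; exact hcc.tendsto_atTop
  refine ⟨κ, hκcc, hκV, ?_⟩
  set v := (h ^ (q : ℤ) : ℂ ≃ₜ ℂ) (σ 0) with hv
  have hσκ : ∀ i : ℤ, i = q ∨ i = q + 1 → Disjoint (range ((h ^ i : ℂ ≃ₜ ℂ) ∘ σ)) (range κ) := by
    intro i hi
    refine disjoint_left.2 fun z hz hzκ => hκV hzκ ?_
    rcases hi with rfl | rfl
    · exact Or.inl (hgood _ hz)
    · exact Or.inr (hgood _ hz)
  have hvκ : v ∉ range κ := disjoint_left.1 (hσκ q (Or.inl rfl)) ⟨0, rfl⟩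
  have hgerm := hσ.isCC.isGerm_atTop
  obtain ⟨p, hp⟩ := hgerm.exists_lands H.emb e H.compl
  obtain ⟨x, rfl⟩ := H.circle.surjective p
  have hmono : StrictMono (G : CircleDeg1Lift) :=
    (CircleDeg1Lift.strictMono_iff_injective _).2 (CircleDeg1Lift.toOrderIso G).injective
  have hGn : ∀ n : ℕ, ((G ^ (n : ℤ) : CircleDeg1Liftˣ) : CircleDeg1Lift) = (G : CircleDeg1Lift) ^ n :=
    fun n => by rw [zpow_natCast, Units.val_pow_eq_pow_val]
  have hlandn : ∀ n : ℕ, Lands (map ((h ^ (n : ℤ) : ℂ ≃ₜ ℂ) ∘ σ) atTop)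
      (π (((G : CircleDeg1Lift) ^ n) x)) := by
    intro n
    have := (H.lift.zpow H.emb n).lands H.emb hp
    rwa [hGn, map_map] at this
  have hne : π (((G : CircleDeg1Lift) ^ q) x) ≠ π x := by
    intro heq
    have h2 := hlandn q
    rw [heq] at h2
    have := (H.isCC_zpow hσ q).isGerm_atTop.eq_of_lands H.emb e H.compl hgerm h2 hp
    exact disjoint_left.1 H.disjoint_q (mem_image_of_mem _ hσ.right_mem) (by rw [this]; exact hσ.right_mem)
  have hlast := hlandn (q + 1)
  push_cast at hlast
  have hl₁ : Lands (map κ atTop) (π ((G : CircleDeg1Lift) x)) := by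
    rw [hκt, ← map_map]; exact H.lift.lands H.emb hp
  have hout := hκcc.isCrossSection_out H.emb hvκ
  rcases H.circle.separates H.emb e H.compl hmono good hne hκcc hvκ (hκb ▸ hp) hl₁ with ⟨-, hd⟩ | ⟨hd, -⟩
  · have := hlast _ hout hd
    obtain ⟨t, ht⟩ := (mem_map.1 this |> fun h => (Filter.nonempty_of_mem h))
    have ht' : ((h ^ (q + 1 : ℤ) : ℂ ≃ₜ ℂ) ∘ σ) t ∈ out κ v := (H.emb.injective.mem_set_image).1 ht
    exact subset_out hκ hvκ (isPreconnected_line (H.isCC_zpow hσ (q + 1)).line)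
      (hσκ _ (Or.inr rfl)) ⟨t, rfl⟩ ht' ⟨0, rfl⟩
  · have := hlandn q _ hout hd
    obtain ⟨t, ht⟩ := (mem_map.1 this |> fun h => (Filter.nonempty_of_mem h))
    have ht' : ((h ^ (q : ℤ) : ℂ ≃ₜ ℂ) ∘ σ) t ∈ out κ v := (H.emb.injective.mem_set_image).1 ht
    exact absurd (subset_out hκ hvκ (isPreconnected_line (H.isCC_zpow hσ q).line)
      (hσκ _ (Or.inl rfl)) ⟨t, rfl⟩ ht' ⟨0, rfl⟩) (notMem_out hvκ)

theorem notMem_out_cut (H : IsCore ψ f h π G q c M B) (e : X ≃ₜ ℂ) (hσ : IsPiece ψ B σ a b)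
    (hiso : ∀ τ a' b', IsPiece ψ B τ a' b' → ∀ k : ℤ, k ≠ 0 → |k| ≤ q + 1 →
      ¬ (h ^ k : ℂ ≃ₜ ℂ) '' out σ c ⊆ out τ c)
    (hq : 2 ≤ q) {C : Set X} (hC : IsCompact C) (hCc : IsPreconnected C) (hbC : b ∈ C)
    (hfbC : f b ∈ C) (hCB : C ∩ range ψ ⊆ B ∪ f '' B)
    (hCf : Disjoint C ((f ^ (q : ℤ) : X ≃ₜ X) '' C)) {κ : ℝ → ℂ} (hκ : IsCC ψ κ b (f b))
    (hκV : range κ ⊆ ((h ^ (q : ℤ) : ℂ ≃ₜ ℂ) '' (ψ ⁻¹' B) ∪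
        (h ^ (q + 1 : ℤ) : ℂ ≃ₜ ℂ) '' (ψ ⁻¹' B))ᶜ) :
    (h ^ (q + 1 : ℤ) : ℂ ≃ₜ ℂ) (σ 0) ∉ out κ ((h ^ (q : ℤ) : ℂ ≃ₜ ℂ) (σ 0)) := by
  have h0 : (h ^ (0 : ℤ) : ℂ ≃ₜ ℂ) = 1 := zpow_zero h
  have h1 : (h ^ (1 : ℤ) : ℂ ≃ₜ ℂ) = h := zpow_one h
  have hgood := fun (i : ℤ) => range_comp_subset h i hσ
  have hdis : ∀ i j : ℤ, 0 ≤ i → i ≤ q + 1 → 0 ≤ j → j ≤ q + 1 → i ≠ j →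
      Disjoint ((h ^ i : ℂ ≃ₜ ℂ) '' (ψ ⁻¹' B)) ((h ^ j : ℂ ≃ₜ ℂ) '' (ψ ⁻¹' B)) :=
    fun i j hi hi' hj hj' hij => H.disjoint_images hij (abs_le.2 (by omega))
  have hmodel : ∀ z, ψ (h z) = f (ψ z) := H.lift.conj
  have hmodelq : ∀ z, ψ ((h ^ (q : ℤ) : ℂ ≃ₜ ℂ) z) = (f ^ (q : ℤ) : X ≃ₜ X) (ψ z) :=
    (H.lift.zpow H.emb q).conj
  have hqs : ∀ z, (h ^ (q + 1 : ℤ) : ℂ ≃ₜ ℂ) z = (h ^ (q : ℤ) : ℂ ≃ₜ ℂ) (h z) := fun z => by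
    rw [zpow_add_one]; rfl
  have hqsf : ∀ z, (f ^ (q + 1 : ℤ) : X ≃ₜ X) z = (f ^ (q : ℤ) : X ≃ₜ X) (f z) := fun z => by
    rw [zpow_add_one]; rfl
  have hCz : ∀ z, ψ z ∈ C → z ∈ (h ^ (0 : ℤ) : ℂ ≃ₜ ℂ) '' (ψ ⁻¹' B) ∪
      (h ^ (1 : ℤ) : ℂ ≃ₜ ℂ) '' (ψ ⁻¹' B) := by
    intro z hz
    rw [h0, h1]
    rcases hCB ⟨hz, mem_range_self z⟩ with hb | ⟨y, hy, hyz⟩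
    · exact Or.inl ⟨z, hb, rfl⟩
    · obtain ⟨w, rfl⟩ : y ∈ range ψ := H.lift.conj.mem_range_iff.1 (hyz ▸ mem_range_self z)
      exact Or.inr ⟨w, hy, H.emb.injective ((hmodel w).trans hyz)⟩
  have hCqz : ∀ z, ψ z ∈ (f ^ (q : ℤ) : X ≃ₜ X) '' C → z ∈ (h ^ (q : ℤ) : ℂ ≃ₜ ℂ) '' (ψ ⁻¹' B) ∪
      (h ^ (q + 1 : ℤ) : ℂ ≃ₜ ℂ) '' (ψ ⁻¹' B) := by
    rintro z ⟨y, hy, hyz⟩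
    obtain ⟨w, rfl⟩ : y ∈ range ψ :=
      (H.lift.zpow H.emb q).conj.mem_range_iff.1 (hyz ▸ mem_range_self z)
    have hz : z = (h ^ (q : ℤ) : ℂ ≃ₜ ℂ) w := H.emb.injective (by rw [hmodelq, hyz])
    subst hz
    rcases hCz w hy with ⟨y, hyB, rfl⟩ | ⟨y, hyB, rfl⟩
    · exact Or.inl ⟨y, hyB, by rw [h0]; rfl⟩
    · exact Or.inr ⟨y, hyB, by rw [hqs, h1]⟩
  set v := (h ^ (q : ℤ) : ℂ ≃ₜ ℂ) (σ 0) with hv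
  set w := (h ^ (q + 1 : ℤ) : ℂ ≃ₜ ℂ) (σ 0) with hw
  have hvκ : v ∉ range κ := fun hm => hκV hm (Or.inl (hgood q ⟨0, rfl⟩))
  have hwκ : w ∉ range κ := fun hm => hκV hm (Or.inr (hgood (q + 1) ⟨0, rfl⟩))
  -- the first separating set: the cut closed up by the connector
  have hA : IsCompact (ψ '' range κ ∪ C) := by
    obtain ⟨g, hg, -, hgr, hg0, hg1⟩ :=
      exists_arc_of_line H.emb hκ.line hκ.tendsto_atBot hκ.tendsto_atTop
    have : ψ '' range κ ∪ C = g '' Icc 0 1 ∪ C := by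
      rw [image_Icc_eq, hgr, hg0, hg1]
      ext y
      simp only [mem_union, mem_insert_iff]
      constructor
      · tauto
      · rintro ((rfl | rfl | h) | h) <;> tauto
    rw [this]
    exact (isCompact_Icc.image_of_continuousOn hg).union hC
  have hJA : JoinedIn (e '' (ψ '' range κ ∪ C))ᶜ (e (ψ v)) (e (ψ w)) := by
    set S := insert ((f ^ (q : ℤ) : X ≃ₜ X) b) (ψ '' range ((h ^ (q : ℤ) : ℂ ≃ₜ ℂ) ∘ σ)) ∪
      (f ^ (q : ℤ) : X ≃ₜ X) '' C ∪
      insert ((f ^ (q + 1 : ℤ) : X ≃ₜ X) b) (ψ '' range ((h ^ (q + 1 : ℤ) : ℂ ≃ₜ ℂ) ∘ σ)) with hS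
    have hins : ∀ i : ℤ, IsPreconnected
        (insert ((f ^ i : X ≃ₜ X) b) (ψ '' range ((h ^ i : ℂ ≃ₜ ℂ) ∘ σ))) := by
      intro i
      have hcc := H.isCC_zpow hσ i
      have hpre : IsPreconnected (ψ '' range ((h ^ i : ℂ ≃ₜ ℂ) ∘ σ)) :=
        (isPreconnected_line hcc.line).image _ H.emb.continuous.continuousOn
      refine hpre.subset_closure (subset_insert _ _) (insert_subset ?_ subset_closure)
      rw [hcc.closure_range H.emb]
      exact Or.inr (Or.inl rfl)
    have hSp : IsPreconnected S := by
      refine IsPreconnected.union ((f ^ (q + 1 : ℤ) : X ≃ₜ X) b) (Or.inr ?_) (Or.inl rfl)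
        (IsPreconnected.union ((f ^ (q : ℤ) : X ≃ₜ X) b) (Or.inl rfl) (mem_image_of_mem _ hbC)
          (hins q) (hCc.image _ (f ^ (q : ℤ) : X ≃ₜ X).continuous.continuousOn)) (hins (q + 1))
      rw [hqsf]; exact mem_image_of_mem _ hfbC
    have hS1 : S ⊆ ψ '' ((h ^ (q : ℤ) : ℂ ≃ₜ ℂ) '' (ψ ⁻¹' B) ∪
        (h ^ (q + 1 : ℤ) : ℂ ≃ₜ ℂ) '' (ψ ⁻¹' B)) ∪ (f ^ (q : ℤ) : X ≃ₜ X) '' C := by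
      rintro y (((rfl | hy) | hy) | rfl | hy)
      · exact Or.inr (mem_image_of_mem _ hbC)
      · exact Or.inl (image_mono ((hgood q).trans subset_union_left) hy)
      · exact Or.inr hy
      · refine Or.inr ?_
        rw [hqsf]; exact mem_image_of_mem _ hfbC
      · exact Or.inl (image_mono ((hgood (q + 1)).trans subset_union_right) hy)
    have hSA : Disjoint S (ψ '' range κ ∪ C) := by
      refine disjoint_left.2 fun y hy hyA => ?_
      rcases hyA with ⟨z, hz, rfl⟩ | hyC
      · rcases hS1 hy with hy | hy
        · exact hκV hz ((H.emb.injective.mem_set_image).1 hy)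
        · exact hκV hz (hCqz z hy)
      · rcases hS1 hy with ⟨z, hz, rfl⟩ | hy
        · rcases hCz z hyC with h2 | h2 <;> rcases hz with h3 | h3
          · exact disjoint_left.1 (hdis _ _ (by omega) (by omega) (by omega) (by omega) (by omega)) h2 h3
          · exact disjoint_left.1 (hdis _ _ (by omega) (by omega) (by omega) (by omega) (by omega)) h2 h3
          · exact disjoint_left.1 (hdis _ _ (by omega) (by omega) (by omega) (by omega) (by omega)) h2 h3
          · exact disjoint_left.1 (hdis _ _ (by omega) (by omega) (by omega) (by omega) (by omega)) h2 h3
        · exact disjoint_left.1 hCf hyC hy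
    refine joinedIn_of_isPreconnected (hA.image e.continuous).isClosed.isOpen_compl
      (hSp.image _ e.continuous.continuousOn) ?_
      (mem_image_of_mem _ (Or.inl (Or.inl (Or.inr ⟨v, ⟨0, rfl⟩, rfl⟩))))
      (mem_image_of_mem _ (Or.inr (Or.inr ⟨w, ⟨0, rfl⟩, rfl⟩)))
    rintro _ ⟨y, hy, rfl⟩ ⟨y', hy', hyy⟩
    exact disjoint_left.1 hSA hy (e.injective hyy ▸ hy')
  -- the second separating set: the complement of the disc, again with the connector
  have hB : IsClosed ((range ψ)ᶜ ∪ C) := H.emb.isOpen_range.isClosed_compl.union hC.isClosed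
  have hJB : JoinedIn (e '' ((range ψ)ᶜ ∪ C))ᶜ (e (ψ v)) (e (ψ w)) := by
    have := H.joinedIn_compl_images hσ hiso (i := 0) (i' := 1) (j := q) (j' := q + 1)
      ⟨by omega, by omega⟩ ⟨by omega, by omega⟩ ⟨by omega, by omega⟩ ⟨by omega, by omega⟩
      (by omega) (by omega) (by omega) (by omega) (by omega)
    refine (this.map (f := e ∘ ψ) (e.continuous.comp H.emb.continuous)).mono ?_
    rintro _ ⟨z, hz, rfl⟩ ⟨y, hy, hyz⟩
    obtain rfl := e.injective hyz
    exact hy.elim (fun h => h (mem_range_self z)) fun h => hz (hCz z h)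
  have hAB : e '' (ψ '' range κ ∪ C) ∩ e '' ((range ψ)ᶜ ∪ C) = e '' C := by
    rw [← image_inter e.injective]
    congr 1
    ext y
    constructor
    · rintro ⟨⟨z, -, rfl⟩ | h2, h3 | h3⟩
      · exact absurd (mem_range_self z) h3
      · exact h3
      · exact h2
      · exact h2
    · exact fun h => ⟨Or.inr h, Or.inr h⟩
  have hJ := joinedIn_union_compl (hA.image e.continuous) (e.isClosed_image.2 hB)
    (by rw [hAB]; exact hCc.image _ e.continuous.continuousOn) hJA hJB
  obtain ⟨P, hP⟩ := hJ
  have hPO : ∀ t, ∃ z, z ∉ range κ ∧ ψ z = e.symm (P t) := by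
    intro t
    have h3 := hP t
    have h4 : e.symm (P t) ∉ (ψ '' range κ ∪ C) ∪ ((range ψ)ᶜ ∪ C) := by
      rw [← image_union] at h3
      exact fun h => h3 ⟨_, h, e.apply_symm_apply _⟩
    obtain ⟨z, hz⟩ : e.symm (P t) ∈ range ψ := by
      by_contra h; exact h4 (Or.inr (Or.inl h))
    exact ⟨z, fun h => h4 (Or.inl (Or.inl ⟨z, h, hz⟩)), hz⟩
  have hPc : IsPreconnected (ψ ⁻¹' (range (e.symm ∘ P))) := by
    refine (isPreconnected_range (e.symm.continuous.comp P.continuous)).preimage_of_isOpenMap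
      H.emb.injective H.emb.isOpenMap ?_
    rintro _ ⟨t, rfl⟩
    obtain ⟨z, -, hz⟩ := hPO t
    exact ⟨z, hz⟩
  have hw' : w ∈ side κ v := by
    refine subset_side hPc ?_ (x := v) ⟨0, by simp⟩ (mem_side hvκ) ⟨1, by simp⟩
    rw [disjoint_left]
    rintro z ⟨t, ht⟩ hz
    obtain ⟨z', hz', hzt⟩ := hPO t
    obtain rfl := H.emb.injective (hzt.trans ht)
    exact hz' hz
  exact fun ho => disjoint_left.1 (disjoint_out_side v) ho hw'

/-- A blocker as in `IsCore` cannot have connectors joining its boundary points to their images. -/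
theorem false (H : IsCore ψ f h π G q c M B) (e : X ≃ₜ ℂ) {l m : ℤ}
    (good : IsGoodTime (CircleDeg1Lift.translationNumber (G : CircleDeg1Lift)) q l m) (hq : 2 ≤ q)
    (hB : (ψ ⁻¹' B).Nonempty) (hfix : ∀ a ∈ B, f a ≠ a)
    (hC : ∀ a ∈ B, a ∉ range ψ → ∃ C, IsCompact C ∧ IsPreconnected C ∧ a ∈ C ∧ f a ∈ C ∧
      C ∩ range ψ ⊆ B ∪ f '' B ∧ Disjoint C ((f ^ (q : ℤ) : X ≃ₜ X) '' C)) : False := by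
  obtain ⟨σ, a, b, hσ, hiso⟩ := H.exists_isolated e hB
  obtain ⟨κ, hκ, hκV, hκo⟩ := H.exists_cut e hσ hiso good hq (hfix b hσ.right_mem)
  obtain ⟨C, h1, h2, h3, h4, h5, h6⟩ := hC b hσ.right_mem hσ.isCC.notMem_right
  exact H.notMem_out_cut e hσ hiso hq h1 h2 h3 h4 h5 h6 hκ hκV hκo

end IsCore

end

section

theorem isGoodTime_qConst {α : AddCircle (1 : ℝ)} {τ : ℝ} (hα : (τ : AddCircle (1 : ℝ)) = α)
    (hα0 : α ≠ 0) : 2 ≤ qConst α 0 ∧ ∃ l m : ℤ, IsGoodTime τ (qConst α 0) l m := by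
  have hnorm : ∀ n : ℕ, ‖n • α‖ = |n * τ - round (n * τ)| := by
    intro n
    rw [← hα, ← AddCircle.coe_nsmul, UnitAddCircle.norm_eq, nsmul_eq_mul]
  have hnorm1 : ‖α‖ = |τ - round τ| := by simpa using hnorm 1
  have hpos : 0 < ‖α‖ := norm_pos_iff.2 hα0
  have hne : {q : ℕ | 0 < q ∧ ((IsRationalAC α ∧ ‖q • α‖ = 0) ∨
      (¬IsRationalAC α ∧ ((2 * 0 + 1 : ℕ) : ℝ) * ‖q • α‖ < ‖α‖))}.Nonempty := by
    by_cases hr : IsRationalAC α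
    · obtain ⟨r, rfl⟩ := hr
      refine ⟨r.den, r.den_pos, Or.inl ⟨⟨r, rfl⟩, ?_⟩⟩
      rw [← AddCircle.coe_nsmul, UnitAddCircle.norm_eq, nsmul_eq_mul]
      have : (r.den : ℝ) * (r : ℝ) = (r.num : ℤ) := by
        exact_mod_cast Rat.den_mul_eq_num r
      rw [this, round_intCast, sub_self, abs_zero]
    · obtain ⟨n, hn⟩ := exists_nat_one_div_lt hpos
      obtain ⟨k, hk, -, hk'⟩ := Real.exists_nat_abs_mul_sub_round_le τ (n := n + 1) n.succ_pos
      refine ⟨k, hk, Or.inr ⟨hr, ?_⟩⟩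
      rw [hnorm]
      push_cast at hk' ⊢
      have : (1 : ℝ) / (n + 1 + 1) ≤ 1 / (n + 1) := by gcongr; linarith
      linarith
  obtain ⟨hq0, hq⟩ := Nat.sInf_mem hne
  change 0 < qConst α 0 at hq0
  change (IsRationalAC α ∧ ‖qConst α 0 • α‖ = 0) ∨
      (¬IsRationalAC α ∧ ((2 * 0 + 1 : ℕ) : ℝ) * ‖qConst α 0 • α‖ < ‖α‖) at hq
  set q := qConst α 0
  have hlt : ‖q • α‖ < ‖α‖ := by
    rcases hq with ⟨-, h⟩ | ⟨-, h⟩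
    · rwa [h]
    · simpa using h
  have hnear : ∀ z : ℤ, ‖α‖ ≤ |τ - z| := fun z => hnorm1 ▸ round_le τ z
  have hl : (⌊τ⌋ : ℝ) < τ := by
    refine lt_of_le_of_ne (Int.floor_le τ) fun h => ?_
    have := hnear ⌊τ⌋
    rw [← h] at this
    simp at this
    exact hα0 this
  have hl' := Int.lt_floor_add_one τ
  have h1 : ‖α‖ ≤ τ - ⌊τ⌋ := by
    have := hnear ⌊τ⌋
    rwa [abs_of_pos (sub_pos.2 hl)] at this
  have h2 : ‖α‖ ≤ ⌊τ⌋ + 1 - τ := by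
    have := hnear (⌊τ⌋ + 1)
    push_cast at this
    rwa [abs_sub_comm, abs_of_pos (sub_pos.2 hl')] at this
  refine ⟨?_, ⌊τ⌋, round (q * τ), hl, hl', ?_, ?_, ?_⟩
  · by_contra! h
    have hq1 : q = 1 := by omega
    rw [hq1, one_smul] at hlt
    exact lt_irrefl _ hlt
  · rw [← hnorm]; exact hlt.trans_le h1
  · rw [← hnorm]; exact hlt.trans_le h2
  · intro n j hn hτ
    have hr : IsRationalAC α := ⟨(j : ℚ) / n, by rw [← hα, hτ]; push_cast; rfl⟩
    have h0 : ‖q • α‖ = 0 := by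
      rcases hq with ⟨-, h⟩ | ⟨h, -⟩
      · exact h
      · exact absurd hr h
    rw [hnorm, abs_eq_zero, sub_eq_zero] at h0
    exact h0

end

section

variable {X : Type u} [TopologicalSpace X] [T3Space X] {ψ : ℂ → X}

theorem exists_isOpenEmbedding_range_eq {U : Set X} (hU : IsOpen U)
    (h : Nonempty (↥U ≃ₜ (ℝ × ℝ))) : ∃ ψ : ℂ → X, IsOpenEmbedding ψ ∧ range ψ = U := by
  obtain ⟨e⟩ := h
  let e' := Complex.equivRealProdCLM.toHomeomorph.trans e.symm
  refine ⟨Subtype.val ∘ e', hU.isOpenEmbedding_subtypeVal.comp e'.isOpenEmbedding, ?_⟩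
  rw [range_comp, e'.surjective.range_eq, image_univ, Subtype.range_val]

theorem exists_isModel (hψ : IsOpenEmbedding ψ) {f : X ≃ₜ X} (hf : f '' range ψ = range ψ) :
    ∃ h : ℂ ≃ₜ ℂ, IsModel ψ f h := by
  let e := hψ.isEmbedding.toHomeomorph
  let f' : range ψ ≃ₜ range ψ := (f.image (range ψ)).trans (Homeomorph.setCongr hf)
  refine ⟨(e.trans f').trans e.symm, fun z => ?_⟩
  have : ∀ y, ψ (e.symm y) = y := fun y => congrArg Subtype.val (e.apply_symm_apply y)
  exact (this _).trans rfl

theorem CircleDeg1Lift.exists_units {G : CircleDeg1Lift} (hG : StrictMono G) (hc : Continuous G) :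
    ∃ u : CircleDeg1Liftˣ, (u : CircleDeg1Lift) = G :=
  CircleDeg1Lift.isUnit_iff_bijective.2 ⟨hG.injective,
    hc.surjective G.tendsto_atTop G.tendsto_atBot⟩

theorem peEnd_injective (U : Set X) : Function.Injective (peEnd U) := Sum.inr_injective

theorem exists_isPECircle
    (φ : ↥(PrimeEndCircle (range ψ)) ≃ₜ AddCircle (1 : ℝ)) :
    ∃ π : ℝ → PrimeEnd (range ψ), IsPECircle π ∧
      ∀ (p : PrimeEnd (range ψ)) (t : ℝ),
        φ ⟨peEnd (range ψ) p, ⟨p, rfl⟩⟩ = (t : AddCircle (1 : ℝ)) ↔ p = π t := by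
  choose π hπ using fun t : ℝ => (φ.symm (t : AddCircle (1 : ℝ))).2
  have hiff : ∀ (p : PrimeEnd (range ψ)) (t : ℝ),
      φ ⟨peEnd (range ψ) p, ⟨p, rfl⟩⟩ = (t : AddCircle (1 : ℝ)) ↔ p = π t := by
    intro p t
    rw [← φ.eq_symm_apply, Subtype.ext_iff, ← hπ t]
    exact (peEnd_injective _).eq_iff
  refine ⟨π, ⟨fun p => ?_, fun x y => ?_, fun E hE => ?_⟩, hiff⟩
  · obtain ⟨t, ht⟩ := QuotientAddGroup.mk_surjective (φ ⟨peEnd (range ψ) p, ⟨p, rfl⟩⟩)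
    exact ⟨t, ((hiff p t).1 ht.symm).symm⟩
  · rw [← hiff, (hiff (π x) x).2 rfl, eq_comm, ← sub_eq_zero, ← AddCircle.coe_sub,
      AddCircle.coe_eq_zero_iff]
    refine exists_congr fun n => ?_
    rw [zsmul_eq_mul, mul_one, eq_sub_iff_add_eq', eq_comm]
  · have : {t | PrimeEndDivides (π t) E} =
        (fun t : ℝ => (φ.symm (t : AddCircle (1 : ℝ))).1) ⁻¹' peSection (range ψ) E := by
      ext t
      change PrimeEndDivides (π t) E ↔ (φ.symm (t : AddCircle (1 : ℝ))).1 ∈ peSection (range ψ) E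
      rw [← hπ t, peEnd_mem_peSection]
    rw [this]
    exact (isOpen_peSection hE).preimage
      (continuous_subtype_val.comp (φ.symm.continuous.comp (AddCircle.continuous_mk' 1)))

theorem isLift_of_isPEExtension {f : X ≃ₜ X} {h : ℂ ≃ₜ ℂ} (hψ : IsOpenEmbedding ψ)
    (hh : IsModel ψ f h) {F : PrimeEndComp (range ψ) ≃ₜ PrimeEndComp (range ψ)}
    (hF : IsPEExtension f (range ψ) F) {π : ℝ → PrimeEnd (range ψ)} {G : CircleDeg1Liftˣ}
    (hG : ∀ t, F (peEnd (range ψ) (π t)) = peEnd (range ψ) (π ((G : CircleDeg1Lift) t))) :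
    IsLift f h π G where
  conj := hh
  divides t E hE := by
    have hf : ∀ x ∈ range ψ, f x ∈ range ψ := fun x hx => hh.mem_range_iff.2 hx
    have hf' : ∀ x ∈ range ψ, f.symm x ∈ range ψ := fun x hx =>
      hh.mem_range_iff.1 (by rwa [f.apply_symm_apply])
    constructor
    · intro hd
      have := hF.symm.divides_preimage hf' (p := π ((G : CircleDeg1Lift) t)) (p' := π t)
        (by rw [← hG, F.symm_apply_apply]) hE hd
      rwa [← f.image_eq_preimage_symm] at this
    · intro hd
      have := hF.divides_preimage hf (hG t) (hh.isCrossSection hψ hE) hd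
      rwa [f.injective.preimage_image] at this

end

section

variable {X : Type u} [TopologicalSpace X] [T3Space X] {ψ : ℂ → X}

theorem Homeomorph.zpow_natCast_apply {Y : Type*} [TopologicalSpace Y] (f : Y ≃ₜ Y) (n : ℕ) (a : Y) :
    (f ^ (n : ℤ) : Y ≃ₜ Y) a = f^[n] a := by
  rw [zpow_natCast]
  induction n generalizing a with
  | zero => rfl
  | succ n ih => rw [pow_succ, Function.iterate_succ_apply, ← ih]; rfl

theorem iterZ_eq {Y : Type u} [TopologicalSpace Y] (f : Y ≃ₜ Y) (k : ℤ) (A : Set Y) :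
    iterZ f k A = (f ^ k : Y ≃ₜ Y) '' A := by
  let φ : (Y ≃ₜ Y) →* Equiv.Perm Y :=
    { toFun := Homeomorph.toEquiv, map_one' := rfl, map_mul' := fun _ _ => rfl }
  have : f.toEquiv ^ k = (f ^ k : Y ≃ₜ Y).toEquiv := (map_zpow φ f k).symm
  rw [iterZ, this]
  rfl

/-- The part of `IsCore` which does not involve a blocker. -/
structure IsBase (ψ : ℂ → X) (f : X ≃ₜ X) (h : ℂ ≃ₜ ℂ) (π : ℝ → PrimeEnd (range ψ))
    (G : CircleDeg1Liftˣ) (q : ℕ) (c : ℂ) (M : Set ℂ) : Prop where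
  emb : IsOpenEmbedding ψ
  compl : (range ψ)ᶜ.Nontrivial
  circle : IsPECircle π
  lift : IsLift f h π G
  two_le : 2 ≤ q
  good : ∃ l m, IsGoodTime (CircleDeg1Lift.translationNumber (G : CircleDeg1Lift)) q l m
  preconnected : IsPreconnected M
  isCompact : IsCompact M
  mem : ∀ j : ℤ, |j| ≤ q + 1 → (h ^ j : ℂ ≃ₜ ℂ) c ∈ M
  wander : ∀ n : ℤ, n = 1 ∨ n = q → ∀ S : Set ℂ, IsCrossSection (range ψ) (ψ '' S) →
    (∀ k : ℤ, k ≠ 0 → Disjoint ((h ^ (n * k) : ℂ ≃ₜ ℂ) '' S) S) →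
    (∃ k : ℤ, 0 < k ∧ ¬ Disjoint ((h ^ (n * k) : ℂ ≃ₜ ℂ) '' S) M) ∧
      ∃ k : ℤ, k < 0 ∧ ¬ Disjoint ((h ^ (n * k) : ℂ ≃ₜ ℂ) '' S) M

theorem exists_isBase {f : X ≃ₜ X} {h : ℂ ≃ₜ ℂ} {π : ℝ → PrimeEnd (range ψ)} {G : CircleDeg1Liftˣ}
    {q : ℕ} (hψ : IsOpenEmbedding ψ) (hU : (range ψ)ᶜ.Nontrivial) (hπ : IsPECircle π)
    (hG : IsLift f h π G) (hq : 2 ≤ q)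
    (good : ∃ l m, IsGoodTime (CircleDeg1Lift.translationNumber (G : CircleDeg1Lift)) q l m)
    (hbnw : BdNonwandering f (range ψ)) : ∃ M, IsBase ψ f h π G q 0 M := by
  have hlarge : ∀ n : ℕ, 1 ≤ n → ∃ L : Set ℂ, IsCompact L ∧ ∀ M, L ⊆ M → ∀ S : Set ℂ,
      IsCrossSection (range ψ) (ψ '' S) →
      (∀ k : ℤ, k ≠ 0 → Disjoint ((h ^ ((n : ℤ) * k) : ℂ ≃ₜ ℂ) '' S) S) →
      (∃ k : ℤ, 0 < k ∧ ¬ Disjoint ((h ^ ((n : ℤ) * k) : ℂ ≃ₜ ℂ) '' S) M) ∧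
      ∃ k : ℤ, k < 0 ∧ ¬ Disjoint ((h ^ ((n : ℤ) * k) : ℂ ≃ₜ ℂ) '' S) M := by
    intro n hn
    obtain ⟨K, hK, hKU, hD⟩ := hbnw n hn
    refine ⟨ψ ⁻¹' K, hψ.isInducing.isCompact_preimage' hK hKU, fun M hM S hS hw => ?_⟩
    have him : ∀ k : ℤ, iterZ f ((n : ℤ) * k) (ψ '' S) = ψ '' ((h ^ ((n : ℤ) * k) : ℂ ≃ₜ ℂ) '' S) :=
      fun k => by rw [iterZ_eq, (hG.zpow hψ _).conj.image]
    have hmeet : ∀ k : ℤ, (iterZ f ((n : ℤ) * k) (ψ '' S) ∩ K).Nonempty →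
        ¬ Disjoint ((h ^ ((n : ℤ) * k) : ℂ ≃ₜ ℂ) '' S) M := by
      rintro k ⟨y, hy, hyK⟩
      rw [him] at hy
      obtain ⟨z, hz, rfl⟩ := hy
      exact not_disjoint_iff.2 ⟨z, hz, hM hyK⟩
    obtain ⟨⟨k, hk, hk'⟩, k', hk'0, hk''⟩ := hD (ψ '' S) ⟨hS, fun k hk => by
      rw [him, ← image_inter hψ.injective, (hw k hk).inter_eq, image_empty]⟩
    exact ⟨⟨k, hk, hmeet k hk'⟩, k', hk'0, hmeet k' hk''⟩
  obtain ⟨L₁, hL₁, h₁⟩ := hlarge 1 le_rfl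
  obtain ⟨L₂, hL₂, h₂⟩ := hlarge q (by omega)
  have hfin : {z | ∃ j : ℤ, |j| ≤ q + 1 ∧ (h ^ j : ℂ ≃ₜ ℂ) 0 = z}.Finite := by
    refine ((finite_Icc (-(q + 1 : ℤ)) (q + 1)).image fun j => (h ^ j : ℂ ≃ₜ ℂ) 0).subset ?_
    rintro z ⟨j, hj, rfl⟩
    exact ⟨j, abs_le.1 hj, rfl⟩
  obtain ⟨R, hR⟩ := exists_closedBall ((hfin.isCompact.union hL₁).union hL₂)
  refine ⟨Metric.closedBall 0 R, hψ, hU, hπ, hG, hq, good,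
    (convex_closedBall _ _).isPreconnected, isCompact_closedBall _ _,
    fun j hj => hR (Or.inl (Or.inl ⟨j, hj, rfl⟩)), ?_⟩
  rintro n (rfl | rfl)
  · exact fun S => h₁ _ (fun z hz => hR (Or.inl (Or.inr hz))) S
  · exact fun S => h₂ _ (fun z hz => hR (Or.inr hz)) S

namespace IsBase

variable {f : X ≃ₜ X} {h : ℂ ≃ₜ ℂ} {π : ℝ → PrimeEnd (range ψ)} {G : CircleDeg1Liftˣ}
  {q : ℕ} {c : ℂ} {M : Set ℂ} {B : Set X}

theorem isCore (H : IsBase ψ f h π G q c M) (hB : IsBlocker ψ B)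
    (hM : ∀ j : ℤ, |j| ≤ q + 1 → Disjoint ((h ^ j : ℂ ≃ₜ ℂ) '' (ψ ⁻¹' B)) M)
    (hdis : ∀ k : ℕ, 1 ≤ k → k ≤ q + 1 → ∀ a ∈ B, f^[k] a ∈ B → a ∉ range ψ)
    (hqB : ∀ a ∈ B, f^[q] a ∉ B) : IsCore ψ f h π G q c M B where
  emb := H.emb
  compl := H.compl
  circle := H.circle
  lift := H.lift
  pos := by have := H.two_le; omega
  fixed n z j hn hz := by
    obtain ⟨l, m, good⟩ := H.good
    have hmono : StrictMono (G : CircleDeg1Lift) :=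
      (CircleDeg1Lift.strictMono_iff_injective _).2 (CircleDeg1Lift.toOrderIso G).injective
    have hGn : ∀ n : ℕ, ((G ^ (n : ℤ) : CircleDeg1Liftˣ) : CircleDeg1Lift) =
        (G : CircleDeg1Lift) ^ n := fun n => by rw [zpow_natCast, Units.val_pow_eq_pow_val]
    refine ⟨m, ?_⟩
    rw [hGn]
    obtain ⟨n, rfl | rfl⟩ := n.eq_nat_or_neg
    · rw [hGn] at hz
      exact good.fixed (by omega) hz
    · refine good.fixed (n := n) (j := -j) (by omega) ?_
      rw [← hGn]
      have h1 := CircleDeg1Lift.units_apply_inv_apply (G ^ (n : ℤ)) z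
      rw [← zpow_neg, hz, CircleDeg1Lift.map_add_int] at h1
      push_cast
      linarith
  preconnected := H.preconnected
  mem := H.mem
  wander := H.wander
  blocker := hB
  disjoint_core := hM
  disjoint_iterate j hj hjq := by
    have hpos : ∀ k : ℕ, 1 ≤ k → k ≤ q + 1 →
        Disjoint ((h ^ (k : ℤ) : ℂ ≃ₜ ℂ) '' (ψ ⁻¹' B)) (ψ ⁻¹' B) := by
      intro k hk hkq
      rw [disjoint_left]
      rintro _ ⟨z, hz, rfl⟩ hz'
      change ψ _ ∈ B at hz'
      rw [(H.lift.zpow H.emb k).conj, Homeomorph.zpow_natCast_apply] at hz'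
      exact hdis k hk hkq _ hz hz' (mem_range_self z)
    have hjq' := abs_le.1 hjq
    obtain ⟨n, rfl | rfl⟩ := j.eq_nat_or_neg
    · exact hpos n (by omega) (by omega)
    · have := (hpos n (by omega) (by omega)).symm
      rw [← zero_sub, ← disjoint_image_zpow_iff, image_zpow_zero (A := ψ ⁻¹' B)]
      exact this
  disjoint_q := by
    rw [disjoint_left]
    rintro _ ⟨a, ha, rfl⟩ ha'
    rw [Homeomorph.zpow_natCast_apply] at ha'
    exact hqB a ha ha'

theorem false (H : IsBase ψ f h π G q c M) (e : X ≃ₜ ℂ) (hB : IsBlocker ψ B)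
    (hM : ∀ j : ℤ, |j| ≤ q + 1 → Disjoint ((h ^ j : ℂ ≃ₜ ℂ) '' (ψ ⁻¹' B)) M)
    (hne : (B ∩ range ψ).Nonempty)
    (hdis : ∀ k : ℕ, 1 ≤ k → k ≤ q + 1 → ∀ a ∈ B, f^[k] a ∈ B → a ∉ range ψ)
    (hqB : ∀ a ∈ B, f^[q] a ∉ B) (hfix : ∀ a ∈ B, f a ≠ a)
    (hC : ∀ a ∈ B, ∃ C, IsCompact C ∧ IsPreconnected C ∧ a ∈ C ∧ f a ∈ C ∧
      C ∩ range ψ ⊆ B ∪ f '' B ∧ ∀ y ∈ C, f^[q] y ∉ C) : False := by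
  obtain ⟨l, m, good⟩ := H.good
  obtain ⟨_, hy, z, rfl⟩ := hne
  refine (H.isCore hB hM hdis hqB).false e good H.two_le ⟨z, hy⟩ hfix fun a ha _ => ?_
  obtain ⟨C, h1, h2, h3, h4, h5, h6⟩ := hC a ha
  refine ⟨C, h1, h2, h3, h4, h5, disjoint_right.2 ?_⟩
  rintro _ ⟨y, hy, rfl⟩
  rw [Homeomorph.zpow_natCast_apply]
  exact h6 y hy

end IsBase

end

section

variable {X : Type u} [TopologicalSpace X] [T3Space X] {ψ : ℂ → X}

/-- A parametrized arc from a point to its image whose first `q + 1` iterates meet it only where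
they have to. -/
structure IsFreeArc (f : X ≃ₜ X) (q : ℕ) (g : ℝ → X) : Prop where
  continuous : Continuous g
  injOn : InjOn g (Icc 0 1)
  apply_one : g 1 = f (g 0)
  step : ∀ s ∈ Icc (0:ℝ) 1, ∀ t ∈ Icc (0:ℝ) 1, f (g s) = g t → s = 0 ∧ t = 1
  far : ∀ k : ℕ, 2 ≤ k → k ≤ q + 1 → ∀ s ∈ Icc (0:ℝ) 1, ∀ t ∈ Icc (0:ℝ) 1, f^[k] (g s) ≠ g t

theorem IsNTranslationArc.exists_isFreeArc {f : X ≃ₜ X} {q : ℕ} {γ : Set X} {x : X}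
    (hq : 2 ≤ q) (H : IsNTranslationArc f (q + 2) γ x) :
    ∃ g, IsFreeArc f q g ∧ g 0 = x ∧ g '' Icc 0 1 = γ ∧
      ∀ s ∈ Icc (0:ℝ) 1, ∀ t ∈ Icc (0:ℝ) 1, f^[q + 2] (g s) = g t → s = 1 ∧ t = 0 := by
  obtain ⟨⟨-, g, hgc, hgi, g0, g1, rfl, hstep⟩, hN⟩ := H
  obtain ⟨hfar, hlast⟩ := hN (by omega)
  let g' : ℝ → X := fun t => g (projIcc (0:ℝ) 1 zero_le_one t)
  have hg' : ∀ t ∈ Icc (0:ℝ) 1, g' t = g t := fun t ht => by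
    simp only [g', projIcc_of_mem zero_le_one ht]
  have mem0 : (0:ℝ) ∈ Icc (0:ℝ) 1 := left_mem_Icc.2 zero_le_one
  have mem1 : (1:ℝ) ∈ Icc (0:ℝ) 1 := right_mem_Icc.2 zero_le_one
  have hfar' : ∀ k : ℕ, 2 ≤ k → k ≤ q + 1 → ∀ s ∈ Icc (0:ℝ) 1, ∀ t ∈ Icc (0:ℝ) 1,
      f^[k] (g s) ≠ g t := fun k hk hkq s hs t ht heq =>
    (hfar k hk hkq).subset ⟨mem_image_of_mem _ (mem_image_of_mem g hs), heq ▸ mem_image_of_mem g ht⟩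
  refine ⟨g', ⟨hgc.comp_continuous (continuous_subtype_val.comp continuous_projIcc)
    (fun t => (projIcc (0:ℝ) 1 zero_le_one t).2), hgi.congr fun t ht => (hg' t ht).symm, ?_, ?_, ?_⟩,
    ?_, image_congr hg', ?_⟩
  · rw [hg' _ mem0, hg' _ mem1, g0, g1]
  · intro s hs t ht heq
    rw [hg' s hs, hg' t ht] at heq
    rcases hstep with h | ⟨-, h⟩
    · have hx : f (g s) = f x :=
        h.subset ⟨mem_image_of_mem f (mem_image_of_mem g hs), heq ▸ mem_image_of_mem g ht⟩
      exact ⟨hgi hs mem0 (by rw [g0, f.injective hx]), hgi ht mem1 (by rw [g1, ← heq, hx])⟩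
    · refine absurd ?_ (hfar' 2 le_rfl (by omega) 0 mem0 0 mem0)
      simpa [g0] using h
  · intro k hk hkq s hs t ht
    rw [hg' s hs, hg' t ht]
    exact hfar' k hk hkq s hs t ht
  · rw [hg' _ mem0, g0]
  · intro s hs t ht heq
    rw [hg' s hs, hg' t ht] at heq
    have hmem : f^[q + 2] (g s) ∈ f^[q + 2] '' (g '' Icc 0 1) ∩ g '' Icc 0 1 :=
      ⟨mem_image_of_mem _ (mem_image_of_mem g hs), heq ▸ mem_image_of_mem g ht⟩
    rcases hlast with h | ⟨h, hx⟩
    · rw [h] at hmem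
      exact hmem.elim
    · rw [h, mem_singleton_iff] at hmem
      refine ⟨hgi hs mem1 ?_, hgi ht mem0 (by rw [g0, ← heq, hmem])⟩
      rw [g1]
      refine f.injective.iterate (q + 2) ?_
      rw [hmem, ← Function.iterate_succ_apply, hx]

theorem IsNTranslationArc.exists_shift {f : X ≃ₜ X} {q : ℕ} {γ : Set X} {x y : X}
    (hq : 2 ≤ q) (H : IsNTranslationArc f (q + 2) γ x) (hy : y ∈ γ) (hyx : y ≠ f x) :
    ∃ g, IsFreeArc f q g ∧ g 0 = y ∧ g '' Icc 0 1 ⊆ γ ∪ f '' γ := by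
  obtain ⟨g, hg, rfl, rfl, hlast⟩ := H.exists_isFreeArc hq
  obtain ⟨a, ha, rfl⟩ := hy
  have ha1 : a < 1 := ha.2.lt_of_ne fun h => hyx (by rw [h, hg.apply_one])
  let k : ℝ → X := fun s => if s ≤ 1 - a then g (a + s) else f (g (s - 1 + a))
  have hk : ∀ s ∈ Icc (0:ℝ) 1, (∃ u ∈ Icc (0:ℝ) 1, a ≤ u ∧ u = a + s ∧ k s = g u) ∨
      ∃ u ∈ Icc (0:ℝ) 1, 0 < u ∧ u ≤ a ∧ u = s - 1 + a ∧ k s = f (g u) := by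
    intro s hs
    by_cases h : s ≤ 1 - a
    · exact .inl ⟨a + s, ⟨by linarith [ha.1, hs.1], by linarith⟩, by linarith [hs.1], rfl, if_pos h⟩
    · push Not at h
      exact .inr ⟨s - 1 + a, ⟨by linarith, by linarith [hs.2]⟩, by linarith, by linarith [hs.2],
        rfl, if_neg h.not_ge⟩
  have hk0 : k 0 = g a := by simp [k, ha.2]
  refine ⟨k, ⟨?_, ?_, ?_, ?_, ?_⟩, hk0, ?_⟩
  · refine Continuous.if_le (hg.continuous.comp (by fun_prop))
      (f.continuous.comp (hg.continuous.comp (by fun_prop))) continuous_id continuous_const ?_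
    rintro s rfl
    simp [hg.apply_one]
  · intro s hs t ht heq
    rcases hk s hs with ⟨u, hu, -, hus, hsu⟩ | ⟨u, hu, hu0, -, hus, hsu⟩ <;>
      rcases hk t ht with ⟨v, hv, -, hvt, htv⟩ | ⟨v, hv, hv0, -, hvt, htv⟩ <;>
      rw [hsu, htv] at heq
    · linarith [hg.injOn hu hv heq]
    · exact absurd (hg.step v hv u hu heq.symm).1 hv0.ne'
    · exact absurd (hg.step u hu v hv heq).1 hu0.ne'
    · linarith [hg.injOn hu hv (f.injective heq)]
  · rw [hk0]
    rcases eq_or_lt_of_le ha.1 with h | h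
    · simp [k, ← h, hg.apply_one]
    · simp [k, h.not_ge]
  · intro s hs t ht heq
    rcases hk s hs with ⟨u, hu, hau, hus, hsu⟩ | ⟨u, hu, hu0, hau, hus, hsu⟩ <;>
      rcases hk t ht with ⟨v, hv, hav, hvt, htv⟩ | ⟨v, hv, hv0, hav, hvt, htv⟩ <;>
      rw [hsu, htv] at heq
    · obtain ⟨h0, h1⟩ := hg.step u hu v hv heq
      constructor <;> linarith [ha.1, hs.1, ht.2]
    · have := hg.injOn hu hv (f.injective heq)
      constructor <;> linarith
    · exact absurd heq (hg.far 2 le_rfl (by omega) u hu v hv)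
    · exact absurd (hg.step u hu v hv (f.injective heq)).1 hu0.ne'
  · intro n hn hnq s hs t ht heq
    obtain ⟨m, rfl⟩ : ∃ m, n = m + 1 := ⟨n - 1, by omega⟩
    rcases hk s hs with ⟨u, hu, hau, hus, hsu⟩ | ⟨u, hu, hu0, hau, hus, hsu⟩ <;>
      rcases hk t ht with ⟨v, hv, hav, hvt, htv⟩ | ⟨v, hv, hv0, hav, hvt, htv⟩ <;>
      rw [hsu, htv] at heq
    · exact hg.far _ hn hnq u hu v hv heq
    · rw [Function.iterate_succ_apply'] at heq
      have heq' := f.injective heq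
      obtain rfl | hm : m = 1 ∨ 2 ≤ m := by omega
      · obtain ⟨h0, h1⟩ := hg.step u hu v hv heq'
        linarith
      · exact hg.far m hm (by omega) u hu v hv heq'
    · rw [← Function.iterate_succ_apply] at heq
      obtain rfl | hm : m = q ∨ m < q := by omega
      · linarith [(hlast u hu v hv heq).1]
      · exact hg.far _ (by omega) (by omega) u hu v hv heq
    · rw [← Function.iterate_succ_apply, Function.iterate_succ_apply'] at heq
      exact hg.far _ hn hnq u hu v hv (f.injective heq)
  · rintro _ ⟨s, hs, rfl⟩
    rcases hk s hs with ⟨u, hu, -, -, h⟩ | ⟨u, hu, -, -, -, h⟩ <;> rw [h]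
    · exact .inl (mem_image_of_mem g hu)
    · exact .inr (mem_image_of_mem f (mem_image_of_mem g hu))

theorem exists_isCompact_image_zpow (h : ℂ ≃ₜ ℂ) {M : Set ℂ} (hM : IsCompact M) (n : ℤ) :
    ∃ L, IsCompact L ∧ ∀ j : ℤ, |j| ≤ n → (h ^ j : ℂ ≃ₜ ℂ) '' M ⊆ L :=
  ⟨⋃ j ∈ Icc (-n) n, (h ^ j : ℂ ≃ₜ ℂ) '' M,
    (finite_Icc _ _).isCompact_biUnion fun _ _ => hM.image (h ^ _ : ℂ ≃ₜ ℂ).continuous,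
    fun j hj => subset_biUnion_of_mem (u := fun j : ℤ => (h ^ j : ℂ ≃ₜ ℂ) '' M) (abs_le.1 hj)⟩

theorem disjoint_image_zpow_preimage {h : ℂ ≃ₜ ℂ} {M L : Set ℂ} {B : Set X} {n : ℤ}
    (hL : ∀ j : ℤ, |j| ≤ n → (h ^ j : ℂ ≃ₜ ℂ) '' M ⊆ L) (hB : Disjoint B (ψ '' L)) (j : ℤ)
    (hj : |j| ≤ n) : Disjoint ((h ^ j : ℂ ≃ₜ ℂ) '' (ψ ⁻¹' B)) M := by
  have : Disjoint (ψ ⁻¹' B) ((h ^ (-j) : ℂ ≃ₜ ℂ) '' M) :=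
    Disjoint.mono_right (hL (-j) (by rwa [abs_neg]))
      (disjoint_left.2 fun z hz hzL => disjoint_left.1 hB hz (mem_image_of_mem ψ hzL))
  have := (disjoint_image_zpow_iff h (i := -j) (j := 0)).1
    (by rw [image_zpow_zero]; exact this.symm)
  rw [sub_zero] at this
  rw [← image_zpow_zero h (ψ ⁻¹' B)] at this
  have := (disjoint_image_zpow_iff h).1 this.symm
  rwa [zero_sub, neg_neg] at this

theorem exists_disk_subset (e : X ≃ₜ ℂ) {P : Set X} {y : X} (hP : P ∈ 𝓝 y) :
    ∃ r > 0, {z | ‖e z - e y‖ ≤ r} ⊆ P := by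
  have : e '' P ∈ 𝓝 (e y) := e.isOpenMap.image_mem_nhds hP
  obtain ⟨r, hr, hsub⟩ := Metric.nhds_basis_closedBall.mem_iff.1 this
  refine ⟨r, hr, fun z hz => ?_⟩
  obtain ⟨w, hw, hwz⟩ := hsub (mem_closedBall_iff_norm.2 hz)
  exact e.injective hwz ▸ hw

namespace IsBase

variable {f : X ≃ₜ X} {h : ℂ ≃ₜ ℂ} {π : ℝ → PrimeEnd (range ψ)} {G : CircleDeg1Liftˣ} {q : ℕ}
  {c : ℂ} {M : Set ℂ} {g : ℝ → X}

theorem false_of_arc_meets (H : IsBase ψ f h π G q c M) (e : X ≃ₜ ℂ) (hg : IsFreeArc f q g)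
    (h0 : g 0 ∉ range ψ)
    (hM : ∀ j : ℤ, |j| ≤ q + 1 → Disjoint ((h ^ j : ℂ ≃ₜ ℂ) '' (ψ ⁻¹' (g '' Icc 0 1))) M)
    (hne : (g '' Icc 0 1 ∩ range ψ).Nonempty) : False := by
  have hq := H.two_le
  have h1 : g 1 ∉ range ψ := by rwa [hg.apply_one, H.lift.conj.mem_range_iff]
  refine H.false e (isBlocker_arc H.emb e hg.continuous.continuousOn hg.injOn h0 h1) hM hne
    ?_ ?_ ?_ ?_
  · rintro k hk hkq _ ⟨s, hs, rfl⟩ ⟨t, ht, hst⟩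
    obtain rfl | hk : k = 1 ∨ 2 ≤ k := by omega
    · rwa [(hg.step s hs t ht hst.symm).1]
    · exact absurd hst.symm (hg.far k hk hkq s hs t ht)
  · rintro _ ⟨s, hs, rfl⟩ ⟨t, ht, hst⟩
    exact hg.far q hq (by omega) s hs t ht hst.symm
  · rintro _ ⟨s, hs, rfl⟩ hst
    obtain ⟨a, b⟩ := hg.step s hs s hs hst
    linarith
  · rintro _ ⟨s, hs, rfl⟩
    have hs0 : s ∈ Icc 0 s := right_mem_Icc.2 hs.1
    have hs1 : s ∈ Icc s 1 := left_mem_Icc.2 hs.2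
    have sub0 : Icc 0 s ⊆ Icc 0 1 := Icc_subset_Icc_right hs.2
    have sub1 : Icc s 1 ⊆ Icc 0 1 := Icc_subset_Icc_left hs.1
    refine ⟨g '' Icc s 1 ∪ f '' (g '' Icc 0 s),
      (isCompact_Icc.image hg.continuous).union ((isCompact_Icc.image hg.continuous).image f.continuous),
      (isPreconnected_Icc.image g hg.continuous.continuousOn).union (g 1)
        (mem_image_of_mem g (right_mem_Icc.2 hs.2))
        (hg.apply_one ▸ mem_image_of_mem f (mem_image_of_mem g (left_mem_Icc.2 hs.1)))
        ((isPreconnected_Icc.image g hg.continuous.continuousOn).image f f.continuous.continuousOn),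
      .inl (mem_image_of_mem g hs1), .inr (mem_image_of_mem f (mem_image_of_mem g hs0)),
      inter_subset_left.trans (union_subset_union (image_mono sub1) (image_mono (image_mono sub0))),
      ?_⟩
    obtain ⟨p, rfl⟩ : ∃ p, q = p + 1 := ⟨q - 1, by omega⟩
    rintro _ (⟨u, hu, rfl⟩ | ⟨_, ⟨u, hu, rfl⟩, rfl⟩) (⟨v, hv, huv⟩ | ⟨_, ⟨v, hv, rfl⟩, huv⟩)
    · exact hg.far _ hq (by omega) u (sub1 hu) v (sub1 hv) huv.symm
    · rw [Function.iterate_succ_apply'] at huv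
      have huv' := f.injective huv
      obtain rfl | hp : p = 1 ∨ 2 ≤ p := by omega
      · obtain ⟨a, b⟩ := hg.step u (sub1 hu) v (sub0 hv) huv'.symm
        linarith [hu.1, hv.2]
      · exact hg.far p hp (by omega) u (sub1 hu) v (sub0 hv) huv'.symm
    · rw [← Function.iterate_succ_apply] at huv
      exact hg.far _ (by omega) (by omega) u (sub0 hu) v (sub1 hv) huv.symm
    · rw [← Function.iterate_succ_apply, Function.iterate_succ_apply'] at huv
      exact hg.far _ hq (by omega) u (sub0 hu) v (sub0 hv) (f.injective huv).symm

theorem false_of_disjoint_arc (H : IsBase ψ f h π G q c M) (e : X ≃ₜ ℂ) (hg : IsFreeArc f q g)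
    (hy : g 0 ∈ frontier (range ψ)) (hd : Disjoint (g '' Icc 0 1) (range ψ)) : False := by
  have hq := H.two_le
  have mem0 : (0:ℝ) ∈ Icc (0:ℝ) 1 := left_mem_Icc.2 zero_le_one
  have mem1 : (1:ℝ) ∈ Icc (0:ℝ) 1 := right_mem_Icc.2 zero_le_one
  have hyU : g 0 ∉ range ψ := disjoint_left.1 hd (mem_image_of_mem g mem0)
  obtain ⟨w, hwU, hwy⟩ := H.compl.exists_ne (g 0)
  obtain ⟨L, hL, hML⟩ := exists_isCompact_image_zpow h H.isCompact (q + 1)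
  have hψc := H.emb.continuous
  have hΓ : IsClosed (g '' Icc 0 1) := (isCompact_Icc.image hg.continuous).isClosed
  have hΓk : ∀ k : ℕ, IsClosed (f^[k] '' (g '' Icc 0 1)) := fun k =>
    ((isCompact_Icc.image hg.continuous).image (f.continuous.iterate k)).isClosed
  have hmove : ∀ k : ℕ, 1 ≤ k → k ≤ q + 1 → ∀ s ∈ Icc (0:ℝ) 1, f^[k] (g s) ≠ g 0 := by
    intro k hk hkq s hs heq
    obtain rfl | hk : k = 1 ∨ 2 ≤ k := by omega
    · exact zero_ne_one (hg.step s hs 0 mem0 heq).2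
    · exact hg.far k hk hkq s hs 0 mem0 heq
  have ev : ∀ k : ℕ, 1 ≤ k → k ≤ q + 1 → ∃ P ∈ 𝓝 (g 0), (∀ a ∈ P, f^[k] a ∉ P) ∧
      (∀ a ∈ P, a ∉ f^[k] '' (g '' Icc 0 1)) ∧ (2 ≤ k → ∀ a ∈ P, f^[k] a ∉ g '' Icc 0 1) := by
    intro k hk hkq
    obtain ⟨V, W, hV, hW, hkV, hW0, hVW⟩ := t2_separation (hmove k hk hkq 0 mem0)
    have h1 : f^[k] ⁻¹' V ∈ 𝓝 (g 0) := (f.continuous.iterate k).continuousAt (hV.mem_nhds hkV)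
    have h2 : (f^[k] '' (g '' Icc 0 1))ᶜ ∈ 𝓝 (g 0) := (hΓk k).isOpen_compl.mem_nhds <| by
      rintro ⟨_, ⟨s, hs, rfl⟩, heq⟩
      exact hmove k hk hkq s hs heq
    have h3 : {a | 2 ≤ k → f^[k] a ∉ g '' Icc 0 1} ∈ 𝓝 (g 0) := by
      by_cases hk2 : 2 ≤ k
      · refine mem_of_superset ((f.continuous.iterate k).continuousAt (hΓ.isOpen_compl.mem_nhds ?_))
          fun a ha _ => ha
        rintro ⟨t, ht, heq⟩
        exact hg.far k hk2 hkq 0 mem0 t ht heq.symm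
      · exact mem_of_superset univ_mem fun a _ h => absurd h hk2
    refine ⟨_, inter_mem (inter_mem h1 (hW.mem_nhds hW0)) (inter_mem h2 h3), ?_, ?_, ?_⟩
    · exact fun a ha ha' => disjoint_left.1 hVW ha.1.1 ha'.1.2
    · exact fun a ha => ha.2.1
    · exact fun hk2 a ha => ha.2.2 hk2
  choose! P hP hPP hPΓ hΓP using ev
  have hPall : (⋂ k ∈ Finset.Icc 1 (q + 1), P k) ∈ 𝓝 (g 0) :=
    (Filter.biInter_finset_mem _).2 fun k hk => hP k (Finset.mem_Icc.1 hk).1 (Finset.mem_Icc.1 hk).2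
  have hLn : (ψ '' L)ᶜ ∈ 𝓝 (g 0) := (hL.image hψc).isClosed.isOpen_compl.mem_nhds
    fun hm => hyU (image_subset_range _ _ hm)
  obtain ⟨r, hr, hsub⟩ := exists_disk_subset e
    (inter_mem (inter_mem hPall hLn) (isOpen_compl_singleton.mem_nhds hwy.symm))
  have hDP : ∀ a, ‖e a - e (g 0)‖ ≤ r → ∀ k, 1 ≤ k → k ≤ q + 1 → a ∈ P k := fun a ha k hk hkq =>
    mem_iInter₂.1 (hsub ha).1.1 k (Finset.mem_Icc.2 ⟨hk, hkq⟩)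
  have hDL : ∀ a, ‖e a - e (g 0)‖ ≤ r → a ∉ ψ '' L := fun a ha => (hsub ha).1.2
  have hw : r < ‖e w - e (g 0)‖ := lt_of_not_ge fun hle => (hsub hle).2 rfl
  have hDD : ∀ a b, ‖e a - e (g 0)‖ ≤ r → ‖e b - e (g 0)‖ ≤ r → ∀ k, 1 ≤ k → k ≤ q + 1 →
      f^[k] a ≠ b := fun a b ha hb k hk hkq heq =>
    hPP k hk hkq a (hDP a ha k hk hkq) (heq ▸ hDP b hb k hk hkq)
  have h00 : ‖e (g 0) - e (g 0)‖ ≤ r := by simpa using hr.le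
  set B : Set X := {z | ‖e z - e (g 0)‖ = r} with hBdef
  have hBp : IsPreconnected B := by
    have : B = e.symm '' Metric.sphere (e (g 0)) r := by
      ext z
      rw [e.symm.image_eq_preimage_symm, mem_preimage, mem_sphere_iff_norm]
      rfl
    rw [this]
    exact (isPreconnected_sphere (by rw [Complex.rank_real_complex]; norm_num) _ _).image _
      e.symm.continuous.continuousOn
  have hB : IsBlocker ψ B := isBlocker_circle H.emb e hyU hwU hr hw
  have hBcl : IsCompact B := hB.1
  have hBne : (B ∩ range ψ).Nonempty := by
    obtain ⟨_, hb, z, rfl⟩ := mem_closure_iff.1 hy.1 {a | ‖e a - e (g 0)‖ < r}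
      (isOpen_lt (by fun_prop) continuous_const) (by simpa using hr)
    have hc : r < ‖e (ψ c) - e (g 0)‖ := lt_of_not_ge fun hle => hDL _ hle <| by
      refine mem_image_of_mem ψ (hML 0 (by simp; omega) ?_)
      rw [image_zpow_zero]
      simpa using H.mem 0 (by simp; omega)
    obtain ⟨z, hz⟩ := mem_range_of_exists_le_of_exists_ge
      (f := fun z => ‖e (ψ z) - e (g 0)‖) (by fun_prop) ⟨z, le_of_lt (show _ < r from hb)⟩
      ⟨c, hc.le⟩
    exact ⟨ψ z, hz, mem_range_self z⟩
  obtain ⟨s, hs, hsB⟩ : ∃ s ∈ Icc (0:ℝ) 1, g s ∈ B := by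
    have hc := hg.continuous
    have := intermediate_value_Icc (f := fun t => ‖e (g t) - e (g 0)‖) zero_le_one
      (by fun_prop) (show r ∈ Icc _ _ from ⟨by simpa using hr.le, le_of_not_ge fun hle => ?_⟩)
    · exact this
    · exact hDD (g 0) (g 1) h00 hle 1 le_rfl (by omega) hg.apply_one.symm
  obtain ⟨t, ht, htB⟩ : ∃ t ∈ Icc (0:ℝ) 1, f.symm (g t) ∈ B := by
    have hc := hg.continuous
    have := intermediate_value_Icc' (f := fun t => ‖e (f.symm (g t)) - e (g 0)‖) zero_le_one
      (by fun_prop) (show r ∈ Icc _ _ from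
        ⟨by simpa [hg.apply_one] using hr.le, le_of_not_ge fun hle => ?_⟩)
    · exact this
    · exact hDD _ (g 0) hle h00 1 le_rfl (by omega) (f.apply_symm_apply _)
  refine H.false e hB (disjoint_image_zpow_preimage hML (disjoint_left.2 fun a ha => hDL a ha.le))
    hBne (fun k hk hkq a ha ha' => (hDD a _ ha.le ha'.le k hk hkq rfl).elim)
    (fun a ha ha' => hDD a _ ha.le ha'.le q (by omega) (by omega) rfl)
    (fun a ha heq => hDD a a ha.le ha.le 1 le_rfl (by omega) heq) fun a ha => ?_
  refine ⟨(B ∪ g '' Icc 0 1) ∪ f '' B, (hBcl.union (isCompact_Icc.image hg.continuous)).union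
    (hBcl.image f.continuous), ?_, .inl (.inl ha), .inr (mem_image_of_mem f ha), ?_, ?_⟩
  · refine (hBp.union (g s) hsB (mem_image_of_mem g hs)
      (isPreconnected_Icc.image g hg.continuous.continuousOn)).union (g t)
      (.inr (mem_image_of_mem g ht)) ⟨_, htB, f.apply_symm_apply _⟩
      (hBp.image f f.continuous.continuousOn)
  · rintro b ⟨(hb | hb) | hb, hbU⟩
    · exact .inl hb
    · exact (disjoint_left.1 hd hb hbU).elim
    · exact .inr hb
  · obtain ⟨p, rfl⟩ : ∃ p, q = p + 1 := ⟨q - 1, by omega⟩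
    have hDΓ : ∀ a, ‖e a - e (g 0)‖ ≤ r → ∀ k, 2 ≤ k → k ≤ p + 1 + 1 → f^[k] a ∉ g '' Icc 0 1 :=
      fun a ha k hk hkq => hΓP k (by omega) hkq hk a (hDP a ha k (by omega) hkq)
    have hΓD : ∀ b ∈ g '' Icc 0 1, ∀ k, 1 ≤ k → k ≤ p + 1 + 1 → ¬ ‖e (f^[k] b) - e (g 0)‖ ≤ r :=
      fun b hb k hk hkq hle =>
        hPΓ k hk hkq _ (hDP _ hle k hk hkq) (mem_image_of_mem _ hb)
    rintro b ((hb | hb) | ⟨b, hb, rfl⟩) ((hb' | hb') | ⟨b', hb', heq⟩)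
    · exact hDD b _ hb.le hb'.le (p + 1) (by omega) (by omega) rfl
    · exact hDΓ b hb.le (p + 1) hq (by omega) hb'
    · rw [Function.iterate_succ_apply'] at heq
      exact hDD b b' hb.le hb'.le p (by omega) (by omega) (f.injective heq).symm
    · exact hΓD b hb (p + 1) (by omega) (by omega) hb'.le
    · obtain ⟨s, hs, rfl⟩ := hb
      obtain ⟨t, ht, hst⟩ := hb'
      exact hg.far _ hq (by omega) s hs t ht hst.symm
    · rw [Function.iterate_succ_apply'] at heq
      exact hΓD b hb p (by omega) (by omega) (f.injective heq ▸ hb'.le)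
    · rw [← Function.iterate_succ_apply] at hb'
      exact hDD b _ hb.le hb'.le _ (by omega) (by omega) rfl
    · rw [← Function.iterate_succ_apply] at hb'
      exact hDΓ b hb.le _ (by omega) (by omega) hb'
    · rw [← Function.iterate_succ_apply, Function.iterate_succ_apply'] at heq
      exact hDD b b' hb.le hb'.le _ (by omega) (by omega) (f.injective heq).symm

end IsBase

end

/-- Plane case of the translation-arc theorem, with the explicit constant
`N = q(α,0) + 2`: if `f` is ∂-nonwandering in the invariant open disk `U` and the prime ends
rotation number is `α ≠ 0`, then there is a compact `K ⊆ U` such that every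
`N`-translation arc contained in `ℝ² ∖ K` is disjoint from `∂U`. -/
theorem translation_arc_theorem_plane
    (f : (ℝ × ℝ) ≃ₜ (ℝ × ℝ)) (hor : IsOrientationPreserving f)
    (U : Set (ℝ × ℝ)) (hUopen : IsOpen U) (hUinv : ⇑f '' U = U)
    (hUplane : Nonempty (↥U ≃ₜ (ℝ × ℝ))) (hUcompl : Set.Nontrivial Uᶜ)
    (hbnw : BdNonwandering f U)
    (F : PrimeEndComp U ≃ₜ PrimeEndComp U) (hF : IsPEExtension f U F)
    (φ : ↥(PrimeEndCircle U) ≃ₜ AddCircle (1 : ℝ))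
    (G : CircleDeg1Lift) (hGmono : StrictMono ⇑G) (hGcont : Continuous ⇑G)
    (hGlift : ∀ (p : PrimeEnd U) (x : ℝ),
      φ ⟨peEnd U p, ⟨p, rfl⟩⟩ = (x : AddCircle (1 : ℝ)) →
      ∃ p' : PrimeEnd U, F (peEnd U p) = peEnd U p' ∧
        φ ⟨peEnd U p', ⟨p', rfl⟩⟩ = ((G x : ℝ) : AddCircle (1 : ℝ)))
    (α : AddCircle (1 : ℝ)) (hα : ((G.translationNumber : ℝ) : AddCircle (1 : ℝ)) = α)
    (hα0 : α ≠ 0) :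
    ∃ K : Set (ℝ × ℝ), IsCompact K ∧ K ⊆ U ∧
      ∀ (γ : Set (ℝ × ℝ)) (x : ℝ × ℝ),
        IsNTranslationArc f (qConst α 0 + 2) γ x → γ ⊆ Kᶜ → Disjoint γ (frontier U) := by
  obtain ⟨ψ, hψ, rfl⟩ := exists_isOpenEmbedding_range_eq hUopen hUplane
  obtain ⟨h, hh⟩ := exists_isModel hψ hUinv
  obtain ⟨G, rfl⟩ := CircleDeg1Lift.exists_units hGmono hGcont
  obtain ⟨π, hπ, hφπ⟩ := exists_isPECircle φ
  have hG : IsLift f h π G := isLift_of_isPEExtension hψ hh hF fun t => by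
    obtain ⟨p, hp, hφp⟩ := hGlift (π t) t ((hφπ _ _).2 rfl)
    rw [hp, (hφπ _ _).1 hφp]
  obtain ⟨hq, good⟩ := isGoodTime_qConst hα hα0
  obtain ⟨M, H⟩ := exists_isBase hψ hUcompl hπ hG hq good hbnw
  obtain ⟨L, hL, hML⟩ := exists_isCompact_image_zpow h H.isCompact (qConst α 0 + 2)
  refine ⟨ψ '' L, hL.image hψ.continuous, image_subset_range _ _, fun γ x hγ hγL => ?_⟩
  refine disjoint_left.2 fun z hz hzf => ?_
  obtain ⟨y, hy, hyx, hyf⟩ : ∃ y ∈ γ, y ≠ f x ∧ y ∈ frontier (range ψ) := by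
    by_cases hzx : z = f x
    · have hxγ : x ∈ γ := by
        obtain ⟨⟨-, g, -, -, g0, -, rfl, -⟩, -⟩ := hγ
        exact ⟨0, left_mem_Icc.2 zero_le_one, g0⟩
      refine ⟨x, hxγ, hγ.1.1.symm, ?_⟩
      rw [← hUinv, ← f.image_frontier, hzx] at hzf
      exact (f.injective.mem_set_image).1 hzf
    · exact ⟨z, hz, hzx, hzf⟩
  obtain ⟨g, hg, rfl, hgγ⟩ := hγ.exists_shift hq hy hyx
  let e : (ℝ × ℝ) ≃ₜ ℂ := Complex.equivRealProdCLM.toHomeomorph.symm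
  by_cases hd : Disjoint (g '' Icc 0 1) (range ψ)
  · exact H.false_of_disjoint_arc e hg hyf hd
  · refine H.false_of_arc_meets e hg (fun hm => ?_) (fun j hj => ?_) (not_disjoint_iff_nonempty_inter.1 hd)
    · exact (hUopen.frontier_eq ▸ hyf).2 hm
    · have hγM := disjoint_image_zpow_preimage hML (subset_compl_iff_disjoint_right.1 hγL)
      refine disjoint_left.2 ?_
      rintro _ ⟨z, hz, rfl⟩ hzM
      rcases hgγ hz with hzγ | ⟨w, hwγ, hwz⟩
      · exact disjoint_left.1 (hγM j (hj.trans (by omega))) (mem_image_of_mem _ hzγ) hzM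
      · obtain ⟨v, rfl⟩ : w ∈ range ψ := hh.mem_range_iff.1 (hwz ▸ mem_range_self z)
        rw [← hh] at hwz
        obtain rfl := hψ.injective hwz
        refine disjoint_left.1 (hγM (j + 1) ?_) (mem_image_of_mem _ hwγ) (?_ : _ ∈ M)
        · exact (abs_add_le j 1).trans (by rw [abs_one]; omega)
        · rw [zpow_add_one]
          exact hzM

end
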